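/- Suppose a domain U ⊆ ℝ² satisfies one of the two conditions: (1) F_U = ∅; (2) F_U is nonempty and disconnected. Then U is uniquely determined in the class of all domains in ℝ² by the relative metric of its Hausdorff boundary. -/

import Mathlib

open Set Metric Filter

noncomputable section

/-- Euclidean `n`-space. -/
abbrev Euc (n : ℕ) := EuclideanSpace ℝ (Fin n)

/-- A domain: a nonempty open connected subset of Euclidean space. -/
def IsEucDomain {n : ℕ} (U : Set (Euc n)) : Prop := IsOpen U ∧ IsConnected U

/-- Intrinsic extended distance inside `S`: the infimum of the lengths (total
variations) of continuous paths joining `x` and `y` within `S`. -/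
def intrinsicDist {n : ℕ} (S : Set (Euc n)) (x y : Euc n) : ENNReal :=
  ⨅ (γ : ℝ → Euc n) (_ : ContinuousOn γ (Icc (0:ℝ) 1)) (_ : γ 0 = x) (_ : γ 1 = y)
    (_ : MapsTo γ (Icc (0:ℝ) 1) S), eVariationOn γ (Icc (0:ℝ) 1)

/-- A Cauchy sequence (in the intrinsic metric) of points of `U` that does not
converge (in the intrinsic metric) to a point of `U`; such sequences represent
elements of the Hausdorff boundary of `U`. -/
structure HBSeq {n : ℕ} (U : Set (Euc n)) where
  seq : ℕ → Euc n
  mem : ∀ k, seq k ∈ U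
  cauchy : ∀ ε : ENNReal, 0 < ε → ∃ N : ℕ, ∀ j ≥ N, ∀ k ≥ N,
    intrinsicDist U (seq j) (seq k) < ε
  notConv : ¬ ∃ u ∈ U, Tendsto (fun k => intrinsicDist U (seq k) u) atTop (nhds 0)

/-- Two Cauchy sequences represent the same Hausdorff-boundary element iff the
intrinsic distance between corresponding terms tends to `0`. -/
def HBEquiv {n : ℕ} (U : Set (Euc n)) (s t : HBSeq U) : Prop :=
  Tendsto (fun k => intrinsicDist U (s.seq k) (t.seq k)) atTop (nhds 0)

/-- The Hausdorff boundary of `U`: points of the completion of `(U, ρ_U)` not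
corresponding to points of `U`. -/
def HausdorffBoundary {n : ℕ} (U : Set (Euc n)) : Type := Quot (HBEquiv U)

/-- The relative metric on the Hausdorff boundary (the completion metric). -/
def hbDist {n : ℕ} {U : Set (Euc n)} (a b : HausdorffBoundary U) : ENNReal :=
  limsup (fun k => intrinsicDist U ((Quot.out a).seq k) ((Quot.out b).seq k)) atTop

/-- The support of a Hausdorff-boundary element: the Euclidean limit of a
representing Cauchy sequence. -/
def hbSupport {n : ℕ} {U : Set (Euc n)} (a : HausdorffBoundary U) : Euc n :=
  limUnder atTop (Quot.out a).seq

/-- A (bijective) isometry of Hausdorff boundaries in the relative metrics. -/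
def IsHBIsometry {n : ℕ} {U V : Set (Euc n)}
    (f : HausdorffBoundary U → HausdorffBoundary V) : Prop :=
  Function.Bijective f ∧ ∀ a b : HausdorffBoundary U, hbDist (f a) (f b) = hbDist a b

/-- `U` is uniquely determined in the class `𝒰` by the relative metric of its
Hausdorff boundary: any member of `𝒰` with Hausdorff boundary isometric (in the
relative metrics) to that of `U` is the image of `U` under a Euclidean isometry. -/
def UniquelyDeterminedIn {n : ℕ} (𝒰 : Set (Set (Euc n))) (U : Set (Euc n)) : Prop :=
  ∀ V ∈ 𝒰, (∃ f : HausdorffBoundary U → HausdorffBoundary V, IsHBIsometry f) →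
    ∃ J : Euc n ≃ᵢ Euc n, J '' U = V

/-- `F_U = U \ cl (conv ∂U)`. -/
def FPart (U : Set (Euc 2)) : Set (Euc 2) := U \ closure (convexHull ℝ (frontier U))

/-- `U ∩ Int (conv ∂U)`, whose connected components are the `U_i`. -/
def corePart (U : Set (Euc 2)) : Set (Euc 2) := U ∩ interior (convexHull ℝ (frontier U))

/-- The connected components of a set `W`. -/
def componentsOf (W : Set (Euc 2)) : Set (Set (Euc 2)) :=
  {C | ∃ x ∈ W, C = connectedComponentIn W x}

open scoped Topology RealInnerProductSpace

section IntrinsicDist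

variable {n : ℕ} {S : Set (Euc n)} {x y z : Euc n}

lemma intrinsicDist_le {γ : ℝ → Euc n} (hc : ContinuousOn γ (Icc (0:ℝ) 1))
    (h0 : γ 0 = x) (h1 : γ 1 = y) (hS : MapsTo γ (Icc (0:ℝ) 1) S) :
    intrinsicDist S x y ≤ eVariationOn γ (Icc (0:ℝ) 1) :=
  iInf_le_of_le γ <| iInf_le_of_le hc <| iInf_le_of_le h0 <| iInf_le_of_le h1 <| iInf_le _ hS

lemma exists_path_of_intrinsicDist_lt {c : ENNReal} (h : intrinsicDist S x y < c) :
    ∃ γ : ℝ → Euc n, ContinuousOn γ (Icc (0:ℝ) 1) ∧ γ 0 = x ∧ γ 1 = y ∧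
      MapsTo γ (Icc (0:ℝ) 1) S ∧ eVariationOn γ (Icc (0:ℝ) 1) < c := by
  simp only [intrinsicDist, iInf_lt_iff] at h
  obtain ⟨γ, h1, h2, h3, h4, h5⟩ := h
  exact ⟨γ, h1, h2, h3, h4, h5⟩

/-- A path on `[a, b]` bounds the intrinsic distance of its end points. -/
lemma intrinsicDist_le_of_path {γ : ℝ → Euc n} {a b : ℝ} (hab : a ≤ b)
    (hc : ContinuousOn γ (Icc a b)) (hS : MapsTo γ (Icc a b) S) :
    intrinsicDist S (γ a) (γ b) ≤ eVariationOn γ (Icc a b) := by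
  have hm : MapsTo (fun t : ℝ => a + t * (b - a)) (Icc 0 1) (Icc a b) := by
    rintro t ⟨h0, h1⟩
    constructor <;> nlinarith
  have hmono : MonotoneOn (fun t : ℝ => a + t * (b - a)) (Icc 0 1) := by
    intro s _ t _ hst
    have := mul_le_mul_of_nonneg_right hst (sub_nonneg.2 hab)
    simpa using this
  refine (intrinsicDist_le (γ := γ ∘ fun t : ℝ => a + t * (b - a)) ?_ (by simp) (by simp)
    (hS.comp hm)).trans (eVariationOn.comp_le_of_monotoneOn γ _ hmono hm)
  exact hc.comp (by fun_prop) hm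

lemma intrinsicDist_comm_le : intrinsicDist S x y ≤ intrinsicDist S y x := by
  refine le_of_forall_gt fun c hc => ?_
  obtain ⟨γ, h1, h2, h3, h4, h5⟩ := exists_path_of_intrinsicDist_lt hc
  have hm : MapsTo (fun t : ℝ => 1 - t) (Icc 0 1) (Icc 0 1) := by
    rintro t ⟨h0, h1⟩
    constructor <;> linarith
  have ha : AntitoneOn (fun t : ℝ => 1 - t) (Icc 0 1) := fun s _ t _ hst =>
    sub_le_sub_left hst 1
  refine ((intrinsicDist_le (γ := γ ∘ fun t : ℝ => 1 - t) (h1.comp (by fun_prop) hm)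
    (by simpa using h3) (by simpa using h2) (h4.comp hm)).trans
    (eVariationOn.comp_le_of_antitoneOn γ _ ha hm)).trans_lt h5

lemma intrinsicDist_comm : intrinsicDist S x y = intrinsicDist S y x :=
  le_antisymm intrinsicDist_comm_le intrinsicDist_comm_le

lemma intrinsicDist_triangle : intrinsicDist S x z ≤ intrinsicDist S x y + intrinsicDist S y z := by
  refine le_of_forall_gt fun c hc => ?_
  obtain ⟨a, ha, b, hb, hab⟩ : ∃ a, intrinsicDist S x y < a ∧ ∃ b, intrinsicDist S y z < b ∧
      a + b ≤ c := by
    obtain ⟨d, hd, hdc⟩ := exists_between hc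
    have hft : intrinsicDist S x y + intrinsicDist S y z ≠ ⊤ := (hd.trans_le le_top).ne
    have h1 := (ENNReal.add_ne_top.1 hft).1
    have h2 := (ENNReal.add_ne_top.1 hft).2
    obtain ⟨ε, hε, he⟩ := ENNReal.lt_iff_exists_nnreal_btwn.1 (tsub_pos_of_lt hc)
    have hε2 : (ε / 2 : ENNReal) ≠ 0 := by simpa using hε.ne'
    refine ⟨_, ENNReal.lt_add_right h1 hε2, _, ENNReal.lt_add_right h2 hε2, ?_⟩
    calc _ = (intrinsicDist S x y + intrinsicDist S y z) + (ε / 2 + ε / 2 : ENNReal) := by ring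
      _ ≤ (intrinsicDist S x y + intrinsicDist S y z) +
          (c - (intrinsicDist S x y + intrinsicDist S y z)) := by
          rw [ENNReal.add_halves]; gcongr
      _ = c := add_tsub_cancel_of_le hc.le
  obtain ⟨γ, g1, g2, g3, g4, g5⟩ := exists_path_of_intrinsicDist_lt ha
  obtain ⟨δ, d1, d2, d3, d4, d5⟩ := exists_path_of_intrinsicDist_lt hb
  set κ : ℝ → Euc n := fun t => if t ≤ 1 then γ t else δ (t - 1) with hκ
  have e1 : EqOn κ γ (Icc 0 1) := fun t ht => by simp [hκ, ht.2]
  have e2 : EqOn κ (δ ∘ fun t => t - 1) (Icc 1 2) := fun t ht => by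
    rcases eq_or_lt_of_le ht.1 with h | h
    · subst h; simp [hκ, g3, d2]
    · simp [hκ, not_le.2 h]
  have hm : MapsTo (fun t : ℝ => t - 1) (Icc 1 2) (Icc 0 1) := by
    rintro t ⟨h0, h1⟩
    constructor <;> linarith
  have hmono : MonotoneOn (fun t : ℝ => t - 1) (Icc 1 2) := fun s _ t _ hst => by
    simpa using hst
  have hu : Icc (0:ℝ) 2 = Icc 0 1 ∪ Icc 1 2 := (Icc_union_Icc_eq_Icc (by norm_num) (by norm_num)).symm
  have hcont : ContinuousOn κ (Icc 0 2) := by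
    rw [hu]
    exact (g1.congr e1).union_of_isClosed ((d1.comp (by fun_prop) hm).congr e2) isClosed_Icc isClosed_Icc
  have hmaps : MapsTo κ (Icc 0 2) S := by
    rw [hu]
    exact (g4.congr e1.symm).union ((d4.comp hm).congr e2.symm)
  have h0 : κ 0 = x := by rw [e1 (by simp), g2]
  have h2 : κ 2 = z := by rw [e2 (by norm_num)]; norm_num; exact d3
  have := intrinsicDist_le_of_path (by norm_num) hcont hmaps
  have hadd := eVariationOn.Icc_add_Icc κ (s := univ) (zero_le_one (α := ℝ)) one_le_two (mem_univ _)
  simp only [univ_inter] at hadd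
  rw [h0, h2, ← hadd, eVariationOn.congr e1, eVariationOn.congr e2] at this
  refine this.trans_lt (lt_of_lt_of_le ?_ hab)
  exact ENNReal.add_lt_add g5 ((eVariationOn.comp_le_of_monotoneOn δ _ hmono hm).trans_lt d5)

lemma edist_le_intrinsicDist : edist x y ≤ intrinsicDist S x y := by
  refine le_of_forall_gt fun c hc => ?_
  obtain ⟨γ, g1, g2, g3, g4, g5⟩ := exists_path_of_intrinsicDist_lt hc
  rw [← g2, ← g3]
  exact (eVariationOn.edist_le γ (by simp) (by simp)).trans_lt g5

lemma intrinsicDist_le_edist (h : segment ℝ x y ⊆ S) : intrinsicDist S x y ≤ edist x y := by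
  have hl : LipschitzWith (nndist x y) (AffineMap.lineMap x y : ℝ → Euc n) :=
    lipschitzWith_lineMap x y
  have h1 : MapsTo (AffineMap.lineMap x y : ℝ → Euc n) (Icc 0 1) S := by
    intro t ht
    apply h
    rw [segment_eq_image_lineMap]
    exact mem_image_of_mem _ ht
  refine (intrinsicDist_le hl.continuous.continuousOn (by simp) (by simp) h1).trans ?_
  have := (hl.lipschitzOnWith (s := Icc (0:ℝ) 1)).comp_eVariationOn_le (g := id) (mapsTo_id _)
  refine this.trans ?_
  have h2 : eVariationOn (id : ℝ → ℝ) (Icc 0 1) ≤ 1 := by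
    have := (monotone_id.monotoneOn (Icc (0:ℝ) 1)).eVariationOn_eq (a := 0) (b := 1) (by simp) (by simp)
    rw [inter_self] at this
    rw [this]
    simp
  calc _ ≤ (nndist x y : ENNReal) * 1 := by gcongr
    _ = edist x y := by rw [mul_one, edist_nndist]

lemma intrinsicDist_eq_edist (h : segment ℝ x y ⊆ S) : intrinsicDist S x y = edist x y :=
  le_antisymm (intrinsicDist_le_edist h) edist_le_intrinsicDist

lemma intrinsicDist_ne_top (hS : IsEucDomain S) (hx : x ∈ S) (hy : y ∈ S) :
    intrinsicDist S x y ≠ ⊤ := by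
  refine hS.2.isPreconnected.induction₂' (fun x y => intrinsicDist S x y ≠ ⊤) ?_ ?_ hx hy
  · intro x hx
    obtain ⟨r, hr, hb⟩ := Metric.isOpen_iff.1 hS.1 x hx
    filter_upwards [mem_nhdsWithin_of_mem_nhds (ball_mem_nhds x hr)] with y hy
    have : intrinsicDist S x y ≠ ⊤ :=
      ne_top_of_le_ne_top (edist_ne_top x y) (intrinsicDist_le_edist
        (((convex_ball x r).segment_subset (mem_ball_self hr) hy).trans hb))
    exact ⟨this, intrinsicDist_comm (x := x) ▸ this⟩
  · intro a b c _ _ _ h1 h2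
    exact ne_top_of_le_ne_top (ENNReal.add_ne_top.2 ⟨h1, h2⟩) intrinsicDist_triangle

end IntrinsicDist

open scoped Topology

/-- The Euclidean plane. -/
abbrev Plane := Euc 2

/-- A bundled plane domain. -/
structure Dom where
  carrier : Set Plane
  isDom : IsEucDomain carrier

namespace Dom

instance : Membership Plane Dom := ⟨fun U p => p ∈ U.carrier⟩

variable (U : Dom)

lemma isOpen : IsOpen U.carrier := U.isDom.1

/-- Points of a domain, carrying the intrinsic metric. -/
structure Pt where
  val : Plane
  mem : val ∈ U.carrier

instance : MetricSpace U.Pt where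
  dist p q := (intrinsicDist U.carrier p.val q.val).toReal
  dist_self p := by
    have : intrinsicDist U.carrier p.val p.val = 0 := by
      rw [intrinsicDist_eq_edist (by simpa using p.mem), edist_self]
    simp [this]
  dist_comm p q := by
    rw [intrinsicDist_comm]
  dist_triangle p q r := by
    have h1 := intrinsicDist_ne_top U.isDom p.mem q.mem
    have h2 := intrinsicDist_ne_top U.isDom q.mem r.mem
    change (intrinsicDist U.carrier p.val r.val).toReal ≤
      (intrinsicDist U.carrier p.val q.val).toReal + (intrinsicDist U.carrier q.val r.val).toReal
    rw [← ENNReal.toReal_add h1 h2]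
    exact ENNReal.toReal_mono (ENNReal.add_ne_top.2 ⟨h1, h2⟩) intrinsicDist_triangle
  eq_of_dist_eq_zero {p q} h := by
    have h1 := intrinsicDist_ne_top U.isDom p.mem q.mem
    have h2 : intrinsicDist U.carrier p.val q.val = 0 := by
      rcases (ENNReal.toReal_eq_zero_iff _).1 h with h | h
      · exact h
      · exact absurd h h1
    have h3 : edist p.val q.val ≤ 0 := h2 ▸ edist_le_intrinsicDist
    have h4 : p.val = q.val := by simpa using h3
    cases p; cases q; simp_all

variable {U}

lemma Pt.dist_def (p q : U.Pt) : dist p q = (intrinsicDist U.carrier p.val q.val).toReal := rfl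

lemma Pt.ofReal_dist (p q : U.Pt) :
    ENNReal.ofReal (dist p q) = intrinsicDist U.carrier p.val q.val := by
  rw [Pt.dist_def, ENNReal.ofReal_toReal (intrinsicDist_ne_top U.isDom p.mem q.mem)]

lemma Pt.dist_val_le (p q : U.Pt) : dist p.val q.val ≤ dist p q := by
  rw [Pt.dist_def, dist_edist]
  exact ENNReal.toReal_mono (intrinsicDist_ne_top U.isDom p.mem q.mem) edist_le_intrinsicDist

lemma Pt.dist_eq (p q : U.Pt) (h : segment ℝ p.val q.val ⊆ U.carrier) :
    dist p q = dist p.val q.val := by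
  rw [Pt.dist_def, intrinsicDist_eq_edist h, dist_edist]

lemma Pt.lipschitz_val : LipschitzWith 1 (Pt.val : U.Pt → Plane) :=
  LipschitzWith.of_dist_le_mul fun p q => by simpa using Pt.dist_val_le p q

variable (U) in
/-- The completion of a domain in its intrinsic metric. -/
abbrev X := UniformSpace.Completion U.Pt

/-- The support map of the completion. -/
def pos (x : U.X) : Plane := UniformSpace.Completion.extension (Pt.val : U.Pt → Plane) x

lemma pos_coe (p : U.Pt) : pos (p : U.X) = p.val :=
  UniformSpace.Completion.extension_coe Pt.lipschitz_val.uniformContinuous p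

lemma lipschitz_pos : LipschitzWith 1 (pos : U.X → Plane) :=
  Pt.lipschitz_val.completion_extension

lemma dist_pos_le (x y : U.X) : dist (pos x) (pos y) ≤ dist x y := by
  simpa using lipschitz_pos.dist_le_mul x y

lemma continuous_pos : Continuous (pos : U.X → Plane) := lipschitz_pos.continuous

variable (U) in
/-- A base point. -/
def base : U.Pt := ⟨U.isDom.2.nonempty.some, U.isDom.2.nonempty.some_mem⟩

open Classical in
variable (U) in
/-- The embedding of a domain into its completion (with a junk value outside). -/
def pt (p : Plane) : U.X := if h : p ∈ U.carrier then ((⟨p, h⟩ : U.Pt) : U.X) else (U.base : U.X)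

lemma pt_of_mem {p : Plane} (h : p ∈ U) : U.pt p = ((⟨p, h⟩ : U.Pt) : U.X) := dif_pos h

lemma pos_pt {p : Plane} (h : p ∈ U) : pos (U.pt p) = p := by
  rw [pt_of_mem h, pos_coe]

lemma dist_pt_eq {p q : Plane} (h : segment ℝ p q ⊆ U.carrier) :
    dist (U.pt p) (U.pt q) = dist p q := by
  rw [pt_of_mem (U := U) (h (left_mem_segment ℝ p q)), pt_of_mem (U := U) (h (right_mem_segment ℝ p q)),
    UniformSpace.Completion.dist_eq, Pt.dist_eq _ _ h]

lemma pt_mk (p : U.Pt) : U.pt p.val = (p : U.X) := pt_of_mem p.mem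

lemma continuousOn_pt : ContinuousOn U.pt U.carrier := by
  intro p hp
  obtain ⟨r, hr, hb⟩ := Metric.isOpen_iff.1 U.isOpen p hp
  refine ContinuousAt.continuousWithinAt ?_
  rw [ContinuousAt, tendsto_iff_dist_tendsto_zero]
  have : (fun q => dist q p) =ᶠ[𝓝 p] fun q => dist (U.pt q) (U.pt p) := by
    filter_upwards [ball_mem_nhds p hr] with q hq
    rw [dist_pt_eq (((convex_ball p r).segment_subset hq (mem_ball_self hr)).trans hb)]
  refine Tendsto.congr' this ?_
  simpa using (tendsto_id (x := 𝓝 p)).dist (tendsto_const_nhds (x := p))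

lemma eq_pt_of_pos_mem {x : U.X} (h : pos x ∈ U) : x = U.pt (pos x) := by
  have hc : ContinuousAt (fun x : U.X => U.pt (pos x)) x :=
    ((continuousOn_pt.continuousAt (U.isOpen.mem_nhds h)).comp continuous_pos.continuousAt)
  have hd : ∃ᶠ y in 𝓝 x, y = U.pt (pos y) := by
    have := UniformSpace.Completion.denseRange_coe (α := U.Pt) x
    rw [mem_closure_iff_frequently] at this
    refine this.mono ?_
    rintro _ ⟨p, rfl⟩
    rw [pos_coe, pt_mk]
  have := isClosed_diagonal.mem_of_frequently_of_tendsto (f := fun y : U.X => (y, U.pt (pos y)))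
    hd (tendsto_id.prodMk_nhds hc)
  exact this

variable (U) in
/-- The Hausdorff boundary as a subtype of the completion. -/
def Bd := {x : U.X // pos x ∉ U}

instance : MetricSpace U.Bd := inferInstanceAs (MetricSpace {x : U.X // pos x ∉ U})

/-- Support of a boundary element. -/
def Bd.pos (x : U.Bd) : Plane := Dom.pos x.1

variable (U) in
/-- Distance between a point of the domain and a boundary element. -/
def dp (p : Plane) (x : U.Bd) : ℝ := dist (U.pt p) x.1

lemma exists_near (x : U.X) {ε : ℝ} (hε : 0 < ε) : ∃ p ∈ U, dist (U.pt p) x < ε := by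
  obtain ⟨p, hp⟩ := UniformSpace.Completion.denseRange_coe.exists_dist_lt x hε
  exact ⟨p.val, p.mem, by rwa [pt_mk, dist_comm]⟩

lemma pos_mem_closure (x : U.X) : pos x ∈ closure U.carrier := by
  rw [Metric.mem_closure_iff]
  intro ε hε
  obtain ⟨p, hp, h⟩ := exists_near x hε
  refine ⟨p, hp, ?_⟩
  rw [← pos_pt hp, dist_comm]
  exact (dist_pos_le _ _).trans_lt h

lemma Bd.pos_not_mem (x : U.Bd) : x.pos ∉ U := x.2

lemma Bd.pos_mem_frontier (x : U.Bd) : x.pos ∈ frontier U.carrier := by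
  rw [U.isOpen.frontier_eq]
  exact ⟨pos_mem_closure _, x.2⟩

/-- A boundary point that is the end of a convex subset of the domain is the support of
a boundary element accessed through that subset. -/
lemma access {D : Set Plane} (hD : Convex ℝ D) (hDU : D ⊆ U.carrier) {z : Plane}
    (hz : z ∈ closure D) (hzU : z ∉ U) :
    ∃ x : U.Bd, x.pos = z ∧ ∀ p ∈ D, U.dp p x = dist p z := by
  obtain ⟨u, huD, hu⟩ := mem_closure_iff_seq_limit.1 hz
  have key : ∀ p ∈ D, ∀ q ∈ D, dist (U.pt p) (U.pt q) = dist p q := fun p hp q hq =>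
    dist_pt_eq ((hD.segment_subset hp hq).trans hDU)
  have hcau : CauchySeq fun n => U.pt (u n) := by
    rw [Metric.cauchySeq_iff']
    intro ε hε
    obtain ⟨N, hN⟩ := Metric.cauchySeq_iff'.1 hu.cauchySeq ε hε
    exact ⟨N, fun n hn => by rw [key _ (huD n) _ (huD N)]; exact hN n hn⟩
  obtain ⟨x, hx⟩ := cauchySeq_tendsto_of_complete hcau
  have hpos : pos x = z := by
    refine tendsto_nhds_unique ((continuous_pos.tendsto x).comp hx) ?_
    refine hu.congr fun n => ?_
    simp [pos_pt (U := U) (hDU (huD n))]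
  refine ⟨⟨x, by rwa [hpos]⟩, hpos, fun p hp => ?_⟩
  refine tendsto_nhds_unique (tendsto_const_nhds.dist hx) ?_
  refine (tendsto_const_nhds.dist hu).congr fun n => ?_
  rw [key _ hp _ (huD n)]

lemma exists_path_X (x y : U.X) {ε : ℝ} (hε : 0 < ε) : ∃ γ : ℝ → Plane, ContinuousOn γ (Icc 0 1) ∧
    MapsTo γ (Icc 0 1) U.carrier ∧ dist (U.pt (γ 0)) x < ε ∧ dist (U.pt (γ 1)) y < ε ∧
    (x = U.pt (γ 0) ∨ pos x ∉ U) ∧ (y = U.pt (γ 1) ∨ pos y ∉ U) ∧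
    ∀ t ∈ Icc (0:ℝ) 1, dist x (U.pt (γ t)) + dist (U.pt (γ t)) y < dist x y + ε := by
  have near : ∀ x : U.X, ∃ p ∈ U, dist (U.pt p) x < ε / 5 ∧ (x = U.pt p ∨ pos x ∉ U) := by
    intro x
    by_cases hx : pos x ∈ U
    · refine ⟨pos x, hx, ?_, Or.inl (eq_pt_of_pos_mem hx)⟩
      rw [← eq_pt_of_pos_mem hx, dist_self]; positivity
    · obtain ⟨p, hp, h⟩ := exists_near x (show 0 < ε / 5 by positivity)
      exact ⟨p, hp, h, Or.inr hx⟩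
  obtain ⟨p, hp, hpx, hpx'⟩ := near x
  obtain ⟨q, hq, hqy, hqy'⟩ := near y
  have hlt : intrinsicDist U.carrier p q < ENNReal.ofReal (dist (U.pt p) (U.pt q) + ε / 5) := by
    rw [pt_of_mem hp, pt_of_mem hq, UniformSpace.Completion.dist_eq,
      ENNReal.ofReal_add dist_nonneg (by positivity), Pt.ofReal_dist]
    exact ENNReal.lt_add_right (intrinsicDist_ne_top U.isDom hp hq) (by simpa using hε)
  obtain ⟨γ, g1, g2, g3, g4, g5⟩ := exists_path_of_intrinsicDist_lt hlt
  refine ⟨γ, g1, g4, ?_, ?_, by rwa [g2], by rwa [g3], fun t ht => ?_⟩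
  · rw [g2]; linarith
  · rw [g3]; linarith
  have hγt : γ t ∈ U := g4 ht
  have e1 : intrinsicDist U.carrier p (γ t) ≤ eVariationOn γ (Icc 0 t) := by
    rw [← g2]
    exact intrinsicDist_le_of_path ht.1 (g1.mono (Icc_subset_Icc_right ht.2))
      (g4.mono_left (Icc_subset_Icc_right ht.2))
  have e2 : intrinsicDist U.carrier (γ t) q ≤ eVariationOn γ (Icc t 1) := by
    rw [← g3]
    exact intrinsicDist_le_of_path ht.2 (g1.mono (Icc_subset_Icc_left ht.1))
      (g4.mono_left (Icc_subset_Icc_left ht.1))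
  have hadd := eVariationOn.Icc_add_Icc γ (s := univ) ht.1 ht.2 (mem_univ _)
  simp only [univ_inter] at hadd
  have e3 := (add_le_add e1 e2).trans_lt (hadd ▸ g5)
  have e4 : dist (U.pt p) (U.pt (γ t)) + dist (U.pt (γ t)) (U.pt q)
      < dist (U.pt p) (U.pt q) + ε / 5 := by
    rw [← ENNReal.ofReal_lt_ofReal_iff (by positivity), ENNReal.ofReal_add dist_nonneg dist_nonneg]
    rw [pt_of_mem hp, pt_of_mem hq, pt_of_mem hγt] at *
    simpa only [UniformSpace.Completion.dist_eq, Pt.ofReal_dist] using e3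
  have := dist_triangle x (U.pt p) (U.pt (γ t))
  have := dist_triangle (U.pt (γ t)) (U.pt q) y
  have := dist_triangle4 (U.pt p) x y (U.pt q)
  rw [dist_comm x (U.pt p)] at *
  rw [dist_comm y (U.pt q)] at *
  linarith

/-- The distance from a point to the complement of the domain. -/
def rad (U : Dom) (p : Plane) : ℝ := infDist p U.carrierᶜ

lemma rad_nonneg (p : Plane) : 0 ≤ U.rad p := infDist_nonneg

lemma ball_rad_subset (p : Plane) : ball p (U.rad p) ⊆ U.carrier := by
  intro q hq
  by_contra h
  exact absurd (infDist_le_dist_of_mem (x := p) (show q ∈ U.carrierᶜ from h))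
    (by rw [mem_ball, dist_comm] at hq; exact not_le.2 hq)

lemma rad_le_dist {p z : Plane} (hz : z ∉ U) : U.rad p ≤ dist p z :=
  infDist_le_dist_of_mem (x := p) (show z ∈ U.carrierᶜ from hz)

lemma le_rad {p : Plane} {r : ℝ} (hne : ∃ z, z ∉ U) (h : ball p r ⊆ U.carrier) : r ≤ U.rad p := by
  obtain ⟨z, hz⟩ := hne
  refine (le_infDist ⟨z, hz⟩).2 fun y hy => ?_
  by_contra hlt
  exact hy (h (by rw [mem_ball, dist_comm]; exact not_le.1 hlt))

lemma rad_pos {p : Plane} (hne : ∃ z, z ∉ U) (hp : p ∈ U) : 0 < U.rad p := by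
  obtain ⟨r, hr, hb⟩ := Metric.isOpen_iff.1 U.isOpen p hp
  exact hr.trans_le (le_rad hne hb)

lemma mem_of_rad_pos {p : Plane} (hp : 0 < U.rad p) : p ∈ U :=
  ball_rad_subset p (mem_ball_self hp)

lemma exists_dist_eq_rad (hne : ∃ z, z ∉ U) (p : Plane) : ∃ z ∉ U, dist p z = U.rad p := by
  obtain ⟨z, hz, h⟩ := U.isOpen.isClosed_compl.exists_infDist_eq_dist (by exact hne) p
  exact ⟨z, hz, h.symm⟩

/-- A boundary element touched by a ball contained in the domain. -/
structure Touch (U : Dom) (c : Plane) (r : ℝ) (x : U.Bd) : Prop where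
  pos_rad : 0 < r
  ball_subset : ball c r ⊆ U.carrier
  dist_center : dist c x.pos = r
  dp_eq : ∀ p ∈ ball c r, U.dp p x = dist p x.pos

lemma exists_touch {c z : Plane} {r : ℝ} (hr : 0 < r) (h : ball c r ⊆ U.carrier) (hz : z ∉ U)
    (hd : dist c z = r) : ∃ x : U.Bd, x.pos = z ∧ Touch U c r x := by
  obtain ⟨x, h1, h2⟩ := access (convex_ball c r) h (z := z)
    (by rw [closure_ball c hr.ne', mem_closedBall, dist_comm]; exact hd.le) hz
  exact ⟨x, h1, hr, h, by rw [h1, hd], by rwa [h1]⟩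

lemma exists_nearest (hne : ∃ z, z ∉ U) {p : Plane} (hp : p ∈ U) :
    ∃ x : U.Bd, Touch U p (U.rad p) x := by
  obtain ⟨z, hz, h⟩ := exists_dist_eq_rad hne p
  obtain ⟨x, -, hx⟩ := exists_touch (rad_pos hne hp) (ball_rad_subset p) hz h
  exact ⟨x, hx⟩

lemma Touch.dp_center {c : Plane} {r : ℝ} {x : U.Bd} (h : Touch U c r x) : U.dp c x = r := by
  rw [h.dp_eq c (mem_ball_self h.pos_rad), h.dist_center]

/-! Elementary metric inequalities. -/

lemma dist_pos_le_dp {p : Plane} (hp : p ∈ U) (x : U.Bd) : dist p x.pos ≤ U.dp p x := by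
  have := dist_pos_le (U.pt p) x.1
  rwa [pos_pt hp] at this

lemma Bd.dist_pos_le (x y : U.Bd) : dist x.pos y.pos ≤ dist x y := Dom.dist_pos_le _ _

lemma dist_le_dp_add_dp (p : Plane) (x y : U.Bd) : dist x y ≤ U.dp p x + U.dp p y :=
  dist_triangle_left (α := U.X) _ _ _

lemma dp_le_dp_add_dist (p : Plane) (x y : U.Bd) : U.dp p x ≤ U.dp p y + dist x y := by
  rw [dist_comm]; exact dist_triangle _ _ _

lemma dp_le_dist_add_dp (p q : Plane) (x : U.Bd) : U.dp p x ≤ dist (U.pt p) (U.pt q) + U.dp q x :=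
  dist_triangle _ _ _

lemma dp_nonneg (p : Plane) (x : U.Bd) : 0 ≤ U.dp p x := dist_nonneg

lemma dp_pos {p : Plane} (hp : p ∈ U) (x : U.Bd) : 0 < U.dp p x := by
  refine lt_of_lt_of_le (dist_pos.2 ?_) (dist_pos_le_dp hp x)
  rintro rfl
  exact x.2 hp

lemma rad_le_dp {p : Plane} (hp : p ∈ U) (x : U.Bd) : U.rad p ≤ U.dp p x :=
  (rad_le_dist x.2).trans (dist_pos_le_dp hp x)

lemma Bd.ext_of_dp {x y : U.Bd} (h : ∀ ε > 0, ∃ p, U.dp p x < ε ∧ U.dp p y < ε) : x = y := by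
  refine eq_of_forall_dist_le fun ε hε => ?_
  obtain ⟨p, h1, h2⟩ := h (ε / 2) (half_pos hε)
  linarith [dist_le_dp_add_dp p x y]

lemma continuousOn_dp (x : U.Bd) : ContinuousOn (fun p => U.dp p x) U.carrier :=
  fun p hp => Filter.Tendsto.dist (continuousOn_pt p hp) tendsto_const_nhds

lemma Bd.exists_near (x : U.Bd) {ε : ℝ} (hε : 0 < ε) : ∃ p ∈ U, U.dp p x < ε := Dom.exists_near x.1 hε

end Dom

open scoped Topology

namespace Dom

variable {U V : Dom}

lemma dist_pt_toReal {p q : Plane} (hp : p ∈ U) (hq : q ∈ U) :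
    ENNReal.ofReal (dist (U.pt p) (U.pt q)) = intrinsicDist U.carrier p q := by
  rw [pt_of_mem hp, pt_of_mem hq, UniformSpace.Completion.dist_eq, Pt.ofReal_dist]

lemma exists_lim (s : HBSeq U.carrier) : ∃ x : U.Bd, Tendsto (fun k => U.pt (s.seq k)) atTop (𝓝 x.1) := by
  have hcau : CauchySeq fun n => U.pt (s.seq n) := by
    rw [Metric.cauchySeq_iff]
    intro ε hε
    obtain ⟨N, hN⟩ := s.cauchy (ENNReal.ofReal ε) (by simpa using hε)
    refine ⟨N, fun j hj k hk => ?_⟩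
    have := hN j hj k hk
    rwa [← dist_pt_toReal (s.mem j) (s.mem k), ENNReal.ofReal_lt_ofReal_iff hε] at this
  obtain ⟨x, hx⟩ := cauchySeq_tendsto_of_complete hcau
  refine ⟨⟨x, fun hx' => s.notConv ⟨pos x, hx', ?_⟩⟩, hx⟩
  rw [eq_pt_of_pos_mem hx'] at hx
  have := (ENNReal.continuous_ofReal.tendsto _).comp (tendsto_iff_dist_tendsto_zero.1 hx)
  rw [ENNReal.ofReal_zero] at this
  refine this.congr fun k => ?_
  exact dist_pt_toReal (s.mem k) hx'

/-- The boundary element represented by a sequence. -/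
def limBd (s : HBSeq U.carrier) : U.Bd := (exists_lim s).choose

lemma tendsto_limBd (s : HBSeq U.carrier) :
    Tendsto (fun k => U.pt (s.seq k)) atTop (𝓝 (limBd s).1) := (exists_lim s).choose_spec

lemma tendsto_intrinsicDist (s t : HBSeq U.carrier) :
    Tendsto (fun k => intrinsicDist U.carrier (s.seq k) (t.seq k)) atTop
      (𝓝 (ENNReal.ofReal (dist (limBd s) (limBd t)))) := by
  refine ((ENNReal.continuous_ofReal.tendsto _).comp
    ((tendsto_limBd s).dist (tendsto_limBd t))).congr fun k => ?_
  exact dist_pt_toReal (s.mem k) (t.mem k)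

lemma hbEquiv_iff (s t : HBSeq U.carrier) : HBEquiv U.carrier s t ↔ limBd s = limBd t := by
  have h := tendsto_intrinsicDist s t
  constructor
  · intro h'
    have := tendsto_nhds_unique h h'
    rw [ENNReal.ofReal_eq_zero] at this
    exact dist_le_zero.1 this
  · intro h'
    rw [h', dist_self, ENNReal.ofReal_zero] at h
    exact h

/-- Identification of the two models of the Hausdorff boundary. -/
def toBd (a : HausdorffBoundary U.carrier) : U.Bd :=
  Quot.lift limBd (fun s t h => (hbEquiv_iff s t).1 h) a

lemma toBd_out (a : HausdorffBoundary U.carrier) : limBd (Quot.out a) = toBd a := by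
  conv_rhs => rw [← Quot.out_eq a]
  rfl

lemma hbDist_eq (a b : HausdorffBoundary U.carrier) :
    hbDist a b = ENNReal.ofReal (dist (toBd a) (toBd b)) := by
  rw [hbDist, (tendsto_intrinsicDist _ _).limsup_eq, toBd_out, toBd_out]

lemma toBd_bijective : Function.Bijective (toBd : HausdorffBoundary U.carrier → U.Bd) := by
  constructor
  · intro a b hab
    rw [← Quot.out_eq a, ← Quot.out_eq b]
    refine Quot.sound ((hbEquiv_iff _ _).2 ?_)
    rw [toBd_out, toBd_out, hab]
  · intro x
    choose p hp hpx using fun n : ℕ => x.exists_near (ε := 1 / (n + 1)) (by positivity)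
    have hlim : Tendsto (fun n => U.pt (p n)) atTop (𝓝 x.1) := by
      rw [tendsto_iff_dist_tendsto_zero]
      exact squeeze_zero (fun _ => dist_nonneg) (fun n => (hpx n).le)
        tendsto_one_div_add_atTop_nhds_zero_nat
    let s : HBSeq U.carrier :=
      { seq := p
        mem := hp
        cauchy := fun ε hε => by
          obtain ⟨δ, hδ, hδε⟩ := ENNReal.lt_iff_exists_nnreal_btwn.1 hε
          have hδ' : (0:ℝ) < δ := by simpa using hδ
          obtain ⟨N, hN⟩ := Metric.cauchySeq_iff.1 hlim.cauchySeq δ hδ'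
          refine ⟨N, fun j hj k hk => ?_⟩
          rw [← dist_pt_toReal (hp j) (hp k)]
          refine lt_of_le_of_lt ?_ hδε
          rw [← ENNReal.ofReal_coe_nnreal]
          exact ENNReal.ofReal_le_ofReal (hN j hj k hk).le
        notConv := by
          rintro ⟨u, hu, h⟩
          have h2 : Tendsto (fun n => dist (U.pt (p n)) (U.pt u)) atTop (𝓝 0) := by
            have := (ENNReal.tendsto_toReal ENNReal.zero_ne_top).comp h
            refine this.congr fun k => ?_
            simp [← dist_pt_toReal (hp k) hu, dist_nonneg]
          have h3 := tendsto_nhds_unique hlim (tendsto_iff_dist_tendsto_zero.2 h2)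
          exact x.2 (by rw [h3, pos_pt hu]; exact hu) }
    refine ⟨Quot.mk _ s, Subtype.ext ?_⟩
    exact tendsto_nhds_unique (tendsto_limBd s) hlim

/-- An isometry of Hausdorff boundaries gives an isometric bijection of boundary elements. -/
lemma exists_isometryEquiv {f : HausdorffBoundary U.carrier → HausdorffBoundary V.carrier}
    (hf : IsHBIsometry f) : Nonempty (U.Bd ≃ᵢ V.Bd) := by
  let eU := Equiv.ofBijective _ (toBd_bijective (U := U))
  let eV := Equiv.ofBijective _ (toBd_bijective (U := V))
  let ef := Equiv.ofBijective f hf.1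
  refine ⟨⟨(eU.symm.trans ef).trans eV, Isometry.of_dist_eq fun x y => ?_⟩⟩
  have h := hf.2 (eU.symm x) (eU.symm y)
  rw [hbDist_eq, hbDist_eq, ENNReal.ofReal_eq_ofReal_iff dist_nonneg dist_nonneg] at h
  have e : ∀ z, toBd (eU.symm z) = z := eU.apply_symm_apply
  rw [e, e] at h
  exact h

end Dom

open scoped Topology

namespace Dom

variable {U V : Dom}

lemma Bd.hne (x : U.Bd) : ∃ z, z ∉ U := ⟨x.pos, x.2⟩

lemma rad_continuous : Continuous U.rad := continuous_infDist_pt _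

/-- A pair of boundary elements joined by a straight open segment inside the domain. -/
structure Chord (U : Dom) (x y : U.Bd) : Prop where
  ne : x.pos ≠ y.pos
  mem : ∀ p ∈ openSegment ℝ x.pos y.pos, p ∈ U
  dp_left : ∀ p ∈ openSegment ℝ x.pos y.pos, U.dp p x = dist p x.pos
  dp_right : ∀ p ∈ openSegment ℝ x.pos y.pos, U.dp p y = dist p y.pos

lemma Chord.symm {x y : U.Bd} (h : Chord U x y) : Chord U y x where
  ne := h.ne.symm
  mem p hp := h.mem p (openSegment_symm ℝ x.pos y.pos ▸ hp)
  dp_left p hp := h.dp_right p (openSegment_symm ℝ x.pos y.pos ▸ hp)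
  dp_right p hp := h.dp_left p (openSegment_symm ℝ x.pos y.pos ▸ hp)

lemma Chord.dist_eq {x y : U.Bd} (h : Chord U x y) : dist x y = dist x.pos y.pos := by
  refine le_antisymm ?_ (Bd.dist_pos_le x y)
  have hm : midpoint ℝ x.pos y.pos ∈ openSegment ℝ x.pos y.pos := by
    rw [openSegment_eq_image_lineMap]
    exact ⟨1 / 2, by norm_num, by rw [midpoint, invOf_eq_inv]; norm_num⟩
  have := dist_le_dp_add_dp (midpoint ℝ x.pos y.pos) x y
  rw [h.dp_left _ hm, h.dp_right _ hm, dist_midpoint_left, dist_midpoint_right] at this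
  norm_num at this
  linarith

lemma Touch.pos_ne {c : Plane} {r : ℝ} {x y : U.Bd} (hx : Touch U c r x) (hy : Touch U c r y)
    (h : x ≠ y) : x.pos ≠ y.pos := by
  intro he
  refine h (Bd.ext_of_dp fun ε hε => ?_)
  have : x.pos ∈ closure (ball c r) := by
    rw [closure_ball c hx.pos_rad.ne', mem_closedBall, dist_comm, hx.dist_center]
  obtain ⟨p, hp, hd⟩ := Metric.mem_closure_iff.1 this ε hε
  rw [dist_comm] at hd
  exact ⟨p, by rwa [hx.dp_eq p hp], by rwa [hy.dp_eq p hp, ← he]⟩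

lemma Touch.openSegment_subset {c : Plane} {r : ℝ} {x y : U.Bd} (hx : Touch U c r x)
    (hy : Touch U c r y) (h : x ≠ y) : openSegment ℝ x.pos y.pos ⊆ ball c r := by
  have h1 : x.pos ∈ closedBall c r := by rw [mem_closedBall, dist_comm, hx.dist_center]
  have h2 : y.pos ∈ closedBall c r := by rw [mem_closedBall, dist_comm, hy.dist_center]
  have := (strictConvex_closedBall ℝ c r).openSegment_subset h1 h2 (hx.pos_ne hy h)
  rwa [interior_closedBall c hx.pos_rad.ne'] at this

lemma Touch.chord {c : Plane} {r : ℝ} {x y : U.Bd} (hx : Touch U c r x) (hy : Touch U c r y)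
    (h : x ≠ y) : Chord U x y where
  ne := hx.pos_ne hy h
  mem _ hp := hx.ball_subset (hx.openSegment_subset hy h hp)
  dp_left p hp := hx.dp_eq p (hx.openSegment_subset hy h hp)
  dp_right p hp := hy.dp_eq p (hx.openSegment_subset hy h hp)

/-- First step of a geodesic towards a boundary element. -/
lemma exists_sphere_step {y : V.Bd} {p : Plane} {h : ℝ} (hp : p ∈ V) (h0 : 0 < h) (hr : h < V.rad p)
    (hb : h < V.dp p y) : ∃ q, dist q p = h ∧ V.dp q y ≤ V.dp p y - h := by
  have hsub : closedBall p h ⊆ V.carrier := (closedBall_subset_ball hr).trans (ball_rad_subset p)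
  have hball : ∀ q ∈ closedBall p h, dist (V.pt p) (V.pt q) = dist p q := fun q hq =>
    dist_pt_eq (((convex_closedBall p h).segment_subset (mem_closedBall_self h0.le) hq).trans hsub)
  have hne : (sphere p h).Nonempty := NormedSpace.sphere_nonempty.2 h0.le
  obtain ⟨q, hq, hmin⟩ := (isCompact_sphere p h).exists_isMinOn hne
    ((continuousOn_dp y).mono (sphere_subset_closedBall.trans hsub))
  refine ⟨q, hq, le_of_forall_pos_le_add fun ε hε => ?_⟩
  obtain ⟨γ, g1, g2, g3, g4, g5, -, g6⟩ := exists_path_X (V.pt p) y.1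
    (show 0 < min ε (V.dp p y - h) from lt_min hε (by linarith))
  have hγ0 : γ 0 = p := by
    rcases g5 with h | h
    · have := congrArg pos h
      rw [pos_pt hp, pos_pt (U := V) (g2 (by simp))] at this
      exact this.symm
    · exact absurd (by rw [pos_pt hp]; exact hp) h
  have hγ1 : h < dist (γ 1) p := by
    by_contra hle
    push Not at hle
    have e1 := hball (γ 1) hle
    have e2 : V.dp p y ≤ dist (V.pt p) (V.pt (γ 1)) + V.dp (γ 1) y := dp_le_dist_add_dp _ _ _
    have e3 : V.dp (γ 1) y < V.dp p y - h := g4.trans_le (min_le_right _ _)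
    rw [dist_comm] at hle
    linarith
  have hc : ContinuousOn (fun t => dist (γ t) p) (Icc 0 1) :=
    fun t ht => Filter.Tendsto.dist (g1 t ht) tendsto_const_nhds
  obtain ⟨t, ht, hth⟩ := intermediate_value_Icc zero_le_one hc
    (show h ∈ Icc _ _ from ⟨by simp [hγ0, h0.le], hγ1.le⟩)
  have e1 := hmin (show γ t ∈ sphere p h from hth)
  have e2 := g6 t ht
  rw [hball (γ t) (by rw [mem_closedBall]; exact hth.le), dist_comm p] at e2
  simp only at hth
  rw [hth] at e2
  have e3 := min_le_left ε (V.dp p y - h)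
  change V.dp q y ≤ V.dp (γ t) y at e1
  change h + V.dp (γ t) y < V.dp p y + _ at e2
  linarith

/-- Geodesic points at a given distance. -/
lemma exists_exact {y₁ y₂ : V.Bd} {η κ : ℝ} (h0 : 0 < η)
    (hκ : 0 < κ) (key : ∀ p ∈ V, η ≤ V.dp p y₁ → η / 2 ≤ V.dp p y₂ →
      V.dp p y₁ + V.dp p y₂ ≤ dist y₁ y₂ + κ → κ ≤ V.rad p) {τ : ℝ} (hτ : η ≤ τ)
    (hτ' : τ + η ≤ dist y₁ y₂) :
    ∃ p ∈ V, V.dp p y₁ = τ ∧ V.dp p y₂ = dist y₁ y₂ - τ := by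
  have hstep : ∀ n : ℕ, ∃ p ∈ V, V.dp p y₁ = τ ∧ κ ≤ V.rad p ∧
      V.dp p y₂ ≤ dist y₁ y₂ - τ + 1 / (n + 1) := by
    intro n
    obtain ⟨γ, g1, g2, g3, g4, -, -, g6⟩ := exists_path_X y₁.1 y₂.1
      (show 0 < min (min κ η) (1 / ((n:ℝ) + 1)) by positivity)
    have l1 := min_le_left (min κ η) (1 / ((n:ℝ) + 1))
    have l2 := min_le_right (min κ η) (1 / ((n:ℝ) + 1))
    have l3 := min_le_left κ η
    have l4 := min_le_right κ η
    have hc : ContinuousOn (fun t => V.dp (γ t) y₁) (Icc 0 1) := (continuousOn_dp y₁).comp g1 g2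
    change V.dp (γ 0) y₁ < _ at g3
    change V.dp (γ 1) y₂ < _ at g4
    obtain ⟨t, ht, hth⟩ := intermediate_value_Icc zero_le_one hc
      (show τ ∈ Icc _ _ from ⟨by linarith, by linarith [dist_le_dp_add_dp (γ 1) y₁ y₂]⟩)
    have e := g6 t ht
    rw [dist_comm y₁.1] at e
    change V.dp (γ t) y₁ + V.dp (γ t) y₂ < dist y₁ y₂ + _ at e
    simp only at hth
    have e2 := dist_le_dp_add_dp (γ t) y₁ y₂
    refine ⟨γ t, g2 ht, hth, key _ (g2 ht) (by linarith) (by linarith) (by linarith), by linarith⟩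
  choose p hp hp1 hpr hp2 using hstep
  have hbd : ∀ n, p n ∈ closedBall y₁.pos τ := fun n => by
    rw [mem_closedBall, ← hp1 n]; exact dist_pos_le_dp (hp n) y₁
  obtain ⟨q, -, φ, hφ, hlim⟩ := (isCompact_closedBall y₁.pos τ).tendsto_subseq hbd
  have hqr : κ ≤ V.rad q := ge_of_tendsto' ((rad_continuous.tendsto q).comp hlim) fun n => hpr _
  have hq : q ∈ V := mem_of_rad_pos (hκ.trans_le hqr)
  have c1 : ∀ y : V.Bd, Tendsto (fun n => V.dp (p (φ n)) y) atTop (𝓝 (V.dp q y)) := fun y =>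
    (((continuousOn_dp y).continuousAt (V.isOpen.mem_nhds hq)).tendsto).comp hlim
  have e1 : V.dp q y₁ = τ := tendsto_nhds_unique (c1 y₁) (by simp [hp1])
  have e2 : V.dp q y₂ ≤ dist y₁ y₂ - τ := by
    have : Tendsto (fun n => dist y₁ y₂ - τ + 1 / ((φ n : ℝ) + 1)) atTop (𝓝 (dist y₁ y₂ - τ + 0)) :=
      tendsto_const_nhds.add (tendsto_one_div_add_atTop_nhds_zero_nat.comp hφ.tendsto_atTop)
    rw [add_zero] at this
    exact le_of_tendsto_of_tendsto' (c1 y₂) this fun n => hp2 _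
  exact ⟨q, hq, e1, le_antisymm e2 (by linarith [dist_le_dp_add_dp q y₁ y₂])⟩

lemma le_dist_pos_of_key {y₁ y₂ : V.Bd} {η κ : ℝ} (h0 : 0 < η) (h1 : 3 * η ≤ dist y₁ y₂)
    (hκ : 0 < κ) (key : ∀ p ∈ V, η / 2 ≤ V.dp p y₁ → η / 2 ≤ V.dp p y₂ →
      V.dp p y₁ + V.dp p y₂ ≤ dist y₁ y₂ + κ → κ ≤ V.rad p) :
    dist y₁ y₂ - 4 * η ≤ dist y₁.pos y₂.pos := by
  set ℓ := dist y₁ y₂ with hℓ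
  obtain ⟨p₀, hp₀, ha₀, hb₀⟩ := exists_exact (y₁ := y₁) (y₂ := y₂) h0 hκ
    (fun p hp e1 e2 => key p hp (by linarith) e2) (τ := η) le_rfl (by linarith)
  rw [← hℓ] at hb₀
  obtain ⟨N, hN⟩ := exists_nat_gt ((ℓ - 2 * η) / min κ η)
  have hmin : 0 < min κ η := lt_min hκ h0
  have hN0 : (0:ℝ) < N := lt_of_le_of_lt (div_nonneg (by linarith) hmin.le) hN
  set h := (ℓ - 2 * η) / N with hh
  have hpos : 0 < h := div_pos (by linarith) hN0
  have hlt : h < min κ η := by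
    rw [hh, div_lt_iff₀ hN0]; rw [div_lt_iff₀ hmin] at hN; linarith
  have hhκ : h < κ := hlt.trans_le (min_le_left _ _)
  have hhη : h < η := hlt.trans_le (min_le_right _ _)
  have hNh : N * h = ℓ - 2 * η := by rw [hh]; field_simp
  have rad₀ : κ ≤ V.rad p₀ := key p₀ hp₀ (by linarith) (by linarith) (by linarith)
  obtain ⟨q₁, hq₁, hb₁⟩ := exists_sphere_step (y := y₂) hp₀ hpos (hhκ.trans_le rad₀) (by linarith)
  set w := q₁ - p₀ with hw
  have hwn : ‖w‖ = h := by rw [hw, ← dist_eq_norm, hq₁]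
  have ind : ∀ k : ℕ, k + 1 ≤ N → (p₀ + (k:ℝ) • w ∈ V ∧ p₀ + ((k:ℝ) + 1) • w ∈ V ∧
      V.dp (p₀ + (k:ℝ) • w) y₁ ≤ η + k * h ∧ V.dp (p₀ + ((k:ℝ) + 1) • w) y₁ ≤ η + (k + 1) * h ∧
      V.dp (p₀ + ((k:ℝ) + 1) • w) y₂ ≤ ℓ - η - (k + 1) * h) := by
    intro k
    induction k with
    | zero =>
      intro _
      have e : p₀ + w = q₁ := by rw [hw]; abel
      have hq₁V : closedBall p₀ h ⊆ V.carrier :=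
        (closedBall_subset_ball (hhκ.trans_le rad₀)).trans (ball_rad_subset p₀)
      have hs : segment ℝ q₁ p₀ ⊆ V.carrier :=
        ((convex_closedBall p₀ h).segment_subset (by rw [mem_closedBall, hq₁])
          (mem_closedBall_self hpos.le)).trans hq₁V
      have := dp_le_dist_add_dp q₁ p₀ y₁
      rw [dist_pt_eq hs, hq₁] at this
      refine ⟨by simpa using hp₀, ?_, by simp [ha₀], ?_, ?_⟩
      · simp only [CharP.cast_eq_zero, zero_add, one_smul, e]
        exact hq₁V (by rw [mem_closedBall, hq₁])
      · simp only [CharP.cast_eq_zero, zero_add, one_smul, e]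
        linarith
      · simp only [CharP.cast_eq_zero, zero_add, one_smul, e]
        linarith
    | succ k ih =>
      intro hk
      obtain ⟨i1, i2, i3, i4, i5⟩ := ih (by omega)
      set pm := p₀ + (k:ℝ) • w with hpm
      set p := p₀ + ((k:ℝ) + 1) • w with hp
      have hdp : p - pm = w := by rw [hp, hpm]; module
      have hk' : ((k:ℝ) + 2) * h ≤ N * h := by
        have : ((k:ℝ) + 2) ≤ N := by exact_mod_cast hk
        gcongr
      have hsum := dist_le_dp_add_dp p y₁ y₂
      have hkh : 0 ≤ (k:ℝ) * h := by positivity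
      have hradp : κ ≤ V.rad p := key p i2 (by linarith) (by linarith) (by linarith)
      obtain ⟨q, hq, hbq⟩ := exists_sphere_step (y := y₂) i2 hpos (hhκ.trans_le hradp)
        (by linarith)
      have hcb : closedBall p h ⊆ V.carrier :=
        (closedBall_subset_ball (hhκ.trans_le hradp)).trans (ball_rad_subset p)
      have hqc : q ∈ closedBall p h := by rw [mem_closedBall, hq]
      have hpc : p ∈ closedBall p h := mem_closedBall_self hpos.le
      have hpmd : dist p pm = h := by rw [dist_eq_norm, hdp, hwn]
      have hpmc : pm ∈ closedBall p h := by rw [mem_closedBall, dist_comm, hpmd]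
      have s1 := dp_le_dist_add_dp q pm y₁
      rw [dist_pt_eq (((convex_closedBall p h).segment_subset hqc hpmc).trans hcb)] at s1
      have s2 := dp_le_dist_add_dp q p y₁
      rw [dist_pt_eq (((convex_closedBall p h).segment_subset hqc hpc).trans hcb), hq] at s2
      have s3 := dist_le_dp_add_dp q y₁ y₂
      have s4 : dist q pm = dist q p + dist p pm :=
        le_antisymm (dist_triangle _ _ _) (by rw [hq, hpmd]; linarith)
      have s5 : q - p = p - pm := by
        have sr : SameRay ℝ (q - p) (p - pm) := by
          rw [sameRay_iff_norm_add, sub_add_sub_cancel, ← dist_eq_norm, ← dist_eq_norm,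
            ← dist_eq_norm, s4]
        exact sr.eq_of_norm_eq (by rw [← dist_eq_norm, ← dist_eq_norm, hq, hpmd])
      have s6 : p₀ + (((k:ℝ) + 1) + 1) • w = q := by
        have : q = p + w := by rw [← hdp, ← s5]; abel
        rw [this, hp]; module
      push_cast
      rw [s6]
      exact ⟨i2, hcb hqc, i4, by linarith, by linarith⟩
  have hN1 : 1 ≤ N := by
    rcases Nat.eq_zero_or_pos N with h | h
    · simp [h] at hN0
    · exact h
  obtain ⟨-, i2, -, -, i5⟩ := ind (N - 1) (by omega)
  have hcast : ((N - 1 : ℕ) : ℝ) + 1 = N := by rw [Nat.cast_sub hN1]; simp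
  rw [hcast] at i2 i5
  have f1 := dist_pos_le_dp i2 y₂
  have f2 := dist_pos_le_dp hp₀ y₁
  have f3 : dist p₀ (p₀ + (N:ℝ) • w) = N * h := by
    rw [dist_eq_norm, sub_add_cancel_left, norm_neg, norm_smul, hwn]; simp
  have f4 := dist_triangle4 p₀ y₁.pos y₂.pos (p₀ + (N:ℝ) • w)
  rw [dist_comm y₂.pos] at f4
  linarith

lemma chord_of_key {y₁ y₂ : V.Bd} (hne : y₁ ≠ y₂)
    (key : ∀ η > 0, ∃ κ > 0, ∀ p ∈ V, η ≤ V.dp p y₁ → η ≤ V.dp p y₂ →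
      V.dp p y₁ + V.dp p y₂ ≤ dist y₁ y₂ + κ → κ ≤ V.rad p) :
    Chord V y₁ y₂ := by
  have hℓ : 0 < dist y₁ y₂ := dist_pos.2 hne
  have hd : dist y₁.pos y₂.pos = dist y₁ y₂ := by
    refine le_antisymm (Bd.dist_pos_le _ _) (le_of_forall_pos_le_add fun ε hε => ?_)
    obtain ⟨η, h0, h1, h2⟩ : ∃ η > 0, 3 * η ≤ dist y₁ y₂ ∧ 4 * η ≤ ε :=
      ⟨min (dist y₁ y₂ / 3) (ε / 4), by positivity, by linarith [min_le_left (dist y₁ y₂ / 3) (ε / 4)],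
        by linarith [min_le_right (dist y₁ y₂ / 3) (ε / 4)]⟩
    obtain ⟨κ, hκ, hk⟩ := key (η / 2) (half_pos h0)
    linarith [le_dist_pos_of_key h0 h1 hκ hk]
  have main : ∀ p ∈ openSegment ℝ y₁.pos y₂.pos, p ∈ V ∧ V.dp p y₁ = dist p y₁.pos ∧
      V.dp p y₂ = dist p y₂.pos := by
    intro p hp
    have hsum : dist y₁.pos p + dist p y₂.pos = dist y₁.pos y₂.pos :=
      dist_add_dist_of_mem_segment (openSegment_subset_segment _ _ _ hp)
    have hposne : y₁.pos ≠ y₂.pos := dist_pos.1 (hd ▸ hℓ)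
    have hp1 : 0 < dist y₁.pos p := dist_pos.2 (by
      rintro rfl; exact hposne ((left_mem_openSegment_iff).1 hp))
    have hp2 : 0 < dist p y₂.pos := dist_pos.2 (by
      rintro rfl; exact hposne ((right_mem_openSegment_iff).1 hp))
    set η := min (dist y₁.pos p) (dist p y₂.pos) with hη
    have l1 := min_le_left (dist y₁.pos p) (dist p y₂.pos)
    have l2 := min_le_right (dist y₁.pos p) (dist p y₂.pos)
    have hη0 : 0 < η := lt_min hp1 hp2
    obtain ⟨κ, hκ, hk⟩ := key (η / 2) (half_pos hη0)
    obtain ⟨q, hq, e1, e2⟩ := exists_exact (y₁ := y₁) (y₂ := y₂) hη0 hκ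
      (fun p hp e1 e2 => hk p hp (by linarith) e2) (τ := dist y₁.pos p) l1 (by linarith)
    have q1 := dist_pos_le_dp hq y₁
    have q2 := dist_pos_le_dp hq y₂
    have q3 := dist_triangle y₁.pos q y₂.pos
    rw [dist_comm y₁.pos q] at q3
    have q4 : dist y₁.pos q = dist y₁.pos p := by rw [dist_comm y₁.pos q]; linarith
    have q5 : dist q y₂.pos = dist p y₂.pos := by linarith
    obtain rfl : q = p := by
      have w1 : Wbtw ℝ y₁.pos q y₂.pos := by
        rw [← dist_add_dist_eq_iff]; linarith
      have w2 : Wbtw ℝ y₁.pos p y₂.pos := by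
        rw [← dist_add_dist_eq_iff]; linarith
      obtain ⟨s, hs, rfl⟩ := w1
      obtain ⟨t, ht, rfl⟩ := w2
      rw [dist_left_lineMap, dist_left_lineMap, Real.norm_of_nonneg hs.1,
        Real.norm_of_nonneg ht.1] at q4
      rw [mul_right_cancel₀ (dist_pos.2 hposne).ne' q4]
    refine ⟨hq, ?_, ?_⟩
    · rw [e1, dist_comm]
    · linarith
  exact ⟨dist_pos.1 (hd ▸ hℓ), fun p hp => (main p hp).1, fun p hp => (main p hp).2.1,
    fun p hp => (main p hp).2.2⟩

/-- Two elements touched by a common ball correspond to the ends of a chord. -/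
lemma Touch.chord_map (f : U.Bd ≃ᵢ V.Bd) {c : Plane} {r : ℝ} {x₁ x₂ : U.Bd} (h₁ : Touch U c r x₁)
    (h₂ : Touch U c r x₂) (hne : x₁ ≠ x₂) : Chord V (f x₁) (f x₂) := by
  refine chord_of_key (f.injective.ne hne) fun η hη => ?_
  have hℓ : dist (f x₁) (f x₂) = dist x₁.pos x₂.pos := by
    rw [f.isometry.dist_eq, (h₁.chord h₂ hne).dist_eq]
  set ℓ := dist x₁.pos x₂.pos with hℓd
  have hposne := h₁.pos_ne h₂ hne
  let K : Set Plane := (closedBall x₁.pos (ℓ + 1)) ∩ ((ball c r)ᶜ ∩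
    ({s | η / 4 ≤ dist s x₁.pos} ∩ {s | η / 4 ≤ dist s x₂.pos}))
  have hK : IsCompact K := by
    refine (isCompact_closedBall _ _).inter_right (isOpen_ball.isClosed_compl.inter
      (IsClosed.inter ?_ ?_))
    · exact isClosed_le continuous_const (continuous_id.dist continuous_const)
    · exact isClosed_le continuous_const (continuous_id.dist continuous_const)
  obtain ⟨m, hm, hmK⟩ : ∃ m > ℓ, ∀ s ∈ K, m ≤ dist s x₁.pos + dist s x₂.pos := by
    rcases K.eq_empty_or_nonempty with he | hne'
    · exact ⟨ℓ + 1, by linarith, by simp [he]⟩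
    · obtain ⟨s, hs, hmin⟩ := hK.exists_isMinOn hne'
        (f := fun s => dist s x₁.pos + dist s x₂.pos)
        ((continuous_id.dist continuous_const).add (continuous_id.dist continuous_const)).continuousOn
      refine ⟨_, ?_, fun s hs => hmin hs⟩
      have hle : ℓ ≤ dist s x₁.pos + dist s x₂.pos := dist_triangle_left _ _ _
      refine lt_of_le_of_ne hle fun he => hs.2.1 (h₁.openSegment_subset h₂ hne ?_)
      have hw : s ∈ segment ℝ x₁.pos x₂.pos := by
        rw [mem_segment_iff_wbtw, ← dist_add_dist_eq_iff, dist_comm x₁.pos s]; exact he.symm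
      refine mem_openSegment_of_ne_left_right ?_ ?_ hw
      · rintro rfl
        have := hs.2.2.1
        simp at this
        linarith
      · rintro rfl
        have := hs.2.2.2
        simp at this
        linarith
  refine ⟨min (min ((m - ℓ) / 4) (η / 4)) (1 / 4), by
    have : 0 < m - ℓ := by linarith
    positivity, fun p hp ha hb hab => ?_⟩
  set κ := min (min ((m - ℓ) / 4) (η / 4)) (1 / 4) with hκ
  have k1 : κ ≤ (m - ℓ) / 4 := (min_le_left _ _).trans (min_le_left _ _)
  have k2 : κ ≤ η / 4 := (min_le_left _ _).trans (min_le_right _ _)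
  have k3 : κ ≤ 1 / 4 := min_le_right _ _
  by_contra hlt
  push Not at hlt
  obtain ⟨b, hb'⟩ := exists_nearest (f x₁).hne hp
  have hδ := hb'.dp_center
  set s := (f.symm b).pos with hs
  have d1 : dist s x₁.pos ≤ V.dp p (f x₁) + V.rad p := by
    calc _ ≤ dist (f.symm b) x₁ := Bd.dist_pos_le _ _
      _ = dist b (f x₁) := by rw [← f.isometry.dist_eq, f.apply_symm_apply]
      _ ≤ V.dp p b + V.dp p (f x₁) := dist_le_dp_add_dp _ _ _
      _ = _ := by rw [hδ, add_comm]
  have d2 : dist s x₂.pos ≤ V.dp p (f x₂) + V.rad p := by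
    calc _ ≤ dist (f.symm b) x₂ := Bd.dist_pos_le _ _
      _ = dist b (f x₂) := by rw [← f.isometry.dist_eq, f.apply_symm_apply]
      _ ≤ V.dp p b + V.dp p (f x₂) := dist_le_dp_add_dp _ _ _
      _ = _ := by rw [hδ, add_comm]
  have tri : ℓ ≤ dist s x₁.pos + dist s x₂.pos := dist_triangle_left _ _ _
  have hsK : s ∈ K := by
    refine ⟨?_, fun hin => (f.symm b).2 (h₁.ball_subset hin), ?_, ?_⟩
    · rw [mem_closedBall]; linarith
    · change η / 4 ≤ _
      linarith
    · change η / 4 ≤ _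
      linarith
  linarith [hmK s hsK]

end Dom

namespace Dom

variable {U V : Dom}

variable (U) in
/-- The part of a domain interior to the convex hull of its frontier. -/
def core : Set Plane := corePart U.carrier

lemma core_subset : U.core ⊆ U.carrier := inter_subset_left

lemma core_subset_hull : U.core ⊆ convexHull ℝ (frontier U.carrier) :=
  inter_subset_right.trans interior_subset

lemma isOpen_core : IsOpen U.core := U.isOpen.inter isOpen_interior

lemma not_mem_of_mem_frontier {z : Plane} (hz : z ∈ frontier U.carrier) : z ∉ U := by
  rw [U.isOpen.frontier_eq] at hz
  exact hz.2

lemma exists_not_mem_of_core {q : Plane} (hq : q ∈ U.core) : ∃ z, z ∉ U := by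
  have : (frontier U.carrier).Nonempty := by
    rw [← convexHull_nonempty_iff (𝕜 := ℝ)]
    exact ⟨q, core_subset_hull hq⟩
  obtain ⟨z, hz⟩ := this
  exact ⟨z, not_mem_of_mem_frontier hz⟩

variable (U) in
/-- The power function whose maximisers are the centres of cells. -/
def phi (q c : Plane) : ℝ := U.rad c ^ 2 - dist c q ^ 2

lemma continuous_phi : Continuous fun p : Plane × Plane => U.phi p.1 p.2 :=
  ((rad_continuous.comp continuous_snd).pow 2).sub ((continuous_snd.dist continuous_fst).pow 2)

lemma phi_self (q : Plane) : U.phi q q = U.rad q ^ 2 := by simp [phi]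

lemma rad_sq_le {c y : Plane} (hy : y ∉ U) (q : Plane) :
    U.phi q c ≤ dist y q ^ 2 - 2 * ⟪c - q, y - q⟫ := by
  have h := pow_le_pow_left₀ (rad_nonneg c) (rad_le_dist (p := c) hy) 2
  have e : c - y = (c - q) - (y - q) := by abel
  rw [phi, dist_eq_norm c q, dist_eq_norm y q]
  rw [dist_eq_norm, e, norm_sub_sq_real] at h
  linarith

/-- Finitely many frontier points surround a point of the core. -/
lemma exists_finite_hull {s : Set Plane} {q : Plane} (hq : q ∈ interior (convexHull ℝ s)) :
    ∃ t : Finset Plane, (t : Set Plane) ⊆ s ∧ q ∈ interior (convexHull ℝ (t : Set Plane)) := by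
  classical
  obtain ⟨b, hb, hbs⟩ := exists_mem_interior_convexHull_affineBasis (mem_interior_iff_mem_nhds.1 hq)
  have hbi : ∀ i, ∃ t : Finset Plane, (t : Set Plane) ⊆ s ∧ b i ∈ convexHull ℝ (t : Set Plane) := by
    intro i
    have := hbs (subset_convexHull ℝ _ (mem_range_self i))
    rw [convexHull_eq_union_convexHull_finite_subsets] at this
    simpa using this
  choose t ht hbt using hbi
  refine ⟨Finset.univ.biUnion t, ?_, ?_⟩
  · intro y hy
    simp only [Finset.coe_biUnion, mem_iUnion] at hy
    obtain ⟨i, -, hi⟩ := hy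
    exact ht i hi
  · refine interior_mono (convexHull_min ?_ (convex_convexHull ℝ _)) hb
    rintro _ ⟨i, rfl⟩
    refine convexHull_mono ?_ (hbt i)
    intro y hy
    simp only [Finset.coe_biUnion, mem_iUnion]
    exact ⟨i, by simp, hy⟩

/-- Local coercivity of the power function. -/
lemma exists_phi_bound {q : Plane} (hq : q ∈ U.core) :
    ∃ ε > 0, ∃ R : ℝ, ∀ q' ∈ ball q ε, ∀ c, U.phi q' c ≤ R - ε * dist c q' := by
  obtain ⟨t, ht, hqt⟩ := exists_finite_hull hq.2
  obtain ⟨δ, hδ, hball⟩ := Metric.mem_nhds_iff.1 (mem_interior_iff_mem_nhds.1 hqt)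
  obtain ⟨R, hR⟩ := (t.finite_toSet.isBounded).subset_closedBall q
  refine ⟨δ / 2, half_pos hδ, (|R| + δ) ^ 2, fun q' hq' c => ?_⟩
  rw [mem_ball] at hq'
  have hle : ∃ y ∈ t, δ / 4 * dist c q' ≤ ⟪c - q', y - q'⟫ := by
    set n := ‖c - q'‖ with hn
    let z := q' + (δ / 4 / n) • (c - q')
    have hz : z ∈ convexHull ℝ (t : Set Plane) := by
      apply hball
      rw [mem_ball]
      have : dist z q' ≤ δ / 4 := by
        rw [dist_eq_norm, add_sub_cancel_left, norm_smul, ← hn, Real.norm_of_nonneg (by positivity)]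
        rcases eq_or_ne n 0 with h | h
        · simp [h]; positivity
        · rw [div_mul_cancel₀ _ h]
      linarith [dist_triangle z q' q]
    have hconv : ConvexOn ℝ univ fun y : Plane => ⟪c - q', y⟫ :=
      ((innerSL ℝ (c - q')).toLinearMap.convexOn convex_univ)
    obtain ⟨y, hy, hyz⟩ := hconv.exists_ge_of_mem_convexHull (subset_univ _) hz
    refine ⟨y, hy, ?_⟩
    rw [inner_add_right, inner_smul_right, real_inner_self_eq_norm_sq, ← hn] at hyz
    rw [inner_sub_right, dist_eq_norm, ← hn]
    have : δ / 4 / n * n ^ 2 = δ / 4 * n := by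
      rcases eq_or_ne n 0 with h | h
      · simp [h]
      · field_simp
    linarith
  obtain ⟨y, hy, hyc⟩ := hle
  have h1 := rad_sq_le (c := c) (not_mem_of_mem_frontier (ht hy)) q'
  have h2 : dist y q' ≤ |R| + δ := by
    have := hR hy
    rw [mem_closedBall] at this
    rw [dist_comm] at hq'
    linarith [dist_triangle y q q', le_abs_self R]
  have h3 := pow_le_pow_left₀ dist_nonneg h2 2
  linarith

/-- `c` is a maximiser of the power function at `q`. -/
def IsMax (U : Dom) (q c : Plane) : Prop := ∀ c', U.phi q c' ≤ U.phi q c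

lemma exists_isMax {q : Plane} (hq : q ∈ U.core) : ∃ c, IsMax U q c := by
  obtain ⟨ε, hε, R, hb⟩ := exists_phi_bound hq
  have h0 : ∀ c, U.phi q c ≤ R - ε * dist c q := hb q (mem_ball_self hε)
  have hK := isCompact_closedBall q (|R| / ε)
  obtain ⟨c, hc, hmax⟩ := hK.exists_isMaxOn ⟨q, mem_closedBall_self (by positivity)⟩
    (continuous_phi.comp (Continuous.prodMk_right q)).continuousOn
  refine ⟨c, fun c' => ?_⟩
  by_cases hc' : c' ∈ closedBall q (|R| / ε)
  · exact hmax hc'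
  · have h1 := h0 c'
    rw [mem_closedBall, not_le, div_lt_iff₀ hε] at hc'
    have h2 : U.phi q q ≤ U.phi q c := hmax (mem_closedBall_self (by positivity))
    rw [phi_self] at h2
    have := sq_nonneg (U.rad q)
    linarith [le_abs_self R]

lemma IsMax.dist_lt {q c : Plane} (h : IsMax U q c) (hq : q ∈ U.core) : dist c q < U.rad c := by
  have h1 := h q
  have h2 := rad_pos (exists_not_mem_of_core hq) (core_subset hq)
  rw [phi_self, phi] at h1
  exact lt_of_pow_lt_pow_left₀ 2 (rad_nonneg c) (by nlinarith)

lemma IsMax.rad_pos {q c : Plane} (h : IsMax U q c) (hq : q ∈ U.core) : 0 < U.rad c :=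
  dist_nonneg.trans_lt (h.dist_lt hq)

lemma isCompact_convexHull_plane {K : Set Plane} (hK : IsCompact K) :
    IsCompact (convexHull ℝ K) := by
  let Φ : (Fin 3 → ℝ) × (Fin 3 → Plane) → Plane := fun p => ∑ i, p.1 i • p.2 i
  have hΦ : Continuous Φ := by fun_prop
  have hc : IsCompact (stdSimplex ℝ (Fin 3) ×ˢ (univ.pi fun _ : Fin 3 => K)) :=
    (isCompact_stdSimplex ℝ (Fin 3)).prod (isCompact_univ_pi fun _ => hK)
  convert hc.image hΦ
  refine Subset.antisymm (fun q hq => ?_) ?_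
  · obtain ⟨ι, _, z, w, hz, hind, hw, hw1, hwq⟩ := eq_pos_convex_span_of_mem_convexHull hq
    have hcard : Fintype.card ι ≤ Fintype.card (Fin 3) := by
      have := hind.card_le_finrank_succ
      have h2 := Submodule.finrank_le (vectorSpan ℝ (range z))
      rw [finrank_euclideanSpace_fin] at h2
      simp only [Fintype.card_fin]
      omega
    obtain ⟨e⟩ := Function.Embedding.nonempty_of_card_le hcard
    obtain ⟨k⟩ : Nonempty K := by
      obtain ⟨k, hk⟩ := convexHull_nonempty_iff.1 ⟨q, hq⟩
      exact ⟨⟨k, hk⟩⟩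
    refine ⟨(Function.extend e w 0, Function.extend e z fun _ => k), ⟨⟨fun j => ?_, ?_⟩, ?_⟩, ?_⟩
    · by_cases hj : ∃ i, e i = j
      · obtain ⟨i, rfl⟩ := hj
        simpa only [e.injective.extend_apply] using (hw i).le
      · simp only [Function.extend_apply' _ _ _ hj, Pi.zero_apply, le_refl]
    · rw [← hw1]
      refine (Fintype.sum_of_injective e e.injective _ _ (fun j hj => ?_) fun i => ?_).symm
      · simp only [Function.extend_apply' _ _ _ hj, Pi.zero_apply]
      · simp only [e.injective.extend_apply]
    · intro j _
      by_cases hj : ∃ i, e i = j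
      · obtain ⟨i, rfl⟩ := hj
        simpa only [e.injective.extend_apply] using hz (mem_range_self i)
      · simp only [Function.extend_apply' _ _ _ hj]
        exact k.2
    · rw [← hwq]
      refine (Fintype.sum_of_injective e e.injective _ _ (fun j hj => ?_) fun i => ?_).symm
      · simp only [Function.extend_apply' _ _ _ hj, Pi.zero_apply, zero_smul]
      · simp only [e.injective.extend_apply]
  · rintro _ ⟨⟨w, z⟩, ⟨⟨hw, hw1⟩, hz⟩, rfl⟩
    exact (convex_convexHull ℝ K).sum_mem (fun i _ => hw i) hw1
      fun i _ => subset_convexHull ℝ K (hz i (mem_univ i))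

/-- A maximiser sees the point in the convex hull of its contact points. -/
lemma IsMax.mem_convexHull {q c : Plane} (h : IsMax U q c) (hne : ∃ z, z ∉ U) :
    q ∈ convexHull ℝ (U.carrierᶜ ∩ sphere c (U.rad c)) := by
  by_contra hq
  have hcomp : IsCompact (U.carrierᶜ ∩ sphere c (U.rad c)) :=
    (isCompact_sphere _ _).inter_left U.isOpen.isClosed_compl
  obtain ⟨F, u, hF, hu⟩ := geometric_hahn_banach_closed_point (convex_convexHull ℝ _)
    (isCompact_convexHull_plane hcomp).isClosed hq
  set v := (InnerProductSpace.toDual ℝ Plane).symm F with hv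
  have hFv : ∀ x, F x = ⟪v, x⟫ := fun x => by rw [hv, InnerProductSpace.toDual_symm_apply]
  choose z hz hzd using fun n : ℕ => exists_dist_eq_rad hne (c + (1 / ((n:ℝ) + 1)) • v)
  have hin : ∀ n, ⟪v, q - z n⟫ ≤ 0 := by
    intro n
    set t : ℝ := 1 / ((n:ℝ) + 1) with ht
    have htp : 0 < t := by positivity
    have h1 := h (c + t • v)
    have h2 := pow_le_pow_left₀ (rad_nonneg c) (rad_le_dist (p := c) (hz n)) 2
    rw [phi, phi, ← hzd n, dist_eq_norm, dist_eq_norm, dist_eq_norm] at h1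
    rw [dist_eq_norm] at h2
    have e1 : c + t • v - z n = (c - z n) + t • v := by abel
    have e2 : c + t • v - q = (c - q) + t • v := by abel
    rw [e1, e2, norm_add_sq_real, norm_add_sq_real, inner_smul_right, inner_smul_right] at h1
    have e3 : ⟪v, q - z n⟫ = ⟪c - z n, v⟫ - ⟪c - q, v⟫ := by
      rw [← inner_sub_left, real_inner_comm]; congr 1; abel
    rw [e3]
    by_contra hlt
    push Not at hlt
    have := mul_pos htp hlt
    linarith
  have hlim0 : Tendsto (fun n : ℕ => c + (1 / ((n:ℝ) + 1)) • v) atTop (𝓝 c) := by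
    have : Tendsto (fun n : ℕ => c + (1 / ((n:ℝ) + 1)) • v) atTop (𝓝 (c + (0:ℝ) • v)) :=
      tendsto_const_nhds.add (tendsto_one_div_add_atTop_nhds_zero_nat.smul_const v)
    simpa using this
  have hrad := (rad_continuous (U := U)).tendsto c |>.comp hlim0
  have hbd : ∃ R, ∀ n, z n ∈ closedBall c R := by
    have h1 := hrad.isBoundedUnder_le.bddAbove_range
    have h2 := (hlim0.dist (tendsto_const_nhds (x := c))).isBoundedUnder_le.bddAbove_range
    obtain ⟨A, hA⟩ := h1
    obtain ⟨B, hB⟩ := h2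
    refine ⟨A + B, fun n => ?_⟩
    have a1 : U.rad (c + (1 / ((n:ℝ) + 1)) • v) ≤ A := hA (mem_range_self n)
    have a2 : dist (c + (1 / ((n:ℝ) + 1)) • v) c ≤ B := hB (mem_range_self n)
    rw [mem_closedBall]
    have := dist_triangle_left (z n) c (c + (1 / ((n:ℝ) + 1)) • v)
    rw [hzd] at this
    linarith
  obtain ⟨R, hR⟩ := hbd
  obtain ⟨z₀, -, φ, hφ, hlim⟩ := (isCompact_closedBall c R).tendsto_subseq hR
  have hz₀ : z₀ ∈ U.carrierᶜ :=
    U.isOpen.isClosed_compl.mem_of_tendsto hlim (Eventually.of_forall fun n => hz (φ n))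
  have hd : dist c z₀ = U.rad c := by
    refine tendsto_nhds_unique ((hlim0.comp hφ.tendsto_atTop).dist hlim) ?_
    refine (hrad.comp hφ.tendsto_atTop).congr fun n => ?_
    exact (hzd _).symm
  have hle : ⟪v, q - z₀⟫ ≤ 0 := by
    have : Tendsto (fun n => ⟪v, q - z (φ n)⟫) atTop (𝓝 ⟪v, q - z₀⟫) :=
      tendsto_const_nhds.inner (tendsto_const_nhds.sub hlim)
    exact le_of_tendsto' this fun n => hin _
  have := hF z₀ (subset_convexHull ℝ _ ⟨hz₀, by rw [mem_sphere, dist_comm]; exact hd⟩)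
  rw [hFv] at this hu
  rw [inner_sub_right] at hle
  linarith

/-- A Delaunay cell representing a point of the core. -/
structure Cell (U : Dom) (q : Plane) where
  center : Plane
  verts : Finset U.Bd
  wt : U.Bd → ℝ
  touch : ∀ x ∈ verts, Touch U center (U.rad center) x
  wt_pos : ∀ x ∈ verts, 0 < wt x
  wt_sum : ∑ x ∈ verts, wt x = 1
  sum_eq : ∑ x ∈ verts, wt x • x.pos = q
  indep : AffineIndependent ℝ (fun x : verts => x.1.pos)
  isMax : IsMax U q center

lemma exists_cell_of_isMax {q c : Plane} (h : IsMax U q c) (hq : q ∈ U.core) :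
    ∃ C : Cell U q, C.center = c := by
  classical
  obtain ⟨ι, _, z, w, hz, hind, hw, hw1, hwq⟩ :=
    eq_pos_convex_span_of_mem_convexHull (h.mem_convexHull (exists_not_mem_of_core hq))
  have hr := h.rad_pos hq
  have hex : ∀ i, ∃ x : U.Bd, x.pos = z i ∧ Touch U c (U.rad c) x := fun i =>
    exists_touch hr (ball_rad_subset c) (hz (mem_range_self i)).1
      (by have := (hz (mem_range_self i)).2; rwa [mem_sphere, dist_comm] at this)
  choose x hx ht using hex
  have hxi : Function.Injective x := fun i j hij => hind.injective (by rw [← hx i, ← hx j, hij])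
  let e : ι ≃ (Finset.univ.image x) :=
    Equiv.ofBijective (fun i => ⟨x i, Finset.mem_image_of_mem x (Finset.mem_univ i)⟩)
      ⟨fun i j hij => hxi (congrArg Subtype.val hij), fun ⟨y, hy⟩ => by
        obtain ⟨i, -, rfl⟩ := Finset.mem_image.1 hy
        exact ⟨i, rfl⟩⟩
  let w' : U.Bd → ℝ := fun y => if hy : ∃ i, x i = y then w hy.choose else 0
  have hw' : ∀ i, w' (x i) = w i := by
    intro i
    have hy : ∃ j, x j = x i := ⟨i, rfl⟩
    simp only [w', dif_pos hy]
    rw [hxi hy.choose_spec]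
  refine ⟨⟨c, Finset.univ.image x, w', ?_, ?_, ?_, ?_, ?_, h⟩, rfl⟩
  · intro y hy
    obtain ⟨i, -, rfl⟩ := Finset.mem_image.1 hy
    exact ht i
  · intro y hy
    obtain ⟨i, -, rfl⟩ := Finset.mem_image.1 hy
    rw [hw']; exact hw i
  · rw [Finset.sum_image fun i _ j _ hij => hxi hij]
    simpa only [hw'] using hw1
  · rw [Finset.sum_image fun i _ j _ hij => hxi hij]
    simpa only [hw', hx] using hwq
  · rw [← affineIndependent_equiv e]
    have : (fun y : (Finset.univ.image x) => y.1.pos) ∘ e = z := funext hx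
    rwa [this]

lemma exists_cell {q : Plane} (hq : q ∈ U.core) : Nonempty (Cell U q) := by
  obtain ⟨c, hc⟩ := exists_isMax hq
  exact ⟨(exists_cell_of_isMax hc hq).choose⟩

end Dom

namespace Dom

variable {U V : Dom}

lemma sum_sum_norm_sub_sq {ι κ E : Type*} [NormedAddCommGroup E] [InnerProductSpace ℝ E]
    (s : Finset ι) (t : Finset κ) (a : ι → ℝ) (b : κ → ℝ) (ha : ∑ i ∈ s, a i = 1)
    (hb : ∑ j ∈ t, b j = 1) (y : ι → E) (z : κ → E) :
    ∑ i ∈ s, ∑ j ∈ t, a i * b j * ‖y i - z j‖ ^ 2 =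
      ∑ i ∈ s, a i * ‖y i‖ ^ 2 + ∑ j ∈ t, b j * ‖z j‖ ^ 2
        - 2 * ⟪∑ i ∈ s, a i • y i, ∑ j ∈ t, b j • z j⟫ := by
  have e : ∀ i j, a i * b j * ‖y i - z j‖ ^ 2 =
      (a i * ‖y i‖ ^ 2) * b j + a i * (b j * ‖z j‖ ^ 2) - 2 * (a i * (b j * ⟪y i, z j⟫)) := by
    intro i j
    rw [norm_sub_sq_real]; ring
  simp only [e, Finset.sum_sub_distrib, Finset.sum_add_distrib, ← Finset.mul_sum,
    ← Finset.sum_mul, ha, hb, one_mul, mul_one]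
  rw [sum_inner]
  simp only [inner_sum, inner_smul_left, inner_smul_right, RCLike.conj_to_real, Finset.mul_sum]
  congr 1
  refine Finset.sum_congr rfl fun i _ => Finset.sum_congr rfl fun j _ => ?_
  ring

/-- The squared distance between two weighted barycentres. -/
lemma norm_sub_barycenter_sq {ι κ E : Type*} [NormedAddCommGroup E] [InnerProductSpace ℝ E]
    (s : Finset ι) (t : Finset κ) (a : ι → ℝ) (b : κ → ℝ) (ha : ∑ i ∈ s, a i = 1)
    (hb : ∑ j ∈ t, b j = 1) (y : ι → E) (z : κ → E) :
    ‖∑ i ∈ s, a i • y i - ∑ j ∈ t, b j • z j‖ ^ 2 =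
      ∑ i ∈ s, ∑ j ∈ t, a i * b j * ‖y i - z j‖ ^ 2
        - (∑ i ∈ s, ∑ j ∈ s, a i * a j * ‖y i - y j‖ ^ 2) / 2
        - (∑ i ∈ t, ∑ j ∈ t, b i * b j * ‖z i - z j‖ ^ 2) / 2 := by
  rw [sum_sum_norm_sub_sq s t a b ha hb y z, sum_sum_norm_sub_sq s s a a ha ha y y,
    sum_sum_norm_sub_sq t t b b hb hb z z, norm_sub_sq_real,
    real_inner_self_eq_norm_sq, real_inner_self_eq_norm_sq]
  ring

/-! The planar geometry of two overlapping discs. -/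

lemma lens_real {α β ξ ω X₁ X₂ H κ : ℝ} (hα : 0 ≤ α) (hβ : 0 ≤ β) (hH : 0 < H)
    (hD : X₂ - X₁ ≤ κ * H) (hκ1 : κ ≤ 1)
    (h₁ : α ^ 2 + 2 * α * X₁ + 2 * H * ξ + ξ ^ 2 = 0)
    (h₂ : β ^ 2 - 2 * β * X₂ + 2 * H * ω + ω ^ 2 = 0) (hQ : 0 < α * ω + β * ξ) :
    (√(α ^ 2 + ξ ^ 2) + √(β ^ 2 + ω ^ 2)) ^ 2 ≤
      (α + β) ^ 2 + (ξ - ω) ^ 2 + 2 * (α * β) * κ ^ 2 := by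
  have e1 : ξ * H + α * X₁ ≤ 0 := by nlinarith [sq_nonneg α, sq_nonneg ξ]
  have e2 : ω * H - β * X₂ ≤ 0 := by nlinarith [sq_nonneg β, sq_nonneg ω]
  have hQle : α * ω + β * ξ ≤ α * β * κ := by
    have h3 : (α * ω + β * ξ) * H ≤ α * β * κ * H := by
      nlinarith [mul_le_mul_of_nonneg_left e1 hβ, mul_le_mul_of_nonneg_left e2 hα,
        mul_le_mul_of_nonneg_left hD (mul_nonneg hα hβ)]
    exact le_of_mul_le_mul_right h3 hH
  have hαβ : 0 < α * β := by
    by_contra h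
    have h0 : α * β = 0 := le_antisymm (not_lt.1 h) (mul_nonneg hα hβ)
    rw [h0] at hQle
    linarith
  have hα' : 0 < α := lt_of_le_of_ne hα (by rintro rfl; simp at hαβ)
  have hβ' : 0 < β := lt_of_le_of_ne hβ (by rintro rfl; simp at hαβ)
  set Q := α * ω + β * ξ with hQd
  set P := α * β - ξ * ω with hP
  have hQ1 : Q ≤ α * β := hQle.trans (by nlinarith)
  have hP' : 3 / 4 * (α * β) ≤ P := by
    rcases le_or_gt (ξ * ω) 0 with h | h
    · linarith
    · have : 4 * (α * β) * (ξ * ω) ≤ Q ^ 2 := by nlinarith [sq_nonneg (α * ω - β * ξ)]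
      have : Q ^ 2 ≤ (α * β) ^ 2 := pow_le_pow_left₀ hQ.le hQ1 2
      have : 4 * (ξ * ω) ≤ α * β := by
        by_contra hlt
        push Not at hlt
        nlinarith [mul_lt_mul_of_pos_left hlt hαβ]
      linarith
  have hprod : √(α ^ 2 + ξ ^ 2) * √(β ^ 2 + ω ^ 2) = √(P ^ 2 + Q ^ 2) := by
    rw [← Real.sqrt_mul (by positivity)]
    congr 1
    rw [hP, hQd]; ring
  have hPpos : 0 < P := by linarith
  have hs : √(P ^ 2 + Q ^ 2) ≤ P + (α * β) * κ ^ 2 := by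
    refine Real.sqrt_le_iff.2 ⟨by positivity, ?_⟩
    have : Q ^ 2 ≤ (α * β * κ) ^ 2 := pow_le_pow_left₀ hQ.le hQle 2
    have h4 : (α * β) ^ 2 * κ ^ 2 ≤ 2 * P * (α * β * κ ^ 2) := by
      have : 0 ≤ α * β * κ ^ 2 := by positivity
      nlinarith
    nlinarith [sq_nonneg (α * β * κ ^ 2)]
  have s1 := Real.sq_sqrt (show 0 ≤ α ^ 2 + ξ ^ 2 by positivity)
  have s2 := Real.sq_sqrt (show 0 ≤ β ^ 2 + ω ^ 2 by positivity)
  have : (√(α ^ 2 + ξ ^ 2) + √(β ^ 2 + ω ^ 2)) ^ 2 =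
      √(α ^ 2 + ξ ^ 2) ^ 2 + √(β ^ 2 + ω ^ 2) ^ 2 + 2 * √(P ^ 2 + Q ^ 2) := by
    rw [← hprod]; ring
  rw [this, s1, s2]
  linarith

/-- The rotation by a right angle. -/
def rot (p : Plane) : Plane := !₂[-p 1, p 0]

lemma norm_sq_plane (p : Plane) : ‖p‖ ^ 2 = p 0 ^ 2 + p 1 ^ 2 := by
  rw [EuclideanSpace.norm_sq_eq, Fin.sum_univ_two]; simp

lemma inner_plane (p q : Plane) : ⟪p, q⟫ = p 0 * q 0 + p 1 * q 1 := by
  rw [PiLp.inner_apply, Fin.sum_univ_two]; simp [mul_comm]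

lemma rot_apply_zero (p : Plane) : rot p 0 = -p 1 := rfl
lemma rot_apply_one (p : Plane) : rot p 1 = p 0 := rfl

lemma norm_rot (p : Plane) : ‖rot p‖ = ‖p‖ := by
  rw [← sq_eq_sq₀ (norm_nonneg _) (norm_nonneg _), norm_sq_plane, norm_sq_plane, rot_apply_zero,
    rot_apply_one]; ring

lemma inner_rot_self (p : Plane) : ⟪p, rot p⟫ = 0 := by
  rw [inner_plane, rot_apply_zero, rot_apply_one]; ring

lemma norm_sq_eq_inner {a : Plane} (ha : ‖a‖ = 1) (p : Plane) :
    ‖p‖ ^ 2 = ⟪p, a⟫ ^ 2 + ⟪p, rot a⟫ ^ 2 := by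
  have h : a 0 ^ 2 + a 1 ^ 2 = 1 := by rw [← norm_sq_plane, ha]; norm_num
  rw [norm_sq_plane, inner_plane, inner_plane, rot_apply_zero, rot_apply_one]
  linear_combination (-(p 0 ^ 2) - p 1 ^ 2) * h

lemma lens_point {o a v c₁ c₂ x w : Plane} {X₁ X₂ H κ : ℝ}
    (hav : ∀ p : Plane, ‖p‖ ^ 2 = ⟪p, a⟫ ^ 2 + ⟪p, v⟫ ^ 2)
    (hv : ‖v‖ = 1) (hva : ⟪v, a⟫ = 0) (ha : ‖a‖ = 1)
    (hc₁ : c₁ = o + X₁ • a) (hc₂ : c₂ = o + X₂ • a) (hH : 0 < H)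
    (hx : ‖x - c₁‖ ^ 2 = X₁ ^ 2 + H ^ 2) (hw : ‖w - c₂‖ ^ 2 = X₂ ^ 2 + H ^ 2)
    (hxa : ⟪x - o, a⟫ ≤ 0) (hwa : 0 ≤ ⟪w - o, a⟫) (hne : ⟪x - o, a⟫ < ⟪w - o, a⟫)
    (hpos : 0 ≤ ⟪w - o, a⟫ * ⟪x - o, v⟫ - ⟪x - o, a⟫ * ⟪w - o, v⟫)
    (hD : X₂ - X₁ ≤ κ * H) (hκ1 : κ ≤ 1) :
    ∃ m, ‖m - c₁‖ ^ 2 ≤ X₁ ^ 2 + H ^ 2 ∧ ‖m - c₂‖ ^ 2 ≤ X₂ ^ 2 + H ^ 2 ∧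
      (‖x - m‖ + ‖w - m‖) ^ 2 ≤ ‖x - w‖ ^ 2 - 2 * (⟪x - o, a⟫ * ⟪w - o, a⟫) * κ ^ 2 := by
  have haa : ⟪a, a⟫ = 1 := by rw [real_inner_self_eq_norm_sq, ha]; norm_num
  have hvv : ⟪v, v⟫ = 1 := by rw [real_inner_self_eq_norm_sq, hv]; norm_num
  have hav' : ⟪a, v⟫ = 0 := by rw [real_inner_comm]; exact hva
  set A := ⟪x - o, a⟫ with hA
  set B := ⟪w - o, a⟫ with hB
  set Y := ⟪x - o, v⟫ with hY
  set W := ⟪w - o, v⟫ with hW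
  have onL : ∀ b : ℝ, b ^ 2 ≤ H ^ 2 → ∀ X : ℝ, ‖o + b • v - (o + X • a)‖ ^ 2 ≤ X ^ 2 + H ^ 2 := by
    intro b hb X
    have e : o + b • v - (o + X • a) = b • v - X • a := by abel
    rw [e, hav, inner_sub_left, inner_sub_left, inner_smul_left, inner_smul_left, inner_smul_left,
      inner_smul_left, hva, haa, hvv, hav']
    simp only [RCLike.conj_to_real]
    nlinarith
  have dx : ∀ b : ℝ, ∀ y : Plane, ‖y - (o + b • v)‖ ^ 2 = ⟪y - o, a⟫ ^ 2 + (⟪y - o, v⟫ - b) ^ 2 := by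
    intro b y
    have e : y - (o + b • v) = (y - o) - b • v := by abel
    rw [e, hav, inner_sub_left (y - o), inner_sub_left (y - o), inner_smul_left, inner_smul_left, hva, hvv]
    simp only [RCLike.conj_to_real]
    ring
  have dc : ∀ X : ℝ, ∀ y : Plane, ‖y - (o + X • a)‖ ^ 2 = (⟪y - o, a⟫ - X) ^ 2 + ⟪y - o, v⟫ ^ 2 := by
    intro b y
    have e : y - (o + b • a) = (y - o) - b • a := by abel
    rw [e, hav, inner_sub_left (y - o), inner_sub_left (y - o), inner_smul_left, inner_smul_left, hav', haa]
    simp only [RCLike.conj_to_real]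
    ring
  have dxw : ‖x - w‖ ^ 2 = (A - B) ^ 2 + (Y - W) ^ 2 := by
    have e : x - w = (x - o) - (w - o) := by abel
    rw [e, hav, inner_sub_left (x - o), inner_sub_left (x - o)]
  rw [hc₁, dc, ← hA, ← hY] at hx
  rw [hc₂, dc, ← hB, ← hW] at hw
  have sqrt_eq : ∀ b : ℝ, ∀ y : Plane, ‖y - (o + b • v)‖ =
      √(⟪y - o, a⟫ ^ 2 + (⟪y - o, v⟫ - b) ^ 2) := fun b y => by
    rw [← dx, Real.sqrt_sq (norm_nonneg _)]
  have hBA : 0 < B - A := by linarith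
  set M := (B * Y - A * W) / (B - A) with hM
  have hM0 : 0 ≤ M := div_nonneg hpos hBA.le
  rcases le_or_gt M H with hMH | hMH
  · refine ⟨o + M • v, ?_, ?_, ?_⟩
    · rw [hc₁]; exact onL M (pow_le_pow_left₀ hM0 hMH 2) _
    · rw [hc₂]; exact onL M (pow_le_pow_left₀ hM0 hMH 2) _
    · have hYM : Y - M = -A / (B - A) * (Y - W) := by
        rw [hM]; field_simp; ring
      have hWM : W - M = -(B / (B - A)) * (Y - W) := by
        rw [hM]; field_simp; ring
      have n1 : ‖x - (o + M • v)‖ = -A / (B - A) * ‖x - w‖ := by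
        rw [← sq_eq_sq₀ (norm_nonneg _) (mul_nonneg (div_nonneg (by linarith) hBA.le) (norm_nonneg _)),
          dx, mul_pow, dxw, ← hA, ← hY, hYM]
        field_simp; ring
      have n2 : ‖w - (o + M • v)‖ = B / (B - A) * ‖x - w‖ := by
        rw [← sq_eq_sq₀ (norm_nonneg _) (mul_nonneg (div_nonneg hwa hBA.le) (norm_nonneg _)),
          dx, mul_pow, dxw, ← hB, ← hW, hWM]
        field_simp; ring
      have : ‖x - (o + M • v)‖ + ‖w - (o + M • v)‖ = ‖x - w‖ := by
        rw [n1, n2]; field_simp; ring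
      rw [this]
      have : 0 ≤ -A * B := mul_nonneg (by linarith) hwa
      nlinarith [mul_nonneg this (sq_nonneg κ)]
  · refine ⟨o + H • v, ?_, ?_, ?_⟩
    · rw [hc₁]; exact onL H le_rfl _
    · rw [hc₂]; exact onL H le_rfl _
    · have := lens_real (α := -A) (β := B) (ξ := Y - H) (ω := W - H) (X₁ := X₁) (X₂ := X₂)
        (H := H) (κ := κ) (by linarith) hwa hH hD hκ1 (by linear_combination hx) (by linear_combination hw)
        (by rw [hM, lt_div_iff₀ hBA] at hMH; linarith)
      rw [sqrt_eq, sqrt_eq, dxw, ← hA, ← hB, ← hY, ← hW]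
      rw [neg_sq] at this
      refine this.trans (le_of_eq ?_)
      ring

end Dom

namespace Dom

variable {U V : Dom}

lemma Touch.dist_le_via {c₁ c₂ e m : Plane} {r₁ r₂ : ℝ} {x w : U.Bd} (hx : Touch U c₁ r₁ x)
    (hw : Touch U c₂ r₂ w) (he₁ : e ∈ ball c₁ r₁) (he₂ : e ∈ ball c₂ r₂)
    (hm₁ : m ∈ closedBall c₁ r₁) (hm₂ : m ∈ closedBall c₂ r₂) :
    dist x w ≤ dist x.pos m + dist w.pos m := by
  have hseg : ∀ n : ℕ, AffineMap.lineMap m e (1 / ((n : ℝ) + 1)) ∈ ball c₁ r₁ ∩ ball c₂ r₂ := by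
    intro n
    have h01 : (1 / ((n : ℝ) + 1)) ∈ Ioc (0:ℝ) 1 :=
      ⟨by positivity, (div_le_one (by positivity)).2 (by linarith [n.cast_nonneg (α := ℝ)])⟩
    have key : ∀ c r, 0 < r → e ∈ ball c r → m ∈ closedBall c r →
        AffineMap.lineMap m e (1 / ((n : ℝ) + 1)) ∈ ball c r := by
      intro c r hr he hm
      rw [← interior_closedBall c hr.ne'] at he ⊢
      rw [AffineMap.lineMap_apply_module]
      exact (convex_closedBall c r).combo_self_interior_mem_interior hm he
        (by linarith [h01.2]) h01.1 (by ring)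
    exact ⟨key _ _ hx.pos_rad he₁ hm₁, key _ _ hw.pos_rad he₂ hm₂⟩
  have hlim : Tendsto (fun n : ℕ => AffineMap.lineMap m e (1 / ((n : ℝ) + 1))) atTop (𝓝 m) := by
    have := (AffineMap.lineMap_continuous (R := ℝ) (p := m) (q := e)).tendsto 0
    rw [AffineMap.lineMap_apply_zero] at this
    exact this.comp tendsto_one_div_add_atTop_nhds_zero_nat
  refine ge_of_tendsto' ((tendsto_const_nhds.dist hlim).add (tendsto_const_nhds.dist hlim))
    fun n => ?_
  refine (dist_le_dp_add_dp (AffineMap.lineMap m e (1 / ((n : ℝ) + 1))) x w).trans (le_of_eq ?_)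
  rw [hx.dp_eq _ (hseg n).1, hw.dp_eq _ (hseg n).2, dist_comm, dist_comm _ w.pos]

lemma phi_sub_phi (p c₁ c₂ : Plane) : U.phi p c₁ - U.phi p c₂ =
    2 * ⟪p, c₁ - c₂⟫ + (U.rad c₁ ^ 2 - ‖c₁‖ ^ 2 - U.rad c₂ ^ 2 + ‖c₂‖ ^ 2) := by
  rw [phi, phi, dist_eq_norm, dist_eq_norm, norm_sub_sq_real, norm_sub_sq_real, inner_sub_right,
    real_inner_comm c₁ p, real_inner_comm c₂ p]
  ring

lemma phi_nonpos_of_not_mem {z : Plane} (hz : z ∉ U) (c : Plane) : U.phi z c ≤ 0 := by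
  have := pow_le_pow_left₀ (rad_nonneg c) (rad_le_dist (p := c) hz) 2
  rw [phi]; linarith

lemma Touch.phi_eq_zero {c : Plane} {x : U.Bd} (h : Touch U c (U.rad c) x) : U.phi x.pos c = 0 := by
  rw [phi, h.dist_center, sub_self]

lemma mem_ball_of_phi_pos {m c : Plane} (h : 0 < U.phi m c) : m ∈ ball c (U.rad c) := by
  rw [phi, sub_pos] at h
  rw [mem_ball, dist_comm]
  exact lt_of_pow_lt_pow_left₀ 2 (rad_nonneg c) h

lemma mem_closedBall_of_phi_nonneg {m c : Plane} (h : 0 ≤ U.phi m c) :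
    m ∈ closedBall c (U.rad c) := by
  rw [phi, sub_nonneg] at h
  rw [mem_closedBall, dist_comm]
  exact le_of_sq_le_sq h (rad_nonneg c)

/-- Boundary elements touching overlapping discs, one of them on the radical axis. -/
lemma Touch.dist_le_of_phi_eq_zero {c₁ c₂ m : Plane} {x w : U.Bd} (hx : Touch U c₁ (U.rad c₁) x)
    (hw : Touch U c₂ (U.rad c₂) w) (hm₁ : 0 < U.phi m c₁) (hm₂ : 0 < U.phi m c₂)
    (h : U.phi x.pos c₂ = 0) : dist x w ≤ dist x.pos w.pos := by
  have := hx.dist_le_via hw (mem_ball_of_phi_pos hm₁) (mem_ball_of_phi_pos hm₂)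
    (mem_closedBall_of_phi_nonneg hx.phi_eq_zero.ge) (mem_closedBall_of_phi_nonneg h.ge)
  rwa [dist_self, zero_add, dist_comm w.pos] at this

/-- Boundary elements touching two overlapping discs are almost at their Euclidean distance. -/
lemma Touch.dist_sq_le {c₁ c₂ m : Plane} {x w : U.Bd} {κ : ℝ} (hx : Touch U c₁ (U.rad c₁) x)
    (hw : Touch U c₂ (U.rad c₂) w) (hc : c₁ ≠ c₂) (hm : 0 < U.phi m c₁)
    (hm' : U.phi m c₁ = U.phi m c₂) (hκ : 0 ≤ κ) (hκ1 : κ ≤ 1)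
    (hD : dist c₁ c₂ ^ 2 ≤ κ ^ 2 * U.phi m c₁) :
    dist x w ^ 2 ≤ dist x.pos w.pos ^ 2 +
      2 * ((-U.phi x.pos c₂ / (2 * dist c₁ c₂)) * (-U.phi w.pos c₁ / (2 * dist c₁ c₂))) * κ ^ 2 := by
  have hD0 : 0 < dist c₁ c₂ := dist_pos.2 hc
  set D := dist c₁ c₂ with hDd
  have hx2 := phi_nonpos_of_not_mem x.2 c₂
  have hw1 := phi_nonpos_of_not_mem w.2 c₁
  change U.phi x.pos c₂ ≤ 0 at hx2
  change U.phi w.pos c₁ ≤ 0 at hw1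
  rcases eq_or_ne (U.phi x.pos c₂) 0 with h0 | h0
  · have := hx.dist_le_of_phi_eq_zero hw hm (hm' ▸ hm) h0
    have := pow_le_pow_left₀ dist_nonneg this 2
    rw [h0]
    simpa using this
  set r₁ := U.rad c₁ with hr₁
  set r₂ := U.rad c₂ with hr₂
  set a := (1 / D) • (c₂ - c₁) with ha
  have hDn : ‖c₂ - c₁‖ = D := by rw [hDd, dist_comm, dist_eq_norm]
  have ha1 : ‖a‖ = 1 := by
    rw [ha, norm_smul, hDn, Real.norm_of_nonneg (by positivity)]; field_simp
  have hca : c₂ - c₁ = D • a := by rw [ha, smul_smul]; field_simp; simp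
  have haa : ⟪a, a⟫ = 1 := by rw [real_inner_self_eq_norm_sq, ha1]; norm_num
  set t := (D ^ 2 + r₁ ^ 2 - r₂ ^ 2) / (2 * D) with ht
  have ht' : 2 * D * t = D ^ 2 + r₁ ^ 2 - r₂ ^ 2 := by rw [ht]; field_simp
  set o := c₁ + t • a with ho
  have hlin : ∀ p : Plane, ⟪p - o, a⟫ = -(U.phi p c₁ - U.phi p c₂) / (2 * D) := by
    intro p
    have e1 : p - c₂ = (p - c₁) - D • a := by rw [← hca]; abel
    have e2 : ‖p - c₂‖ ^ 2 = ‖p - c₁‖ ^ 2 - 2 * (D * ⟪p - c₁, a⟫) + D ^ 2 := by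
      rw [e1, norm_sub_sq_real, inner_smul_right, norm_smul, ha1, Real.norm_of_nonneg hD0.le]
      ring
    have e3 : ⟪p - o, a⟫ = ⟪p - c₁, a⟫ - t := by
      rw [ho, ← sub_sub, inner_sub_left, inner_smul_left, haa]; simp
    rw [e3, phi, phi, dist_comm, dist_comm c₂, dist_eq_norm, dist_eq_norm, e2]
    field_simp
    linear_combination -ht'
  have hmt : t ^ 2 ≤ dist c₁ m ^ 2 := by
    have e3 : ⟪m - o, a⟫ = ⟪m - c₁, a⟫ - t := by
      rw [ho, ← sub_sub, inner_sub_left, inner_smul_left, haa]; simp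
    rw [hlin, hm', sub_self, neg_zero, zero_div] at e3
    have : |⟪m - c₁, a⟫| ≤ ‖m - c₁‖ * ‖a‖ := abs_real_inner_le_norm _ _
    rw [ha1, mul_one, ← dist_eq_norm, dist_comm] at this
    have h2 := pow_le_pow_left₀ (abs_nonneg _) this 2
    rw [sq_abs] at h2
    have e4 : ⟪m - c₁, a⟫ = t := by linarith
    rwa [e4] at h2
  have hH2 : U.phi m c₁ ≤ r₁ ^ 2 - t ^ 2 := by rw [phi]; linarith
  set H := √(r₁ ^ 2 - t ^ 2) with hH
  have hHsq : H ^ 2 = r₁ ^ 2 - t ^ 2 := Real.sq_sqrt (by linarith)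
  have hH0 : 0 < H := Real.sqrt_pos.2 (by linarith)
  have hDH : D ≤ κ * H := by
    refine le_of_sq_le_sq ?_ (by positivity)
    rw [mul_pow, hHsq]
    exact hD.trans (mul_le_mul_of_nonneg_left hH2 (sq_nonneg κ))
  have hAx : ⟪x.pos - o, a⟫ = U.phi x.pos c₂ / (2 * D) := by
    rw [hlin, hx.phi_eq_zero]; ring
  have hAw : ⟪w.pos - o, a⟫ = -U.phi w.pos c₁ / (2 * D) := by
    rw [hlin, hw.phi_eq_zero]; ring
  have hAx0 : ⟪x.pos - o, a⟫ < 0 := by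
    rw [hAx]; exact div_neg_of_neg_of_pos (lt_of_le_of_ne hx2 h0) (by positivity)
  have hAw0 : 0 ≤ ⟪w.pos - o, a⟫ := by
    rw [hAw]; exact div_nonneg (by linarith) (by positivity)
  have hc1 : c₁ = o + (-t) • a := by rw [ho, neg_smul]; abel
  have hc2 : c₂ = o + (D - t) • a := by rw [ho, sub_smul, ← hca]; abel
  have hr1' : (-t) ^ 2 + H ^ 2 = r₁ ^ 2 := by rw [hHsq]; ring
  have hr2' : (D - t) ^ 2 + H ^ 2 = r₂ ^ 2 := by rw [hHsq]; linear_combination -ht'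
  have hxn : ‖x.pos - c₁‖ ^ 2 = (-t) ^ 2 + H ^ 2 := by
    rw [hr1', ← hx.dist_center, dist_comm, dist_eq_norm]
  have hwn : ‖w.pos - c₂‖ ^ 2 = (D - t) ^ 2 + H ^ 2 := by
    rw [hr2', ← hw.dist_center, dist_comm, dist_eq_norm]
  obtain ⟨v, hv1, hva, hav, hpos⟩ : ∃ v : Plane, ‖v‖ = 1 ∧ ⟪v, a⟫ = 0 ∧
      (∀ p : Plane, ‖p‖ ^ 2 = ⟪p, a⟫ ^ 2 + ⟪p, v⟫ ^ 2) ∧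
      0 ≤ ⟪w.pos - o, a⟫ * ⟪x.pos - o, v⟫ - ⟪x.pos - o, a⟫ * ⟪w.pos - o, v⟫ := by
    have h1 : ‖rot a‖ = 1 := by rw [norm_rot, ha1]
    have h2 : ⟪rot a, a⟫ = 0 := by rw [real_inner_comm, inner_rot_self]
    rcases le_total 0 (⟪w.pos - o, a⟫ * ⟪x.pos - o, rot a⟫ - ⟪x.pos - o, a⟫ * ⟪w.pos - o, rot a⟫)
      with h | h
    · exact ⟨rot a, h1, h2, norm_sq_eq_inner ha1, h⟩
    · refine ⟨-rot a, by rw [norm_neg, h1], by rw [inner_neg_left, h2, neg_zero], fun p => ?_, ?_⟩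
      · rw [inner_neg_right, neg_sq]; exact norm_sq_eq_inner ha1 p
      · rw [inner_neg_right, inner_neg_right]; linarith
  obtain ⟨k, hk1, hk2, hk⟩ := lens_point hav hv1 hva ha1 hc1 hc2 hH0 hxn hwn hAx0.le hAw0
    (hAx0.trans_le hAw0) hpos (by linarith) hκ1
  rw [hr1'] at hk1
  rw [hr2'] at hk2
  have hvia := hx.dist_le_via hw (mem_ball_of_phi_pos hm) (mem_ball_of_phi_pos (hm' ▸ hm))
    (m := k) (by rw [mem_closedBall, dist_eq_norm]; exact le_of_sq_le_sq hk1 (rad_nonneg _))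
    (by rw [mem_closedBall, dist_eq_norm]; exact le_of_sq_le_sq hk2 (rad_nonneg _))
  refine (pow_le_pow_left₀ dist_nonneg hvia 2).trans ?_
  rw [dist_eq_norm, dist_eq_norm, dist_eq_norm]
  refine hk.trans (le_of_eq ?_)
  rw [hAx, hAw]
  ring

/-- The image of a point under the boundary isometry, computed in a cell. -/
def Cell.img {q : Plane} (C : Cell U q) (f : U.Bd → V.Bd) : Plane :=
  ∑ x ∈ C.verts, C.wt x • (f x).pos

variable {q q₁ q₂ : Plane}

lemma Cell.sum_phi (C : Cell U q) (c₁ c₂ : Plane) :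
    ∑ x ∈ C.verts, C.wt x * (U.phi x.pos c₁ - U.phi x.pos c₂) = U.phi q c₁ - U.phi q c₂ := by
  simp only [phi_sub_phi, mul_add, Finset.sum_add_distrib, ← Finset.sum_mul, C.wt_sum, one_mul]
  congr 1
  conv_rhs => rw [← C.sum_eq, sum_inner, Finset.mul_sum]
  refine Finset.sum_congr rfl fun x _ => ?_
  rw [inner_smul_left]; simp; ring

lemma Cell.dist_img (C : Cell U q) (f : U.Bd ≃ᵢ V.Bd) {x y : U.Bd} (hx : x ∈ C.verts)
    (hy : y ∈ C.verts) : ‖(f x).pos - (f y).pos‖ = ‖x.pos - y.pos‖ := by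
  rcases eq_or_ne x y with rfl | h
  · simp
  · rw [← dist_eq_norm, ← dist_eq_norm,
      ← (Touch.chord_map f (C.touch x hx) (C.touch y hy) h).dist_eq, f.isometry.dist_eq,
      ((C.touch x hx).chord (C.touch y hy) h).dist_eq]

/-- Comparison of images of two cells. -/
lemma Cell.norm_img_sub_sq_le (C₁ : Cell U q₁) (C₂ : Cell U q₂) (f : U.Bd ≃ᵢ V.Bd) :
    ‖C₁.img f - C₂.img f‖ ^ 2 ≤ ‖q₁ - q₂‖ ^ 2 + ∑ x ∈ C₁.verts, ∑ w ∈ C₂.verts,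
      C₁.wt x * C₂.wt w * (dist x w ^ 2 - dist x.pos w.pos ^ 2) := by
  have e1 := norm_sub_barycenter_sq C₁.verts C₂.verts C₁.wt C₂.wt C₁.wt_sum C₂.wt_sum
    (fun x => (f x).pos) (fun x => (f x).pos)
  have e2 := norm_sub_barycenter_sq C₁.verts C₂.verts C₁.wt C₂.wt C₁.wt_sum C₂.wt_sum
    (fun x => x.pos) (fun x => x.pos)
  rw [C₁.sum_eq, C₂.sum_eq] at e2
  have s1 : ∀ {q : Plane} (C : Cell U q), ∑ i ∈ C.verts, ∑ j ∈ C.verts,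
      C.wt i * C.wt j * ‖(f i).pos - (f j).pos‖ ^ 2 =
      ∑ i ∈ C.verts, ∑ j ∈ C.verts, C.wt i * C.wt j * ‖i.pos - j.pos‖ ^ 2 := fun C =>
    Finset.sum_congr rfl fun i hi => Finset.sum_congr rfl fun j hj => by rw [C.dist_img f hi hj]
  rw [s1, s1] at e1
  have s2 : ∑ x ∈ C₁.verts, ∑ w ∈ C₂.verts, C₁.wt x * C₂.wt w * ‖(f x).pos - (f w).pos‖ ^ 2 ≤
      ∑ x ∈ C₁.verts, ∑ w ∈ C₂.verts, C₁.wt x * C₂.wt w * dist x w ^ 2 := by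
    refine Finset.sum_le_sum fun x hx => Finset.sum_le_sum fun w hw => ?_
    refine mul_le_mul_of_nonneg_left ?_ (mul_pos (C₁.wt_pos x hx) (C₂.wt_pos w hw)).le
    refine pow_le_pow_left₀ (norm_nonneg _) ?_ 2
    rw [← f.isometry.dist_eq, ← dist_eq_norm]
    exact Bd.dist_pos_le _ _
  simp only [mul_sub, Finset.sum_sub_distrib, dist_eq_norm _ (Bd.pos _)]
  unfold Cell.img
  rw [e1, e2]
  linarith

lemma Cell.img_eq_of_center_eq (C₁ : Cell U q₁) (C₂ : Cell U q₂) (f : U.Bd ≃ᵢ V.Bd)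
    (h : C₁.center = C₂.center) : ‖C₁.img f - C₂.img f‖ ≤ ‖q₁ - q₂‖ := by
  refine le_of_sq_le_sq ?_ (norm_nonneg _)
  refine (C₁.norm_img_sub_sq_le C₂ f).trans (add_le_of_nonpos_right ?_)
  refine Finset.sum_nonpos fun x hx => Finset.sum_nonpos fun w hw => ?_
  refine mul_nonpos_of_nonneg_of_nonpos (mul_pos (C₁.wt_pos x hx) (C₂.wt_pos w hw)).le ?_
  rcases eq_or_ne x w with rfl | hne
  · simp
  · rw [((C₁.touch x hx).chord (h ▸ C₂.touch w hw) hne).dist_eq, sub_self]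

lemma Cell.phi_pos (C : Cell U q) (hq : q ∈ U.core) : 0 < U.phi q C.center := by
  have h1 := C.isMax q
  rw [phi_self] at h1
  have h2 := pow_pos (Dom.rad_pos (exists_not_mem_of_core hq) (core_subset hq)) 2
  linarith

lemma Cell.phi_diff_nonneg (C : Cell U q) {x : U.Bd} (hx : x ∈ C.verts) (c : Plane) :
    0 ≤ U.phi x.pos C.center - U.phi x.pos c := by
  rw [(C.touch x hx).phi_eq_zero]
  linarith [phi_nonpos_of_not_mem x.pos_not_mem c]

lemma Cell.img_eq (C₁ C₂ : Cell U q) (hq : q ∈ U.core) (f : U.Bd ≃ᵢ V.Bd) :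
    C₁.img f = C₂.img f := by
  have hphi : U.phi q C₁.center = U.phi q C₂.center := le_antisymm (C₂.isMax _) (C₁.isMax _)
  have hz : ∀ x ∈ C₁.verts, U.phi x.pos C₂.center = 0 := by
    intro x hx
    have hsum := C₁.sum_phi C₁.center C₂.center
    rw [hphi, sub_self, Finset.sum_eq_zero_iff_of_nonneg fun x hx =>
      mul_nonneg (C₁.wt_pos x hx).le (C₁.phi_diff_nonneg hx _)] at hsum
    have := (mul_eq_zero.1 (hsum x hx)).resolve_left (C₁.wt_pos x hx).ne'
    rw [(C₁.touch x hx).phi_eq_zero] at this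
    linarith
  rw [← sub_eq_zero, ← norm_le_zero_iff]
  refine le_of_sq_le_sq ?_ le_rfl
  refine (C₁.norm_img_sub_sq_le C₂ f).trans ?_
  rw [sub_self, norm_zero]
  refine add_le_of_nonpos_right (Finset.sum_nonpos fun x hx => Finset.sum_nonpos fun w hw => ?_)
  refine mul_nonpos_of_nonneg_of_nonpos (mul_pos (C₁.wt_pos x hx) (C₂.wt_pos w hw)).le ?_
  rw [sub_nonpos]
  exact pow_le_pow_left₀ dist_nonneg ((C₁.touch x hx).dist_le_of_phi_eq_zero (C₂.touch w hw)
    (C₁.phi_pos hq) (C₂.phi_pos hq) (hz x hx)) 2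

lemma Cell.norm_img_sub_sq_le_of_overlap (C₁ : Cell U q₁) (C₂ : Cell U q₂) (f : U.Bd ≃ᵢ V.Bd)
    {m : Plane} {κ : ℝ} (hc : C₁.center ≠ C₂.center) (hm : 0 < U.phi m C₁.center)
    (hm' : U.phi m C₁.center = U.phi m C₂.center) (hκ : 0 ≤ κ) (hκ1 : κ ≤ 1)
    (hD : dist C₁.center C₂.center ^ 2 ≤ κ ^ 2 * U.phi m C₁.center) :
    ‖C₁.img f - C₂.img f‖ ^ 2 ≤ (1 + κ ^ 2 / 2) * ‖q₁ - q₂‖ ^ 2 := by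
  have hD0 : 0 < dist C₁.center C₂.center := dist_pos.2 hc
  set D := dist C₁.center C₂.center with hDd
  set s₁ := (U.phi q₁ C₁.center - U.phi q₁ C₂.center) / (2 * D) with hs₁
  set s₂ := (U.phi q₂ C₂.center - U.phi q₂ C₁.center) / (2 * D) with hs₂
  have hs₁0 : 0 ≤ s₁ := div_nonneg (sub_nonneg.2 (C₁.isMax _)) (by positivity)
  have hs₂0 : 0 ≤ s₂ := div_nonneg (sub_nonneg.2 (C₂.isMax _)) (by positivity)
  have hs : s₁ + s₂ ≤ ‖q₁ - q₂‖ := by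
    have e : s₁ + s₂ = ⟪q₁ - q₂, C₁.center - C₂.center⟫ / D := by
      have := phi_sub_phi (U := U) q₁ C₁.center C₂.center
      have := phi_sub_phi (U := U) q₂ C₁.center C₂.center
      rw [hs₁, hs₂, inner_sub_left]
      field_simp
      linarith
    rw [e, div_le_iff₀ hD0, hDd, dist_eq_norm]
    exact real_inner_le_norm _ _
  have hsum : ∑ x ∈ C₁.verts, ∑ w ∈ C₂.verts,
      C₁.wt x * C₂.wt w * (dist x w ^ 2 - dist x.pos w.pos ^ 2) ≤ 2 * κ ^ 2 * (s₁ * s₂) := by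
    calc _ ≤ ∑ x ∈ C₁.verts, ∑ w ∈ C₂.verts,
        (C₁.wt x * (U.phi x.pos C₁.center - U.phi x.pos C₂.center)) *
        (C₂.wt w * (U.phi w.pos C₂.center - U.phi w.pos C₁.center)) *
          (2 * κ ^ 2 / (2 * D) ^ 2) := by
          refine Finset.sum_le_sum fun x hx => Finset.sum_le_sum fun w hw => ?_
          have h := (C₁.touch x hx).dist_sq_le (C₂.touch w hw) hc hm hm' hκ hκ1 hD
          have h' := mul_le_mul_of_nonneg_left (sub_le_iff_le_add'.2 h)
            (mul_pos (C₁.wt_pos x hx) (C₂.wt_pos w hw)).le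
          refine h'.trans (le_of_eq ?_)
          rw [(C₁.touch x hx).phi_eq_zero, (C₂.touch w hw).phi_eq_zero, ← hDd]
          field_simp
          ring
      _ = 2 * κ ^ 2 * (s₁ * s₂) := by
          simp only [← Finset.sum_mul, ← Finset.mul_sum]
          rw [C₁.sum_phi, C₂.sum_phi, hs₁, hs₂]
          field_simp
  have := C₁.norm_img_sub_sq_le C₂ f
  have h4 : s₁ * s₂ ≤ ‖q₁ - q₂‖ ^ 2 / 4 := by nlinarith [sq_nonneg (s₁ - s₂)]
  nlinarith [mul_le_mul_of_nonneg_left h4 (sq_nonneg κ)]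

open Classical in
variable (U) in
/-- The map of cores induced by a boundary isometry (with a junk value outside the core). -/
def F (f : U.Bd ≃ᵢ V.Bd) (q : Plane) : Plane :=
  if h : q ∈ U.core then (exists_cell h).some.img f else 0

lemma F_eq (f : U.Bd ≃ᵢ V.Bd) (C : Cell U q) (hq : q ∈ U.core) : U.F f q = C.img f := by
  rw [F, dif_pos hq]
  exact Cell.img_eq _ _ hq f

end Dom

namespace Dom

variable {U V : Dom}

/-- A map with pointwise Lipschitz constants at most one along a segment is contracting on it. -/
lemma norm_sub_le_of_pointwise {g : Plane → Plane} {a b : Plane}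
    (h : ∀ p ∈ segment ℝ a b, ∀ η > 0, ∀ᶠ q in 𝓝 p, ‖g q - g p‖ ≤ (1 + η) * ‖q - p‖) :
    ‖g b - g a‖ ≤ ‖b - a‖ := by
  set γ : ℝ → Plane := fun t => AffineMap.lineMap a b t with hγ
  have hγc : Continuous γ := AffineMap.lineMap_continuous
  have hγs : ∀ t ∈ Icc (0:ℝ) 1, γ t ∈ segment ℝ a b := fun t ht => by
    rw [segment_eq_image_lineMap]; exact ⟨t, ht, rfl⟩
  have hγd : ∀ s t, ‖γ s - γ t‖ = |s - t| * ‖b - a‖ := fun s t => by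
    rw [← dist_eq_norm, hγ, dist_lineMap_lineMap, dist_eq_norm a b, norm_sub_rev a, Real.dist_eq]
  have hcont : ContinuousOn (fun t => g (γ t)) (Icc 0 1) := by
    intro t ht
    refine ContinuousAt.continuousWithinAt ?_
    have : ContinuousAt g (γ t) := by
      rw [ContinuousAt, tendsto_iff_norm_sub_tendsto_zero]
      refine squeeze_zero' (Eventually.of_forall fun _ => norm_nonneg _)
        (h _ (hγs t ht) 1 one_pos) ?_
      have : Continuous fun q : Plane => (1 + 1) * ‖q - γ t‖ := by fun_prop
      simpa using this.tendsto (γ t)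
    exact ContinuousAt.comp this hγc.continuousAt
  refine le_of_forall_pos_le_add fun ε hε => ?_
  set η := ε / (‖b - a‖ + 1) with hη
  have hη0 : 0 < η := by positivity
  have hsub : Icc (0:ℝ) 1 ⊆ {t | ‖g (γ t) - g (γ 0)‖ ≤ (1 + η) * ‖b - a‖ * t} := by
    refine IsClosed.Icc_subset_of_forall_mem_nhdsWithin ?_ (by simp) ?_
    · have h1 : ContinuousOn (fun t => ‖g (γ t) - g (γ 0)‖ - (1 + η) * ‖b - a‖ * t) (Icc 0 1) :=
        (hcont.sub continuousOn_const).norm.sub (by fun_prop)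
      have := h1.preimage_isClosed_of_isClosed isClosed_Icc isClosed_Iic (t := Iic 0)
      convert this using 1
      ext t
      simp [and_comm]
    · rintro t ⟨ht, ht01⟩
      have h1 := hγc.continuousAt.eventually (h _ (hγs t (Ico_subset_Icc_self ht01)) η hη0)
      filter_upwards [nhdsWithin_le_nhds h1, self_mem_nhdsWithin] with s hs hst
      change ‖g (γ t) - g (γ 0)‖ ≤ (1 + η) * ‖b - a‖ * t at ht
      rw [hγd, abs_of_pos (sub_pos.2 hst)] at hs
      calc _ ≤ ‖g (γ s) - g (γ t)‖ + ‖g (γ t) - g (γ 0)‖ := norm_sub_le_norm_sub_add_norm_sub _ _ _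
        _ ≤ _ := by linarith
  have h1 : ‖g (γ 1) - g (γ 0)‖ ≤ (1 + η) * ‖b - a‖ * 1 := hsub (right_mem_Icc.2 zero_le_one)
  simp only [hγ, AffineMap.lineMap_apply_one, AffineMap.lineMap_apply_zero, mul_one] at h1
  have : η * ‖b - a‖ ≤ ε := by
    rw [hη, div_mul_eq_mul_div, div_le_iff₀ (by positivity)]
    nlinarith
  linarith

variable {q : Plane}

lemma tendsto_phi {u c : ℕ → Plane} {q₀ c₀ : Plane} (hu : Tendsto u atTop (𝓝 q₀))
    (hc : Tendsto c atTop (𝓝 c₀)) :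
    Tendsto (fun n => U.phi (u n) (c n)) atTop (𝓝 (U.phi q₀ c₀)) := by
  have h1 : Tendsto (fun n => U.rad (c n)) atTop (𝓝 (U.rad c₀)) := (rad_continuous.tendsto c₀).comp hc
  exact (h1.pow 2).sub ((Filter.Tendsto.dist hc hu).pow 2)

lemma continuous_phi_left (c : Plane) : Continuous fun m => U.phi m c := by
  unfold phi; fun_prop

lemma IsMax.tendsto_subseq (hq : q ∈ U.core) {u c : ℕ → Plane} (hu : Tendsto u atTop (𝓝 q))
    (hc : ∀ n, IsMax U (u n) (c n)) :
    ∃ c₀, ∃ φ : ℕ → ℕ, StrictMono φ ∧ Tendsto (c ∘ φ) atTop (𝓝 c₀) ∧ IsMax U q c₀ := by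
  obtain ⟨ε, hε, R, hb⟩ := exists_phi_bound hq
  have hcb : ∀ᶠ n in atTop, c n ∈ closedBall q (|R| / ε + 1) := by
    filter_upwards [hu.eventually (ball_mem_nhds q hε), hu.eventually (ball_mem_nhds q one_pos)]
      with n hn hn1
    have h1 := hb (u n) hn (c n)
    have h2 := hc n (u n)
    rw [phi_self] at h2
    have h4 : dist (c n) (u n) ≤ |R| / ε := by
      rw [le_div_iff₀ hε]
      linarith [sq_nonneg (U.rad (u n)), le_abs_self R]
    rw [mem_closedBall]
    linarith [dist_triangle (c n) (u n) q]
  obtain ⟨c₀, -, φ, hφ, hlim⟩ := (isCompact_closedBall q _).tendsto_subseq' hcb.frequently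
  have hu' : Tendsto (fun n => u (φ n)) atTop (𝓝 q) := hu.comp hφ.tendsto_atTop
  refine ⟨c₀, φ, hφ, hlim, fun c' => ?_⟩
  exact le_of_tendsto_of_tendsto' (tendsto_phi hu' tendsto_const_nhds) (tendsto_phi hu' hlim)
    fun n => hc (φ n) c'

lemma F_pointwise (f : U.Bd ≃ᵢ V.Bd) (hq : q ∈ U.core) {η : ℝ} (hη : 0 < η) :
    ∀ᶠ q' in 𝓝 q, ‖U.F f q' - U.F f q‖ ≤ (1 + η) * ‖q' - q‖ := by
  by_contra hcon
  obtain ⟨u, hu, hbad⟩ := exists_seq_forall_of_frequently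
    ((not_eventually.1 hcon).and_eventually (isOpen_core.mem_nhds hq))
  have hCell : ∀ n, ∃ c, IsMax U (u n) c := fun n => exists_isMax (hbad n).2
  choose c hc using hCell
  obtain ⟨c₀, φ, hφ, hlim, hmax⟩ := IsMax.tendsto_subseq hq hu hc
  have hu' : Tendsto (fun n => u (φ n)) atTop (𝓝 q) := hu.comp hφ.tendsto_atTop
  obtain ⟨C₀, hC₀⟩ := exists_cell_of_isMax hmax hq
  have hp₀ : 0 < U.phi q c₀ := hC₀ ▸ C₀.phi_pos hq
  obtain ⟨δ, hδ, hδb⟩ : ∃ δ > 0, ∀ m ∈ ball q δ, U.phi q c₀ / 2 < U.phi m c₀ := by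
    have h1 := continuous_phi_left (U := U) c₀
    have h2 : ∀ᶠ m in 𝓝 q, U.phi q c₀ / 2 < U.phi m c₀ :=
      (h1.tendsto q).eventually (lt_mem_nhds (half_lt_self hp₀))
    exact Metric.eventually_nhds_iff_ball.1 h2
  set κ := min 1 η with hκ
  have hκ0 : 0 < κ := by positivity
  have hd : Tendsto (fun n => dist (c₀) (c (φ n)) ^ 2) atTop (𝓝 0) := by
    have := (tendsto_const_nhds (x := c₀)).dist hlim |>.pow 2
    simpa using this
  obtain ⟨n, hn1, hn2⟩ := ((hd.eventually (gt_mem_nhds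
    (show 0 < κ ^ 2 * (U.phi q c₀ / 2) by positivity))).and
    (hu'.eventually (ball_mem_nhds q hδ))).exists
  have hbn := (hbad (φ n)).1
  have hun := (hbad (φ n)).2
  obtain ⟨C, hC⟩ := exists_cell_of_isMax (hc (φ n)) hun
  apply hbn
  rw [F_eq f C₀ hq, F_eq f C hun]
  rcases eq_or_ne C.center C₀.center with he | hne
  · have := C.img_eq_of_center_eq C₀ f he
    nlinarith [norm_nonneg (u (φ n) - q)]
  · obtain ⟨m, hm, hmeq⟩ := (convex_segment q (u (φ n))).isPreconnected.intermediate_value₂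
      (left_mem_segment ℝ _ _) (right_mem_segment ℝ _ _)
      (f := fun m => U.phi m C.center) (g := fun m => U.phi m C₀.center)
      (continuous_phi_left _).continuousOn
      (continuous_phi_left _).continuousOn
      (C₀.isMax _) (C.isMax _)
    have hmb : m ∈ ball q δ := (convex_ball q δ).segment_subset (mem_ball_self hδ) hn2 hm
    have hmp := hδb m hmb
    rw [← hC₀] at hmp
    have := C.norm_img_sub_sq_le_of_overlap C₀ f (κ := κ) (m := m) hne
      (by linarith [hC₀ ▸ hp₀]) hmeq hκ0.le (min_le_left _ _) (by
        rw [hmeq, hC, dist_comm, hC₀]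
        refine hn1.le.trans (mul_le_mul_of_nonneg_left ?_ (sq_nonneg κ))
        rw [← hC₀]; exact hmp.le)
    refine le_of_sq_le_sq (this.trans ?_) (by positivity)
    rw [mul_pow]
    refine mul_le_mul_of_nonneg_right ?_ (sq_nonneg _)
    have : κ ≤ η := min_le_right _ _
    nlinarith

lemma F_contract (f : U.Bd ≃ᵢ V.Bd) {a b : Plane} (h : segment ℝ a b ⊆ U.core) :
    dist (U.F f a) (U.F f b) ≤ dist a b := by
  rw [dist_comm, dist_comm a, dist_eq_norm, dist_eq_norm]
  exact norm_sub_le_of_pointwise fun p hp η hη => F_pointwise f (h hp) hη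

lemma continuousOn_F (f : U.Bd ≃ᵢ V.Bd) : ContinuousOn (U.F f) U.core := by
  intro q hq
  obtain ⟨r, hr, hb⟩ := Metric.isOpen_iff.1 isOpen_core q hq
  refine ContinuousAt.continuousWithinAt ?_
  rw [ContinuousAt, tendsto_iff_dist_tendsto_zero]
  refine squeeze_zero' (Eventually.of_forall fun _ => dist_nonneg) (g := fun p => dist p q) ?_
    (tendsto_iff_dist_tendsto_zero.1 tendsto_id)
  filter_upwards [ball_mem_nhds q hr] with p hp
  exact F_contract f (((convex_ball q r).segment_subset hp (mem_ball_self hr)).trans hb)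

/-! The bound comparing the map of cores with the boundary isometry. -/

lemma Cell.phi_eq (C : Cell U q) {x : U.Bd} (hx : x ∈ C.verts) :
    U.phi q C.center = dist x.pos q ^ 2 - 2 * ⟪C.center - q, x.pos - q⟫ := by
  have e : C.center - x.pos = (C.center - q) - (x.pos - q) := by abel
  rw [phi, ← (C.touch x hx).dist_center, dist_eq_norm C.center q, dist_eq_norm x.pos, dist_eq_norm, e,
    norm_sub_sq_real]
  ring

lemma Cell.verts_nonempty (C : Cell U q) : C.verts.Nonempty := by
  rw [Finset.nonempty_iff_ne_empty]
  intro h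
  have := C.wt_sum
  rw [h, Finset.sum_empty] at this
  exact zero_ne_one this

lemma Cell.exists_dist_sq_le (C : Cell U q) :
    ∃ x ∈ C.verts, dist x.pos q ^ 2 ≤ U.phi q C.center := by
  have hsum : ∑ x ∈ C.verts, C.wt x * ⟪C.center - q, x.pos - q⟫ = 0 := by
    have : ∀ x, C.wt x * ⟪C.center - q, x.pos - q⟫ =
        ⟪C.center - q, C.wt x • x.pos⟫ - C.wt x * ⟪C.center - q, q⟫ := fun x => by
      rw [inner_smul_right, inner_sub_right]; ring
    simp only [this, Finset.sum_sub_distrib, ← Finset.sum_mul, C.wt_sum]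
    rw [← inner_sum, C.sum_eq]; ring
  by_contra hcon
  push Not at hcon
  have : 0 < ∑ x ∈ C.verts, C.wt x * ⟪C.center - q, x.pos - q⟫ := by
    refine Finset.sum_pos (fun x hx => mul_pos (C.wt_pos x hx) ?_) C.verts_nonempty
    have := hcon x hx
    rw [C.phi_eq hx] at this
    linarith
  linarith

lemma Cell.mem_ball (C : Cell U q) (hq : q ∈ U.core) : q ∈ ball C.center (U.rad C.center) := by
  rw [Metric.mem_ball, dist_comm]; exact C.isMax.dist_lt hq

lemma Cell.dp_eq (C : Cell U q) (hq : q ∈ U.core) {x : U.Bd} (hx : x ∈ C.verts) :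
    U.dp q x = dist q x.pos := (C.touch x hx).dp_eq q (C.mem_ball hq)

lemma Cell.dist_img_vert (C : Cell U q) (f : U.Bd ≃ᵢ V.Bd) {x : U.Bd} (hx : x ∈ C.verts) :
    dist (C.img f) (f x).pos = dist q x.pos := by
  have e1 := norm_sub_barycenter_sq C.verts {x} C.wt (fun _ => 1) C.wt_sum (by simp)
    (fun x => (f x).pos) (fun x => (f x).pos)
  have e2 := norm_sub_barycenter_sq C.verts {x} C.wt (fun _ => 1) C.wt_sum (by simp)
    (fun x => x.pos) (fun x => x.pos)
  have s1 : ∑ i ∈ C.verts, ∑ j ∈ C.verts,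
      C.wt i * C.wt j * ‖(f i).pos - (f j).pos‖ ^ 2 =
      ∑ i ∈ C.verts, ∑ j ∈ C.verts, C.wt i * C.wt j * ‖i.pos - j.pos‖ ^ 2 :=
    Finset.sum_congr rfl fun i hi => Finset.sum_congr rfl fun j hj => by rw [C.dist_img f hi hj]
  have s2 : ∑ i ∈ C.verts, C.wt i * ‖(f i).pos - (f x).pos‖ ^ 2 =
      ∑ i ∈ C.verts, C.wt i * ‖i.pos - x.pos‖ ^ 2 :=
    Finset.sum_congr rfl fun i hi => by rw [C.dist_img f hi hx]
  simp only [Finset.sum_singleton, mul_one, one_smul, sub_self, norm_zero] at e1 e2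
  rw [s1, s2, ← e2, C.sum_eq] at e1
  rw [dist_eq_norm, dist_eq_norm]
  exact (sq_eq_sq₀ (norm_nonneg _) (norm_nonneg _)).1 e1

lemma phi_lineMap_le (w a c : Plane) {t : ℝ} (h0 : 0 ≤ t) (h1 : t ≤ 1) (ha : a ∉ U) :
    U.phi (AffineMap.lineMap w a t) c ≤ (1 - t) * (U.phi w c + dist w a ^ 2) := by
  have e : dist c (AffineMap.lineMap w a t) ^ 2 =
      (1 - t) * dist c w ^ 2 + t * dist c a ^ 2 - t * (1 - t) * dist w a ^ 2 := by
    have e1 : c - AffineMap.lineMap w a t = (1 - t) • (c - w) + t • (c - a) := by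
      rw [AffineMap.lineMap_apply_module]; module
    have e2 : w - a = (c - a) - (c - w) := by abel
    rw [dist_eq_norm, dist_eq_norm, dist_eq_norm, dist_eq_norm, e1, e2, norm_add_sq_real,
      norm_sub_sq_real (c - a) (c - w), norm_smul, norm_smul, inner_smul_left, inner_smul_right,
      Real.norm_of_nonneg h0, Real.norm_of_nonneg (sub_nonneg.2 h1), real_inner_comm (c - w) (c - a)]
    simp only [RCLike.conj_to_real]
    ring
  have h2 := phi_nonpos_of_not_mem ha c
  rw [phi] at h2 ⊢
  rw [phi, e]
  nlinarith [mul_nonneg h0 (sub_nonneg.2 h1), mul_nonneg (sq_nonneg (1 - t)) (sq_nonneg (dist w a)),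
    mul_le_mul_of_nonneg_left h2 h0]

lemma lineMap_mem_core {w : Plane} (hw : w ∈ U.core) {a : U.Bd} (ha : Touch U w (U.rad w) a) {t : ℝ}
    (h0 : 0 ≤ t) (h1 : t < 1) : AffineMap.lineMap w a.pos t ∈ U.core := by
  constructor
  · refine ball_rad_subset w ?_
    rw [Metric.mem_ball, dist_comm, dist_left_lineMap, ha.dist_center, Real.norm_of_nonneg h0]
    nlinarith [ha.pos_rad]
  · rw [AffineMap.lineMap_apply_module]
    exact (convex_convexHull ℝ _).combo_interior_self_mem_interior hw.2
      (subset_convexHull ℝ _ a.pos_mem_frontier) (by linarith) h0 (by ring)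

/-- Points of the core are mapped close to the images of nearby boundary elements. -/
lemma dist_F_le (f : U.Bd ≃ᵢ V.Bd) {w : Plane} (hw : w ∈ U.core) (x : U.Bd) :
    dist (U.F f w) (f x).pos ≤ U.dp w x + 2 * U.rad w := by
  obtain ⟨a, ha⟩ := exists_nearest (exists_not_mem_of_core hw) (core_subset hw)
  obtain ⟨c, hc⟩ := exists_isMax hw
  refine le_of_forall_pos_le_add fun ε hε => ?_
  set M := U.phi w c + dist w a.pos ^ 2 with hM
  have hlim : Tendsto (fun t : ℝ => (1 - t) * M) (𝓝[<] 1) (𝓝 0) := by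
    have : Continuous fun t : ℝ => (1 - t) * M := by fun_prop
    simpa using (this.tendsto 1).mono_left nhdsWithin_le_nhds
  obtain ⟨t, ht, ht1, ht0⟩ := ((hlim.eventually (gt_mem_nhds
    (show (0:ℝ) < (ε / 2) ^ 2 by positivity))).and ((eventually_mem_nhdsWithin (a := (1:ℝ)) (s := Iio 1)).and
    (nhdsWithin_le_nhds (lt_mem_nhds (zero_lt_one (α := ℝ)))))).exists
  have ht1' : t < 1 := ht1
  set p := AffineMap.lineMap w a.pos t with hp
  have hpc : p ∈ U.core := lineMap_mem_core hw ha ht0.le ht1'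
  obtain ⟨C⟩ := exists_cell hpc
  obtain ⟨y, hy, hyd⟩ := C.exists_dist_sq_le
  have hyp : dist y.pos p ≤ ε / 2 := by
    refine le_of_sq_le_sq (hyd.trans ?_) (by positivity)
    refine (phi_lineMap_le w a.pos C.center ht0.le ht1'.le a.pos_not_mem).trans (le_trans ?_ ht.le)
    exact mul_le_mul_of_nonneg_left (by linarith [hc C.center]) (by linarith)
  have hseg : segment ℝ w p ⊆ U.core := by
    intro z hz
    rw [segment_eq_image_lineMap] at hz
    obtain ⟨s, hs, rfl⟩ := hz
    have : AffineMap.lineMap w p s = AffineMap.lineMap w a.pos (s * t) := by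
      rw [hp, AffineMap.lineMap_lineMap_right]
    rw [this]
    exact lineMap_mem_core hw ha (mul_nonneg hs.1 ht0.le) (by nlinarith [hs.1, hs.2])
  have hwp : dist w p ≤ U.rad w := by
    rw [hp, dist_left_lineMap, ha.dist_center, Real.norm_of_nonneg ht0.le]
    nlinarith [ha.pos_rad]
  have h1 := F_contract f hseg
  have h2 := C.dist_img_vert f hy
  rw [← F_eq f C hpc, dist_comm p] at h2
  have h3 : dist (f y).pos (f x).pos ≤ dist y x := by
    rw [← f.isometry.dist_eq]; exact Bd.dist_pos_le _ _
  have h4 := dist_le_dp_add_dp p y x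
  have h5 := dp_le_dist_add_dp p w x
  rw [dist_pt_eq (by rw [segment_symm]; exact hseg.trans core_subset), dist_comm p w] at h5
  rw [C.dp_eq hpc hy, dist_comm p] at h4
  have := dist_triangle4 (U.F f w) (U.F f p) (f y).pos (f x).pos
  linarith

lemma dist_F_le' (f : U.Bd ≃ᵢ V.Bd) {w : Plane} (hw : w ∈ U.core) (x : U.Bd) :
    dist (U.F f w) (f x).pos ≤ 3 * U.dp w x := by
  linarith [dist_F_le f hw x, rad_le_dp (core_subset hw) x]

end Dom

namespace Dom

variable {U V : Dom}

lemma dist_lineMap_sq (c w a : Plane) (t : ℝ) : dist c (AffineMap.lineMap w a t) ^ 2 =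
    (1 - t) * dist c w ^ 2 + t * dist c a ^ 2 - t * (1 - t) * dist w a ^ 2 := by
  have e1 : c - AffineMap.lineMap w a t = (1 - t) • (c - w) + t • (c - a) := by
    rw [AffineMap.lineMap_apply_module]; module
  have e2 : w - a = (c - a) - (c - w) := by abel
  rw [dist_eq_norm, dist_eq_norm, dist_eq_norm, dist_eq_norm, e1, e2, norm_add_sq_real,
    norm_sub_sq_real (c - a) (c - w), norm_smul, norm_smul, inner_smul_left, inner_smul_right,
    real_inner_comm (c - w) (c - a), mul_pow, mul_pow, Real.norm_eq_abs, Real.norm_eq_abs, sq_abs,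
    sq_abs]
  simp only [RCLike.conj_to_real]
  ring

lemma dist_lineMap_lineMap_left (v p a : Plane) (s : ℝ) :
    dist (AffineMap.lineMap v a s) (AffineMap.lineMap p a s) = |1 - s| * dist v p := by
  rw [dist_eq_norm, dist_eq_norm, ← Real.norm_eq_abs, ← norm_smul]
  congr 1
  rw [AffineMap.lineMap_apply_module, AffineMap.lineMap_apply_module]; module

lemma segment_subset_of_lineMap {a b : Plane} {S : Set Plane} {s : ℝ} (hs : 0 ≤ s)
    (h : ∀ t, 0 ≤ t → t ≤ s → AffineMap.lineMap a b t ∈ S) :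
    segment ℝ a (AffineMap.lineMap a b s) ⊆ S := by
  intro z hz
  rw [segment_eq_image_lineMap] at hz
  obtain ⟨t, ht, rfl⟩ := hz
  rw [AffineMap.lineMap_lineMap_right]
  exact h _ (mul_nonneg ht.1 hs) (mul_le_of_le_one_left hs ht.2)

lemma lineMap_mem_interior_hull {v a : Plane} (hv : v ∈ U.core) (ha : a ∈ frontier U.carrier) {s : ℝ}
    (h0 : 0 ≤ s) (h1 : s < 1) :
    AffineMap.lineMap v a s ∈ interior (convexHull ℝ (frontier U.carrier)) := by
  rw [AffineMap.lineMap_apply_module]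
  exact (convex_convexHull ℝ _).combo_interior_self_mem_interior hv.2
    (subset_convexHull ℝ _ ha) (by linarith) h0 (by ring)

/-- Near a point that sees a boundary element, the map of cores does not increase the distance
to that element. -/
lemma eventually_dist_F_le (f : U.Bd ≃ᵢ V.Bd) {p : Plane} {x : U.Bd}
    (hs : ∀ s : ℝ, 0 ≤ s → s < 1 → AffineMap.lineMap p x.pos s ∈ U)
    (hd : ∀ s : ℝ, 0 ≤ s → s < 1 →
      U.dp (AffineMap.lineMap p x.pos s) x = dist (AffineMap.lineMap p x.pos s) x.pos)
    {η : ℝ} (hη : 0 < η) :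
    ∀ᶠ v in 𝓝[U.core] p, dist (U.F f v) (f x).pos ≤ dist p x.pos + η := by
  set D := dist p x.pos with hD
  have hD0 : 0 ≤ D := dist_nonneg
  set s := 1 - min 1 (η / (6 * (D + 1))) with hsdef
  have hm : 0 < min 1 (η / (6 * (D + 1))) := by positivity
  have hs0 : 0 ≤ s := by linarith [min_le_left 1 (η / (6 * (D + 1)))]
  have hs1 : s < 1 := by linarith
  have hsD : 3 * ((1 - s) * D) ≤ η / 2 := by
    have h1 : 1 - s ≤ η / (6 * (D + 1)) := by linarith [min_le_right 1 (η / (6 * (D + 1)))]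
    rw [le_div_iff₀ (by positivity)] at h1
    nlinarith
  have hK : IsCompact ((fun t : ℝ => AffineMap.lineMap p x.pos t) '' Icc 0 s) :=
    isCompact_Icc.image AffineMap.lineMap_continuous
  obtain ⟨δ, hδ, hδU⟩ := hK.exists_thickening_subset_open U.isOpen (by
    rintro _ ⟨t, ht, rfl⟩
    exact hs t ht.1 (ht.2.trans_lt hs1))
  have hball : ∀ t, 0 ≤ t → t ≤ s → ball (AffineMap.lineMap p x.pos t) δ ⊆ U.carrier :=
    fun t h0 h1 z hz => hδU (mem_thickening_iff.2 ⟨_, ⟨t, ⟨h0, h1⟩, rfl⟩, hz⟩)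
  filter_upwards [nhdsWithin_le_nhds (ball_mem_nhds p (show 0 < min δ (η / 8) by positivity)),
    self_mem_nhdsWithin] with v hv hvc
  rw [Metric.mem_ball, lt_min_iff] at hv
  have hclose : ∀ t, 0 ≤ t → t ≤ s →
      dist (AffineMap.lineMap v x.pos t) (AffineMap.lineMap p x.pos t) ≤ dist v p := by
    intro t h0 h1
    rw [dist_lineMap_lineMap_left, abs_of_nonneg (by linarith)]
    nlinarith [dist_nonneg (x := v) (y := p)]
  have hmem : ∀ t, 0 ≤ t → t ≤ s → AffineMap.lineMap v x.pos t ∈ U.core := fun t h0 h1 =>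
    ⟨hball t h0 h1 ((hclose t h0 h1).trans_lt hv.1),
      lineMap_mem_interior_hull hvc x.pos_mem_frontier h0 (h1.trans_lt hs1)⟩
  set w := AffineMap.lineMap v x.pos s with hw
  have hwc : w ∈ U.core := hmem s hs0 le_rfl
  have h1 := F_contract f (segment_subset_of_lineMap hs0 hmem)
  have h2 := dist_F_le' f hwc x
  have h3 := dp_le_dist_add_dp w (AffineMap.lineMap p x.pos s) x
  rw [dist_pt_eq (((convex_ball _ δ).segment_subset
    ((hclose s hs0 le_rfl).trans_lt hv.1) (mem_ball_self hδ)).trans (hball s hs0 le_rfl)),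
    hd s hs0 hs1, dist_lineMap_right, Real.norm_of_nonneg (by linarith)] at h3
  have h4 := hclose s hs0 le_rfl
  have h5 : dist v w ≤ dist v p + D := by
    rw [hw, dist_left_lineMap, Real.norm_of_nonneg hs0]
    nlinarith [dist_nonneg (x := v) (y := x.pos), dist_triangle v p x.pos]
  linarith [dist_triangle (U.F f v) (U.F f w) (f x).pos, hv.2]

/-- The map of cores extends continuously to chords whose length is preserved. -/
lemma Chord.tendsto_F (f : U.Bd ≃ᵢ V.Bd) {x y : U.Bd} (h : Chord U x y)
    (hd : dist (f x).pos (f y).pos = dist x.pos y.pos) {t : ℝ} (ht : t ∈ Ioo (0:ℝ) 1) :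
    Tendsto (U.F f) (𝓝[U.core] AffineMap.lineMap x.pos y.pos t)
      (𝓝 (AffineMap.lineMap (f x).pos (f y).pos t)) := by
  have hop : ∀ {a b : U.Bd} (_ : Chord U a b) {t : ℝ} (_ : t ∈ Ioo (0:ℝ) 1) (s : ℝ), 0 ≤ s → s < 1 →
      AffineMap.lineMap (AffineMap.lineMap a.pos b.pos t) a.pos s ∈ openSegment ℝ a.pos b.pos := by
    intro a b _ t ht s h0 h1
    rw [openSegment_eq_image_lineMap]
    refine ⟨(1 - s) * t, ⟨mul_pos (by linarith) ht.1, by nlinarith [ht.1, ht.2]⟩, ?_⟩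
    simp only [AffineMap.lineMap_apply_module]; module
  have key : ∀ {a b : U.Bd} (_ : Chord U a b) {t : ℝ} (_ : t ∈ Ioo (0:ℝ) 1) {η : ℝ} (_ : 0 < η),
      ∀ᶠ v in 𝓝[U.core] AffineMap.lineMap a.pos b.pos t,
        dist (U.F f v) (f a).pos ≤ t * dist a.pos b.pos + η := by
    intro a b hab t ht η hη
    have := eventually_dist_F_le f (x := a) (p := AffineMap.lineMap a.pos b.pos t)
      (fun s h0 h1 => hab.mem _ (hop hab ht s h0 h1)) (fun s h0 h1 => hab.dp_left _ (hop hab ht s h0 h1)) hη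
    rwa [dist_lineMap_left, Real.norm_of_nonneg ht.1.le] at this
  set l := dist x.pos y.pos with hl
  have hl0 : 0 ≤ l := dist_nonneg
  rw [Metric.tendsto_nhds]
  intro ε hε
  obtain ⟨η, hη, hη2⟩ : ∃ η > 0, η * (2 * l + 1) < ε ^ 2 ∧ η < 1 := by
    refine ⟨min (1 / 2) (ε ^ 2 / (2 * (2 * l + 1))), by positivity, ?_, by
      linarith [min_le_left (1 / 2) (ε ^ 2 / (2 * (2 * l + 1)))]⟩
    have := min_le_right (1 / 2) (ε ^ 2 / (2 * (2 * l + 1)))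
    rw [le_div_iff₀ (by positivity)] at this
    nlinarith [sq_pos_of_pos hε]
  have h2 := key h.symm (t := 1 - t) ⟨by linarith [ht.2], by linarith [ht.1]⟩ hη
  rw [AffineMap.lineMap_apply_one_sub] at h2
  filter_upwards [key h ht hη, h2] with v h1 h2
  rw [dist_comm y.pos] at h2
  refine lt_of_pow_lt_pow_left₀ 2 hε.le (lt_of_le_of_lt ?_ hη2.1)
  rw [dist_lineMap_sq, hd]
  have q1 := pow_le_pow_left₀ dist_nonneg h1 2
  have q2 := pow_le_pow_left₀ dist_nonneg h2 2
  have q3 := mul_le_mul_of_nonneg_left q1 (by linarith [ht.2] : 0 ≤ 1 - t)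
  have q4 := mul_le_mul_of_nonneg_left q2 ht.1.le
  have q5 : t * (1 - t) ≤ 1 / 4 := by nlinarith [sq_nonneg (t - 1 / 2)]
  have q6 := mul_le_mul_of_nonneg_right q5 (by positivity : 0 ≤ 4 * l * η)
  nlinarith [mul_pos hη (sub_pos.2 hη2.2), mul_nonneg hl0 hη.le]

/-- Holes of the domain seen from a point with a limiting image are images of boundary points
at most as far away. -/
lemma exists_bd_dist_le (f : U.Bd ≃ᵢ V.Bd) {p z p' : Plane} (hp : p ∈ U) (hz : z ∉ U)
    (hint : openSegment ℝ p z ⊆ interior (convexHull ℝ (frontier U.carrier)))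
    (hF : Tendsto (U.F f) (𝓝[U.core] p) (𝓝 p')) : ∃ y : V.Bd, dist p' y.pos ≤ dist p z := by
  set γ : ℝ → Plane := fun t => AffineMap.lineMap p z t with hγ
  have hγc : Continuous γ := AffineMap.lineMap_continuous
  set S := Icc (0:ℝ) 1 ∩ γ ⁻¹' U.carrierᶜ with hS
  have hSc : IsCompact S := isCompact_Icc.inter_right (U.isOpen.isClosed_compl.preimage hγc)
  have hSn : S.Nonempty := ⟨1, right_mem_Icc.2 zero_le_one, by
    simpa [hγ] using (show z ∉ U.carrier from hz)⟩
  obtain ⟨τ, hτ, hmin⟩ := hSc.exists_isLeast hSn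
  have hbefore : ∀ s, 0 ≤ s → s < τ → γ s ∈ U := by
    intro s h0 h1
    by_contra h
    exact absurd (hmin ⟨⟨h0, h1.le.trans hτ.1.2⟩, h⟩) (not_le.2 h1)
  have hτ0 : 0 < τ := by
    refine lt_of_le_of_ne hτ.1.1 fun h => ?_
    have := hτ.2
    rw [← h] at this
    simp only [mem_preimage, hγ, AffineMap.lineMap_apply_zero] at this
    exact this hp
  have hcore : ∀ s, 0 < s → s < τ → γ s ∈ U.core := fun s h0 h1 =>
    ⟨hbefore s h0.le h1, hint (by
      rw [openSegment_eq_image_lineMap]; exact ⟨s, ⟨h0, h1.trans_le hτ.1.2⟩, rfl⟩)⟩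
  have hD : Convex ℝ (γ '' Ioo 0 τ) := (convex_Ioo 0 τ).affine_image (AffineMap.lineMap p z)
  obtain ⟨x, hx, hxd⟩ := access (U := U) hD (by
      rintro _ ⟨s, hs, rfl⟩; exact hbefore s hs.1.le hs.2) (z := γ τ)
    (by
      refine image_closure_subset_closure_image hγc ⟨τ, ?_, rfl⟩
      rw [closure_Ioo hτ0.ne]; exact right_mem_Icc.2 hτ0.le) hτ.2
  refine ⟨f x, ?_⟩
  have hγd : ∀ s t, dist (γ s) (γ t) = |s - t| * dist p z := fun s t => by
    rw [hγ, dist_lineMap_lineMap, Real.dist_eq]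
  refine le_trans ?_ (mul_le_of_le_one_left dist_nonneg hτ.1.2)
  refine le_of_forall_pos_le_add fun ε hε => ?_
  have t1 : Tendsto γ (𝓝[>] 0) (𝓝[U.core] p) := by
    refine tendsto_nhdsWithin_iff.2 ⟨?_, ?_⟩
    · have := (hγc.tendsto 0).mono_left (nhdsWithin_le_nhds (s := Ioi 0))
      simpa [hγ] using this
    · filter_upwards [Ioo_mem_nhdsGT hτ0] with s hs using hcore s hs.1 hs.2
  obtain ⟨s, hs1, hs2⟩ := (((hF.comp t1).eventually (ball_mem_nhds p' (half_pos hε))).and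
    (Ioo_mem_nhdsGT hτ0)).exists
  obtain ⟨t, ht1, ht2⟩ : ∃ t ∈ Ioo s τ, 3 * ((τ - t) * dist p z) < ε / 2 := by
    have hc : Continuous fun t : ℝ => 3 * ((τ - t) * dist p z) := by fun_prop
    have h1 : Tendsto (fun t : ℝ => 3 * ((τ - t) * dist p z)) (𝓝[<] τ) (𝓝 0) := by
      simpa using (hc.tendsto τ).mono_left (nhdsWithin_le_nhds (s := Iio τ))
    obtain ⟨t, ht, ht'⟩ := ((h1.eventually (gt_mem_nhds (half_pos hε))).and (Ioo_mem_nhdsLT hs2.2)).exists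
    exact ⟨t, ht', ht⟩
  have hseg : segment ℝ (γ s) (γ t) ⊆ U.core := by
    have : Convex ℝ (γ '' Icc s t) := (convex_Icc s t).affine_image (AffineMap.lineMap p z)
    refine (this.segment_subset ⟨s, left_mem_Icc.2 ht1.1.le, rfl⟩
      ⟨t, right_mem_Icc.2 ht1.1.le, rfl⟩).trans ?_
    rintro _ ⟨r, hr, rfl⟩
    exact hcore r (hs2.1.trans_le hr.1) (hr.2.trans_lt ht1.2)
  have h1 := F_contract f hseg
  have h2 := dist_F_le' f (hcore t (hs2.1.trans ht1.1) ht1.2) x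
  rw [hxd _ ⟨t, ⟨hs2.1.trans ht1.1, ht1.2⟩, rfl⟩, hγd, abs_sub_comm, abs_of_pos (by linarith [ht1.2])] at h2
  rw [hγd, abs_sub_comm, abs_of_pos (by linarith [ht1.1])] at h1
  have h3 : (t - s) * dist p z ≤ τ * dist p z :=
    mul_le_mul_of_nonneg_right (by linarith [ht1.2, hs2.1]) dist_nonneg
  simp only [Function.comp_apply] at hs1
  rw [dist_comm] at hs1
  linarith [dist_triangle4 p' (U.F f (γ s)) (U.F f (γ t)) (f x).pos]

/-- A segment in the core whose ends have limiting images at the same distance is mapped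
isometrically. -/
lemma F_lineMap_eq (f : U.Bd ≃ᵢ V.Bd) {p₁ p₂ p₁' p₂' : Plane}
    (hseg : openSegment ℝ p₁ p₂ ⊆ U.core) (h₁ : Tendsto (U.F f) (𝓝[U.core] p₁) (𝓝 p₁'))
    (h₂ : Tendsto (U.F f) (𝓝[U.core] p₂) (𝓝 p₂')) (hd : dist p₁' p₂' = dist p₁ p₂) {t : ℝ}
    (ht : t ∈ Ioo (0:ℝ) 1) :
    U.F f (AffineMap.lineMap p₁ p₂ t) = AffineMap.lineMap p₁' p₂' t := by
  have key : ∀ {a b a' : Plane} (_ : openSegment ℝ a b ⊆ U.core)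
      (_ : Tendsto (U.F f) (𝓝[U.core] a) (𝓝 a')) {t : ℝ} (_ : t ∈ Ioo (0:ℝ) 1),
      dist (U.F f (AffineMap.lineMap a b t)) a' ≤ t * dist a b := by
    intro a b a' hs h t ht
    have hin : ∀ r ∈ Ioo (0:ℝ) 1, AffineMap.lineMap a b r ∈ openSegment ℝ a b := fun r hr => by
      rw [openSegment_eq_image_lineMap]; exact ⟨r, hr, rfl⟩
    have t1 : Tendsto (fun s : ℝ => AffineMap.lineMap a b s) (𝓝[>] 0) (𝓝[U.core] a) := by
      refine tendsto_nhdsWithin_iff.2 ⟨?_, ?_⟩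
      · have := ((AffineMap.lineMap_continuous (R := ℝ) (p := a) (q := b)).tendsto 0).mono_left
          (nhdsWithin_le_nhds (s := Ioi 0))
        simpa using this
      · filter_upwards [Ioo_mem_nhdsGT one_pos] with s hs' using hs (hin s hs')
    have t2 := Filter.Tendsto.dist (tendsto_const_nhds (x := U.F f (AffineMap.lineMap a b t))) (h.comp t1)
    have t3 : Tendsto (fun s : ℝ => |t - s| * dist a b) (𝓝[>] 0) (𝓝 (t * dist a b)) := by
      have hc : Continuous fun s : ℝ => |t - s| * dist a b := by fun_prop
      have := (hc.tendsto 0).mono_left (nhdsWithin_le_nhds (s := Ioi 0))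
      simpa [abs_of_pos ht.1] using this
    refine le_of_tendsto_of_tendsto t2 t3 ?_
    filter_upwards [Ioo_mem_nhdsGT one_pos] with s hs'
    have := F_contract f (((convex_openSegment a b).segment_subset (hin t ht) (hin s hs')).trans hs)
    rwa [dist_lineMap_lineMap, Real.dist_eq] at this
  have e1 := key hseg h₁ ht
  have e2 := key (openSegment_symm ℝ p₁ p₂ ▸ hseg) h₂ (t := 1 - t)
    ⟨by linarith [ht.2], by linarith [ht.1]⟩
  rw [AffineMap.lineMap_apply_one_sub, dist_comm p₂] at e2
  have e3 := dist_lineMap_sq (U.F f (AffineMap.lineMap p₁ p₂ t)) p₁' p₂' t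
  rw [hd] at e3
  have q1 := mul_le_mul_of_nonneg_left (pow_le_pow_left₀ dist_nonneg e1 2) (by linarith [ht.2] : 0 ≤ 1 - t)
  have q2 := mul_le_mul_of_nonneg_left (pow_le_pow_left₀ dist_nonneg e2 2) ht.1.le
  refine dist_le_zero.1 (le_of_sq_le_sq ?_ le_rfl)
  nlinarith

end Dom

namespace Dom

variable {U V : Dom}

/-- The combination of three points with given weights. -/
def comb (y : Fin 3 → Plane) (w : Fin 3 → ℝ) : Plane := ∑ i, w i • y i

lemma sum_fin_three {M : Type*} [AddCommMonoid M] {i j k : Fin 3} (hij : i ≠ j) (hik : i ≠ k)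
    (hjk : j ≠ k) (g : Fin 3 → M) : ∑ l, g l = g i + g j + g k := by
  have : (Finset.univ : Finset (Fin 3)) = {i, j, k} := by
    revert i j k; decide
  rw [this, Finset.sum_insert (by simp [hij, hik]), Finset.sum_insert (by simp [hjk]),
    Finset.sum_singleton, add_assoc]

lemma exists_others (k : Fin 3) : ∃ i j : Fin 3, i ≠ j ∧ i ≠ k ∧ j ≠ k := by
  revert k; decide

lemma comb_lineMap (y : Fin 3 → Plane) (v w : Fin 3 → ℝ) (t : ℝ) :
    AffineMap.lineMap (comb y v) (comb y w) t = comb y (fun i => (1 - t) * v i + t * w i) := by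
  simp only [comb, AffineMap.lineMap_apply_module, Finset.smul_sum, smul_smul, add_smul,
    Finset.sum_add_distrib]

lemma comb_sub (y : Fin 3 → Plane) {w : Fin 3 → ℝ} (hw : ∑ i, w i = 1) (p : Plane) :
    comb y w - p = ∑ i, w i • (y i - p) := by
  simp only [comb, smul_sub, Finset.sum_sub_distrib, ← Finset.sum_smul, hw, one_smul]

lemma dist_comb_comb {y z : Fin 3 → Plane} (h : ∀ i j, dist (y i) (y j) = dist (z i) (z j))
    {v w : Fin 3 → ℝ} (hv : ∑ i, v i = 1) (hw : ∑ i, w i = 1) :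
    dist (comb y v) (comb y w) = dist (comb z v) (comb z w) := by
  simp only [dist_eq_norm] at h ⊢
  rw [← sq_eq_sq₀ (norm_nonneg _) (norm_nonneg _), comb, comb, comb, comb,
    norm_sub_barycenter_sq _ _ _ _ hv hw, norm_sub_barycenter_sq _ _ _ _ hv hw]
  simp only [h]

/-- Three points on a sphere of center `p`. -/
lemma norm_combination_sq {a b e : Plane} {r α β ε : ℝ} (ha : ‖a‖ = r) (hb : ‖b‖ = r) (he : ‖e‖ = r)
    (h : α + β + ε = 1) : ‖α • a + β • b + ε • e‖ ^ 2 =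
      r ^ 2 - α * β * ‖a - b‖ ^ 2 - α * ε * ‖a - e‖ ^ 2 - β * ε * ‖b - e‖ ^ 2 := by
  rw [norm_add_sq_real, norm_add_sq_real, norm_sub_sq_real, norm_sub_sq_real, norm_sub_sq_real,
    inner_add_left]
  simp only [norm_smul, inner_smul_left, inner_smul_right, mul_pow, Real.norm_eq_abs, sq_abs,
    RCLike.conj_to_real, ha, hb, he]
  obtain rfl : ε = 1 - α - β := by linarith
  ring

lemma inner_of_norm_eq {a b : Plane} {r : ℝ} (ha : ‖a‖ = r) (hb : ‖b‖ = r) :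
    ⟪a, b⟫ = r ^ 2 - ‖a - b‖ ^ 2 / 2 := by
  rw [norm_sub_sq_real, ha, hb]; ring

/-- Three boundary elements whose images touch a common disk at affinely independent points. -/
structure Tri (f : U.Bd ≃ᵢ V.Bd) (c : Plane) (r : ℝ) (x : Fin 3 → U.Bd) : Prop where
  touch : ∀ i, Touch V c r (f (x i))
  indep : AffineIndependent ℝ fun i => (f (x i)).pos

namespace Tri

variable {f : U.Bd ≃ᵢ V.Bd} {c : Plane} {r : ℝ} {x : Fin 3 → U.Bd}

lemma norm_eq (h : Tri f c r x) (i : Fin 3) : ‖(f (x i)).pos - c‖ = r := by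
  rw [← dist_eq_norm, dist_comm]; exact (h.touch i).dist_center

lemma inj (h : Tri f c r x) {i j : Fin 3} (hij : i ≠ j) : (f (x i)).pos ≠ (f (x j)).pos :=
  fun e => hij (h.indep.injective e)

lemma chord (h : Tri f c r x) {i j : Fin 3} (hij : i ≠ j) : Chord U (x i) (x j) := by
  have := Touch.chord_map f.symm (h.touch i) (h.touch j) (fun e => h.inj hij (by rw [e]))
  simpa using this

lemma dist_eq (h : Tri f c r x) (i j : Fin 3) :
    dist (x i).pos (x j).pos = dist (f (x i)).pos (f (x j)).pos := by
  rcases eq_or_ne i j with rfl | hij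
  · simp
  · have h1 := (h.touch i).chord (h.touch j) (fun e => h.inj hij (by rw [e]))
    rw [← (h.chord hij).dist_eq, ← h1.dist_eq, f.isometry.dist_eq]

lemma span (h : Tri f c r x) (p : Plane) :
    ∃ w : Fin 3 → ℝ, ∑ i, w i = 1 ∧ comb (fun i => (f (x i)).pos) w = p := by
  have htop : affineSpan ℝ (Set.range fun i => (f (x i)).pos) = ⊤ := by
    rw [h.indep.affineSpan_eq_top_iff_card_eq_finrank_add_one]; simp
  let b : AffineBasis (Fin 3) ℝ Plane := ⟨_, h.indep, htop⟩
  refine ⟨fun i => b.coord i p, b.sum_coord_apply_eq_one p, ?_⟩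
  exact b.linear_combination_coord_eq_self p

lemma indep_source (h : Tri f c r x) : AffineIndependent ℝ fun i => (x i).pos := by
  rw [affineIndependent_iff_of_fintype]
  intro w hw h0
  have hi := (affineIndependent_iff_of_fintype ℝ _).1 h.indep w hw
  apply hi
  rw [Finset.univ.weightedVSub_eq_linear_combination hw] at h0 ⊢
  have e := dist_comb_comb h.dist_eq (v := fun i => if i = 0 then 1 else 0)
    (w := fun i => (if i = 0 then 1 else 0) + w i) (by simp) (by simp [Finset.sum_add_distrib, hw])
  simp only [comb, add_smul, Finset.sum_add_distrib] at e
  rw [h0, add_zero, dist_self, eq_comm, dist_eq_zero] at e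
  simpa using e.symm

lemma mem_interior (h : Tri f c r x) {w : Fin 3 → ℝ} (hw : ∀ i, 0 < w i) (hw1 : ∑ i, w i = 1) :
    comb (fun i => (x i).pos) w ∈ interior (convexHull ℝ (frontier U.carrier)) := by
  have htop : affineSpan ℝ (Set.range fun i => (x i).pos) = ⊤ := by
    rw [h.indep_source.affineSpan_eq_top_iff_card_eq_finrank_add_one]; simp
  let b : AffineBasis (Fin 3) ℝ Plane := ⟨_, h.indep_source, htop⟩
  have hsub : Set.range b ⊆ frontier U.carrier := by
    rintro _ ⟨i, rfl⟩; exact (x i).pos_mem_frontier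
  refine interior_mono (convexHull_mono hsub) ?_
  rw [AffineBasis.interior_convexHull]
  intro i
  have : comb (fun i => (x i).pos) w = Finset.univ.affineCombination ℝ b w := by
    rw [Finset.affineCombination_eq_linear_combination _ _ _ hw1]; rfl
  rw [this, b.coord_apply_combination_of_mem (Finset.mem_univ i) hw1]
  exact hw i

lemma comb_side {y : Fin 3 → Plane} {s : Fin 3 → ℝ} (hs1 : ∑ i, s i = 1) {i j k : Fin 3} (hij : i ≠ j)
    (hik : i ≠ k) (hjk : j ≠ k) (hk : s k = 0) : comb y s = AffineMap.lineMap (y i) (y j) (s j) := by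
  rw [sum_fin_three hij hik hjk, hk] at hs1
  rw [comb, sum_fin_three hij hik hjk, hk, AffineMap.lineMap_apply_module, zero_smul, add_zero,
    show s i = 1 - s j by linarith]

lemma side_mem (h : Tri f c r x) {s : Fin 3 → ℝ} (hs1 : ∑ i, s i = 1) {i j k : Fin 3} (hij : i ≠ j)
    (hik : i ≠ k) (hjk : j ≠ k) (hk : s k = 0) (hi : 0 < s i) (hj : 0 < s j) :
    comb (fun i => (x i).pos) s ∈ U := by
  rw [comb_side hs1 hij hik hjk hk]
  rw [sum_fin_three hij hik hjk, hk] at hs1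
  refine (h.chord hij).mem _ ?_
  rw [openSegment_eq_image_lineMap]
  exact ⟨s j, ⟨hj, by linarith⟩, rfl⟩

lemma side_tendsto (h : Tri f c r x) {s : Fin 3 → ℝ} (hs1 : ∑ i, s i = 1) {i j k : Fin 3} (hij : i ≠ j)
    (hik : i ≠ k) (hjk : j ≠ k) (hk : s k = 0) (hi : 0 < s i) (hj : 0 < s j) :
    Tendsto (U.F f) (𝓝[U.core] comb (fun i => (x i).pos) s) (𝓝 (comb (fun i => (f (x i)).pos) s)) := by
  rw [comb_side hs1 hij hik hjk hk, comb_side hs1 hij hik hjk hk]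
  rw [sum_fin_three hij hik hjk, hk] at hs1
  exact (h.chord hij).tendsto_F f (h.dist_eq i j).symm ⟨hj, by linarith⟩

/-- A hole is far from the sides. -/
lemma le_of_side (h : Tri f c r x) {w : Fin 3 → ℝ} (hw : ∀ i, 0 < w i) (hw1 : ∑ i, w i = 1)
    (hole : comb (fun i => (x i).pos) w ∉ U) {s : Fin 3 → ℝ} (hs1 : ∑ i, s i = 1) {i j k : Fin 3}
    (hij : i ≠ j) (hik : i ≠ k) (hjk : j ≠ k) (hk : s k = 0) (hi : 0 ≤ s i) (hj : 0 ≤ s j) :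
    r ≤ dist (comb (fun i => (f (x i)).pos) s) (comb (fun i => (f (x i)).pos) w) +
      dist (comb (fun i => (f (x i)).pos) s) c := by
  have vert : ∀ {i j : Fin 3} (_ : i ≠ j) (_ : i ≠ k) (_ : j ≠ k) (_ : s j = 0),
      r ≤ dist (comb (fun i => (f (x i)).pos) s) c := by
    intro i j hij hik hjk h0
    rw [comb_side hs1 hij hik hjk hk, h0, AffineMap.lineMap_apply_zero, dist_comm,
      (h.touch i).dist_center]
  rcases hi.eq_or_lt with hi | hi
  · have := vert hij.symm hjk hik hi.symm
    linarith [dist_nonneg (x := comb (fun i => (f (x i)).pos) s) (y := comb (fun i => (f (x i)).pos) w)]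
  rcases hj.eq_or_lt with hj | hj
  · have := vert hij hik hjk hj.symm
    linarith [dist_nonneg (x := comb (fun i => (f (x i)).pos) s) (y := comb (fun i => (f (x i)).pos) w)]
  have hp := h.side_mem hs1 hij hik hjk hk hi hj
  have hmem : comb (fun i => (x i).pos) s ∈ closure (convexHull ℝ (frontier U.carrier)) := by
    refine subset_closure ?_
    rw [comb_side hs1 hij hik hjk hk]
    refine (convex_convexHull ℝ _).segment_subset (subset_convexHull ℝ _ (x i).pos_mem_frontier)
      (subset_convexHull ℝ _ (x j).pos_mem_frontier) ?_
    rw [sum_fin_three hij hik hjk, hk] at hs1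
    rw [segment_eq_image_lineMap]
    exact ⟨s j, ⟨hj.le, by linarith⟩, rfl⟩
  obtain ⟨y, hy⟩ := exists_bd_dist_le f hp hole
    ((convex_convexHull ℝ _).openSegment_closure_interior_subset_interior hmem (h.mem_interior hw hw1))
    (h.side_tendsto hs1 hij hik hjk hk hi hj)
  rw [dist_comb_comb h.dist_eq hs1 hw1] at hy
  have hyr : r ≤ dist y.pos c := by
    by_contra hlt
    exact y.pos_not_mem ((h.touch i).ball_subset (not_le.1 hlt))
  linarith [dist_triangle_left y.pos c (comb (fun i => (f (x i)).pos) s)]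

lemma dist_comb_lt (h : Tri f c r x) {w : Fin 3 → ℝ} (hw : ∀ i, 0 < w i) (hw1 : ∑ i, w i = 1) :
    dist (comb (fun i => (f (x i)).pos) w) c < r := by
  have hr : 0 < r := (h.touch 0).pos_rad
  rw [dist_eq_norm]
  refine lt_of_pow_lt_pow_left₀ 2 hr.le ?_
  rw [comb_sub _ hw1, Fin.sum_univ_three, norm_combination_sq (h.norm_eq 0) (h.norm_eq 1) (h.norm_eq 2)
    (by rwa [Fin.sum_univ_three] at hw1)]
  have h01 : 0 < ‖(f (x 0)).pos - c - ((f (x 1)).pos - c)‖ := by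
    rw [sub_sub_sub_cancel_right, norm_pos_iff, sub_ne_zero]; exact h.inj (by decide)
  have := mul_pos (mul_pos (hw 0) (hw 1)) (sq_pos_of_pos h01)
  have := mul_nonneg (mul_pos (hw 0) (hw 2)).le (sq_nonneg ‖(f (x 0)).pos - c - ((f (x 2)).pos - c)‖)
  have := mul_nonneg (mul_pos (hw 1) (hw 2)).le (sq_nonneg ‖(f (x 1)).pos - c - ((f (x 2)).pos - c)‖)
  linarith

lemma comb_mem_target (h : Tri f c r x) {w : Fin 3 → ℝ} (hw : ∀ i, 0 < w i) (hw1 : ∑ i, w i = 1) :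
    comb (fun i => (f (x i)).pos) w ∈ V :=
  (h.touch 0).ball_subset (h.dist_comb_lt hw hw1)

lemma center_pos (h : Tri f c r x) {w : Fin 3 → ℝ} (hw : ∀ i, 0 < w i) (hw1 : ∑ i, w i = 1)
    (hole : comb (fun i => (x i).pos) w ∉ U) {γ : Fin 3 → ℝ} (hγ1 : ∑ i, γ i = 1)
    (hγ : comb (fun i => (f (x i)).pos) γ = c) (i : Fin 3) : 0 < γ i := by
  by_contra hneg
  set B := Finset.univ.filter fun i => γ i ≤ 0 with hB
  obtain ⟨k, hk, hmin⟩ := B.exists_min_image (fun i => w i / (w i - γ i)) ⟨i, by simpa [hB] using hneg⟩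
  have hk0 : γ k ≤ 0 := by simpa [hB] using hk
  obtain ⟨i, j, hij, hik, hjk⟩ := exists_others k
  have hden : 0 < w k - γ k := by linarith [hw k]
  set t := w k / (w k - γ k) with ht
  have ht0 : 0 < t := div_pos (hw k) hden
  have ht1 : t ≤ 1 := by rw [ht, div_le_one hden]; linarith
  set s : Fin 3 → ℝ := fun i => (1 - t) * w i + t * γ i with hs
  have hs1 : ∑ i, s i = 1 := by
    simp only [hs, Finset.sum_add_distrib, ← Finset.mul_sum, hw1, hγ1]; ring
  have hsk : s k = 0 := by simp only [hs, ht]; field_simp; ring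
  have hnn : ∀ l, 0 ≤ s l := by
    intro l
    simp only [hs]
    rcases le_or_gt (γ l) 0 with hl | hl
    · have h1 := hmin l (by simpa [hB] using hl)
      rw [le_div_iff₀ (by linarith [hw l])] at h1
      linarith
    · exact add_nonneg (mul_nonneg (by linarith) (hw l).le) (mul_pos ht0 hl).le
  have h1 := h.le_of_side hw hw1 hole hs1 hij hik hjk hsk (hnn i) (hnn j)
  have h2 := h.dist_comb_lt hw hw1
  have h3 : comb (fun i => (f (x i)).pos) s =
      AffineMap.lineMap (comb (fun i => (f (x i)).pos) w) c t := by
    rw [← hγ, comb_lineMap]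
  rw [h3, dist_lineMap_left, dist_lineMap_right, Real.norm_of_nonneg ht0.le,
    Real.norm_of_nonneg (by linarith)] at h1
  linarith

lemma center_lt_half (h : Tri f c r x) {γ : Fin 3 → ℝ} (hγ1 : ∑ i, γ i = 1)
    (hγ : comb (fun i => (f (x i)).pos) γ = c) (hpos : ∀ i, 0 < γ i) (k : Fin 3) : γ k < 1 / 2 := by
  obtain ⟨i, j, hij, hik, hjk⟩ := exists_others k
  have hr : 0 < r := (h.touch 0).pos_rad
  have h0 := comb_sub (fun i => (f (x i)).pos) hγ1 c
  rw [hγ, sub_self, sum_fin_three hij hik hjk] at h0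
  rw [sum_fin_three hij hik hjk] at hγ1
  have e : γ k • ((f (x k)).pos - c) = -(γ i • ((f (x i)).pos - c) + γ j • ((f (x j)).pos - c)) := by
    rw [eq_neg_iff_add_eq_zero, add_comm, ← h0]
  have e2 := congrArg (fun v => ‖v‖ ^ 2) e
  simp only [norm_neg] at e2
  rw [norm_add_sq_real, norm_smul, norm_smul, norm_smul, inner_smul_left, inner_smul_right,
    inner_of_norm_eq (h.norm_eq i) (h.norm_eq j)] at e2
  simp only [mul_pow, Real.norm_eq_abs, sq_abs, RCLike.conj_to_real, h.norm_eq] at e2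
  have hij' : 0 < ‖(f (x i)).pos - c - ((f (x j)).pos - c)‖ := by
    rw [sub_sub_sub_cancel_right, norm_pos_iff, sub_ne_zero]; exact h.inj hij
  have h3 := mul_pos (mul_pos (hpos i) (hpos j)) (sq_pos_of_pos hij')
  have h4 : γ k ^ 2 * r ^ 2 < (γ i + γ j) ^ 2 * r ^ 2 := by nlinarith
  have h5 := lt_of_mul_lt_mul_right h4 (sq_nonneg r)
  have h6 := lt_of_pow_lt_pow_left₀ 2 (add_pos (hpos i) (hpos j)).le h5
  linarith

/-- The only possible hole corresponds to the orthocenter. -/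
lemma hole_eq (h : Tri f c r x) {w : Fin 3 → ℝ} (hw : ∀ i, 0 < w i) (hw1 : ∑ i, w i = 1)
    (hole : comb (fun i => (x i).pos) w ∉ U) {γ : Fin 3 → ℝ} (hγ1 : ∑ i, γ i = 1)
    (hγ : comb (fun i => (f (x i)).pos) γ = c) (l : Fin 3) : w l = 1 - 2 * γ l := by
  have hpos := h.center_pos hw hw1 hole hγ1 hγ
  have hhalf := h.center_lt_half hγ1 hγ hpos
  obtain ⟨k, -, hmin⟩ := Finset.univ.exists_min_image (fun i => w i / (1 - 2 * γ i))
    (Finset.univ_nonempty (α := Fin 3))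
  set μ := w k / (1 - 2 * γ k) with hμ
  have hh : ∀ i, 0 < 1 - 2 * γ i := fun i => by linarith [hhalf i]
  have hle : ∀ i, μ * (1 - 2 * γ i) ≤ w i := fun i => (le_div_iff₀ (hh i)).1 (hmin i (Finset.mem_univ i))
  have hμ0 : 0 < μ := div_pos (hw k) (hh k)
  have hsum : ∑ i, (1 - 2 * γ i) = 1 := by
    rw [Finset.sum_sub_distrib, ← Finset.mul_sum, hγ1]; norm_num
  rcases le_or_gt 1 μ with h1 | h1
  · have hle' : ∀ i, 1 - 2 * γ i ≤ w i := fun i => by nlinarith [hle i, hh i]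
    exact ((Finset.sum_eq_sum_iff_of_le fun i _ => hle' i).1 (by rw [hsum, hw1]) l (Finset.mem_univ l)).symm
  exfalso
  obtain ⟨i, j, hij, hik, hjk⟩ := exists_others k
  set a := (f (x i)).pos - c with ha
  set b := (f (x j)).pos - c with hb
  set e := (f (x k)).pos - c with he
  have hna : ‖a‖ = r := h.norm_eq i
  have hnb : ‖b‖ = r := h.norm_eq j
  have hne : ‖e‖ = r := h.norm_eq k
  have hr : 0 < r := (h.touch 0).pos_rad
  have h0 := comb_sub (fun i => (f (x i)).pos) hγ1 c
  rw [hγ, sub_self, sum_fin_three hij hik hjk] at h0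
  have hw0 := comb_sub (fun i => (f (x i)).pos) hw1 c
  rw [sum_fin_three hij hik hjk] at hw0
  rw [← ha, ← hb, ← he] at h0 hw0
  set ζ := comb (fun i => (f (x i)).pos) w with hζ
  have hγs := hγ1
  have hws := hw1
  rw [sum_fin_three hij hik hjk] at hγs hws
  have hwk : w k = μ * (1 - 2 * γ k) := by rw [hμ]; field_simp [(hh k).ne']
  -- the reflected center
  set c' := c + (a + b) with hc'
  have hi := hle i
  have hj := hle j
  have hζ' : dist ζ c' < r := by
    rw [dist_eq_norm]
    refine lt_of_pow_lt_pow_left₀ 2 hr.le ?_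
    have e1 : ζ - c' = (w i - μ * (1 - 2 * γ i)) • (-b) + (w j - μ * (1 - 2 * γ j)) • (-a) + μ • e := by
      have : ζ - c' = (w i • a + w j • b + w k • e) + (2 * μ) • (γ i • a + γ j • b + γ k • e) - (a + b) := by
        rw [← h0, ← hw0, hc', smul_zero]; abel
      rw [this, hwk]
      have h7 : w j = 1 - w i - μ * (1 - 2 * γ k) := by linarith
      have h8 : γ j = 1 - γ i - γ k := by linarith
      rw [h7, h8]
      module
    have hsum1 : (w i - μ * (1 - 2 * γ i)) + (w j - μ * (1 - 2 * γ j)) + μ = 1 := by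
      rw [hwk] at hws
      linear_combination hws + 2 * μ * hγs
    rw [e1, norm_combination_sq (by rwa [norm_neg]) (by rwa [norm_neg]) hne hsum1]
    have hbe : -b - e ≠ 0 := by
      intro h10
      have h11 : e = -b := by rw [sub_eq_zero] at h10; exact h10.symm
      rw [h11] at h0
      have h12 : γ i • a = (γ k - γ j) • b := by
        have : γ i • a - (γ k - γ j) • b = 0 := by
          refine Eq.trans ?_ h0.symm
          module
        exact sub_eq_zero.1 this
      have h13 := congrArg norm h12
      rw [norm_smul, norm_smul, hna, hnb, Real.norm_of_nonneg (hpos i).le] at h13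
      have h14 := mul_right_cancel₀ hr.ne' h13
      rw [Real.norm_eq_abs] at h14
      rcases abs_cases (γ k - γ j) with ⟨h15, -⟩ | ⟨h15, -⟩
      · linarith [hhalf k]
      · linarith [hhalf j]
    have hae : -a - e ≠ 0 := by
      intro h10
      have h11 : e = -a := by rw [sub_eq_zero] at h10; exact h10.symm
      rw [h11] at h0
      have h12 : γ j • b = (γ k - γ i) • a := by
        have : γ j • b - (γ k - γ i) • a = 0 := by
          refine Eq.trans ?_ h0.symm
          module
        exact sub_eq_zero.1 this
      have h13 := congrArg norm h12
      rw [norm_smul, norm_smul, hna, hnb, Real.norm_of_nonneg (hpos j).le] at h13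
      have h14 := mul_right_cancel₀ hr.ne' h13
      rw [Real.norm_eq_abs] at h14
      rcases abs_cases (γ k - γ i) with ⟨h15, -⟩ | ⟨h15, -⟩
      · linarith [hhalf k]
      · linarith [hhalf i]
    have p1 := mul_nonneg (mul_nonneg (sub_nonneg.2 hi) (sub_nonneg.2 hj)) (sq_nonneg ‖-b - -a‖)
    have q1 := mul_pos hμ0 (sq_pos_of_pos (norm_pos_iff.2 hbe))
    have q2 := mul_pos hμ0 (sq_pos_of_pos (norm_pos_iff.2 hae))
    have p2 := mul_nonneg (sub_nonneg.2 hi) q1.le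
    have p3 := mul_nonneg (sub_nonneg.2 hj) q2.le
    rcases lt_or_ge 0 (w i - μ * (1 - 2 * γ i)) with h16 | h16
    · have := mul_pos h16 q1
      linarith
    · have := mul_pos (show 0 < w j - μ * (1 - 2 * γ j) by linarith) q2
      linarith
  -- the segment to the reflected center crosses a side
  set t := w k / (w k + γ k) with ht
  have hden : 0 < w k + γ k := add_pos (hw k) (hpos k)
  have ht0 : 0 < t := div_pos (hw k) hden
  have ht1 : t < 1 := by rw [ht, div_lt_one hden]; linarith [hpos k]
  set g : Fin 3 → ℝ := fun l => (if l = k then 0 else 1) - γ l with hg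
  have hgk : g k = -γ k := by simp [hg]
  have hgi : g i = 1 - γ i := by simp [hg, hik]
  have hgj : g j = 1 - γ j := by simp [hg, hjk]
  have hg1 : ∑ l, g l = 1 := by rw [sum_fin_three hij hik hjk, hgk, hgi, hgj]; linarith
  have hgc : comb (fun i => (f (x i)).pos) g = c' := by
    have h17 := comb_sub (fun i => (f (x i)).pos) hg1 c
    rw [sum_fin_three hij hik hjk, hgk, hgi, hgj] at h17
    rw [hc', ← sub_eq_iff_eq_add', h17]
    calc _ = a + b - (γ i • a + γ j • b + γ k • e) := by module
      _ = _ := by rw [← h0, sub_zero]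
  set s : Fin 3 → ℝ := fun l => (1 - t) * w l + t * g l with hs
  have hs1 : ∑ i, s i = 1 := by
    simp only [hs, Finset.sum_add_distrib, ← Finset.mul_sum, hw1, hg1]; ring
  have hsk : s k = 0 := by simp only [hs, hgk, ht]; field_simp; ring
  have hsi : 0 ≤ s i := by
    simp only [hs, hgi]
    exact add_nonneg (mul_nonneg (by linarith) (hw i).le) (mul_nonneg ht0.le (by linarith [hhalf i]))
  have hsj : 0 ≤ s j := by
    simp only [hs, hgj]
    exact add_nonneg (mul_nonneg (by linarith) (hw j).le) (mul_nonneg ht0.le (by linarith [hhalf j]))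
  have h18 := h.le_of_side hw hw1 hole hs1 hij hik hjk hsk hsi hsj
  have h19 : comb (fun i => (f (x i)).pos) s = AffineMap.lineMap ζ c' t := by
    rw [← hgc, hζ, comb_lineMap]
  have h20 : dist (comb (fun i => (f (x i)).pos) s) c = dist (comb (fun i => (f (x i)).pos) s) c' := by
    have h21 := comb_sub (fun i => (f (x i)).pos) hs1 c
    have hs1' := hs1
    rw [sum_fin_three hij hik hjk, hsk] at h21 hs1'
    rw [zero_smul, add_zero] at h21
    have h22 : comb (fun i => (f (x i)).pos) s - c' = -(s j • a + s i • b) := by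
      rw [hc', ← sub_sub, h21]
      have : s j = 1 - s i := by linarith
      rw [this]; module
    rw [dist_eq_norm, dist_eq_norm, h22, norm_neg, h21, ← sq_eq_sq₀ (norm_nonneg _) (norm_nonneg _),
      norm_add_sq_real, norm_add_sq_real]
    simp only [norm_smul, inner_smul_left, inner_smul_right, ← ha, ← hb, hna, hnb,
      RCLike.conj_to_real]
    ring
  rw [h20, h19, dist_lineMap_left, dist_lineMap_right, Real.norm_of_nonneg ht0.le,
    Real.norm_of_nonneg (by linarith)] at h18
  linarith

/-- The map of cores is affine on complete cross sections of the triangle. -/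
lemma F_comb_of_level (h : Tri f c r x) {v : Fin 3 → ℝ} (hv : ∀ i, 0 < v i) (hv1 : ∑ i, v i = 1)
    (hlev : ∀ v' : Fin 3 → ℝ, (∀ i, 0 < v' i) → ∑ i, v' i = 1 → v' 2 = v 2 →
      comb (fun i => (x i).pos) v' ∈ U) :
    U.F f (comb (fun i => (x i).pos) v) = comb (fun i => (f (x i)).pos) v := by
  have hvs := hv1
  rw [Fin.sum_univ_three] at hvs
  have h0 := hv 0
  have h1 := hv 1
  have h2 := hv 2
  set a : Fin 3 → ℝ := ![1 - v 2, 0, v 2] with ha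
  set b : Fin 3 → ℝ := ![0, 1 - v 2, v 2] with hb
  have ha1 : ∑ i, a i = 1 := by rw [Fin.sum_univ_three]; simp [ha]
  have hb1 : ∑ i, b i = 1 := by rw [Fin.sum_univ_three]; simp [hb]
  set t := v 1 / (1 - v 2) with ht
  have hden : 0 < 1 - v 2 := by linarith
  have ht0 : 0 < t := div_pos h1 hden
  have ht1 : t < 1 := by rw [ht, div_lt_one hden]; linarith
  have hv' : v = fun i => (1 - t) * a i + t * b i := by
    have htm : t * (1 - v 2) = v 1 := div_mul_cancel₀ _ hden.ne'
    funext i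
    fin_cases i
    · simp [ha, hb]; linarith
    · simp [ha, hb]; linarith
    · simp [ha, hb]; ring
  have key := F_lineMap_eq f (p₁ := comb (fun i => (x i).pos) a) (p₂ := comb (fun i => (x i).pos) b) ?_
    (h.side_tendsto ha1 (i := 0) (j := 2) (k := 1) (by decide) (by decide) (by decide) (by simp [ha])
      (by simp [ha]; linarith) (by simp [ha, h2]))
    (h.side_tendsto hb1 (i := 1) (j := 2) (k := 0) (by decide) (by decide) (by decide) (by simp [hb])
      (by simp [hb]; linarith) (by simp [hb, h2])) (dist_comb_comb h.dist_eq ha1 hb1).symm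
    (t := t) ⟨ht0, ht1⟩
  · rw [comb_lineMap, comb_lineMap, ← hv'] at key
    exact key
  · rw [openSegment_eq_image_lineMap]
    rintro _ ⟨τ, hτ, rfl⟩
    rw [comb_lineMap]
    have hpos : ∀ i, 0 < (1 - τ) * a i + τ * b i := by
      have := mul_pos hτ.1 hden
      have := mul_pos (sub_pos.2 hτ.2) hden
      intro i
      fin_cases i
      · simpa [ha, hb] using ‹0 < (1 - τ) * (1 - v 2)›
      · simpa [ha, hb] using ‹0 < τ * (1 - v 2)›
      · simp [ha, hb]; nlinarith
    have hsum : ∑ i, ((1 - τ) * a i + τ * b i) = 1 := by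
      rw [Finset.sum_add_distrib, ← Finset.mul_sum, ← Finset.mul_sum, ha1, hb1]; ring
    exact ⟨hlev _ hpos hsum (by simp [ha, hb]; ring), h.mem_interior hpos hsum⟩

/-- There are no holes in the triangle. -/
lemma comb_mem (h : Tri f c r x) {w : Fin 3 → ℝ} (hw : ∀ i, 0 < w i) (hw1 : ∑ i, w i = 1) :
    comb (fun i => (x i).pos) w ∈ U := by
  by_contra hole
  obtain ⟨γ, hγ1, hγ⟩ := h.span c
  have hw2 := h.hole_eq hw hw1 hole hγ1 hγ
  have huniq : ∀ v : Fin 3 → ℝ, (∀ i, 0 < v i) → ∑ i, v i = 1 → v 2 ≠ w 2 →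
      comb (fun i => (x i).pos) v ∈ U := by
    intro v hv hv1 hne
    by_contra hv2
    exact hne (by rw [hw2, h.hole_eq hv hv1 hv2 hγ1 hγ])
  have hws := hw1
  rw [Fin.sum_univ_three] at hws
  have h0 := hw 0
  have h1 := hw 1
  have h2 := hw 2
  -- approach the hole along a segment from the opposite side
  set a : Fin 3 → ℝ := ![(1 - w 2 / 2) / 2, (1 - w 2 / 2) / 2, w 2 / 2] with ha
  have ha1 : ∑ i, a i = 1 := by rw [Fin.sum_univ_three]; simp [ha]
  have hap : ∀ i, 0 < a i := by
    intro i
    fin_cases i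
    · simp [ha]; linarith
    · simp [ha]; linarith
    · simp [ha, h2]
  have hpos : ∀ t ∈ Ico (0:ℝ) 1, ∀ i, 0 < (1 - t) * a i + t * w i := fun t ht i =>
    add_pos_of_pos_of_nonneg (mul_pos (by linarith [ht.2]) (hap i)) (mul_nonneg ht.1 (hw i).le)
  have hsum : ∀ t : ℝ, ∑ i, ((1 - t) * a i + t * w i) = 1 := fun t => by
    rw [Finset.sum_add_distrib, ← Finset.mul_sum, ← Finset.mul_sum, ha1, hw1]; ring
  have hne : ∀ t ∈ Ico (0:ℝ) 1, (1 - t) * a 2 + t * w 2 ≠ w 2 := fun t ht => by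
    have : a 2 = w 2 / 2 := by simp [ha]
    rw [this]
    nlinarith [mul_pos (sub_pos.2 ht.2) h2]
  set γ' : ℝ → Plane := fun t =>
    AffineMap.lineMap (comb (fun i => (x i).pos) a) (comb (fun i => (x i).pos) w) t with hγ'
  have hγ'e : ∀ t, γ' t = comb (fun i => (x i).pos) (fun i => (1 - t) * a i + t * w i) := fun t => by
    rw [hγ']; simp only [comb_lineMap]
  have hγ'c : Continuous γ' := AffineMap.lineMap_continuous
  have hmem : ∀ t ∈ Ico (0:ℝ) 1, γ' t ∈ U := fun t ht => by
    rw [hγ'e]; exact huniq _ (hpos t ht) (hsum t) (hne t ht)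
  obtain ⟨y, hy, hyd⟩ := access (U := U) ((convex_Ico 0 1).affine_image
      (AffineMap.lineMap (comb (fun i => (x i).pos) a) (comb (fun i => (x i).pos) w)))
    (by rintro _ ⟨t, ht, rfl⟩; exact hmem t ht) (z := comb (fun i => (x i).pos) w)
    (by
      have h3 : γ' 1 ∈ closure (γ' '' Ico 0 1) := by
        refine image_closure_subset_closure_image hγ'c ⟨1, ?_, rfl⟩
        rw [closure_Ico zero_ne_one]; exact right_mem_Icc.2 zero_le_one
      rwa [show γ' 1 = comb (fun i => (x i).pos) w by simp [hγ']] at h3) hole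
  have hF : ∀ t ∈ Ico (0:ℝ) 1, U.F f (γ' t) = AffineMap.lineMap (comb (fun i => (f (x i)).pos) a)
      (comb (fun i => (f (x i)).pos) w) t := fun t ht => by
    rw [hγ'e, comb_lineMap]
    refine h.F_comb_of_level (hpos t ht) (hsum t) fun v' hv' hv1' h2' => huniq v' hv' hv1' ?_
    rw [h2']; exact hne t ht
  have hcore : ∀ t ∈ Ico (0:ℝ) 1, γ' t ∈ U.core := fun t ht => by
    refine ⟨hmem t ht, ?_⟩
    rw [hγ'e]; exact h.mem_interior (hpos t ht) (hsum t)
  have hbound : ∀ t ∈ Ico (0:ℝ) 1, dist (AffineMap.lineMap (comb (fun i => (f (x i)).pos) a)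
      (comb (fun i => (f (x i)).pos) w) t) (f y).pos ≤ 3 * dist (γ' t) (comb (fun i => (x i).pos) w) := by
    intro t ht
    rw [← hF t ht, ← hyd (γ' t) ⟨t, ht, rfl⟩]
    exact dist_F_le' f (hcore t ht) y
  have hlim : dist (comb (fun i => (f (x i)).pos) w) (f y).pos ≤ 0 := by
    have c1 : Continuous fun t : ℝ => dist (AffineMap.lineMap (comb (fun i => (f (x i)).pos) a)
      (comb (fun i => (f (x i)).pos) w) t) (f y).pos :=
        (AffineMap.lineMap_continuous).dist continuous_const
    have c2 : Continuous fun t : ℝ => 3 * dist (γ' t) (comb (fun i => (x i).pos) w) :=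
      continuous_const.mul (hγ'c.dist continuous_const)
    have l1 := (c1.tendsto 1).mono_left (nhdsWithin_le_nhds (s := Iio 1))
    have l2 := (c2.tendsto 1).mono_left (nhdsWithin_le_nhds (s := Iio 1))
    have := le_of_tendsto_of_tendsto l1 l2 (by
      filter_upwards [Ioo_mem_nhdsLT zero_lt_one] with t ht using hbound t ⟨ht.1.le, ht.2⟩)
    simpa [hγ'] using this
  refine (f y).pos_not_mem ?_
  rw [← dist_le_zero.1 hlim]
  exact h.comb_mem_target hw hw1

lemma comb_mem_core (h : Tri f c r x) {w : Fin 3 → ℝ} (hw : ∀ i, 0 < w i) (hw1 : ∑ i, w i = 1) :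
    comb (fun i => (x i).pos) w ∈ U.core :=
  ⟨h.comb_mem hw hw1, h.mem_interior hw hw1⟩

lemma F_comb (h : Tri f c r x) {w : Fin 3 → ℝ} (hw : ∀ i, 0 < w i) (hw1 : ∑ i, w i = 1) :
    U.F f (comb (fun i => (x i).pos) w) = comb (fun i => (f (x i)).pos) w :=
  h.F_comb_of_level hw hw1 fun _ hv hv1 _ => h.comb_mem hv hv1

end Tri
end Dom

namespace Dom

/-- Twice the signed area of the triangle `a b z`. -/
def side (a b z : Plane) : ℝ := (b 0 - a 0) * (z 1 - a 1) - (b 1 - a 1) * (z 0 - a 0)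

lemma side_swap (a b z : Plane) : side b a z = -side a b z := by simp only [side]; ring

lemma side_lineMap (a b z w : Plane) (t : ℝ) :
    side a b (AffineMap.lineMap z w t) = (1 - t) * side a b z + t * side a b w := by
  simp only [side, AffineMap.lineMap_apply_module, PiLp.add_apply, PiLp.smul_apply, smul_eq_mul]
  ring

lemma side_left (a b : Plane) : side a b a = 0 := by simp [side]

lemma side_right (a b : Plane) : side a b b = 0 := by simp only [side]; ring

lemma side_line (a b : Plane) (t : ℝ) : side a b (AffineMap.lineMap a b t) = 0 := by
  rw [side_lineMap, side_left, side_right]; ring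

lemma continuous_side (a b : Plane) : Continuous (side a b) := by
  unfold side
  fun_prop

lemma eq_lineMap_of_side {a b z : Plane} (hab : a ≠ b) (h : side a b z = 0) :
    z = AffineMap.lineMap a b (⟪b - a, z - a⟫ / ‖b - a‖ ^ 2) := by
  have hd : ‖b - a‖ ^ 2 ≠ 0 := by
    rw [Ne, sq_eq_zero_iff, norm_eq_zero, sub_eq_zero]; exact hab.symm
  rw [side] at h
  rw [norm_sq_plane, inner_plane] at *
  simp only [PiLp.sub_apply] at *
  ext i
  fin_cases i <;>
    simp only [AffineMap.lineMap_apply_module, PiLp.add_apply, PiLp.smul_apply, smul_eq_mul,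
      Fin.zero_eta, Fin.mk_one, Fin.isValue] <;> field_simp
  · linear_combination (-(b 1 - a 1)) * h
  · linear_combination (b 0 - a 0) * h

lemma convex_side_pos (a b : Plane) : Convex ℝ {z | 0 < side a b z} := by
  rw [convex_iff_segment_subset]
  intro x hx y hy
  rw [segment_eq_image_lineMap]
  rintro _ ⟨t, ht, rfl⟩
  replace hx : 0 < side a b x := hx
  replace hy : 0 < side a b y := hy
  change 0 < side a b _
  rw [side_lineMap]
  rcases ht.1.eq_or_lt with rfl | h0
  · simpa using hx
  · exact add_pos_of_nonneg_of_pos (mul_nonneg (by linarith [ht.2]) hx.le) (mul_pos h0 hy)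

lemma convex_side_nonneg (a b : Plane) : Convex ℝ {z | 0 ≤ side a b z} := by
  rw [convex_iff_segment_subset]
  intro x hx y hy
  rw [segment_eq_image_lineMap]
  rintro _ ⟨t, ht, rfl⟩
  replace hx : 0 ≤ side a b x := hx
  replace hy : 0 ≤ side a b y := hy
  change 0 ≤ side a b _
  rw [side_lineMap]
  exact add_nonneg (mul_nonneg (by linarith [ht.2]) hx) (mul_nonneg ht.1 hy)

lemma eventually_mem_interior_hull_of_side {S : Set Plane} {a b e : Plane} (hab : a ≠ b) (ha : a ∈ S)
    (hb : b ∈ S) (he : e ∈ S) (hs : 0 < side a b e) {t : ℝ} (ht : t ∈ Ioo (0:ℝ) 1) :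
    ∀ᶠ m in 𝓝 (AffineMap.lineMap a b t : Plane), 0 < side a b m → m ∈ interior (convexHull ℝ S) := by
  have hd : ‖b - a‖ ^ 2 ≠ 0 := by
    rw [Ne, sq_eq_zero_iff, norm_eq_zero, sub_eq_zero]; exact hab.symm
  suffices H : ∀ᶠ m in 𝓝 (AffineMap.lineMap a b t : Plane), 0 < side a b m → m ∈ convexHull ℝ S by
    filter_upwards [eventually_eventually_nhds.2 H] with m hm hpos
    rw [mem_interior_iff_mem_nhds]
    filter_upwards [hm, (isOpen_lt continuous_const (continuous_side a b)).mem_nhds hpos] with m' h1 h2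
      using h1 h2
  set θ : Plane → ℝ := fun m => side a b m / side a b e with hθ
  have hθc : Continuous θ := (continuous_side a b).div_const _
  have hθ0 : θ (AffineMap.lineMap a b t) = 0 := by simp [hθ, side_line]
  set w : Plane → Plane := fun m => (1 - θ m)⁻¹ • (m - θ m • e) with hw
  have hwc : ContinuousAt w (AffineMap.lineMap a b t) := by
    refine ContinuousAt.smul (ContinuousAt.inv₀ (continuousAt_const.sub hθc.continuousAt) ?_)
      (continuousAt_id.sub (hθc.continuousAt.smul continuousAt_const))
    change 1 - θ _ ≠ 0
    rw [hθ0]; norm_num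
  have hw0 : w (AffineMap.lineMap a b t) = AffineMap.lineMap a b t := by
    simp only [hw, hθ0]; simp
  set σ : Plane → ℝ := fun m => ⟪b - a, w m - a⟫ / ‖b - a‖ ^ 2 with hσ
  have hσc : ContinuousAt σ (AffineMap.lineMap a b t) :=
    (Filter.Tendsto.inner (𝕜 := ℝ) tendsto_const_nhds (hwc.sub continuousAt_const)).div_const _
  have hσ0 : σ (AffineMap.lineMap a b t) = t := by
    simp only [hσ, hw0]
    rw [AffineMap.lineMap_apply, vsub_eq_sub, vadd_eq_add, add_sub_cancel_right, inner_smul_right,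
      real_inner_self_eq_norm_sq, mul_div_cancel_right₀ _ hd]
  have e1 : ∀ᶠ m in 𝓝 (AffineMap.lineMap a b t : Plane), σ m ∈ Ioo (0:ℝ) 1 := by
    refine hσc.eventually_mem ?_
    rw [hσ0]; exact Ioo_mem_nhds ht.1 ht.2
  have e2 : ∀ᶠ m in 𝓝 (AffineMap.lineMap a b t : Plane), θ m < 1 := by
    refine hθc.continuousAt.eventually_lt continuousAt_const ?_
    rw [hθ0]; norm_num
  filter_upwards [e1, e2] with m h1 h2 hpos
  have hθp : 0 < θ m := div_pos hpos hs
  have h1θ : 1 - θ m ≠ 0 := by linarith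
  have hm : m = AffineMap.lineMap (w m) e (θ m) := by
    rw [AffineMap.lineMap_apply_module]
    simp only [hw]
    rw [smul_inv_smul₀ h1θ, sub_add_cancel]
  have hwz : side a b (w m) = 0 := by
    have h3 := side_lineMap a b (w m) e (θ m)
    rw [← hm] at h3
    have h4 : θ m * side a b e = side a b m := div_mul_cancel₀ _ hs.ne'
    rw [h4] at h3
    have : (1 - θ m) * side a b (w m) = 0 := by linarith
    exact (mul_eq_zero.1 this).resolve_left h1θ
  have hwS : w m ∈ convexHull ℝ S := by
    rw [eq_lineMap_of_side hab hwz]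
    refine (convex_convexHull ℝ S).segment_subset (subset_convexHull ℝ S ha) (subset_convexHull ℝ S hb) ?_
    rw [segment_eq_image_lineMap]
    exact ⟨_, ⟨h1.1.le, h1.2.le⟩, rfl⟩
  rw [hm]
  refine (convex_convexHull ℝ S).segment_subset hwS (subset_convexHull ℝ S he) ?_
  rw [segment_eq_image_lineMap]
  exact ⟨_, ⟨hθp.le, h2.le⟩, rfl⟩

/-- Mirror images in a line. -/
lemma exists_side_pos {a b : Plane} (hab : a ≠ b) (p : Plane) {δ : ℝ} (hδ : 0 < δ) (hp : side a b p = 0) :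
    ∃ z₁ z₂ : Plane, dist z₁ p < δ ∧ dist z₂ p < δ ∧ 0 < side a b z₁ ∧ side a b z₂ < 0 ∧
      (∀ s : ℝ, dist z₁ (AffineMap.lineMap a b s) = dist z₂ (AffineMap.lineMap a b s)) ∧
      p ∈ segment ℝ z₁ z₂ := by
  have hd : 0 < ‖b - a‖ := by rw [norm_pos_iff, sub_ne_zero]; exact hab.symm
  have hr : 0 < ‖rot (b - a)‖ := by rwa [norm_rot]
  set η := δ / (2 * ‖rot (b - a)‖) with hη
  have hη0 : 0 < η := by positivity
  have hηd : η * ‖rot (b - a)‖ < δ := by rw [hη]; field_simp; linarith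
  have hdd : 0 < ‖b - a‖ ^ 2 := by positivity
  have hs : ∀ k : ℝ, side a b (p + k • rot (b - a)) = k * ‖b - a‖ ^ 2 := by
    intro k
    rw [norm_sq_plane]
    rw [side] at hp ⊢
    simp only [PiLp.add_apply, PiLp.smul_apply, PiLp.sub_apply, smul_eq_mul, rot_apply_zero,
      rot_apply_one]
    linear_combination hp
  refine ⟨p + η • rot (b - a), p + (-η) • rot (b - a), ?_, ?_, ?_, ?_, fun s => ?_,
    1 / 2, 1 / 2, by norm_num, by norm_num, by norm_num, by module⟩
  · rw [dist_eq_norm, add_sub_cancel_left, norm_smul, Real.norm_of_nonneg hη0.le]; exact hηd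
  · rw [dist_eq_norm, add_sub_cancel_left, norm_smul, norm_neg, Real.norm_of_nonneg hη0.le]; exact hηd
  · rw [hs]; positivity
  · rw [hs]; nlinarith
  · obtain ⟨σ, hσ⟩ : ∃ σ, p = AffineMap.lineMap a b σ := ⟨_, eq_lineMap_of_side hab hp⟩
    rw [hσ, ← sq_eq_sq₀ dist_nonneg dist_nonneg, dist_eq_norm, dist_eq_norm,
      norm_sq_plane, norm_sq_plane]
    simp only [AffineMap.lineMap_apply_module, PiLp.add_apply, PiLp.smul_apply, PiLp.sub_apply,
      smul_eq_mul, rot_apply_zero, rot_apply_one]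
    ring

/-- A point on a given side of a line is determined by its distances to two points of the line. -/
lemma eq_of_dist_eq_of_side {a b z w : Plane} (hab : a ≠ b) {s t : ℝ} (hst : s ≠ t)
    (hs : dist z (AffineMap.lineMap a b s) = dist w (AffineMap.lineMap a b s))
    (ht : dist z (AffineMap.lineMap a b t) = dist w (AffineMap.lineMap a b t))
    (hz : 0 < side a b z) (hw : 0 < side a b w) : z = w := by
  have hd : 0 < ‖b - a‖ ^ 2 := by
    have : 0 < ‖b - a‖ := by rw [norm_pos_iff, sub_ne_zero]; exact hab.symm
    positivity
  rw [← sq_eq_sq₀ dist_nonneg dist_nonneg, dist_eq_norm, dist_eq_norm, norm_sq_plane, norm_sq_plane]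
    at hs ht
  rw [norm_sq_plane] at hd
  simp only [AffineMap.lineMap_apply_module, PiLp.add_apply, PiLp.smul_apply, PiLp.sub_apply,
    smul_eq_mul] at hs ht hd
  have h1 : (b 0 - a 0) * (z 0 - w 0) + (b 1 - a 1) * (z 1 - w 1) = 0 := by
    have : (s - t) * ((b 0 - a 0) * (z 0 - w 0) + (b 1 - a 1) * (z 1 - w 1)) = 0 := by
      linear_combination (ht - hs) / 2
    exact (mul_eq_zero.1 this).resolve_left (sub_ne_zero.2 hst)
  have h2 : side a b z ^ 2 = side a b w ^ 2 := by
    simp only [side]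
    linear_combination ((b 0 - a 0) ^ 2 + (b 1 - a 1) ^ 2) * hs -
      ((b 0 - a 0) * (z 0 + w 0 - 2 * a 0) + (b 1 - a 1) * (z 1 + w 1 - 2 * a 1) -
        2 * s * ((b 0 - a 0) ^ 2 + (b 1 - a 1) ^ 2)) * h1
  have h3 : side a b z = side a b w := (sq_eq_sq₀ hz.le hw.le).1 h2
  simp only [side] at h3
  have h4 : z 0 = w 0 := by
    have : ((b 0 - a 0) ^ 2 + (b 1 - a 1) ^ 2) * (z 0 - w 0) = 0 := by
      linear_combination (b 0 - a 0) * h1 - (b 1 - a 1) * h3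
    linarith [(mul_eq_zero.1 this).resolve_left hd.ne']
  have h5 : z 1 = w 1 := by
    have : ((b 0 - a 0) ^ 2 + (b 1 - a 1) ^ 2) * (z 1 - w 1) = 0 := by
      linear_combination (b 1 - a 1) * h1 + (b 0 - a 0) * h3
    linarith [(mul_eq_zero.1 this).resolve_left hd.ne']
  ext i
  fin_cases i
  · exact h4
  · exact h5

end Dom

namespace Dom

variable {U V : Dom} {q : Plane}

lemma F_mem_hull (f : U.Bd ≃ᵢ V.Bd) (hq : q ∈ U.core) :
    U.F f q ∈ convexHull ℝ (frontier V.carrier) := by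
  obtain ⟨C⟩ := exists_cell hq
  rw [F_eq f C hq, Cell.img]
  exact (convex_convexHull ℝ _).sum_mem (fun x hx => (C.wt_pos x hx).le) C.wt_sum
    fun x _ => subset_convexHull ℝ _ (f x).pos_mem_frontier

/-- The local shape of the cell decomposition. -/
lemma core_cases (f : U.Bd ≃ᵢ V.Bd) (hq : q ∈ U.core) :
    (U.F f q ∈ V.core ∧ V.F f.symm (U.F f q) = q) ∨
      ∃ (x y : U.Bd) (t : ℝ), t ∈ Ioo (0:ℝ) 1 ∧ Chord U x y ∧ Chord V (f x) (f y) ∧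
        dist (f x).pos (f y).pos = dist x.pos y.pos ∧ q = AffineMap.lineMap x.pos y.pos t ∧
        U.F f q = AffineMap.lineMap (f x).pos (f y).pos t := by
  classical
  obtain ⟨C⟩ := exists_cell hq
  have hcard : C.verts.card ≤ 3 := by
    have h1 := C.indep.card_le_finrank_succ
    have h2 := (vectorSpan ℝ (range fun x : C.verts => x.1.pos)).finrank_le
    rw [finrank_euclideanSpace_fin] at h2
    rw [Fintype.card_coe] at h1
    omega
  have hpos := C.verts_nonempty.card_pos
  have hF := F_eq f C hq
  rw [Cell.img] at hF
  have hsum := C.sum_eq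
  have hwt := C.wt_sum
  rcases (by omega : C.verts.card = 1 ∨ C.verts.card = 2 ∨ C.verts.card = 3) with h | h | h
  · obtain ⟨x, hx⟩ := Finset.card_eq_one.1 h
    rw [hx, Finset.sum_singleton] at hsum hwt
    rw [hwt, one_smul] at hsum
    exact (x.pos_not_mem (hsum ▸ core_subset hq)).elim
  · obtain ⟨x, y, hxy, hv⟩ := Finset.card_eq_two.1 h
    have hx : x ∈ C.verts := by simp [hv]
    have hy : y ∈ C.verts := by simp [hv]
    have hx0 := C.wt_pos x hx
    have hy0 := C.wt_pos y hy
    rw [hv, Finset.sum_pair hxy] at hsum hwt hF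
    have hx1 : C.wt x = 1 - C.wt y := by linarith
    refine Or.inr ⟨x, y, C.wt y, ⟨hy0, by linarith⟩, (C.touch x hx).chord (C.touch y hy) hxy,
      Touch.chord_map f (C.touch x hx) (C.touch y hy) hxy, ?_, ?_, ?_⟩
    · have h1 := (C.touch x hx).chord (C.touch y hy) hxy
      have h2 := Touch.chord_map f (C.touch x hx) (C.touch y hy) hxy
      rw [← h1.dist_eq, ← h2.dist_eq, f.isometry.dist_eq]
    · rw [AffineMap.lineMap_apply_module, ← hx1, hsum]
    · rw [AffineMap.lineMap_apply_module, ← hx1, hF]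
  · left
    let e : C.verts ≃ Fin 3 := C.verts.equivFinOfCardEq h
    have htri : Tri f.symm C.center (U.rad C.center) (fun i => f (e.symm i).1) :=
      ⟨fun i => by simpa using C.touch _ (e.symm i).2, by
        simpa [Function.comp_def] using C.indep.comp_embedding e.symm.toEmbedding⟩
    have hs : ∀ {M : Type} [AddCommMonoid M] (g : U.Bd → M),
        ∑ x ∈ C.verts, g x = ∑ i, g (e.symm i).1 := fun g => by
      rw [← Finset.sum_coe_sort, ← Equiv.sum_comp e.symm]
    rw [hs] at hsum hwt hF
    have hw : ∀ i, 0 < C.wt (e.symm i).1 := fun i => C.wt_pos _ (e.symm i).2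
    have h1 := htri.comb_mem_core hw hwt
    have h2 := htri.F_comb hw hwt
    simp only [comb, IsometryEquiv.symm_apply_apply] at h1 h2
    rw [← hF] at h1 h2
    exact ⟨h1, h2.trans hsum⟩

lemma F_mem (f : U.Bd ≃ᵢ V.Bd) (hq : q ∈ U.core) : U.F f q ∈ V := by
  rcases core_cases f hq with h | ⟨x, y, t, ht, -, h, -, -, h2⟩
  · exact core_subset h.1
  · rw [h2]
    refine h.mem _ ?_
    rw [openSegment_eq_image_lineMap]
    exact ⟨t, ht, rfl⟩

lemma F_symm_F_of_mem (f : U.Bd ≃ᵢ V.Bd) (hq : q ∈ U.core) (h : U.F f q ∈ V.core) :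
    V.F f.symm (U.F f q) = q := by
  rcases core_cases f hq with h | ⟨x, y, t, ht, -, hc, hd, h1, h2⟩
  · exact h.2
  · have h3 := hc.tendsto_F f.symm (by simpa using hd.symm) ht
    simp only [IsometryEquiv.symm_apply_apply] at h3
    rw [← h1, ← h2] at h3
    have h4 := continuousOn_F f.symm _ h
    have : (𝓝[V.core] U.F f q).NeBot := mem_closure_iff_nhdsWithin_neBot.1 (subset_closure h)
    exact tendsto_nhds_unique h4 h3

lemma Chord.lineMap_mem {x y : U.Bd} (h : Chord U x y) {t : ℝ} (ht : t ∈ Ioo (0:ℝ) 1) :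
    AffineMap.lineMap x.pos y.pos t ∈ U := by
  refine h.mem _ ?_
  rw [openSegment_eq_image_lineMap]
  exact ⟨t, ht, rfl⟩

lemma Chord.left_ext {x y x' y' : U.Bd} (h : Chord U x y) (h' : Chord U x' y') (hx : x.pos = x'.pos)
    (hy : y.pos = y'.pos) : x = x' := by
  refine Bd.ext_of_dp fun ε hε => ?_
  have hc : Continuous fun t : ℝ => dist (AffineMap.lineMap x.pos y.pos t) x.pos :=
    (AffineMap.lineMap_continuous).dist continuous_const
  have h1 : ∀ᶠ t in 𝓝[>] (0:ℝ), dist (AffineMap.lineMap x.pos y.pos t) x.pos < ε :=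
    nhdsWithin_le_nhds ((hc.tendsto 0).eventually_lt_const (by simpa using hε))
  obtain ⟨t, ht, ht'⟩ := (h1.and (Ioo_mem_nhdsGT zero_lt_one)).exists
  have hmem : AffineMap.lineMap x.pos y.pos t ∈ openSegment ℝ x.pos y.pos := by
    rw [openSegment_eq_image_lineMap]; exact ⟨t, ht', rfl⟩
  refine ⟨_, (h.dp_left _ hmem).trans_lt ht, ?_⟩
  rw [h'.dp_left _ (by rw [← hx, ← hy]; exact hmem), ← hx]
  exact ht

/-- Two collinear chords with a common point coincide. -/
lemma Chord.eq_or_eq {a b a' b' : U.Bd} (h : Chord U a b) (h' : Chord U a' b') {β₁ β₂ t τ : ℝ}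
    (h₁ : a'.pos = AffineMap.lineMap a.pos b.pos β₁) (h₂ : b'.pos = AffineMap.lineMap a.pos b.pos β₂)
    (hτ : τ ∈ Ioo (0:ℝ) 1) (ht : t ∈ Ioo (0:ℝ) 1)
    (hz : (AffineMap.lineMap a.pos b.pos τ : Plane) = AffineMap.lineMap a'.pos b'.pos t) :
    (a = a' ∧ b = b') ∨ (a = b' ∧ b = a') := by
  have hn₁ : β₁ ∉ Ioo (0:ℝ) 1 := fun hm => a'.pos_not_mem (h₁ ▸ h.lineMap_mem hm)
  have hn₂ : β₂ ∉ Ioo (0:ℝ) 1 := fun hm => b'.pos_not_mem (h₂ ▸ h.lineMap_mem hm)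
  have hcomp : ∀ s : ℝ, (AffineMap.lineMap a'.pos b'.pos s : Plane) =
      AffineMap.lineMap a.pos b.pos ((1 - s) * β₁ + s * β₂) := by
    intro s
    rw [h₁, h₂]
    simp only [AffineMap.lineMap_apply_module]
    module
  have hinj := AffineMap.lineMap_injective ℝ h.ne
  have hτe : τ = (1 - t) * β₁ + t * β₂ := hinj (hz.trans (hcomp t))
  have hsol : ∀ s : ℝ, s ∈ Ioo (0:ℝ) 1 → (1 - s) * β₁ + s * β₂ ≠ 0 ∧ (1 - s) * β₁ + s * β₂ ≠ 1 := by
    intro s hs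
    have := h'.lineMap_mem hs
    rw [hcomp] at this
    refine ⟨fun h0 => a.pos_not_mem ?_, fun h0 => b.pos_not_mem ?_⟩
    · simpa [h0] using this
    · simpa [h0] using this
  have hno : ∀ v : ℝ, v = 0 ∨ v = 1 → ¬ (β₁ < v ∧ v < β₂) ∧ ¬ (β₂ < v ∧ v < β₁) := by
    intro v hv
    have key : β₁ ≠ β₂ → (1 - (v - β₁) / (β₂ - β₁)) * β₁ + (v - β₁) / (β₂ - β₁) * β₂ = v := by
      intro hne
      have : β₂ - β₁ ≠ 0 := sub_ne_zero.2 hne.symm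
      field_simp
      ring
    refine ⟨fun hlt => ?_, fun hlt => ?_⟩
    · have := hsol ((v - β₁) / (β₂ - β₁)) ⟨div_pos (by linarith) (by linarith),
        (div_lt_one (by linarith)).2 (by linarith)⟩
      rw [key (by linarith)] at this
      rcases hv with rfl | rfl
      · exact this.1 rfl
      · exact this.2 rfl
    · have := hsol ((v - β₁) / (β₂ - β₁)) ⟨div_pos_of_neg_of_neg (by linarith) (by linarith),
        (div_lt_one_of_neg (by linarith)).2 (by linarith)⟩
      rw [key (by linarith)] at this
      rcases hv with rfl | rfl
      · exact this.1 rfl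
      · exact this.2 rfl
  have n0 := hno 0 (Or.inl rfl)
  have n1 := hno 1 (Or.inr rfl)
  have hcase : (β₁ = 0 ∧ β₂ = 1) ∨ (β₁ = 1 ∧ β₂ = 0) := by
    have ht0 := ht.1
    have ht1 := ht.2
    have hτ0 := hτ.1
    have hτ1 := hτ.2
    have c1 : β₁ ≤ 0 ∨ 1 ≤ β₁ := by
      by_contra! hc; exact hn₁ hc
    have c2 : β₂ ≤ 0 ∨ 1 ≤ β₂ := by
      by_contra! hc; exact hn₂ hc
    rcases c1 with c1 | c1 <;> rcases c2 with c2 | c2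
    · exfalso; nlinarith
    · left
      refine ⟨le_antisymm c1 ?_, le_antisymm ?_ c2⟩
      · by_contra! hc; exact n0.1 ⟨hc, by linarith⟩
      · by_contra! hc; exact n1.1 ⟨by linarith, hc⟩
    · right
      refine ⟨le_antisymm ?_ c1, le_antisymm c2 ?_⟩
      · by_contra! hc; exact n1.2 ⟨by linarith, hc⟩
      · by_contra! hc; exact n0.2 ⟨hc, by linarith⟩
    · exfalso; nlinarith
  rcases hcase with ⟨r1, r2⟩ | ⟨r1, r2⟩
  · rw [r1, AffineMap.lineMap_apply_zero] at h₁
    rw [r2, AffineMap.lineMap_apply_one] at h₂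
    exact Or.inl ⟨h.left_ext h' h₁.symm h₂.symm, h.symm.left_ext h'.symm h₂.symm h₁.symm⟩
  · rw [r1, AffineMap.lineMap_apply_one] at h₁
    rw [r2, AffineMap.lineMap_apply_zero] at h₂
    exact Or.inr ⟨h.left_ext h'.symm h₂.symm h₁.symm, h.symm.left_ext h' h₁.symm h₂.symm⟩

end Dom

namespace Dom

variable {U V : Dom} {q : Plane}

lemma side_ne_zero_of_mem_interior {S : Set Plane} {a b z : Plane} (hab : a ≠ b)
    (hS : ∀ e ∈ S, 0 ≤ side a b e) (hz : z ∈ interior S) : side a b z ≠ 0 := by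
  intro h0
  obtain ⟨δ, hδ, hb⟩ := Metric.isOpen_iff.1 isOpen_interior z hz
  obtain ⟨-, z₂, -, h2, -, h4, -⟩ := exists_side_pos hab z hδ h0
  exact absurd (hS z₂ (interior_subset (hb h2))) (not_le.2 h4)

/-- A chord has the same position in both domains: points off the chord are not mapped to its line. -/
lemma side_F_pos (f : U.Bd ≃ᵢ V.Bd) {x y : U.Bd} (hc : Chord V (f x) (f y))
    (hnn : ∀ e ∈ frontier V.carrier, 0 ≤ side (f x).pos (f y).pos e) {z : Plane} (hz : z ∈ U.core)
    (hside : side x.pos y.pos z ≠ 0)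
    (hσ : ⟪(f y).pos - (f x).pos, U.F f z - (f x).pos⟫ / ‖(f y).pos - (f x).pos‖ ^ 2 ∈ Ioo (0:ℝ) 1) :
    0 < side (f x).pos (f y).pos (U.F f z) := by
  have hull : ∀ e ∈ convexHull ℝ (frontier V.carrier), 0 ≤ side (f x).pos (f y).pos e := fun e he =>
    convexHull_min hnn (convex_side_nonneg _ _) he
  refine lt_of_le_of_ne (hull _ (F_mem_hull f hz)) fun h0 => ?_
  rcases core_cases f hz with h | ⟨x', y', t', ht', -, hc', -, hz1, hz2⟩
  · exact side_ne_zero_of_mem_interior hc.ne hull h.1.2 h0.symm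
  · have h1 := hnn _ (f x').pos_mem_frontier
    have h2 := hnn _ (f y').pos_mem_frontier
    have h3 := h0
    rw [hz2, side_lineMap] at h3
    have h4 := mul_nonneg (sub_pos.2 ht'.2).le h1
    have h5 := mul_nonneg ht'.1.le h2
    have e1 := (mul_eq_zero.1 (by linarith : (1 - t') * side (f x).pos (f y).pos (f x').pos = 0)).resolve_left
      (sub_pos.2 ht'.2).ne'
    have e2 := (mul_eq_zero.1 (by linarith : t' * side (f x).pos (f y).pos (f y').pos = 0)).resolve_left
      ht'.1.ne'
    rcases hc.eq_or_eq hc' (eq_lineMap_of_side hc.ne e1) (eq_lineMap_of_side hc.ne e2) hσ ht'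
      ((eq_lineMap_of_side hc.ne h0.symm).symm.trans hz2) with ⟨r1, r2⟩ | ⟨r1, r2⟩
    · rw [← f.injective r1, ← f.injective r2] at hz1
      exact hside (by rw [hz1, side_line])
    · rw [← f.injective r1, ← f.injective r2] at hz1
      exact hside (by rw [hz1, side_swap, side_line, neg_zero])

lemma Chord.F_lineMap (f : U.Bd ≃ᵢ V.Bd) {x y : U.Bd} (h : Chord U x y)
    (hd : dist (f x).pos (f y).pos = dist x.pos y.pos) {t : ℝ} (ht : t ∈ Ioo (0:ℝ) 1)
    (hm : AffineMap.lineMap x.pos y.pos t ∈ U.core) :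
    U.F f (AffineMap.lineMap x.pos y.pos t) = AffineMap.lineMap (f x).pos (f y).pos t := by
  have : (𝓝[U.core] (AffineMap.lineMap x.pos y.pos t : Plane)).NeBot :=
    mem_closure_iff_nhdsWithin_neBot.1 (subset_closure hm)
  exact tendsto_nhds_unique (continuousOn_F f _ hm) (h.tendsto_F f hd ht)

lemma mem_core_of_side_nonneg (f : U.Bd ≃ᵢ V.Bd) (hq : q ∈ U.core) {x y : U.Bd} {t : ℝ}
    (ht : t ∈ Ioo (0:ℝ) 1) (hc : Chord U x y) (hc' : Chord V (f x) (f y))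
    (hd : dist (f x).pos (f y).pos = dist x.pos y.pos) (hqe : q = AffineMap.lineMap x.pos y.pos t)
    (hnn : ∀ e ∈ frontier V.carrier, 0 ≤ side (f x).pos (f y).pos e) : False := by
  set a := (f x).pos with ha
  set b := (f y).pos with hb
  set p : Plane := AffineMap.lineMap a b t with hp
  have hFq : U.F f q = p := by
    rw [hqe] at hq ⊢; exact hc.F_lineMap f hd ht hq
  have hFc : Tendsto (U.F f) (𝓝 q) (𝓝 p) := by
    rw [← hFq]; exact (continuousOn_F f).continuousAt (isOpen_core.mem_nhds hq)
  have hpV : p ∈ V := hc'.lineMap_mem ht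
  have hd0 : ‖b - a‖ ^ 2 ≠ 0 := by
    rw [Ne, sq_eq_zero_iff, norm_eq_zero, sub_eq_zero]; exact hc'.ne.symm
  have hσp : ∀ᶠ m in 𝓝 p, ⟪b - a, m - a⟫ / ‖b - a‖ ^ 2 ∈ Ioo (0:ℝ) 1 := by
    have : Continuous fun m : Plane => ⟪b - a, m - a⟫ / ‖b - a‖ ^ 2 := by fun_prop
    refine this.continuousAt.eventually_mem ?_
    have h1 : ⟪b - a, p - a⟫ / ‖b - a‖ ^ 2 = t := by
      rw [hp, AffineMap.lineMap_apply, vsub_eq_sub, vadd_eq_add, add_sub_cancel_right, inner_smul_right,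
        real_inner_self_eq_norm_sq, mul_div_cancel_right₀ _ hd0]
    rw [h1]; exact Ioo_mem_nhds ht.1 ht.2
  have hsidepos : ∀ᶠ z in 𝓝 q, z ∈ U.core ∧ (side x.pos y.pos z ≠ 0 → 0 < side a b (U.F f z)) := by
    filter_upwards [isOpen_core.mem_nhds hq, hFc.eventually hσp] with z h1 h2
    exact ⟨h1, fun h3 => side_F_pos f hc' hnn h1 h3 h2⟩
  have hqside : side x.pos y.pos q = 0 := by rw [hqe, side_line]
  obtain ⟨e, he, hepos⟩ : ∃ e ∈ frontier V.carrier, 0 < side a b e := by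
    obtain ⟨δ, hδ, hball⟩ := Metric.eventually_nhds_iff.1 hsidepos
    obtain ⟨z₁, -, h1, -, h3, -⟩ := exists_side_pos hc.ne q hδ hqside
    obtain ⟨h5, h6⟩ := hball h1
    have h7 := h6 h3.ne'
    by_contra! hcon
    have h8 : ∀ e ∈ convexHull ℝ (frontier V.carrier), 0 ≤ side b a e := fun e he =>
      convexHull_min (fun e he => by
        change 0 ≤ side b a e
        rw [side_swap]; linarith [hcon e he]) (convex_side_nonneg _ _) he
    have := h8 _ (F_mem_hull f h5)
    rw [side_swap] at this
    linarith
  have hhalf := eventually_mem_interior_hull_of_side hc'.ne (f x).pos_mem_frontier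
    (f y).pos_mem_frontier he hepos ht
  obtain ⟨ε, hε, hballp⟩ := Metric.eventually_nhds_iff_ball.1 (hhalf.and (V.isOpen.mem_nhds hpV))
  obtain ⟨δ, hδ, hballq⟩ := Metric.eventually_nhds_iff_ball.1
    (hsidepos.and (hFc.eventually (ball_mem_nhds p hε)))
  -- distances to the chord are preserved
  have key : ∀ s ∈ Ioo (0:ℝ) 1, (AffineMap.lineMap x.pos y.pos s : Plane) ∈ ball q δ →
      ∀ z ∈ ball q δ, side x.pos y.pos z ≠ 0 →
      V.F f.symm (U.F f z) = z ∧
      dist (U.F f z) (AffineMap.lineMap a b s) = dist z (AffineMap.lineMap x.pos y.pos s) := by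
    intro s hs hsq z hz hzs
    have hzpos := (hballq z hz).1.2 hzs
    have hFz := (hballq z hz).2
    have hFs : U.F f (AffineMap.lineMap x.pos y.pos s) = AffineMap.lineMap a b s :=
      hc.F_lineMap f hd hs (hballq _ hsq).1.1
    have hs' := (hballq _ hsq).2
    rw [hFs] at hs'
    have hcore : ∀ m ∈ ball p ε, 0 < side a b m → m ∈ V.core := fun m h1 h2 =>
      ⟨(hballp m h1).2, (hballp m h1).1 h2⟩
    have hGF := F_symm_F_of_mem f (hballq z hz).1.1 (hcore _ hFz hzpos)
    refine ⟨hGF, le_antisymm ?_ ?_⟩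
    · rw [← hFs]
      exact F_contract f fun w hw => (hballq w ((convex_ball q δ).segment_subset hz hsq hw)).1.1
    set m : ℝ → Plane := fun τ => AffineMap.lineMap (AffineMap.lineMap a b s : Plane) (U.F f z) τ with hm
    have hmc : Continuous m := AffineMap.lineMap_continuous
    have hm0 : m 0 = AffineMap.lineMap a b s := by simp [hm]
    have hmball : ∀ τ ∈ Icc (0:ℝ) 1, m τ ∈ ball p ε := fun τ hτ =>
      (convex_ball p ε).segment_subset hs' hFz (by
        rw [segment_eq_image_lineMap]; exact ⟨τ, hτ, rfl⟩)
    have hmpos : ∀ τ ∈ Ioc (0:ℝ) 1, 0 < side a b (m τ) := fun τ hτ => by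
      simp only [hm]
      rw [side_lineMap, side_line, mul_zero, zero_add]
      exact mul_pos hτ.1 hzpos
    have hmcore : ∀ τ ∈ Ioc (0:ℝ) 1, m τ ∈ V.core := fun τ hτ =>
      hcore _ (hmball τ ⟨hτ.1.le, hτ.2⟩) (hmpos τ hτ)
    have h1 : ∀ τ ∈ Ioc (0:ℝ) 1, dist z (V.F f.symm (m τ)) ≤ dist (U.F f z) (m τ) := by
      intro τ hτ
      have h2 := F_contract f.symm (a := U.F f z) (b := m τ) (fun w hw => hcore w
        ((convex_ball p ε).segment_subset hFz (hmball τ ⟨hτ.1.le, hτ.2⟩) hw)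
        ((convex_side_pos a b).segment_subset hzpos (hmpos τ hτ) hw))
      rwa [hGF] at h2
    have h3 := hc'.tendsto_F f.symm (by simpa using hd.symm) hs
    simp only [IsometryEquiv.symm_apply_apply] at h3
    have h4 : Tendsto m (𝓝[>] 0) (𝓝[V.core] (AffineMap.lineMap a b s : Plane)) := by
      rw [tendsto_nhdsWithin_iff]
      refine ⟨?_, ?_⟩
      · rw [← hm0]; exact (hmc.tendsto 0).mono_left nhdsWithin_le_nhds
      · filter_upwards [Ioc_mem_nhdsGT zero_lt_one] with τ hτ using hmcore τ hτ
    refine le_of_tendsto_of_tendsto (Filter.Tendsto.dist tendsto_const_nhds (h3.comp h4))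
      (Filter.Tendsto.dist tendsto_const_nhds (h4.mono_right nhdsWithin_le_nhds)) ?_
    filter_upwards [Ioc_mem_nhdsGT zero_lt_one] with τ hτ using h1 τ hτ
  obtain ⟨z₁, z₂, h1, h2, h3, h4, h5, -⟩ := exists_side_pos hc.ne q hδ hqside
  obtain ⟨s, hsq, hs1, hst⟩ : ∃ s, (AffineMap.lineMap x.pos y.pos s : Plane) ∈ ball q δ ∧
      s ∈ Ioo (0:ℝ) 1 ∧ s ≠ t := by
    have hcont : Continuous fun s : ℝ => (AffineMap.lineMap x.pos y.pos s : Plane) :=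
      AffineMap.lineMap_continuous
    have e1 : ∀ᶠ s in 𝓝[>] t, (AffineMap.lineMap x.pos y.pos s : Plane) ∈ ball q δ :=
      nhdsWithin_le_nhds (hcont.continuousAt.eventually_mem (by rw [← hqe]; exact ball_mem_nhds q hδ))
    obtain ⟨s, hs1, hs2⟩ := (e1.and (Ioo_mem_nhdsGT ht.2)).exists
    exact ⟨s, hs1, ⟨ht.1.trans hs2.1, hs2.2⟩, hs2.1.ne'⟩
  have htq : (AffineMap.lineMap x.pos y.pos t : Plane) ∈ ball q δ := by
    rw [← hqe]; exact mem_ball_self hδ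
  have a1 := key t ht htq z₁ h1 h3.ne'
  have a2 := key t ht htq z₂ h2 h4.ne
  have b1 := key s hs1 hsq z₁ h1 h3.ne'
  have b2 := key s hs1 hsq z₂ h2 h4.ne
  have heq : U.F f z₁ = U.F f z₂ := eq_of_dist_eq_of_side hc'.ne hst
    (by rw [b1.2, b2.2, h5]) (by rw [a1.2, a2.2, h5])
    ((hballq z₁ h1).1.2 h3.ne') ((hballq z₂ h2).1.2 h4.ne)
  have : z₁ = z₂ := by rw [← a1.1, heq, a2.1]
  rw [this] at h3
  linarith

theorem F_mem_core (f : U.Bd ≃ᵢ V.Bd) (hq : q ∈ U.core) : U.F f q ∈ V.core := by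
  rcases core_cases f hq with h | ⟨x, y, t, ht, hc, hc', hd, h1, h2⟩
  · exact h.1
  by_cases hneg : ∃ e ∈ frontier V.carrier, side (f x).pos (f y).pos e < 0
  swap
  · push Not at hneg
    exact (mem_core_of_side_nonneg f hq ht hc hc' hd h1 hneg).elim
  by_cases hpos : ∃ e ∈ frontier V.carrier, 0 < side (f x).pos (f y).pos e
  swap
  · push Not at hpos
    refine (mem_core_of_side_nonneg f hq (t := 1 - t) ⟨by linarith [ht.2], by linarith [ht.1]⟩ hc.symm
      hc'.symm (by rw [dist_comm, hd, dist_comm]) ?_ ?_).elim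
    · rw [h1, ← AffineMap.lineMap_apply_one_sub]
    · intro e he
      rw [side_swap]; linarith [hpos e he]
  obtain ⟨e, he, hes⟩ := hneg
  obtain ⟨e', he', hes'⟩ := hpos
  have hx := (f x).pos_mem_frontier
  have hy := (f y).pos_mem_frontier
  have ev1 := eventually_mem_interior_hull_of_side hc'.ne hx hy he' hes' ht
  have ev2 := eventually_mem_interior_hull_of_side hc'.ne.symm hy hx he
    (by rw [side_swap]; linarith) (t := 1 - t) ⟨by linarith [ht.2], by linarith [ht.1]⟩
  rw [AffineMap.lineMap_apply_one_sub] at ev2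
  refine ⟨F_mem f hq, ?_⟩
  rw [h2]
  obtain ⟨δ, hδ, hb⟩ := Metric.eventually_nhds_iff.1 (ev1.and ev2)
  obtain ⟨z₁, z₂, d1, d2, s1, s2, -, hseg⟩ := exists_side_pos hc'.ne
    (AffineMap.lineMap (f x).pos (f y).pos t) hδ (side_line _ _ _)
  have m1 := (hb d1).1 s1
  have m2 := (hb d2).2 (by rw [side_swap]; linarith)
  exact (convex_convexHull ℝ _).interior.segment_subset m1 m2 hseg

theorem F_symm_F (f : U.Bd ≃ᵢ V.Bd) (hq : q ∈ U.core) : V.F f.symm (U.F f q) = q :=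
  F_symm_F_of_mem f hq (F_mem_core f hq)

end Dom

/-- A distance preserving map on a ball is the restriction of an isometry of the plane. -/
lemma exists_isometry_of_dist {f : Plane → Plane} {q : Plane} {δ : ℝ} (hδ : 0 < δ)
    (h : ∀ a ∈ ball q δ, ∀ b ∈ ball q δ, dist (f a) (f b) = dist a b) :
    ∃ J : Plane ≃ᵢ Plane, ∀ a ∈ ball q δ, f a = J a := by
  set g : Plane → Plane := fun a => f (q + a) - f q with hg
  have hmem : ∀ a : Plane, ‖a‖ < δ → q + a ∈ ball q δ := fun a ha => by
    rw [mem_ball, dist_eq_norm, add_sub_cancel_left]; exact ha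
  have hq : q ∈ ball q δ := mem_ball_self hδ
  have hnorm : ∀ a : Plane, ‖a‖ < δ → ‖g a‖ = ‖a‖ := fun a ha => by
    rw [hg, ← dist_eq_norm, h _ (hmem a ha) _ hq, dist_eq_norm, add_sub_cancel_left]
  have hsub : ∀ a b : Plane, ‖a‖ < δ → ‖b‖ < δ → ‖g a - g b‖ = ‖a - b‖ := fun a b ha hb => by
    rw [hg, sub_sub_sub_cancel_right, ← dist_eq_norm, h _ (hmem a ha) _ (hmem b hb), dist_eq_norm,
      add_sub_add_left_eq_sub]
  have hinner : ∀ a b : Plane, ‖a‖ < δ → ‖b‖ < δ → ⟪g a, g b⟫ = ⟪a, b⟫ := fun a b ha hb => by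
    have h1 := norm_sub_sq_real (g a) (g b)
    have h2 := norm_sub_sq_real a b
    rw [hsub a b ha hb, hnorm a ha, hnorm b hb] at h1
    linarith
  have hδ2 : (0:ℝ) < δ / 2 := by positivity
  let e := EuclideanSpace.basisFun (Fin 2) ℝ
  have hsm : ∀ i, ‖(δ / 2) • e i‖ < δ := fun i => by
    rw [norm_smul, e.norm_eq_one, Real.norm_of_nonneg hδ2.le]; linarith
  set v : Fin 2 → Plane := fun i => (δ / 2)⁻¹ • g ((δ / 2) • e i) with hv
  have hvi : ∀ i a, ‖a‖ < δ → ⟪v i, g a⟫ = ⟪e i, a⟫ := fun i a ha => by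
    rw [hv, real_inner_smul_left, hinner _ _ (hsm i) ha, real_inner_smul_left,
      inv_mul_cancel_left₀ hδ2.ne']
  have hvo : Orthonormal ℝ v := by
    rw [orthonormal_iff_ite]
    intro i j
    have : ⟪v i, v j⟫ = ⟪e i, e j⟫ := by
      have h1 : ⟪v i, v j⟫ = (δ / 2)⁻¹ * ⟪v i, g ((δ / 2) • e j)⟫ := real_inner_smul_right _ _ _
      rw [h1, hvi i _ (hsm j), real_inner_smul_right, inv_mul_cancel_left₀ hδ2.ne']
    rw [this]
    exact orthonormal_iff_ite.1 e.orthonormal i j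
  obtain ⟨b, hb⟩ := Orthonormal.exists_orthonormalBasis_extension_of_card_eq (𝕜 := ℝ) (E := Plane)
    (ι := Fin 2) (by simp) (v := v) (s := univ) (hvo.comp _ Subtype.val_injective)
  let L : Plane ≃ₗᵢ[ℝ] Plane := e.equiv b (Equiv.refl _)
  have hL : ∀ a, ‖a‖ < δ → g a = L a := by
    intro a ha
    refine b.repr.injective (PiLp.ext fun i => ?_)
    have h1 : b i = L (e i) := by simp [L]
    rw [b.repr_apply_apply, b.repr_apply_apply]
    conv_rhs => rw [h1, L.inner_map_map]
    rw [hb i (mem_univ i), hvi i a ha]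
  refine ⟨((IsometryEquiv.subRight q).trans L.toIsometryEquiv).trans (IsometryEquiv.addLeft (f q)),
    fun a ha => ?_⟩
  have := hL (a - q) (by rwa [← dist_eq_norm])
  rw [hg] at this
  simp only [add_sub_cancel] at this
  simp only [IsometryEquiv.trans_apply, IsometryEquiv.subRight_apply, IsometryEquiv.addLeft_apply,
    LinearIsometryEquiv.coe_toIsometryEquiv]
  rw [← this]; abel

/-- Plane isometries agreeing on a nonempty open set are equal. -/
lemma isometry_eq_of_eventuallyEq {J K : Plane ≃ᵢ Plane} {S : Set Plane} (hS : IsOpen S)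
    (hne : S.Nonempty) (h : ∀ p ∈ S, J p = K p) : J = K := by
  obtain ⟨q, hq⟩ := hne
  have h1 : J.toRealAffineIsometryEquiv.toAffineMap = K.toRealAffineIsometryEquiv.toAffineMap := by
    have hspan : affineSpan ℝ S = ⊤ := hS.affineSpan_eq_top ⟨q, hq⟩
    refine AffineMap.ext_on hspan ?_
    intro p hp
    exact h p hp
  ext1 p
  exact congrArg (fun g : Plane →ᵃ[ℝ] Plane => g p) h1

namespace Dom

variable {U V : Dom} {q : Plane}

theorem F_locally_isometric (f : U.Bd ≃ᵢ V.Bd) (hq : q ∈ U.core) :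
    ∃ J : Plane ≃ᵢ Plane, ∀ᶠ p in 𝓝 q, U.F f p = J p := by
  obtain ⟨ε, hε, hVε⟩ := Metric.isOpen_iff.1 isOpen_core _ (F_mem_core f hq)
  have hFc : ContinuousAt (U.F f) q := (continuousOn_F f).continuousAt (isOpen_core.mem_nhds hq)
  obtain ⟨δ, hδ, hb⟩ := Metric.eventually_nhds_iff_ball.1
    ((show ∀ᶠ p in 𝓝 q, p ∈ U.core from isOpen_core.mem_nhds hq).and (hFc.eventually (ball_mem_nhds _ hε)))
  obtain ⟨J, hJ⟩ := exists_isometry_of_dist (f := U.F f) (q := q) hδ fun a ha b hb' => by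
    refine le_antisymm (F_contract f fun z hz => (hb z ((convex_ball q δ).segment_subset ha hb' hz)).1) ?_
    have h := F_contract f.symm (a := U.F f a) (b := U.F f b) fun z hz =>
      hVε ((convex_ball _ ε).segment_subset (hb a ha).2 (hb b hb').2 hz)
    rwa [F_symm_F f (hb a ha).1, F_symm_F f (hb b hb').1] at h
  exact ⟨J, Metric.eventually_nhds_iff_ball.2 ⟨δ, hδ, hJ⟩⟩

lemma eq_of_eventually_eq {g : Plane → Plane} {J K : Plane ≃ᵢ Plane} {q : Plane}
    (h1 : ∀ᶠ p in 𝓝 q, g p = J p) (h2 : ∀ᶠ p in 𝓝 q, g p = K p) : J = K := by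
  obtain ⟨δ, hδ, hb⟩ := Metric.eventually_nhds_iff_ball.1 (h1.and h2)
  exact isometry_eq_of_eventuallyEq isOpen_ball ⟨q, mem_ball_self hδ⟩
    fun p hp => (hb p hp).1.symm.trans (hb p hp).2

/-- On a connected part of the core, the map `F` is the restriction of a single isometry. -/
theorem F_eq_isometry_of_preconnected (f : U.Bd ≃ᵢ V.Bd) {S : Set Plane} (hS : IsPreconnected S)
    (hSc : S ⊆ U.core) {J : Plane ≃ᵢ Plane} (hq : q ∈ S) (hJ : ∀ᶠ p in 𝓝 q, U.F f p = J p) :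
    ∀ p ∈ S, U.F f p = J p := by
  have hO : IsOpen {p | ∀ᶠ z in 𝓝 p, U.F f z = J z} := by
    rw [isOpen_iff_eventually]
    intro p hp
    exact eventually_eventually_nhds.2 hp
  have hsub : S ⊆ {p | ∀ᶠ z in 𝓝 p, U.F f z = J z} := by
    refine hS.subset_of_closure_inter_subset hO ⟨q, hq, hJ⟩ ?_
    rintro p ⟨hp, hpS⟩
    obtain ⟨K, hK⟩ := F_locally_isometric f (hSc hpS)
    have hK' := eventually_eventually_nhds.2 hK
    obtain ⟨z, hz, hzJ⟩ := (mem_closure_iff_frequently.1 hp).and_eventually hK' |>.exists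
    rw [eq_of_eventually_eq hz hzJ]
    exact hK
  exact fun p hp => (hsub hp).self_of_nhds

theorem exists_isometry_of_preconnected (f : U.Bd ≃ᵢ V.Bd) {S : Set Plane} (hS : IsPreconnected S)
    (hSc : S ⊆ U.core) : ∃ J : Plane ≃ᵢ Plane, ∀ p ∈ S, U.F f p = J p := by
  rcases S.eq_empty_or_nonempty with rfl | ⟨q, hq⟩
  · exact ⟨IsometryEquiv.refl _, by simp⟩
  obtain ⟨J, hJ⟩ := F_locally_isometric f (hSc hq)
  exact ⟨J, F_eq_isometry_of_preconnected f hS hSc hq hJ⟩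

/-- If core points converge in `U`, their images cannot converge to a point outside `V`. -/
lemma F_limit_mem (f : U.Bd ≃ᵢ V.Bd) {ι : Type*} {l : Filter ι} [l.NeBot] {u : ι → Plane} {x y : Plane}
    (hu : ∀ᶠ i in l, u i ∈ U.core) (hx : Tendsto u l (𝓝 x)) (hy : Tendsto (fun i => U.F f (u i)) l (𝓝 y))
    (hxU : x ∈ U) : y ∈ V := by
  by_contra hyV
  have hne : ∃ z, z ∉ V := ⟨y, hyV⟩
  have hrad : Tendsto (fun i => V.rad (U.F f (u i))) l (𝓝 0) := by
    refine squeeze_zero (fun i => rad_nonneg _) (fun i => rad_le_dist hyV) ?_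
    simpa using Filter.Tendsto.dist hy (tendsto_const_nhds (x := y))
  obtain ⟨r, hr, hb⟩ := Metric.isOpen_iff.1 U.isOpen x hxU
  have h1 := hrad.eventually (gt_mem_nhds (show (0:ℝ) < r / 6 by positivity))
  have h2 := hx.eventually (ball_mem_nhds x (show (0:ℝ) < r / 2 by positivity))
  obtain ⟨i, hi1, hi2, hi3⟩ := (h1.and (h2.and hu)).exists
  have hFi := F_mem_core f hi3
  obtain ⟨b, hb'⟩ := exists_nearest hne (core_subset hFi)
  have h3 := dist_F_le' f.symm hFi b
  rw [F_symm_F f hi3, hb'.dp_center] at h3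
  refine (f.symm b).pos_not_mem (hb ?_)
  have h4 := dist_triangle_left (f.symm b).pos x (u i)
  rw [mem_ball]
  linarith

lemma F_limit_mem_core (f : U.Bd ≃ᵢ V.Bd) {ι : Type*} {l : Filter ι} [l.NeBot] {u : ι → Plane}
    {x y : Plane} (hu : ∀ᶠ i in l, u i ∈ U.core) (hx : Tendsto u l (𝓝 x))
    (hy : Tendsto (fun i => U.F f (u i)) l (𝓝 y)) (hyV : y ∈ V.core) : x ∈ U.core := by
  have h1 : Tendsto (fun i => V.F f.symm (U.F f (u i))) l (𝓝 (V.F f.symm y)) :=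
    ((continuousOn_F f.symm).continuousAt (isOpen_core.mem_nhds hyV)).tendsto.comp hy
  have h2 : Tendsto u l (𝓝 (V.F f.symm y)) :=
    h1.congr' (hu.mono fun i hi => F_symm_F f hi)
  rw [tendsto_nhds_unique hx h2]
  exact F_mem_core f.symm hyV

lemma F_F_symm (f : U.Bd ≃ᵢ V.Bd) (hq : q ∈ V.core) : U.F f (V.F f.symm q) = q :=
  F_symm_F f.symm hq

lemma image_F_core (f : U.Bd ≃ᵢ V.Bd) : U.F f '' U.core = V.core := by
  refine Subset.antisymm (by rintro _ ⟨p, hp, rfl⟩; exact F_mem_core f hp) fun v hv => ?_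
  exact ⟨_, F_mem_core f.symm hv, F_F_symm f hv⟩

/-- A domain contained in the interior of the convex hull of its boundary is determined. -/
theorem exists_isometry_of_eq_core (f : U.Bd ≃ᵢ V.Bd) (hU : U.carrier = U.core) :
    ∃ J : Plane ≃ᵢ Plane, J '' U.carrier = V.carrier := by
  obtain ⟨J, hJ⟩ := exists_isometry_of_preconnected f U.isDom.2.isPreconnected hU.le
  have himg : J '' U.carrier = V.core := by
    rw [← image_F_core f, hU]
    refine image_congr fun p hp => (hJ p ?_).symm
    rw [hU]; exact hp
  refine ⟨J, himg.trans (Subset.antisymm core_subset ?_)⟩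
  obtain ⟨u, hu⟩ := U.isDom.2.nonempty
  refine V.isDom.2.isPreconnected.subset_of_closure_inter_subset isOpen_core
    ⟨J u, core_subset (himg ▸ mem_image_of_mem _ hu), himg ▸ mem_image_of_mem _ hu⟩ ?_
  rintro v ⟨hv, hvV⟩
  have : (𝓝[V.core] v).NeBot := mem_closure_iff_nhdsWithin_neBot.1 hv
  have hself : ∀ᶠ p in 𝓝[V.core] v, p ∈ V.core := eventually_mem_nhdsWithin
  have h1 : ∀ p ∈ V.core, V.F f.symm p = J.symm p := by
    intro p hp
    rw [← himg] at hp
    obtain ⟨w, hw, rfl⟩ := hp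
    rw [← hJ w hw, F_symm_F f (hU ▸ hw), hJ w hw, J.symm_apply_apply]
  have h2 : Tendsto (fun p => V.F f.symm p) (𝓝[V.core] v) (𝓝 (J.symm v)) :=
    ((J.symm.continuous.tendsto v).mono_left nhdsWithin_le_nhds).congr' (hself.mono fun p hp => (h1 p hp).symm)
  have h3 := F_limit_mem f.symm hself (tendsto_id.mono_left nhdsWithin_le_nhds) h2 hvV
  rw [← himg]
  exact ⟨_, h3, J.apply_symm_apply v⟩

end Dom

namespace Dom

variable {U V : Dom} {q : Plane}

/-- On segments of the core the intrinsic distance is not increased by `F`. -/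
lemma dist_pt_F_le (f : U.Bd ≃ᵢ V.Bd) {a b : Plane} (h : segment ℝ a b ⊆ U.core) :
    dist (V.pt (U.F f a)) (V.pt (U.F f b)) ≤ dist a b := by
  obtain ⟨J, hJ⟩ := exists_isometry_of_preconnected f (convex_segment a b).isPreconnected h
  have ha := hJ a (left_mem_segment ℝ a b)
  have hb := hJ b (right_mem_segment ℝ a b)
  rw [dist_pt_eq, ha, hb, J.dist_eq]
  have himg : segment ℝ (U.F f a) (U.F f b) = J '' segment ℝ a b := by
    rw [ha, hb]
    exact (image_segment ℝ J.toRealAffineIsometryEquiv.toAffineMap a b).symm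
  rw [himg]
  rintro _ ⟨p, hp, rfl⟩
  rw [← hJ p hp]
  exact core_subset (F_mem_core f (h hp))

lemma Tri.dp_le {f : U.Bd ≃ᵢ V.Bd} {c : Plane} {r : ℝ} {x : Fin 3 → U.Bd} (h : Tri f c r x)
    {w : Fin 3 → ℝ} (hw : ∀ i, 0 < w i) (hw1 : ∑ i, w i = 1) (i : Fin 3) :
    U.dp (comb (fun i => (x i).pos) w) (x i) ≤ dist (comb (fun i => (x i).pos) w) (x i).pos := by
  obtain ⟨j, k, hjk, hji, hki⟩ := exists_others i
  set p := comb (fun i => (x i).pos) w with hp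
  set z : ℝ → Plane := fun ε => AffineMap.lineMap (x i).pos (x j).pos ε with hz
  have hzc : Continuous z := AffineMap.lineMap_continuous
  have hz0 : z 0 = (x i).pos := by simp [hz]
  have hlim : Tendsto (fun ε => dist p (z ε) + dist (z ε) (x i).pos) (𝓝[>] 0)
      (𝓝 (dist p (x i).pos)) := by
    have hc : Continuous fun ε => dist p (z ε) + dist (z ε) (x i).pos := by fun_prop
    have := (hc.tendsto 0).mono_left (nhdsWithin_le_nhds (s := Ioi 0))
    rwa [hz0, dist_self, add_zero] at this
  refine ge_of_tendsto hlim ?_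
  filter_upwards [Ioo_mem_nhdsGT zero_lt_one] with ε hε
  have hch := h.chord hji.symm
  have hzU : z ε ∈ U := hch.lineMap_mem hε
  set s : Fin 3 → ℝ := fun l => if l = i then 1 - ε else if l = j then ε else 0 with hs
  have hsi : s i = 1 - ε := by simp [hs]
  have hsj : s j = ε := by simp [hs, hji]
  have hsk : s k = 0 := by simp [hs, hki, hjk.symm]
  have hs1 : ∑ l, s l = 1 := by
    rw [sum_fin_three hji.symm hki.symm hjk, hsi, hsj, hsk]; ring
  have hs0 : ∀ l, 0 ≤ s l := fun l => by
    simp only [hs]; split_ifs <;> linarith [hε.1, hε.2]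
  have hzs : z ε = comb (fun i => (x i).pos) s := by
    rw [comb_side hs1 hji.symm hki.symm hjk hsk, hsj]
  have hseg : segment ℝ p (z ε) ⊆ U.carrier := by
    intro m hm
    rw [segment_eq_image_lineMap] at hm
    obtain ⟨t, ht, rfl⟩ := hm
    rcases ht.2.lt_or_eq with h1 | rfl
    · rw [hzs, comb_lineMap]
      refine h.comb_mem (fun l => ?_) ?_
      · nlinarith [hw l, hs0 l, ht.1]
      · rw [Finset.sum_add_distrib, ← Finset.mul_sum, ← Finset.mul_sum, hw1, hs1]; ring
    · rw [AffineMap.lineMap_apply_one]; exact hzU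
  have h1 := dp_le_dist_add_dp p (z ε) (x i)
  rw [dist_pt_eq hseg] at h1
  refine h1.trans (add_le_add le_rfl (hch.dp_left _ ?_).le)
  rw [openSegment_eq_image_lineMap]
  exact ⟨ε, hε, rfl⟩

/-- The image of a core point is as close to the images of its cell vertices as the point to the vertices. -/
lemma Cell.exists_dp_F_le (f : U.Bd ≃ᵢ V.Bd) (hq : q ∈ U.core) (C : Cell U q) {x : U.Bd} (hx : x ∈ C.verts) :
    V.dp (U.F f q) (f x) ≤ dist q x.pos := by
  classical
  have hcard : C.verts.card ≤ 3 := by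
    have h1 := C.indep.card_le_finrank_succ
    have h2 := (vectorSpan ℝ (range fun x : C.verts => x.1.pos)).finrank_le
    rw [finrank_euclideanSpace_fin] at h2
    rw [Fintype.card_coe] at h1
    omega
  have hpos := C.verts_nonempty.card_pos
  have hF := F_eq f C hq
  have himg := C.dist_img_vert f hx
  rw [← hF] at himg
  rw [Cell.img] at hF
  have hsum := C.sum_eq
  have hwt := C.wt_sum
  rcases (by omega : C.verts.card = 1 ∨ C.verts.card = 2 ∨ C.verts.card = 3) with h | h | h
  · obtain ⟨x, hx⟩ := Finset.card_eq_one.1 h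
    rw [hx, Finset.sum_singleton] at hsum hwt
    rw [hwt, one_smul] at hsum
    exact (x.pos_not_mem (hsum ▸ core_subset hq)).elim
  · obtain ⟨y, hyx, hv⟩ : ∃ y, x ≠ y ∧ C.verts = {x, y} := by
      obtain ⟨a, b, hab, hv⟩ := Finset.card_eq_two.1 h
      rw [hv, Finset.mem_insert, Finset.mem_singleton] at hx
      rcases hx with rfl | rfl
      · exact ⟨b, hab, hv⟩
      · exact ⟨a, hab.symm, by rw [hv, Finset.pair_comm]⟩
    have hy : y ∈ C.verts := by simp [hv]
    have hx0 := C.wt_pos x hx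
    have hy0 := C.wt_pos y hy
    rw [hv, Finset.sum_pair hyx] at hwt hF
    have hx1 : C.wt x = 1 - C.wt y := by linarith
    have hch := Touch.chord_map f (C.touch x hx) (C.touch y hy) hyx
    rw [← himg]
    refine (hch.dp_left _ ?_).le
    rw [hF, openSegment_eq_image_lineMap]
    exact ⟨C.wt y, ⟨hy0, by linarith⟩, by rw [AffineMap.lineMap_apply_module, ← hx1]⟩
  · let e : C.verts ≃ Fin 3 := C.verts.equivFinOfCardEq h
    have htri : Tri f.symm C.center (U.rad C.center) (fun i => f (e.symm i).1) :=
      ⟨fun i => by simpa using C.touch _ (e.symm i).2, by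
        simpa [Function.comp_def] using C.indep.comp_embedding e.symm.toEmbedding⟩
    have hs : ∀ {M : Type} [AddCommMonoid M] (g : U.Bd → M),
        ∑ x ∈ C.verts, g x = ∑ i, g (e.symm i).1 := fun g => by
      rw [← Finset.sum_coe_sort, ← Equiv.sum_comp e.symm]
    rw [hs] at hwt hF
    have hw : ∀ i, 0 < C.wt (e.symm i).1 := fun i => C.wt_pos _ (e.symm i).2
    have h1 := htri.dp_le hw hwt (e ⟨x, hx⟩)
    simp only [comb, Equiv.symm_apply_apply] at h1
    rw [← hF, himg] at h1
    exact h1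

/-- Core points close to a boundary element are mapped to points close to its image. -/
theorem dp_F_le (f : U.Bd ≃ᵢ V.Bd) {w : Plane} (hw : w ∈ U.core) (x : U.Bd) :
    V.dp (U.F f w) (f x) ≤ 3 * U.dp w x := by
  obtain ⟨a, ha⟩ := exists_nearest (exists_not_mem_of_core hw) (core_subset hw)
  obtain ⟨c, hc⟩ := exists_isMax hw
  have hrad := rad_le_dp (core_subset hw) x
  refine le_of_forall_pos_le_add fun ε hε => ?_
  set M := U.phi w c + dist w a.pos ^ 2 with hM
  have hlim : Tendsto (fun t : ℝ => (1 - t) * M) (𝓝[<] 1) (𝓝 0) := by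
    have : Continuous fun t : ℝ => (1 - t) * M := by fun_prop
    simpa using (this.tendsto 1).mono_left nhdsWithin_le_nhds
  obtain ⟨t, ht, ht1, ht0⟩ := ((hlim.eventually (gt_mem_nhds
    (show (0:ℝ) < (ε / 2) ^ 2 by positivity))).and ((eventually_mem_nhdsWithin (a := (1:ℝ)) (s := Iio 1)).and
    (nhdsWithin_le_nhds (lt_mem_nhds (zero_lt_one (α := ℝ)))))).exists
  have ht1' : t < 1 := ht1
  set p := AffineMap.lineMap w a.pos t with hp
  have hpc : p ∈ U.core := lineMap_mem_core hw ha ht0.le ht1'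
  obtain ⟨C⟩ := exists_cell hpc
  obtain ⟨y, hy, hyd⟩ := C.exists_dist_sq_le
  have hyp : dist p y.pos ≤ ε / 2 := by
    rw [dist_comm]
    refine le_of_sq_le_sq (hyd.trans ?_) (by positivity)
    refine (phi_lineMap_le w a.pos C.center ht0.le ht1'.le a.pos_not_mem).trans (le_trans ?_ ht.le)
    exact mul_le_mul_of_nonneg_left (by linarith [hc C.center]) (by linarith)
  have hseg : segment ℝ w p ⊆ U.core := by
    intro z hz
    rw [segment_eq_image_lineMap] at hz
    obtain ⟨s, hs, rfl⟩ := hz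
    have : AffineMap.lineMap w p s = AffineMap.lineMap w a.pos (s * t) := by
      rw [hp, AffineMap.lineMap_lineMap_right]
    rw [this]
    exact lineMap_mem_core hw ha (mul_nonneg hs.1 ht0.le) (by nlinarith [hs.1, hs.2])
  have hwp : dist w p ≤ U.rad w := by
    rw [hp, dist_left_lineMap, ha.dist_center, Real.norm_of_nonneg ht0.le]
    nlinarith [ha.pos_rad]
  have h1 := dist_pt_F_le f hseg
  have h2 := C.exists_dp_F_le f hpc hy
  have h3 : dist (f x) (f y) = dist x y := f.isometry.dist_eq _ _
  have h4 := dist_le_dp_add_dp p x y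
  have h5 := dp_le_dist_add_dp p w x
  rw [dist_pt_eq (by rw [segment_symm]; exact hseg.trans core_subset), dist_comm p w] at h5
  rw [C.dp_eq hpc hy] at h4
  have h6 := dp_le_dist_add_dp (U.F f w) (U.F f p) (f x)
  have h7 := dp_le_dp_add_dist (U.F f p) (f x) (f y)
  linarith

end Dom

lemma intrinsicDist_image_le (J : Plane ≃ᵢ Plane) (S : Set Plane) (x y : Plane) :
    intrinsicDist (J '' S) (J x) (J y) ≤ intrinsicDist S x y := by
  refine le_of_forall_gt fun c hc => ?_
  obtain ⟨γ, g1, g2, g3, g4, g5⟩ := exists_path_of_intrinsicDist_lt hc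
  refine lt_of_le_of_lt (intrinsicDist_le (γ := J ∘ γ) (J.continuous.comp_continuousOn g1)
    (by simp [g2]) (by simp [g3]) (fun t ht => mem_image_of_mem J (g4 ht))) (lt_of_le_of_lt ?_ g5)
  have := (J.isometry.lipschitz.lipschitzOnWith (s := univ)).comp_eVariationOn_le
    (f := J) (g := γ) (s := Icc 0 1) (mapsTo_univ _ _)
  simpa using this

lemma intrinsicDist_image (J : Plane ≃ᵢ Plane) (S : Set Plane) (x y : Plane) :
    intrinsicDist (J '' S) (J x) (J y) = intrinsicDist S x y := by
  refine le_antisymm (intrinsicDist_image_le J S x y) ?_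
  have := intrinsicDist_image_le J.symm (J '' S) (J x) (J y)
  simpa [image_image] using this

namespace Dom
variable {U V : Dom} {q : Plane}

/-- The image of a domain under a plane isometry. -/
def map (J : Plane ≃ᵢ Plane) (V : Dom) : Dom :=
  ⟨J '' V.carrier, J.toHomeomorph.isOpenMap _ V.isDom.1,
    V.isDom.2.image J J.continuous.continuousOn⟩

/-- The isometry of intrinsic metrics induced by a plane isometry. -/
def mapPt (J : Plane ≃ᵢ Plane) (V : Dom) : V.Pt ≃ᵢ (V.map J).Pt where
  toFun p := ⟨J p.val, mem_image_of_mem J p.mem⟩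
  invFun p := ⟨J.symm p.val, by
    obtain ⟨y, hy, hyp⟩ := p.mem
    rw [← hyp]; simpa using hy⟩
  left_inv p := by simp
  right_inv p := by simp
  isometry_toFun := Isometry.of_dist_eq fun p q => by
    rw [Pt.dist_def, Pt.dist_def]
    exact congrArg _ (intrinsicDist_image J V.carrier p.val q.val)

/-- The isometry of completions induced by a plane isometry. -/
def mapX (J : Plane ≃ᵢ Plane) (V : Dom) : V.X ≃ᵢ (V.map J).X where
  toEquiv := (UniformSpace.Completion.mapEquiv ⟨(mapPt J V).toEquiv,
    (mapPt J V).isometry.uniformContinuous, (mapPt J V).symm.isometry.uniformContinuous⟩).toEquiv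
  isometry_toFun := (mapPt J V).isometry.completion_map

lemma pos_mapX (J : Plane ≃ᵢ Plane) (V : Dom) (x : V.X) : pos (mapX J V x) = J (pos x) := by
  refine UniformSpace.Completion.induction_on x ?_ fun p => ?_
  · exact isClosed_eq (continuous_pos.comp (mapX J V).continuous)
      (J.continuous.comp continuous_pos)
  · have : mapX J V (p : V.X) = ((mapPt J V p : (V.map J).Pt) : (V.map J).X) :=
      UniformSpace.Completion.map_coe (mapPt J V).isometry.uniformContinuous p
    rw [this, pos_coe, pos_coe]; rfl

lemma map_mem_iff (J : Plane ≃ᵢ Plane) {p : Plane} : J p ∈ V.map J ↔ p ∈ V := by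
  change J p ∈ J '' V.carrier ↔ p ∈ V.carrier
  exact J.injective.mem_set_image

/-- The isometry of Hausdorff boundaries induced by a plane isometry. -/
def mapBd (J : Plane ≃ᵢ Plane) (V : Dom) : V.Bd ≃ᵢ (V.map J).Bd where
  toEquiv := (mapX J V).toEquiv.subtypeEquiv fun x => by
    change pos x ∉ V ↔ pos (mapX J V x) ∉ V.map J
    rw [pos_mapX, map_mem_iff]
  isometry_toFun := Isometry.of_dist_eq fun x y => (mapX J V).dist_eq x.1 y.1

lemma pos_mapBd (J : Plane ≃ᵢ Plane) (x : V.Bd) : (mapBd J V x).pos = J x.pos :=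
  pos_mapX J V x.1

lemma F_mapBd (f : U.Bd ≃ᵢ V.Bd) (J : Plane ≃ᵢ Plane) (hq : q ∈ U.core) :
    U.F (f.trans (mapBd J V)) q = J (U.F f q) := by
  obtain ⟨C⟩ := exists_cell hq
  rw [F_eq _ C hq, F_eq f C hq]
  set A := J.toRealAffineIsometryEquiv.toAffineEquiv.toAffineMap with hA
  have hd : ∀ p, J p = A.linear p + A 0 := fun p => congrFun A.decomp p
  rw [hd, Cell.img, Cell.img, map_sum]
  have h1 : A 0 = ∑ x ∈ C.verts, C.wt x • A 0 := by rw [← Finset.sum_smul, C.wt_sum, one_smul]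
  rw [h1, ← Finset.sum_add_distrib]
  refine Finset.sum_congr rfl fun x _ => ?_
  rw [map_smul, ← smul_add, ← hd, IsometryEquiv.trans_apply, pos_mapBd]

end Dom

namespace Dom
variable {U V : Dom} {q : Plane}

lemma interior_closure_convexHull (S : Set Plane) :
    interior (closure (convexHull ℝ S)) = interior (convexHull ℝ S) := by
  rcases (interior (convexHull ℝ S)).eq_empty_or_nonempty with h | h
  · rw [h]
    by_contra hne
    have h1 : (interior (closure (convexHull ℝ S))).Nonempty := nonempty_iff_ne_empty.2 hne
    have h2 : closure (convexHull ℝ S) ⊆ affineSpan ℝ S :=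
      closure_minimal (convexHull_subset_affineSpan S)
        (AffineSubspace.closed_of_finiteDimensional _)
    have h3 : affineSpan ℝ S = ⊤ := by
      rw [eq_top_iff, ← isOpen_interior.affineSpan_eq_top h1]
      exact affineSpan_le.2 (interior_subset.trans h2)
    rw [← interior_convexHull_nonempty_iff_affineSpan_eq_top, h] at h3
    exact not_nonempty_empty h3
  · exact (convex_convexHull ℝ S).interior_closure_eq_interior_of_nonempty_interior h

lemma eq_core_of_FPart_eq_empty (h : FPart U.carrier = ∅) : U.carrier = U.core := by
  refine Subset.antisymm (fun p hp => ⟨hp, ?_⟩) core_subset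
  have h1 : U.carrier ⊆ closure (convexHull ℝ (frontier U.carrier)) := sdiff_eq_empty.1 h
  have h2 := interior_maximal h1 U.isOpen
  rw [interior_closure_convexHull] at h2
  exact h2 hp

variable (U) in
/-- The closed convex hull of the frontier. -/
def hull : Set Plane := closure (convexHull ℝ (frontier U.carrier))

lemma isClosed_hull : IsClosed U.hull := isClosed_closure

lemma convex_hull : Convex ℝ U.hull := (convex_convexHull ℝ _).closure

lemma frontier_subset_hull : frontier U.carrier ⊆ U.hull :=
  (subset_convexHull ℝ _).trans subset_closure

lemma FPart_eq : FPart U.carrier = U.carrier \ U.hull := rfl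

lemma core_eq : U.core = U.carrier ∩ interior U.hull := by
  rw [hull, interior_closure_convexHull]; rfl

/-- A preconnected set meeting a domain and missing its frontier lies in the domain. -/
lemma subset_of_preconnected {S : Set Plane} (hS : IsPreconnected S) (hd : ∀ p ∈ S, p ∉ U.hull)
    (hne : ∃ p ∈ S, p ∈ U) : S ⊆ U.carrier := by
  refine hS.subset_of_closure_inter_subset U.isOpen (let ⟨p, h, h'⟩ := hne; ⟨p, h, h'⟩) ?_
  rintro p ⟨hp, hpS⟩
  by_contra h
  exact hd p hpS (frontier_subset_hull (U.isOpen.frontier_eq ▸ ⟨hp, h⟩))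

lemma convex_halfPlane (m : Plane) (t : ℝ) : Convex ℝ {p : Plane | t < ⟪m, p⟫} :=
  convex_halfSpace_gt (innerSL ℝ m).toLinearMap.isLinear t

/-- A point off the closed hull is separated by an open half-plane supporting the hull. -/
lemma exists_supporting (hne : U.hull.Nonempty) {z : Plane} (hz : z ∉ U.hull) :
    ∃ (m : Plane) (t : ℝ), ‖m‖ = 1 ∧ (∀ p ∈ U.hull, ⟪m, p⟫ ≤ t) ∧ t < ⟪m, z⟫ ∧
      (∃ p ∈ U.hull, ⟪m, p⟫ = t) ∧
      ((∃ p ∈ U, t < ⟪m, p⟫) → ∀ p, t < ⟪m, p⟫ → p ∈ U) := by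
  obtain ⟨π, hπ, h⟩ := exists_norm_eq_iInf_of_complete_convex hne
    (isClosed_hull (U := U)).isComplete convex_hull z
  rw [norm_eq_iInf_iff_real_inner_le_zero convex_hull hπ] at h
  have hzπ : z - π ≠ 0 := sub_ne_zero.2 fun e => hz (e ▸ hπ)
  have hpos : 0 < ‖z - π‖ := norm_pos_iff.2 hzπ
  have hle : ∀ p ∈ U.hull, ⟪‖z - π‖⁻¹ • (z - π), p⟫ ≤ ⟪‖z - π‖⁻¹ • (z - π), π⟫ := by
    intro p hp
    rw [← sub_nonpos, ← inner_sub_right, real_inner_smul_left]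
    exact mul_nonpos_of_nonneg_of_nonpos (by positivity) (h p hp)
  refine ⟨‖z - π‖⁻¹ • (z - π), ⟪‖z - π‖⁻¹ • (z - π), π⟫, ?_, hle, ?_, ⟨π, hπ, rfl⟩, ?_⟩
  · rw [norm_smul, norm_inv, norm_norm, inv_mul_cancel₀ hpos.ne']
  · rw [← sub_pos, ← inner_sub_right, real_inner_smul_left, real_inner_self_eq_norm_sq]
    positivity
  · rintro ⟨p, hp, hpt⟩
    exact subset_of_preconnected (convex_halfPlane _ _).isPreconnected
      (fun y hy hyC => not_lt.2 (hle y hyC) hy) ⟨p, hpt, hp⟩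

/-- Open half-planes whose unit normals are not opposite intersect. -/
lemma exists_mem_halfPlanes {m n : Plane} (hm : ‖m‖ = 1) (hn : ‖n‖ = 1) (h : m ≠ -n) (s t : ℝ) :
    ∃ p, s < ⟪m, p⟫ ∧ t < ⟪n, p⟫ := by
  have hc : -1 < ⟪m, n⟫ := by
    have h0 : 0 < ‖m + n‖ ^ 2 := by
      have : m + n ≠ 0 := fun e => h (eq_neg_of_add_eq_zero_left e)
      positivity
    rw [norm_add_sq_real m n, hm, hn] at h0
    linarith
  refine ⟨((|s| + |t| + 1) / (1 + ⟪m, n⟫)) • (m + n), ?_, ?_⟩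
  · rw [real_inner_smul_right, inner_add_right, real_inner_self_eq_norm_sq, hm, one_pow,
      div_mul_cancel₀ _ (by linarith)]
    linarith [le_abs_self s, abs_nonneg t]
  · rw [real_inner_smul_right, inner_add_right, real_inner_self_eq_norm_sq, hn, one_pow,
      real_inner_comm n m, add_comm (⟪n, m⟫) (1:ℝ), div_mul_cancel₀ _ (by rw [real_inner_comm]; linarith)]
    linarith [le_abs_self t, abs_nonneg s]

/-- A domain whose closed hull of the frontier is a strip with both complementary half-planes
in the domain. -/
structure Strip (U : Dom) (n : Plane) (s₂ s₁ : ℝ) : Prop where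
  norm : ‖n‖ = 1
  le : s₂ ≤ s₁
  up : ∀ p, s₁ < ⟪n, p⟫ → p ∈ U
  dn : ∀ p, ⟪n, p⟫ < s₂ → p ∈ U
  hull : ∀ p, p ∈ U.hull ↔ s₂ ≤ ⟪n, p⟫ ∧ ⟪n, p⟫ ≤ s₁

lemma exists_strip (hne : (FPart U.carrier).Nonempty) (hc : ¬ IsConnected (FPart U.carrier)) :
    ∃ n s₂ s₁, Strip U n s₂ s₁ := by
  have hC : U.hull.Nonempty := by
    by_contra h
    rw [not_nonempty_iff_eq_empty] at h
    exact hc (by rw [FPart_eq, h, sdiff_empty]; exact U.isDom.2)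
  have hp : ¬ IsPreconnected (FPart U.carrier) := fun h => hc ⟨hne, h⟩
  have hpair : ∃ z₁ ∈ FPart U.carrier, ∃ z₂ ∈ FPart U.carrier, ∀ t ⊆ FPart U.carrier,
      z₁ ∈ t → z₂ ∈ t → ¬ IsPreconnected t := by
    by_contra h
    push Not at h
    exact hp (isPreconnected_of_forall_pair h)
  obtain ⟨z₁, hz₁, z₂, hz₂, hno⟩ := hpair
  obtain ⟨m₁, t₁, hm₁, c₁, hzt₁, ⟨π₁, hπ₁, hπt₁⟩, hU₁⟩ := exists_supporting hC hz₁.2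
  obtain ⟨m₂, t₂, hm₂, c₂, hzt₂, ⟨π₂, hπ₂, hπt₂⟩, hU₂⟩ := exists_supporting hC hz₂.2
  replace hU₁ := hU₁ ⟨z₁, hz₁.1, hzt₁⟩
  replace hU₂ := hU₂ ⟨z₂, hz₂.1, hzt₂⟩
  have hF : ∀ {m : Plane} {t : ℝ}, (∀ p ∈ U.hull, ⟪m, p⟫ ≤ t) → (∀ p, t < ⟪m, p⟫ → p ∈ U) →
      {p : Plane | t < ⟪m, p⟫} ⊆ FPart U.carrier := fun h h' p hp =>
    ⟨h' p hp, fun hpC => not_lt.2 (h p hpC) hp⟩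
  have hm : m₂ = -m₁ := by
    by_contra h
    obtain ⟨p, hp₂, hp₁⟩ := exists_mem_halfPlanes hm₂ hm₁ h t₂ t₁
    exact hno _ (union_subset (hF c₁ hU₁) (hF c₂ hU₂)) (Or.inl hzt₁) (Or.inr hzt₂)
      ((convex_halfPlane _ _).isPreconnected.union p hp₁ hp₂ (convex_halfPlane _ _).isPreconnected)
  subst hm
  refine ⟨m₁, -t₂, t₁, hm₁, ?_, hU₁, fun p hp => hU₂ p (by rw [inner_neg_left]; linarith),
    fun p => ⟨fun hp => ⟨?_, c₁ p hp⟩, ?_⟩⟩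
  · have := c₂ π₁ hπ₁
    rw [inner_neg_left] at this; linarith
  · have := c₂ p hp
    rw [inner_neg_left] at this; linarith
  rintro ⟨hp₂, hp₁⟩
  by_contra hpC
  obtain ⟨m, t, hm, c, hpt, -, hUm⟩ := exists_supporting hC hpC
  have h₁ : m ≠ -m₁ := by
    rintro rfl
    have := c π₂ hπ₂
    rw [hπt₂] at this
    rw [inner_neg_left] at hpt
    linarith
  have h₂ : m ≠ - -m₁ := by
    rw [neg_neg]
    rintro rfl
    have := c π₁ hπ₁
    linarith
  obtain ⟨a, ha, ha₁⟩ := exists_mem_halfPlanes hm hm₁ h₁ t t₁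
  obtain ⟨b, hb, hb₂⟩ := exists_mem_halfPlanes hm hm₂ h₂ t t₂
  replace hUm := hUm ⟨a, hU₁ a ha₁, ha⟩
  refine hno _ (union_subset (union_subset (hF c₁ hU₁) (hF c hUm)) (hF c₂ hU₂))
    (Or.inl (Or.inl hzt₁)) (Or.inr hzt₂) ?_
  exact ((convex_halfPlane _ _).isPreconnected.union a ha₁ ha
    (convex_halfPlane _ _).isPreconnected).union b (Or.inr hb) hb₂
    (convex_halfPlane _ _).isPreconnected

end Dom

/-- A point outside a closed set of reals, between two of its points, lies in a gap. -/
lemma exists_gap {T : Set ℝ} (hT : IsClosed T) {t : ℝ} (ht : t ∉ T) (hl : ∃ a ∈ T, a < t)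
    (hr : ∃ b ∈ T, t < b) : ∃ a ∈ T, ∃ b ∈ T, a < t ∧ t < b ∧ ∀ s ∈ Ioo a b, s ∉ T := by
  obtain ⟨a₀, ha₀, ha₀t⟩ := hl
  obtain ⟨b₀, hb₀, hb₀t⟩ := hr
  have hA : (T ∩ Iic t).Nonempty := ⟨a₀, ha₀, ha₀t.le⟩
  have hB : (T ∩ Ici t).Nonempty := ⟨b₀, hb₀, hb₀t.le⟩
  have hAb : BddAbove (T ∩ Iic t) := ⟨t, fun s hs => hs.2⟩
  have hBb : BddBelow (T ∩ Ici t) := ⟨t, fun s hs => hs.2⟩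
  have ha := (hT.inter isClosed_Iic).csSup_mem hA hAb
  have hb := (hT.inter isClosed_Ici).csInf_mem hB hBb
  refine ⟨_, ha.1, _, hb.1, lt_of_le_of_ne ha.2 fun h => ht (h ▸ ha.1),
    lt_of_le_of_ne hb.2 fun h => ht (h ▸ hb.1), fun s hs hsT => ?_⟩
  rcases le_total s t with h | h
  · exact not_lt.2 (le_csSup hAb ⟨hsT, h⟩) hs.1
  · exact not_lt.2 (csInf_le hBb ⟨hsT, h⟩) hs.2

/-- Two pairs of points at equal distances are related by a plane isometry. -/
lemma exists_isometry_pair {a b a' b' : Plane} (h : dist a b = dist a' b') :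
    ∃ J : Plane ≃ᵢ Plane, J a = a' ∧ J b = b' := by
  have hn : ‖b - a‖ = ‖b' - a'‖ := by
    rw [← dist_eq_norm, ← dist_eq_norm, dist_comm, h, dist_comm]
  have hR := Submodule.reflection_sub hn
  refine ⟨((IsometryEquiv.subRight a).trans
    (((ℝ ∙ ((b - a) - (b' - a')))ᗮ).reflection).toIsometryEquiv).trans (IsometryEquiv.addLeft a'),
    ?_, ?_⟩
  · simp
  · simp only [IsometryEquiv.trans_apply, IsometryEquiv.subRight_apply, IsometryEquiv.addLeft_apply,
      LinearIsometryEquiv.coe_toIsometryEquiv]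
    rw [hR]; abel

namespace Dom
variable {U V : Dom} {q : Plane}

lemma mem_closure_side {a b : Plane} (hab : a ≠ b) {p : Plane} (hp : side a b p = 0) :
    p ∈ closure {z | 0 < side a b z} := by
  rw [Metric.mem_closure_iff]
  intro ε hε
  obtain ⟨z₁, -, h, -, h', -⟩ := exists_side_pos hab p hε hp
  exact ⟨z₁, h', by rwa [dist_comm]⟩

lemma Chord.dp_eq_of_convex {x y : U.Bd} (h : Chord U x y) {D : Set Plane} (hD : Convex ℝ D)
    (hDU : D ⊆ U.carrier) (hx : x.pos ∈ closure D) (hcl : openSegment ℝ x.pos y.pos ⊆ closure D)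
    {p : Plane} (hp : p ∈ D) : U.dp p x = dist p x.pos := by
  obtain ⟨x', hx', hdp⟩ := access hD hDU hx x.pos_not_mem
  suffices x = x' by rw [this, hdp p hp, hx']
  refine Bd.ext_of_dp fun ε hε => ?_
  have hc : ContinuousAt (fun t : ℝ => AffineMap.lineMap x.pos y.pos t) 0 :=
    (AffineMap.lineMap_continuous (R := ℝ) (p := x.pos) (q := y.pos)).continuousAt
  have h1 : ∀ᶠ t in 𝓝 (0:ℝ), dist (AffineMap.lineMap x.pos y.pos t : Plane) x.pos < ε / 4 := by
    refine hc.eventually_mem (ball_mem_nhds _ ?_) |>.mono fun t ht => by simpa using ht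
    positivity
  obtain ⟨t, ht, ht0⟩ := ((eventually_nhdsWithin_of_eventually_nhds h1).and
    (Ioo_mem_nhdsGT (show (0:ℝ) < 1 by norm_num))).exists
  set g : Plane := AffineMap.lineMap x.pos y.pos t with hg
  have hgs : g ∈ openSegment ℝ x.pos y.pos := by
    rw [openSegment_eq_image_lineMap]; exact ⟨t, ht0, rfl⟩
  obtain ⟨δ, hδ, hb⟩ := Metric.isOpen_iff.1 U.isOpen g (h.mem g hgs)
  obtain ⟨m, hmD, hm⟩ := Metric.mem_closure_iff.1 (hcl hgs) (min δ (ε / 4)) (by positivity)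
  rw [dist_comm] at hm
  refine ⟨m, ?_, ?_⟩
  · have e1 := dp_le_dist_add_dp m g x
    rw [h.dp_left g hgs, dist_pt_eq (((convex_ball g δ).segment_subset
      (hm.trans_le (min_le_left _ _)) (mem_ball_self hδ)).trans hb)] at e1
    linarith [hm.trans_le (min_le_right _ _)]
  · rw [hdp m hmD]
    linarith [hm.trans_le (min_le_right _ _), dist_triangle m g x.pos]

/-- A chord whose line carries the whole complement of the domain. -/
structure LineGap (U : Dom) (x y : U.Bd) : Prop where
  chord : Chord U x y
  line : ∀ z ∉ U, side x.pos y.pos z = 0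

lemma LineGap.symm {x y : U.Bd} (h : LineGap U x y) : LineGap U y x :=
  ⟨h.chord.symm, fun z hz => by rw [side_swap, h.line z hz, neg_zero]⟩

lemma side_openSegment {a b p : Plane} (hp : p ∈ openSegment ℝ a b) : side a b p = 0 := by
  rw [openSegment_eq_image_lineMap] at hp
  obtain ⟨t, -, rfl⟩ := hp
  exact side_line a b t

lemma LineGap.dp_le {x y : U.Bd} (h : LineGap U x y) {p : Plane} (hp : side x.pos y.pos p ≠ 0) :
    U.dp p x = dist p x.pos := by
  rcases lt_or_gt_of_ne hp with hp | hp
  · have e : ∀ z, side y.pos x.pos z = 0 ↔ side x.pos y.pos z = 0 := fun z => by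
      rw [side_swap, neg_eq_zero]
    refine h.chord.dp_eq_of_convex (convex_side_pos y.pos x.pos) (fun z hz => ?_)
      (mem_closure_side h.chord.ne.symm (side_right _ _)) (fun z hz => ?_) (p := p) ?_
    · by_contra hzU
      exact (ne_of_gt hz) ((e z).2 (h.line z hzU))
    · exact mem_closure_side h.chord.ne.symm ((e z).2 (side_openSegment hz))
    · change 0 < side y.pos x.pos p
      rw [side_swap]; linarith
  · refine h.chord.dp_eq_of_convex (convex_side_pos x.pos y.pos) (fun z hz => ?_)
      (mem_closure_side h.chord.ne (side_left _ _)) (fun z hz => ?_) (p := p) hp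
    · by_contra hzU
      exact (ne_of_gt hz) (h.line z hzU)
    · exact mem_closure_side h.chord.ne (side_openSegment hz)

lemma LineGap.dist_left {x y : U.Bd} (h : LineGap U x y) (z : U.Bd) :
    dist z x = dist z.pos x.pos := by
  refine le_antisymm (le_of_forall_pos_le_add fun ε hε => ?_) (Bd.dist_pos_le z x)
  have hex : ∃ p ∈ U, U.dp p z < ε / 2 ∧ side x.pos y.pos p ≠ 0 := by
    obtain ⟨p, hp, hpz⟩ := z.exists_near (show 0 < ε / 2 by positivity)
    by_cases hs : side x.pos y.pos p = 0
    · have h1 : ∀ᶠ m in 𝓝 p, m ∈ U ∧ U.dp m z < ε / 2 :=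
        (show ∀ᶠ m in 𝓝 p, m ∈ U from U.isOpen.mem_nhds hp).and
        (((continuousOn_dp z).continuousAt (U.isOpen.mem_nhds hp)).eventually_lt
          continuousAt_const hpz)
      obtain ⟨δ, hδ, hb⟩ := Metric.eventually_nhds_iff_ball.1 h1
      obtain ⟨m, -, hm, -, hms, -⟩ := exists_side_pos h.chord.ne p hδ hs
      exact ⟨m, (hb m hm).1, (hb m hm).2, hms.ne'⟩
    · exact ⟨p, hp, hpz, hs⟩
  obtain ⟨p, hp, hpz, hs⟩ := hex
  have e1 := dist_le_dp_add_dp p z x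
  rw [h.dp_le hs] at e1
  linarith [dist_triangle p z.pos x.pos, dist_pos_le_dp hp z]

lemma LineGap.map_mem {x y : U.Bd} (h : LineGap U x y) (f : U.Bd ≃ᵢ V.Bd)
    (h' : LineGap V (f x) (f y)) {J : Plane ≃ᵢ Plane} (hJx : J x.pos = (f x).pos)
    (hJy : J y.pos = (f y).pos) {z : Plane} (hz : z ∉ U) : J z ∉ V := by
  have hD : {p | 0 < side x.pos y.pos p} ⊆ U.carrier := fun p hp => by
    by_contra hpU
    exact (ne_of_gt hp) (h.line p hpU)
  obtain ⟨w, rfl, -⟩ := access (convex_side_pos x.pos y.pos) hD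
    (mem_closure_side h.chord.ne (h.line z hz)) hz
  have key : ∀ {a b p q : Plane}, a ≠ b → side a b p = 0 → dist p a = dist q a →
      dist p b = dist q b → side a b q = 0 → p = q := by
    intro a b p q hab hp hpa hpb hq
    obtain ⟨s, rfl⟩ : ∃ s : ℝ, p = AffineMap.lineMap a b s := ⟨_, eq_lineMap_of_side hab hp⟩
    obtain ⟨t, rfl⟩ : ∃ t : ℝ, q = AffineMap.lineMap a b t := ⟨_, eq_lineMap_of_side hab hq⟩
    have hd := dist_pos.2 hab
    rw [dist_lineMap_left, dist_lineMap_left, mul_left_inj' hd.ne', Real.norm_eq_abs,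
      Real.norm_eq_abs, ← sq_eq_sq_iff_abs_eq_abs] at hpa
    rw [dist_lineMap_right, dist_lineMap_right, mul_left_inj' hd.ne', Real.norm_eq_abs,
      Real.norm_eq_abs, ← sq_eq_sq_iff_abs_eq_abs] at hpb
    congr 1
    linarith
  have hw : J w.pos = (f w).pos := by
    have e1 : dist (J w.pos) (f x).pos = dist (f w).pos (f x).pos := by
      rw [← h'.dist_left, f.isometry.dist_eq, h.dist_left, ← hJx, J.isometry.dist_eq]
    have e2 : dist (J w.pos) (f y).pos = dist (f w).pos (f y).pos := by
      rw [← h'.symm.dist_left, f.isometry.dist_eq, h.symm.dist_left, ← hJy, J.isometry.dist_eq]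
    refine key h'.chord.ne ?_ e1 e2 (h'.line _ (f w).pos_not_mem)
    rw [eq_lineMap_of_side h.chord.ne (h.line _ w.pos_not_mem)]
    have := J.toRealAffineIsometryEquiv.toAffineEquiv.toAffineMap.apply_lineMap x.pos y.pos
      (⟪y.pos - x.pos, w.pos - x.pos⟫ / ‖y.pos - x.pos‖ ^ 2)
    have h3 : J (AffineMap.lineMap x.pos y.pos
      (⟪y.pos - x.pos, w.pos - x.pos⟫ / ‖y.pos - x.pos‖ ^ 2)) = AffineMap.lineMap (J x.pos)
        (J y.pos) (⟪y.pos - x.pos, w.pos - x.pos⟫ / ‖y.pos - x.pos‖ ^ 2) := this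
    rw [h3, hJx, hJy]
    exact side_line _ _ _
  rw [hw]
  exact (f w).pos_not_mem

lemma LineGap.exists_isometry {x y : U.Bd} (h : LineGap U x y) (f : U.Bd ≃ᵢ V.Bd)
    (h' : LineGap V (f x) (f y)) : ∃ J : Plane ≃ᵢ Plane, J '' U.carrier = V.carrier := by
  obtain ⟨J, hJx, hJy⟩ := exists_isometry_pair (a := x.pos) (b := y.pos) (a' := (f x).pos)
    (b' := (f y).pos) (by rw [← h.symm.dist_left, ← h'.symm.dist_left, f.isometry.dist_eq])
  refine ⟨J, Subset.antisymm ?_ fun p hp => ?_⟩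
  · rintro _ ⟨p, hp, rfl⟩
    by_contra hJp
    refine h'.map_mem f.symm (J := J.symm) (by simpa using h) ?_ ?_ hJp ?_
    · rw [← hJx]; simp
    · rw [← hJy]; simp
    · rw [J.symm_apply_apply]; exact hp
  · refine ⟨J.symm p, ?_, by simp⟩
    by_contra hJp
    exact h.map_mem f h' hJx hJy hJp (by rw [J.apply_symm_apply]; exact hp)

/-- With empty core, a chord carries the complement on its line. -/
lemma Chord.lineGap {x y : V.Bd} (h : Chord V x y) (hV : V.core = ∅) : LineGap V x y := by
  have aux : ∀ {x y : V.Bd}, Chord V x y → ∀ z ∈ frontier V.carrier, ¬ 0 < side x.pos y.pos z := by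
    intro x y h z hz hs
    have hh : (1/2 : ℝ) ∈ Ioo (0:ℝ) 1 := by norm_num
    have h1 := eventually_mem_interior_hull_of_side h.ne x.pos_mem_frontier y.pos_mem_frontier hz hs
      hh
    have h2 : ∀ᶠ m in 𝓝 (AffineMap.lineMap x.pos y.pos (1/2 : ℝ) : Plane), m ∈ V :=
      V.isOpen.mem_nhds (h.lineMap_mem hh)
    obtain ⟨δ, hδ, hb⟩ := Metric.eventually_nhds_iff_ball.1 (h1.and h2)
    obtain ⟨m, -, hm, -, hms, -⟩ := exists_side_pos h.ne _ hδ (side_line x.pos y.pos (1/2))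
    have : m ∈ V.core := ⟨(hb m hm).2, (hb m hm).1 hms⟩
    rw [hV] at this
    exact this
  have aux2 : ∀ {x y : V.Bd}, Chord V x y → ∀ z, 0 < side x.pos y.pos z → z ∈ V := by
    intro x y h
    have hh : (1/2 : ℝ) ∈ Ioo (0:ℝ) 1 := by norm_num
    refine (convex_side_pos x.pos y.pos).isPreconnected.subset_of_closure_inter_subset V.isOpen
      ?_ ?_
    · obtain ⟨δ, hδ, hb⟩ := Metric.isOpen_iff.1 V.isOpen _ (h.lineMap_mem hh)
      obtain ⟨m, -, hm, -, hms, -⟩ := exists_side_pos h.ne _ hδ (side_line x.pos y.pos (1/2))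
      exact ⟨m, hms, hb hm⟩
    · rintro p ⟨hp, hpS⟩
      by_contra hpV
      exact aux h p (V.isOpen.frontier_eq ▸ ⟨hp, hpV⟩) hpS
  refine ⟨h, fun z hz => ?_⟩
  rcases lt_trichotomy (side x.pos y.pos z) 0 with hs | hs | hs
  · exact absurd (aux2 h.symm z (by rw [side_swap]; linarith)) hz
  · exact hs
  · exact absurd (aux2 h z hs) hz

end Dom

/-- An orthonormal frame of the plane. -/
structure Frame (n τ : Plane) : Prop where
  norm_n : ‖n‖ = 1
  norm_t : ‖τ‖ = 1
  orth : ⟪n, τ⟫ = 0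

/-- The point with given coordinates in a frame. -/
def coord (n τ : Plane) (s t : ℝ) : Plane := s • n + t • τ

namespace Frame
variable {n τ : Plane}

lemma inner_n (h : Frame n τ) (s t : ℝ) : ⟪n, coord n τ s t⟫ = s := by
  rw [coord, inner_add_right, real_inner_smul_right, real_inner_smul_right,
    real_inner_self_eq_norm_sq, h.norm_n, h.orth]; ring

lemma inner_t (h : Frame n τ) (s t : ℝ) : ⟪τ, coord n τ s t⟫ = t := by
  rw [coord, inner_add_right, real_inner_smul_right, real_inner_smul_right,
    real_inner_self_eq_norm_sq, h.norm_t, real_inner_comm, h.orth]; ring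

lemma coord_inner (h : Frame n τ) (p : Plane) : coord n τ ⟪n, p⟫ ⟪τ, p⟫ = p := by
  have ho : Orthonormal ℝ ![n, τ] := by
    rw [orthonormal_iff_ite]
    have h1 := h.norm_n
    have h2 := h.norm_t
    intro i j
    fin_cases i <;> fin_cases j <;> simp [h1, h2, h.orth, real_inner_comm]
  obtain ⟨b, hb⟩ := Orthonormal.exists_orthonormalBasis_extension_of_card_eq (𝕜 := ℝ) (E := Plane)
    (ι := Fin 2) (by simp) (v := ![n, τ]) (s := univ) (ho.comp _ Subtype.val_injective)
  have := b.sum_repr' p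
  rw [Fin.sum_univ_two, hb 0 (mem_univ _), hb 1 (mem_univ _)] at this
  exact this

lemma coord_of_inner (h : Frame n τ) {p : Plane} {s : ℝ} (hp : ⟪n, p⟫ = s) : p = coord n τ s ⟪τ, p⟫ := by
  rw [← hp, h.coord_inner]

lemma dist_coord (h : Frame n τ) (s t t' : ℝ) : dist (coord n τ s t) (coord n τ s t') = |t - t'| := by
  rw [dist_eq_norm, coord, coord, add_sub_add_left_eq_sub, ← sub_smul, norm_smul, h.norm_t,
    mul_one, Real.norm_eq_abs]

lemma neg_right (h : Frame n τ) : Frame n (-τ) := ⟨h.norm_n, by rw [norm_neg, h.norm_t], by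
  rw [inner_neg_right, h.orth, neg_zero]⟩

lemma neg_left (h : Frame n τ) : Frame (-n) τ := ⟨by rw [norm_neg, h.norm_n], h.norm_t, by
  rw [inner_neg_left, h.orth, neg_zero]⟩

lemma abs_inner_n_sub_le (h : Frame n τ) (p q : Plane) : |⟪n, p⟫ - ⟪n, q⟫| ≤ dist p q := by
  rw [← inner_sub_right, dist_eq_norm]
  simpa [h.norm_n] using abs_real_inner_le_norm n (p - q)

end Frame

lemma frame_rot {n : Plane} (h : ‖n‖ = 1) : Frame n (Dom.rot n) :=
  ⟨h, by rw [Dom.norm_rot, h], Dom.inner_rot_self n⟩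

lemma coord_neg_right (n τ : Plane) (s t : ℝ) : coord n (-τ) s t = coord n τ s (-t) := by
  simp [coord]

lemma coord_neg_left (n τ : Plane) (s t : ℝ) : coord (-n) τ s t = coord n τ (-s) t := by
  simp [coord]

lemma continuous_coord (n τ : Plane) (s : ℝ) : Continuous (coord n τ s) := by
  unfold coord; fun_prop

lemma lineMap_coord (n τ : Plane) (s a b t : ℝ) :
    AffineMap.lineMap (coord n τ s a) (coord n τ s b) t = coord n τ s (a + t * (b - a)) := by
  simp only [AffineMap.lineMap_apply, coord, vsub_eq_sub, vadd_eq_add]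
  module

namespace Dom
variable {U V : Dom} {q : Plane} {n τ : Plane} {s₂ s₁ : ℝ}

lemma Strip.flip (h : Strip U n s₂ s₁) : Strip U (-n) (-s₁) (-s₂) where
  norm := by rw [norm_neg, h.norm]
  le := neg_le_neg h.le
  up p hp := h.dn p (by rw [inner_neg_left] at hp; linarith)
  dn p hp := h.up p (by rw [inner_neg_left] at hp; linarith)
  hull p := by
    rw [h.hull, inner_neg_left]
    constructor <;> rintro ⟨h1, h2⟩ <;> constructor <;> linarith

lemma Strip.mem_core_iff (h : Strip U n s₂ s₁) {p : Plane} :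
    p ∈ U.core ↔ p ∈ U ∧ s₂ < ⟪n, p⟫ ∧ ⟪n, p⟫ < s₁ := by
  have hn1 : ∀ t : ℝ, ⟪n, p + t • n⟫ = ⟪n, p⟫ + t := fun t => by
    rw [inner_add_right, real_inner_smul_right, real_inner_self_eq_norm_sq, h.norm]; ring
  rw [core_eq]
  constructor
  · rintro ⟨hp, hi⟩
    refine ⟨hp, ?_⟩
    obtain ⟨ε, hε, hb⟩ := Metric.mem_nhds_iff.1 (mem_interior_iff_mem_nhds.1 hi)
    have hm : ∀ t : ℝ, |t| < ε → p + t • n ∈ U.hull := fun t ht => hb (by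
      rw [mem_ball, dist_eq_norm, add_sub_cancel_left, norm_smul, h.norm, mul_one]; exact ht)
    have h1 := (h.hull _).1 (hm (ε / 2) (by rw [abs_of_pos (half_pos hε)]; linarith))
    have h2 := (h.hull _).1 (hm (-(ε / 2)) (by rw [abs_neg, abs_of_pos (half_pos hε)]; linarith))
    rw [hn1] at h1 h2
    constructor <;> linarith [h1.1, h1.2, h2.1, h2.2]
  · rintro ⟨hp, h2, h1⟩
    refine ⟨hp, mem_interior.2 ⟨{p | s₂ < ⟪n, p⟫} ∩ {p | ⟪n, p⟫ < s₁}, fun x hx =>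
      (h.hull x).2 ⟨le_of_lt hx.1, le_of_lt hx.2⟩, ?_, h2, h1⟩⟩
    exact (isOpen_lt (by fun_prop) (by fun_prop)).inter (isOpen_lt (by fun_prop) (by fun_prop))

/-- A degenerate strip determines the domain. -/
lemma Strip.exists_isometry_of_eq {s : ℝ} (h : Strip U n s s) (f : U.Bd ≃ᵢ V.Bd) :
    ∃ J : Plane ≃ᵢ Plane, J '' U.carrier = V.carrier := by
  have hfr := frame_rot h.norm
  set τ := rot n
  set T : Set ℝ := {t | coord n τ s t ∉ U} with hTdef
  have hT : IsClosed T := U.isOpen.isClosed_compl.preimage (continuous_coord n τ s)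
  have hout : ∀ p, p ∉ U → ⟪n, p⟫ = s := fun p hp => le_antisymm
    (not_lt.1 fun hlt => hp (h.up p hlt)) (not_lt.1 fun hlt => hp (h.dn p hlt))
  obtain ⟨p, hpU, hps⟩ : s ∈ (fun p : Plane => ⟪n, p⟫) '' U.carrier := by
    refine U.isDom.2.isPreconnected.intermediate_value
      (h.dn (coord n τ (s - 1) 0) (by rw [hfr.inner_n]; linarith))
      (h.up (coord n τ (s + 1) 0) (by rw [hfr.inner_n]; linarith)) (by fun_prop)
      ⟨?_, ?_⟩ <;> simp only [hfr.inner_n] <;> linarith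
  have ht0 : ⟪τ, p⟫ ∉ T := fun hT => hT (hfr.coord_of_inner hps ▸ hpU)
  have hside : ∀ {m : Plane} {t₀ : ℝ}, (∀ t ∈ T, ⟪m, coord n τ s t⟫ ≤ t₀) →
      ∀ p, p ∈ U.hull → ⟪m, p⟫ ≤ t₀ := by
    intro m t₀ hm
    refine closure_minimal (convexHull_min (fun z hz => ?_) ?_)
      (isClosed_le (f := fun p : Plane => ⟪m, p⟫) (by fun_prop) continuous_const)
    · have hzU := not_mem_of_mem_frontier hz
      have e := hfr.coord_of_inner (hout z hzU)
      change ⟪m, z⟫ ≤ t₀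
      rw [e]
      exact hm _ (by rw [hTdef]; change _ ∉ U; rwa [← e])
    · exact convex_halfSpace_le (innerSL ℝ m).toLinearMap.isLinear t₀
  have hline : ∀ t, coord n τ s t ∈ U.hull := fun t => (h.hull _).2 (by rw [hfr.inner_n]; simp)
  obtain ⟨a, ha, b, hb, hat, htb, hgap⟩ := exists_gap hT ht0 (by
    by_contra! hc
    have := hside (m := -τ) (t₀ := -⟪τ, p⟫) (fun t ht => by
      rw [inner_neg_left, hfr.inner_t]; linarith [hc t ht]) _ (hline (⟪τ, p⟫ - 1))
    rw [inner_neg_left, hfr.inner_t] at this; linarith) (by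
    by_contra! hc
    have := hside (m := τ) (t₀ := ⟪τ, p⟫) (fun t ht => by
      rw [hfr.inner_t]; linarith [hc t ht]) _ (hline (⟪τ, p⟫ + 1))
    rw [hfr.inner_t] at this; linarith)
  have hball : ball (coord n τ s ((a + b) / 2)) ((b - a) / 2) ⊆ U.carrier := by
    intro z hz
    by_contra hzU
    have e := hfr.coord_of_inner (hout z hzU)
    rw [mem_ball, e, hfr.dist_coord, abs_lt] at hz
    exact hgap ⟪τ, z⟫ ⟨by linarith [hz.1], by linarith [hz.2]⟩ (show _ ∉ U from e ▸ hzU)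
  obtain ⟨x, hx, hxt⟩ := exists_touch (by linarith) hball ha (by
    rw [hfr.dist_coord, abs_of_pos (by linarith)]; ring)
  obtain ⟨y, hy, hyt⟩ := exists_touch (by linarith) hball hb (by
    rw [hfr.dist_coord, abs_of_neg (by linarith)]; ring)
  have hxy : x ≠ y := by
    rintro rfl
    have := hfr.dist_coord s a b
    rw [← hx, ← hy, dist_self] at this
    linarith [abs_eq_zero.1 this.symm]
  have hcore : U.core = ∅ := by
    ext q
    rw [h.mem_core_iff]
    simp only [mem_empty_iff_false, iff_false]
    rintro ⟨-, h1, h2⟩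
    linarith
  have hV : V.core = ∅ := by rw [← image_F_core f, hcore, image_empty]
  refine LineGap.exists_isometry (x := x) (y := y) ⟨hxt.chord hyt hxy, fun z hz => ?_⟩ f
    ((hxt.chord_map f hyt hxy).lineGap hV)
  rw [hfr.coord_of_inner (hout z hz), hx, hy]
  have : coord n τ s ⟪τ, z⟫ = AffineMap.lineMap (coord n τ s a) (coord n τ s b)
      ((⟪τ, z⟫ - a) / (b - a)) := by
    rw [lineMap_coord, div_mul_cancel₀ _ (by linarith)]; congr 1; ring
  rw [this, side_line]

end Dom

namespace Dom
variable {U V : Dom} {q : Plane} {n τ l : Plane} {s s₂ s₁ : ℝ}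

/-- The map `F` agrees with `K` near `l` on the half-plane `⟪n, ·⟫ < s`. -/
def Germ (f : U.Bd ≃ᵢ V.Bd) (n : Plane) (s : ℝ) (l : Plane) (K : Plane ≃ᵢ Plane) : Prop :=
  ∀ᶠ p in 𝓝[{p | ⟪n, p⟫ < s}] l, U.F f p = K p

lemma neBot_nhdsWithin_lt (hn : ‖n‖ = 1) (hl : ⟪n, l⟫ = s) :
    (𝓝[{p : Plane | ⟪n, p⟫ < s}] l).NeBot := by
  rw [← mem_closure_iff_nhdsWithin_neBot, Metric.mem_closure_iff]
  intro ε hε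
  refine ⟨l - (ε / 2) • n, ?_, ?_⟩
  · change ⟪n, l - (ε / 2) • n⟫ < s
    rw [inner_sub_right, real_inner_smul_right, real_inner_self_eq_norm_sq, hn, hl]
    linarith
  · rw [dist_eq_norm, sub_sub_cancel, norm_smul, hn, mul_one, Real.norm_eq_abs,
      abs_of_pos (half_pos hε)]
    exact half_lt_self hε

lemma isOpen_lt_inner (n : Plane) (s : ℝ) : IsOpen {p : Plane | ⟪n, p⟫ < s} :=
  isOpen_lt (by fun_prop) continuous_const

lemma convex_lt_inner (n : Plane) (s : ℝ) : Convex ℝ {p : Plane | ⟪n, p⟫ < s} :=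
  convex_halfSpace_lt (innerSL ℝ n).toLinearMap.isLinear s

lemma Strip.exists_disc (h : Strip U n s₂ s₁) (hlt : s₂ < s₁) (hl : l ∈ U) (hν : ⟪n, l⟫ = s₁) :
    ∃ δ > 0, ball l δ ∩ {p | ⟪n, p⟫ < s₁} ⊆ U.core := by
  have h1 : ∀ᶠ p in 𝓝 l, s₂ < ⟪n, p⟫ :=
    (isOpen_lt (f := fun _ => s₂) (g := fun p : Plane => ⟪n, p⟫) continuous_const
      (by fun_prop)).mem_nhds (by rw [mem_ofPred_eq, hν]; exact hlt)
  obtain ⟨δ, hδ, hb⟩ := Metric.eventually_nhds_iff_ball.1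
    ((show ∀ᶠ p in 𝓝 l, p ∈ U from U.isOpen.mem_nhds hl).and h1)
  exact ⟨δ, hδ, fun p hp => h.mem_core_iff.2 ⟨(hb p hp.1).1, (hb p hp.1).2, hp.2⟩⟩

lemma Germ.exists_nhds {f : U.Bd ≃ᵢ V.Bd} {K : Plane ≃ᵢ Plane} (hK : Germ f n s l K) {S : Set Plane}
    (hl : l ∈ closure S) (hS : S ⊆ {p | ⟪n, p⟫ < s}) :
    ∃ q ∈ S, ∀ᶠ p in 𝓝 q, U.F f p = K p := by
  have h1 := eventually_eventually_nhdsWithin.2 hK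
  have : (𝓝[S] l).NeBot := mem_closure_iff_nhdsWithin_neBot.1 hl
  obtain ⟨q, hq, hqS⟩ := ((h1.filter_mono (nhdsWithin_mono _ hS)).and self_mem_nhdsWithin).exists
  exact ⟨q, hqS, by rwa [(isOpen_lt_inner n s).nhdsWithin_eq (hS hqS)] at hq⟩

lemma Germ.unique {f : U.Bd ≃ᵢ V.Bd} {J K : Plane ≃ᵢ Plane} (hn : ‖n‖ = 1) (hν : ⟪n, l⟫ = s)
    (hJ : Germ f n s l J) (hK : Germ f n s l K) : J = K := by
  obtain ⟨q, -, hq⟩ := (show Germ f n s l J from hJ).exists_nhds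
    (mem_closure_iff_nhdsWithin_neBot.2 (neBot_nhdsWithin_lt hn hν)) subset_rfl
  have h1 := eventually_eventually_nhdsWithin.2 (hJ.and hK)
  have := neBot_nhdsWithin_lt hn hν
  obtain ⟨q, hq, hqS⟩ := (h1.and self_mem_nhdsWithin).exists
  rw [(isOpen_lt_inner n s).nhdsWithin_eq hqS] at hq
  exact eq_of_eventually_eq (hq.mono fun _ h => h.1) (hq.mono fun _ h => h.2)

lemma Strip.core_subset_lt (h : Strip U n s₂ s₁) : U.core ⊆ {p | ⟪n, p⟫ < s₁} :=
  fun _ hp => (h.mem_core_iff.1 hp).2.2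

/-- A connected part of the core determines a germ at each adherent point of the line. -/
lemma Strip.exists_germ_of_closure (h : Strip U n s₂ s₁) (hlt : s₂ < s₁) (f : U.Bd ≃ᵢ V.Bd)
    (hl : l ∈ U) (hν : ⟪n, l⟫ = s₁) {S : Set Plane} (hS : IsPreconnected S) (hSc : S ⊆ U.core)
    (hlS : l ∈ closure S) : ∃ K, Germ f n s₁ l K ∧ ∀ p ∈ S, U.F f p = K p := by
  obtain ⟨δ, hδ, hb⟩ := h.exists_disc hlt hl hν
  obtain ⟨x, hxb, hxS⟩ := mem_closure_iff_nhds.1 hlS _ (ball_mem_nhds l hδ)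
  have hD : IsPreconnected (ball l δ ∩ {p | ⟪n, p⟫ < s₁}) :=
    ((convex_ball l δ).inter (convex_lt_inner n s₁)).isPreconnected
  obtain ⟨K, hK⟩ := exists_isometry_of_preconnected f
    (hS.union x hxS (show x ∈ ball l δ ∩ {p | ⟪n, p⟫ < s₁} from
      ⟨hxb, h.core_subset_lt (hSc hxS)⟩) hD) (union_subset hSc hb)
  refine ⟨K, ?_, fun p hp => hK p (Or.inl hp)⟩
  filter_upwards [inter_mem_nhdsWithin {p | ⟪n, p⟫ < s₁} (ball_mem_nhds l hδ)] with p hp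
  exact hK p (Or.inr ⟨hp.2, hp.1⟩)

lemma Strip.exists_germ (h : Strip U n s₂ s₁) (hlt : s₂ < s₁) (f : U.Bd ≃ᵢ V.Bd)
    (hl : l ∈ U) (hν : ⟪n, l⟫ = s₁) : ∃ K, Germ f n s₁ l K := by
  obtain ⟨δ, hδ, hb⟩ := h.exists_disc hlt hl hν
  obtain ⟨K, hK, -⟩ := h.exists_germ_of_closure hlt f hl hν
    ((convex_ball l δ).inter (convex_lt_inner n s₁)).isPreconnected hb (by
      rw [mem_closure_iff_nhdsWithin_neBot, inter_comm,
        nhdsWithin_inter_of_mem' (mem_nhdsWithin_of_mem_nhds (ball_mem_nhds l hδ))]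
      exact neBot_nhdsWithin_lt h.norm hν)
  exact ⟨K, hK⟩

lemma Germ.eq_on (h : Strip U n s₂ s₁) {f : U.Bd ≃ᵢ V.Bd}
    {K : Plane ≃ᵢ Plane} (hK : Germ f n s₁ l K) {S : Set Plane} (hS : IsPreconnected S)
    (hSc : S ⊆ U.core) (hlS : l ∈ closure S) : ∀ p ∈ S, U.F f p = K p := by
  obtain ⟨q, hqS, hq⟩ := hK.exists_nhds hlS (hSc.trans h.core_subset_lt)
  exact F_eq_isometry_of_preconnected f hS hSc hqS hq

lemma Germ.eventually_eq (h : Strip U n s₂ s₁) {f : U.Bd ≃ᵢ V.Bd}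
    {K : Plane ≃ᵢ Plane} (hK : Germ f n s₁ l K) {S : Set Plane} (hS : IsPreconnected S)
    (hSc : S ⊆ U.core) (hlS : l ∈ closure S) {p : Plane} (hp : p ∈ S) :
    ∀ᶠ z in 𝓝 p, U.F f z = K z := by
  obtain ⟨δ, hδ, hb⟩ := Metric.isOpen_iff.1 isOpen_core _ (hSc hp)
  have := hK.eq_on h (hS.union p hp (mem_ball_self hδ) (convex_ball p δ).isPreconnected)
    (union_subset hSc hb) (closure_mono subset_union_left hlS)
  exact Metric.eventually_nhds_iff_ball.2 ⟨δ, hδ, fun z hz => this z (Or.inr hz)⟩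

/-- Germs at two points adherent to the same connected part of the core agree. -/
lemma Germ.of_closure (h : Strip U n s₂ s₁) {n' l' : Plane} {s₂' s₁' : ℝ} (h' : Strip U n' s₂' s₁')
    (hlt : s₂' < s₁') {f : U.Bd ≃ᵢ V.Bd} {K : Plane ≃ᵢ Plane} (hK : Germ f n s₁ l K)
    (hl : l' ∈ U) (hν : ⟪n', l'⟫ = s₁') {S : Set Plane} (hS : IsPreconnected S)
    (hSc : S ⊆ U.core) (hlS : l ∈ closure S) (hlS' : l' ∈ closure S) : Germ f n' s₁' l' K := by
  obtain ⟨K', hK', -⟩ := h'.exists_germ_of_closure hlt f hl hν hS hSc hlS'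
  obtain ⟨p, hp⟩ : S.Nonempty := closure_nonempty_iff.1 ⟨_, hlS⟩
  rwa [eq_of_eventually_eq (hK.eventually_eq h hS hSc hlS hp) (hK'.eventually_eq h' hS hSc hlS' hp)]

/-- The germs along a segment of the line contained in the domain agree. -/
lemma Germ.of_segment (h : Strip U n s₂ s₁) (hlt : s₂ < s₁) {f : U.Bd ≃ᵢ V.Bd} {K : Plane ≃ᵢ Plane}
    (hK : Germ f n s₁ l K) {l' : Plane} (hν : ⟪n, l⟫ = s₁) (hν' : ⟪n, l'⟫ = s₁)
    (hseg : segment ℝ l l' ⊆ U.carrier) : Germ f n s₁ l' K := by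
  have hsn : ∀ p ∈ segment ℝ l l', ⟪n, p⟫ = s₁ := by
    rintro p ⟨a, b, -, -, hab, rfl⟩
    rw [inner_add_right, real_inner_smul_right, real_inner_smul_right, hν, hν', ← add_mul, hab,
      one_mul]
  have hcomp : IsCompact (segment ℝ l l') := by
    rw [segment_eq_image_lineMap]
    exact isCompact_Icc.image AffineMap.lineMap_continuous
  have hO : IsOpen (U.carrier ∩ {p | s₂ < ⟪n, p⟫}) :=
    U.isOpen.inter (isOpen_lt (by fun_prop) (by fun_prop))
  obtain ⟨δ, hδ, hth⟩ := hcomp.exists_thickening_subset_open hO fun p hp =>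
    ⟨hseg hp, by rw [mem_ofPred_eq, hsn p hp]; exact hlt⟩
  have hcl : ∀ p ∈ segment ℝ l l', p ∈ closure (thickening δ (segment ℝ l l') ∩
      {p | ⟪n, p⟫ < s₁}) := fun p hp => by
    rw [mem_closure_iff_nhdsWithin_neBot, inter_comm, nhdsWithin_inter_of_mem'
      (mem_nhdsWithin_of_mem_nhds (isOpen_thickening.mem_nhds (self_subset_thickening hδ _ hp)))]
    exact neBot_nhdsWithin_lt h.norm (hsn p hp)
  refine hK.of_closure h h hlt (hseg (right_mem_segment ℝ l l')) hν' 
    (((convex_segment l l').thickening δ).inter (convex_lt_inner n s₁)).isPreconnected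
    (fun p hp => ?_) (hcl _ (left_mem_segment ℝ l l')) (hcl _ (right_mem_segment ℝ l l'))
  exact h.mem_core_iff.2 ⟨(hth hp.1).1, (hth hp.1).2, hp.2⟩

/-- A path leaving an open set has a first exit time. -/
lemma exists_exit {γ : ℝ → Plane} (hγ : ContinuousOn γ (Icc 0 1)) {O : Set Plane} (hO : IsOpen O)
    (h0 : γ 0 ∈ O) (h1 : γ 1 ∉ O) :
    ∃ b ∈ Ioc (0:ℝ) 1, γ b ∉ O ∧ ∀ t ∈ Ico 0 b, γ t ∈ O := by
  set T := Icc (0:ℝ) 1 ∩ γ ⁻¹' Oᶜ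
  have hT : IsClosed T := hγ.preimage_isClosed_of_isClosed isClosed_Icc hO.isClosed_compl
  have hne : T.Nonempty := ⟨1, by simp, h1⟩
  have hbd : BddBelow T := ⟨0, fun t ht => ht.1.1⟩
  have hm := hT.csInf_mem hne hbd
  refine ⟨sInf T, ⟨lt_of_le_of_ne hm.1.1 fun e => hm.2 (e ▸ h0), hm.1.2⟩, hm.2, fun t ht => ?_⟩
  by_contra hc
  exact not_lt.2 (csInf_le hbd ⟨⟨ht.1, ht.2.le.trans hm.1.2⟩, hc⟩) ht.2

/-- A path leaving the core inside the domain does so through one of the two lines. -/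
lemma Strip.exists_exit (h : Strip U n s₂ s₁) {γ : ℝ → Plane}
    (hγ : ContinuousOn γ (Icc 0 1)) (hU : MapsTo γ (Icc 0 1) U.carrier) (h0 : γ 0 ∈ U.core)
    (h1 : γ 1 ∉ U.core) : ∃ b ∈ Ioc (0:ℝ) 1, (∀ t ∈ Ico 0 b, γ t ∈ U.core) ∧
      γ b ∈ closure (γ '' Ico 0 b) ∧ (⟪n, γ b⟫ = s₂ ∨ ⟪n, γ b⟫ = s₁) := by
  obtain ⟨b, hb, hbc, hc⟩ := Dom.exists_exit hγ isOpen_core h0 h1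
  have hcl : γ b ∈ closure (γ '' Ico 0 b) := by
    have : b ∈ closure (Ico 0 b) := by rw [closure_Ico hb.1.ne]; exact right_mem_Icc.2 hb.1.le
    exact ((hγ b ⟨hb.1.le, hb.2⟩).mono fun t ht => ⟨ht.1, ht.2.le.trans hb.2⟩).mem_closure_image this
  refine ⟨b, hb, hc, hcl, ?_⟩
  have hsub : γ '' Ico 0 b ⊆ {p | s₂ ≤ ⟪n, p⟫} ∩ {p | ⟪n, p⟫ ≤ s₁} := by
    rintro _ ⟨t, ht, rfl⟩
    have := (h.mem_core_iff.1 (hc t ht)).2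
    exact ⟨this.1.le, this.2.le⟩
  have hle := closure_minimal hsub ((isClosed_le (by fun_prop) (by fun_prop)).inter
    (isClosed_le (by fun_prop) (by fun_prop))) hcl
  by_contra! hne
  exact hbc (h.mem_core_iff.2 ⟨hU ⟨hb.1.le, hb.2⟩, lt_of_le_of_ne hle.1 hne.1.symm,
    lt_of_le_of_ne hle.2 hne.2⟩)

/-- Some germs at the two lines of a strip are restrictions of the same isometry. -/
lemma Strip.exists_connecting (h : Strip U n s₂ s₁) (hlt : s₂ < s₁) (f : U.Bd ≃ᵢ V.Bd) :
    ∃ l₁ ∈ U, ∃ l₂ ∈ U, ⟪n, l₁⟫ = s₁ ∧ ⟪n, l₂⟫ = s₂ ∧ ∃ J : Plane ≃ᵢ Plane,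
      Germ f n s₁ l₁ J ∧ Germ f (-n) (-s₂) l₂ J := by
  have hfr := frame_rot h.norm
  have hU : IsPathConnected U.carrier := (IsOpen.isConnected_iff_isPathConnected U.isOpen).1 U.isDom.2
  obtain ⟨γ, hγ⟩ := hU.joinedIn _ (h.up (coord n (rot n) (s₁ + 1) 0) (by rw [hfr.inner_n]; linarith))
    _ (h.dn (coord n (rot n) (s₂ - 1) 0) (by rw [hfr.inner_n]; linarith))
  set g : unitInterval → ℝ := fun t => ⟪n, γ t⟫
  have hg : Continuous g := by fun_prop
  have hg0 : g 0 = s₁ + 1 := by simp only [g, γ.source, hfr.inner_n]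
  have hg1 : g 1 = s₂ - 1 := by simp only [g, γ.target, hfr.inner_n]
  obtain ⟨b, hb, hbmin⟩ := (show IsClosed {t | g t ≤ s₂} from isClosed_le hg continuous_const).isCompact.exists_isLeast
    ⟨1, by change g 1 ≤ s₂; linarith⟩
  obtain ⟨a, ha, hamax⟩ := ((show IsClosed {t | s₁ ≤ g t} from isClosed_le continuous_const hg).inter
    (isClosed_Iic (a := b))).isCompact.exists_isGreatest
    ⟨0, by change s₁ ≤ g 0; linarith, b.2.1⟩
  have hab : a < b := lt_of_le_of_ne ha.2 fun e => by
    have h1 : s₁ ≤ g a := ha.1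
    have h2 : g b ≤ s₂ := hb
    rw [e] at h1; linarith
  have hin : ∀ t ∈ Ioo a b, s₂ < g t ∧ g t < s₁ := fun t ht =>
    ⟨not_le.1 fun hc => not_lt.2 (hbmin hc) ht.2, not_le.1 fun hc => not_lt.2 (hamax ⟨hc, ht.2.le⟩) ht.1⟩
  have hSc : γ '' Ioo a b ⊆ U.core := by
    rintro _ ⟨t, ht, rfl⟩
    exact h.mem_core_iff.2 ⟨hγ t, hin t ht⟩
  have hS : IsPreconnected (γ '' Ioo a b) := isPreconnected_Ioo.image _ γ.continuous.continuousOn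
  have hcl : closure (Ioo a b) = Icc a b := closure_Ioo hab.ne
  have hca : γ a ∈ closure (γ '' Ioo a b) :=
    image_closure_subset_closure_image γ.continuous ⟨a, hcl ▸ left_mem_Icc.2 hab.le, rfl⟩
  have hcb : γ b ∈ closure (γ '' Ioo a b) :=
    image_closure_subset_closure_image γ.continuous ⟨b, hcl ▸ right_mem_Icc.2 hab.le, rfl⟩
  have hsub : γ '' Ioo a b ⊆ {p | s₂ ≤ ⟪n, p⟫} ∩ {p : Plane | ⟪n, p⟫ ≤ s₁} := by
    rintro _ ⟨t, ht, rfl⟩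
    exact ⟨(hin t ht).1.le, (hin t ht).2.le⟩
  have hle := closure_minimal hsub
    ((isClosed_le (by fun_prop) (by fun_prop)).inter (isClosed_le (by fun_prop) (by fun_prop)))
  have hνa : ⟪n, γ a⟫ = s₁ := le_antisymm (hle hca).2 ha.1
  have hνb : ⟪n, γ b⟫ = s₂ := le_antisymm hb (hle hcb).1
  obtain ⟨J, hJ, -⟩ := h.exists_germ_of_closure hlt f (hγ a) hνa hS hSc hca
  exact ⟨_, hγ a, _, hγ b, hνa, hνb, J, hJ, hJ.of_closure h h.flip (neg_lt_neg hlt) (hγ b)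
    (by rw [inner_neg_left, hνb]) hS hSc hca hcb⟩

end Dom

lemma inner_lt_of_mem_interior {n p : Plane} {s : ℝ} (hn : ‖n‖ = 1) {S : Set Plane}
    (hS : ∀ p ∈ S, ⟪n, p⟫ ≤ s) (hp : p ∈ interior S) : ⟪n, p⟫ < s := by
  obtain ⟨ε, hε, hb⟩ := Metric.mem_nhds_iff.1 (mem_interior_iff_mem_nhds.1 hp)
  have h1 := hS (p + (ε / 2) • n) (hb (by
    rw [mem_ball, dist_eq_norm, add_sub_cancel_left, norm_smul, hn, mul_one, Real.norm_eq_abs,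
      abs_of_pos (half_pos hε)]
    linarith))
  rw [inner_add_right, real_inner_smul_right, real_inner_self_eq_norm_sq, hn] at h1
  linarith

namespace Dom
variable {U V : Dom} {q : Plane} {n τ l p : Plane} {s s₂ s₁ : ℝ} {f : U.Bd ≃ᵢ V.Bd}
  {K : Plane ≃ᵢ Plane}

lemma core_subset_interior_hull : U.core ⊆ interior U.hull := by
  rw [core_eq]; exact inter_subset_right

lemma Strip.eventually_mem_core (h : Strip U n s₂ s₁) (hlt : s₂ < s₁) (hl : l ∈ U)
    (hν : ⟪n, l⟫ = s₁) : ∀ᶠ p in 𝓝[{p | ⟪n, p⟫ < s₁}] l, p ∈ U.core := by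
  obtain ⟨δ, hδ, hb⟩ := h.exists_disc hlt hl hν
  filter_upwards [inter_mem_nhdsWithin {p | ⟪n, p⟫ < s₁} (ball_mem_nhds l hδ)] with p hp
  exact hb ⟨hp.2, hp.1⟩

lemma Germ.tendsto (hK : Germ f n s l K) :
    Tendsto (U.F f) (𝓝[{p | ⟪n, p⟫ < s}] l) (𝓝 (K l)) :=
  ((K.continuous.tendsto l).mono_left nhdsWithin_le_nhds).congr' (hK.mono fun _ h => h.symm)

lemma Germ.map_mem (h : Strip U n s₂ s₁) (hlt : s₂ < s₁) (hl : l ∈ U) (hν : ⟪n, l⟫ = s₁)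
    (hK : Germ f n s₁ l K) : K l ∈ V := by
  have := neBot_nhdsWithin_lt h.norm hν
  exact F_limit_mem f (h.eventually_mem_core hlt hl hν) (u := id) nhdsWithin_le_nhds hK.tendsto hl

lemma Germ.map_not_mem_core (h : Strip U n s₂ s₁) (hlt : s₂ < s₁) (hl : l ∈ U) (hν : ⟪n, l⟫ = s₁)
    (hK : Germ f n s₁ l K) : K l ∉ V.core := fun hc => by
  have := neBot_nhdsWithin_lt h.norm hν
  have := F_limit_mem_core f (h.eventually_mem_core hlt hl hν) (u := id) nhdsWithin_le_nhds
    hK.tendsto hc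
  exact (h.mem_core_iff.1 this).2.2.ne hν

lemma Germ.map_mem_hull (h : Strip U n s₂ s₁) (hlt : s₂ < s₁) (hl : l ∈ U) (hν : ⟪n, l⟫ = s₁)
    (hK : Germ f n s₁ l K) : K l ∈ V.hull := by
  have := neBot_nhdsWithin_lt h.norm hν
  exact isClosed_hull.mem_of_tendsto hK.tendsto ((h.eventually_mem_core hlt hl hν).mono
    fun p hp => interior_subset (core_subset_interior_hull (F_mem_core f hp)))

lemma Germ.not_mem_interior_hull (h : Strip U n s₂ s₁) (hlt : s₂ < s₁) (hl : l ∈ U)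
    (hν : ⟪n, l⟫ = s₁) (hK : Germ f n s₁ l K) : K l ∉ interior V.hull := fun hi =>
  hK.map_not_mem_core h hlt hl hν (by rw [core_eq]; exact ⟨hK.map_mem h hlt hl hν, hi⟩)

/-- The isometry of a germ maps the half-plane below the line onto a superset of the hull. -/
lemma Germ.hull_subset (h : Strip U n s₂ s₁) (hlt : s₂ < s₁) (hl : l ∈ U) (hν : ⟪n, l⟫ = s₁)
    (hK : Germ f n s₁ l K) {y : Plane} (hy : y ∈ V.hull) : ⟪n, K.symm y⟫ ≤ s₁ := by
  by_contra! hlty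
  set z := K.symm y with hz
  set d : ℝ → Plane := fun ε => AffineMap.lineMap l z (-ε)
  have hd : Continuous d := AffineMap.lineMap_continuous.comp continuous_neg
  have hd0 : d 0 = l := by simp [d]
  have hνd : ∀ ε, ⟪n, d ε⟫ = s₁ - ε * (⟪n, z⟫ - s₁) := fun ε => by
    simp only [d, AffineMap.lineMap_apply, vsub_eq_sub, vadd_eq_add, inner_add_right,
      real_inner_smul_right, inner_sub_right, hν]
    ring
  have ht : Tendsto d (𝓝[>] 0) (𝓝[{p | ⟪n, p⟫ < s₁}] l) := by
    rw [tendsto_nhdsWithin_iff]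
    refine ⟨hd0 ▸ (hd.tendsto 0).mono_left nhdsWithin_le_nhds, ?_⟩
    filter_upwards [self_mem_nhdsWithin] with ε hε
    rw [hνd]
    have : 0 < ε * (⟪n, z⟫ - s₁) := mul_pos hε (sub_pos.2 hlty)
    linarith
  obtain ⟨ε, ⟨hFK, hc⟩, hε⟩ := ((ht.eventually (hK.and (h.eventually_mem_core hlt hl hν))).and
    self_mem_nhdsWithin).exists
  have hε : 0 < ε := hε
  have h1 : K (d ε) ∈ interior V.hull := hFK ▸ core_subset_interior_hull (F_mem_core f hc)
  refine hK.not_mem_interior_hull h hlt hl hν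
    (convex_hull.openSegment_interior_self_subset_interior h1 hy ?_)
  have hKd : K (d ε) = AffineMap.lineMap (K l) y (-ε) := by
    have : K (d ε) = _ :=
      K.toRealAffineIsometryEquiv.toAffineEquiv.toAffineMap.apply_lineMap l z (-ε)
    rw [this]
    change AffineMap.lineMap (K l) (K z) (-ε) = _
    rw [hz, K.apply_symm_apply]
  rw [hKd, openSegment_eq_image_lineMap]
  refine ⟨ε / (1 + ε), ⟨by positivity, (div_lt_one (by positivity)).2 (by linarith)⟩, ?_⟩
  simp only [AffineMap.lineMap_apply, vsub_eq_sub, vadd_eq_add]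
  have : (1 + ε) ≠ 0 := by positivity
  have e : ε / (1 + ε) + (-ε) * (1 - ε / (1 + ε)) = 0 := by field_simp; ring
  linear_combination (norm := module) e • (y - K l)

lemma Germ.inner_lt_of_mem_core (h : Strip U n s₂ s₁) (hlt : s₂ < s₁) (hl : l ∈ U) (hν : ⟪n, l⟫ = s₁)
    (hK : Germ f n s₁ l K) {y : Plane} (hy : y ∈ V.core) : ⟪n, K.symm y⟫ < s₁ := by
  refine inner_lt_of_mem_interior h.norm (S := K ⁻¹' V.hull) (fun p hp => ?_) ?_
  · simpa using hK.hull_subset h hlt hl hν hp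
  · exact preimage_interior_subset_interior_preimage K.continuous
      (by simpa using core_subset_interior_hull hy)

/-- The isometry of a germ maps the half-plane beyond the line into the other domain. -/
lemma Germ.map_up (h : Strip U n s₂ s₁) (hlt : s₂ < s₁) (hl : l ∈ U) (hν : ⟪n, l⟫ = s₁)
    (hK : Germ f n s₁ l K) {p : Plane} (hp : s₁ < ⟪n, p⟫) : K p ∈ V := by
  refine subset_of_preconnected (S := K '' {p | s₁ < ⟪n, p⟫})
    ((convex_halfPlane n s₁).isPreconnected.image _ K.continuous.continuousOn) ?_ ?_ ⟨p, hp, rfl⟩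
  · rintro _ ⟨p, hp, rfl⟩ hc
    have := hK.hull_subset h hlt hl hν hc
    rw [K.symm_apply_apply] at this
    exact not_lt.2 this hp
  · have hO : K ⁻¹' V.carrier ∈ 𝓝 l :=
      (V.isOpen.preimage K.continuous).mem_nhds (hK.map_mem h hlt hl hν)
    have hcl : (𝓝[{p : Plane | ⟪-n, p⟫ < -s₁}] l).NeBot :=
      neBot_nhdsWithin_lt (by rw [norm_neg, h.norm]) (by rw [inner_neg_left, hν])
    obtain ⟨z, hz, hzs⟩ := ((eventually_nhdsWithin_of_eventually_nhds
      (s := {p : Plane | ⟪-n, p⟫ < -s₁}) hO).and self_mem_nhdsWithin).exists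
    have hzs : ⟪-n, z⟫ < -s₁ := hzs
    rw [inner_neg_left, neg_lt_neg_iff] at hzs
    exact ⟨K z, ⟨z, hzs, rfl⟩, hz⟩

lemma Germ.dp_le (h : Strip U n s₂ s₁) (hlt : s₂ < s₁) (hl : l ∈ U) (hν : ⟪n, l⟫ = s₁)
    (hK : Germ f n s₁ l K) (x : U.Bd) : V.dp (K l) (f x) ≤ 3 * U.dp l x := by
  have := neBot_nhdsWithin_lt h.norm hν
  have h1 : Tendsto (fun w => V.dp (U.F f w) (f x)) (𝓝[{p | ⟪n, p⟫ < s₁}] l)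
      (𝓝 (V.dp (K l) (f x))) :=
    ((continuousOn_dp (f x)).continuousAt (V.isOpen.mem_nhds (hK.map_mem h hlt hl hν))).tendsto.comp
      hK.tendsto
  have h2 : Tendsto (fun w => 3 * U.dp w x) (𝓝[{p | ⟪n, p⟫ < s₁}] l) (𝓝 (3 * U.dp l x)) :=
    (((continuousOn_dp x).continuousAt (U.isOpen.mem_nhds hl)).tendsto.mono_left
      nhdsWithin_le_nhds).const_mul 3
  exact le_of_tendsto_of_tendsto h1 h2 ((h.eventually_mem_core hlt hl hν).mono
    fun w hw => dp_F_le f hw x)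

/-- A germ whose value is the base point of a germ of the identity has that base point. -/
lemma Germ.eq_of_map_eq (h : Strip U n s₂ s₁) (hlt : s₂ < s₁) (hl : l ∈ U) (hν : ⟪n, l⟫ = s₁)
    (hK : Germ f n s₁ l K) {n' l' : Plane} {s₂' s₁' : ℝ} (h' : Strip U n' s₂' s₁')
    (hlt' : s₂' < s₁') (hl' : l' ∈ U) (hν' : ⟪n', l'⟫ = s₁')
    (hI : Germ f n' s₁' l' (IsometryEquiv.refl _)) (he : K l = l') : l = l' := by
  have := neBot_nhdsWithin_lt h.norm hν
  have hc := h.eventually_mem_core hlt hl hν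
  have ht : Tendsto K (𝓝[{p | ⟪n, p⟫ < s₁}] l) (𝓝[{p | ⟪n', p⟫ < s₁'}] l') := by
    rw [tendsto_nhdsWithin_iff]
    refine ⟨he ▸ (K.continuous.tendsto l).mono_left nhdsWithin_le_nhds, ?_⟩
    filter_upwards [hK, hc] with w hw hwc
    rw [← hw]
    exact hI.inner_lt_of_mem_core h' hlt' hl' hν' (F_mem_core f hwc)
  have hfix : ∀ᶠ w in 𝓝[{p | ⟪n, p⟫ < s₁}] l, K w = w := by
    filter_upwards [hK, hc, ht.eventually hI, ht.eventually (h'.eventually_mem_core hlt' hl' hν')]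
      with w h1 h2 h3 h4
    have h3 : U.F f (K w) = K w := h3
    rw [← F_symm_F f h4, h3, ← h1, F_symm_F f h2]
  rw [← he]
  exact tendsto_nhds_unique (tendsto_id.mono_left nhdsWithin_le_nhds)
    (((K.continuous.tendsto l).mono_left nhdsWithin_le_nhds).congr' hfix)

end Dom

namespace Dom
variable {U V : Dom} {q : Plane} {n τ l p : Plane} {s s₂ s₁ : ℝ} {f : U.Bd ≃ᵢ V.Bd}
  {K : Plane ≃ᵢ Plane}

lemma neBot_nhdsWithin_gt (hn : ‖n‖ = 1) (hl : ⟪n, l⟫ = s) :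
    (𝓝[{p : Plane | s < ⟪n, p⟫}] l).NeBot := by
  have := neBot_nhdsWithin_lt (n := -n) (l := l) (s := -s) (by rw [norm_neg, hn])
    (by rw [inner_neg_left, hl])
  simpa only [inner_neg_left, neg_lt_neg_iff] using this

/-- A boundary element accessible from the half-plane `s < ⟪n, ·⟫` along straight segments. -/
def Access (n : Plane) (s : ℝ) (x : U.Bd) : Prop :=
  ⟪n, x.pos⟫ = s ∧ ∀ q, s < ⟪n, q⟫ → U.dp q x = dist q x.pos

lemma Strip.exists_access (h : Strip U n s₂ s₁) (hp : p ∉ U) (hν : ⟪n, p⟫ = s₁) :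
    ∃ x : U.Bd, x.pos = p ∧ Access n s₁ x := by
  obtain ⟨x, hx, hd⟩ := access (convex_halfPlane n s₁) (fun q hq => h.up q hq)
    (mem_closure_iff_nhdsWithin_neBot.2 (neBot_nhdsWithin_gt h.norm hν)) hp
  exact ⟨x, hx, by rw [hx, hν], fun q hq => hx ▸ hd q hq⟩

lemma Access.dp_eq {x : U.Bd} (hx : Access n s x) (hn : ‖n‖ = 1) (hp : p ∈ U) (hν : ⟪n, p⟫ = s) :
    U.dp p x = dist p x.pos := by
  have := neBot_nhdsWithin_gt hn hν
  refine tendsto_nhds_unique (f := fun q => U.dp q x) (l := 𝓝[{q : Plane | s < ⟪n, q⟫}] p)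
    (((continuousOn_dp x).continuousAt (U.isOpen.mem_nhds hp)).tendsto.mono_left
      nhdsWithin_le_nhds) ?_
  have h2 : Tendsto (fun q : Plane => dist q x.pos) (𝓝[{q : Plane | s < ⟪n, q⟫}] p)
      (𝓝 (dist p x.pos)) :=
    (Continuous.tendsto (by fun_prop) p).mono_left nhdsWithin_le_nhds
  refine h2.congr' ?_
  filter_upwards [self_mem_nhdsWithin] with q hq
  exact (hx.2 q hq).symm

lemma Access.dist_eq {x y : U.Bd} (hx : Access n s x) (hy : Access n s y) (hn : ‖n‖ = 1) :
    dist x y = dist x.pos y.pos := by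
  refine le_antisymm ?_ (Bd.dist_pos_le x y)
  have := neBot_nhdsWithin_gt hn hx.1
  have h2 : Tendsto (fun q : Plane => dist q x.pos + dist q y.pos)
      (𝓝[{q : Plane | s < ⟪n, q⟫}] x.pos) (𝓝 (dist x.pos x.pos + dist x.pos y.pos)) :=
    (Continuous.tendsto (by fun_prop) x.pos).mono_left nhdsWithin_le_nhds
  rw [dist_self, zero_add] at h2
  refine ge_of_tendsto h2 ?_
  filter_upwards [self_mem_nhdsWithin] with q hq
  rw [← hx.2 q hq, ← hy.2 q hq]
  exact dist_le_dp_add_dp q x y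

lemma Access.ext {x y : U.Bd} (hx : Access n s x) (hy : Access n s y) (hn : ‖n‖ = 1)
    (h : x.pos = y.pos) : x = y := dist_eq_zero.1 (by rw [hx.dist_eq hy hn, h, dist_self])

open Classical in
/-- The boundary trace of the map `F` along the line `⟪n, ·⟫ = s`. -/
def trace (f : U.Bd ≃ᵢ V.Bd) (n : Plane) (s : ℝ) (p : Plane) : Plane :=
  if h : p ∈ U ∧ ∃ K, Germ f n s p K then h.2.choose p
  else if h : ∃ x : U.Bd, x.pos = p ∧ Access n s x then (f h.choose).pos else p

lemma Germ.trace_eq (hK : Germ f n s p K) (hn : ‖n‖ = 1) (hp : p ∈ U) (hν : ⟪n, p⟫ = s) :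
    trace f n s p = K p := by
  have h : p ∈ U ∧ ∃ K, Germ f n s p K := ⟨hp, K, hK⟩
  rw [trace, dif_pos h, h.2.choose_spec.unique hn hν hK]

lemma Access.trace_eq {x : U.Bd} (hx : Access n s x) (hn : ‖n‖ = 1) :
    trace f n s x.pos = (f x).pos := by
  have h : ∃ y : U.Bd, y.pos = x.pos ∧ Access n s y := ⟨x, rfl, hx⟩
  rw [trace, dif_neg fun h => x.pos_not_mem h.1, dif_pos h,
    h.choose_spec.2.ext hx hn h.choose_spec.1]

/-- Core points close to the image of an accessible element are witnessed by points of the line. -/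
lemma Access.exists_near {x : U.Bd} (hx : Access n s₁ x) (h : Strip U n s₂ s₁)
    {v : Plane} (hv : v ∈ V.core) (hδ : 8 * V.dp v (f x) < s₁ - s₂) :
    ∃ l ∈ U, ⟪n, l⟫ = s₁ ∧ U.dp l x ≤ 8 * V.dp v (f x) := by
  set δ := V.dp v (f x) with hδd
  have hδ0 : 0 < δ := dp_pos (core_subset hv) _
  set u := V.F f.symm v with hu
  have huc : u ∈ U.core := F_mem_core f.symm hv
  have hux : U.dp u x ≤ 3 * δ := by
    have := dp_F_le f.symm hv (f x)
    rwa [f.symm_apply_apply] at this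
  set z := x.pos + δ • n with hz
  have hνz : ⟪n, z⟫ = s₁ + δ := by
    rw [hz, inner_add_right, real_inner_smul_right, real_inner_self_eq_norm_sq, h.norm, hx.1]; ring
  have hzU : z ∈ U := h.up z (by rw [hνz]; linarith)
  have hzx : U.dp z x = δ := by
    rw [hx.2 z (by rw [hνz]; linarith), hz, dist_eq_norm, add_sub_cancel_left, norm_smul, h.norm,
      mul_one, Real.norm_eq_abs, abs_of_pos hδ0]
  have huz : dist (U.pt u) (U.pt z) ≤ 4 * δ := by
    have := dist_triangle (U.pt u) x.1 (U.pt z)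
    rw [dist_comm x.1] at this
    change _ ≤ U.dp u x + U.dp z x at this
    linarith
  obtain ⟨γ, hγ, hγU, -, -, h0, h1, hd⟩ := exists_path_X (U.pt u) (U.pt z) hδ0
  have e0 : γ 0 = u := by
    rcases h0 with h0 | h0
    · rw [← pos_pt (hγU (left_mem_Icc.2 zero_le_one)), ← h0, pos_pt (core_subset huc)]
    · rw [pos_pt (core_subset huc)] at h0; exact absurd (core_subset huc) h0
  have e1 : γ 1 = z := by
    rcases h1 with h1 | h1
    · rw [← pos_pt (hγU (right_mem_Icc.2 zero_le_one)), ← h1, pos_pt hzU]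
    · rw [pos_pt hzU] at h1; exact absurd hzU h1
  obtain ⟨b, hb, -, -, hs⟩ := h.exists_exit hγ hγU (e0 ▸ huc) (by
    rw [e1, h.mem_core_iff, hνz]; rintro ⟨-, -, h⟩; linarith)
  have hbI : b ∈ Icc (0:ℝ) 1 := ⟨hb.1.le, hb.2⟩
  have hdp : U.dp (γ b) x ≤ 8 * δ := by
    have h2 := hd b hbI
    have h3 := dp_le_dist_add_dp (γ b) u x
    rw [dist_comm] at h3
    have : 0 ≤ dist (U.pt (γ b)) (U.pt z) := dist_nonneg
    linarith
  refine ⟨γ b, hγU hbI, hs.resolve_left fun hs => ?_, hdp⟩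
  have h4 : |⟪n, x.pos⟫ - ⟪n, γ b⟫| ≤ dist x.pos (γ b) := by
    rw [← inner_sub_right, dist_eq_norm]
    simpa [h.norm] using abs_real_inner_le_norm n (x.pos - γ b)
  rw [hx.1, hs, dist_comm] at h4
  have h5 := dist_pos_le_dp (hγU hbI) x
  linarith [le_abs_self (s₁ - s₂)]

lemma Access.exists_near_germ {x : U.Bd} (hx : Access n s₁ x) (h : Strip U n s₂ s₁) (hlt : s₂ < s₁)
    {v : Plane} (hv : v ∈ V.core) (hδ : 8 * V.dp v (f x) < s₁ - s₂) :
    ∃ y ∈ V, y ∉ interior V.hull ∧ V.dp y (f x) ≤ 24 * V.dp v (f x) := by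
  obtain ⟨l, hl, hν, hd⟩ := hx.exists_near h hv hδ
  obtain ⟨K, hK⟩ := h.exists_germ hlt f hl hν
  exact ⟨K l, hK.map_mem h hlt hl hν, hK.not_mem_interior_hull h hlt hl hν,
    (hK.dp_le h hlt hl hν x).trans (by linarith)⟩

/-- Points outside the interior of the hull approach the image of an accessible element. -/
lemma Access.exists_outer {x : U.Bd} (hx : Access n s₁ x) (h : Strip U n s₂ s₁) (hlt : s₂ < s₁)
    (f : U.Bd ≃ᵢ V.Bd) {ε : ℝ} (hε : 0 < ε) :
    ∃ y ∈ V, y ∉ V.hull ∧ V.dp y (f x) < ε := by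
  suffices ∃ y ∈ V, y ∉ interior V.hull ∧ V.dp y (f x) < ε by
    obtain ⟨y, hy, hyi, hd⟩ := this
    have h1 : ∀ᶠ z in 𝓝 y, V.dp z (f x) < ε :=
      ((continuousOn_dp (f x)).continuousAt (V.isOpen.mem_nhds hy)).eventually_lt
        continuousAt_const hd
    have h2 : ∃ᶠ z in 𝓝 y, z ∉ V.hull := fun hc => hyi
      (mem_interior_iff_mem_nhds.2 (by simpa using hc))
    obtain ⟨z, hz, hz1, hz2⟩ := (h2.and_eventually (h1.and (V.isOpen.mem_nhds hy))).exists
    exact ⟨z, hz2, hz, hz1⟩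
  obtain ⟨v, hv, hvd⟩ := Bd.exists_near (f x) (ε := min (ε / 25) ((s₁ - s₂) / 8))
    (lt_min (by positivity) (by linarith))
  have h1 := hvd.trans_le (min_le_left _ _)
  have h2 := hvd.trans_le (min_le_right _ _)
  by_cases hi : v ∈ interior V.hull
  · obtain ⟨y, hy, hyi, hyd⟩ := hx.exists_near_germ (f := f) h hlt
      (show v ∈ V.core by rw [core_eq]; exact ⟨hv, hi⟩) (by linarith)
    exact ⟨y, hy, hyi, by linarith [dp_nonneg (U := V) (p := v) (x := f x)]⟩
  · exact ⟨v, hv, hi, by linarith [dp_nonneg (U := V) (p := v) (x := f x)]⟩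

lemma Access.not_mem_interior_hull {x : U.Bd} (hx : Access n s₁ x) (h : Strip U n s₂ s₁)
    (hlt : s₂ < s₁) : (f x).pos ∉ interior V.hull := fun hi => by
  obtain ⟨r, hr, hb⟩ := Metric.isOpen_iff.1 isOpen_interior _ hi
  obtain ⟨y, hy, hyi, hd⟩ := hx.exists_outer h hlt f hr
  exact hyi (interior_subset (hb ((dist_pos_le_dp hy _).trans_lt hd)))

lemma Bd.pos_mem_hull (x : U.Bd) : x.pos ∈ U.hull := frontier_subset_hull x.pos_mem_frontier

lemma trace_not_mem_interior_hull (h : Strip U n s₂ s₁) (hlt : s₂ < s₁) (f : U.Bd ≃ᵢ V.Bd)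
    (hν : ⟪n, p⟫ = s₁) : trace f n s₁ p ∉ interior V.hull := by
  by_cases hp : p ∈ U
  · obtain ⟨K, hK⟩ := h.exists_germ hlt f hp hν
    rw [hK.trace_eq h.norm hp hν]
    exact hK.not_mem_interior_hull h hlt hp hν
  · obtain ⟨x, rfl, hx⟩ := h.exists_access hp hν
    rw [hx.trace_eq h.norm]
    exact hx.not_mem_interior_hull h hlt

lemma trace_mem_hull (h : Strip U n s₂ s₁) (hlt : s₂ < s₁) (f : U.Bd ≃ᵢ V.Bd)
    (hν : ⟪n, p⟫ = s₁) : trace f n s₁ p ∈ V.hull := by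
  by_cases hp : p ∈ U
  · obtain ⟨K, hK⟩ := h.exists_germ hlt f hp hν
    rw [hK.trace_eq h.norm hp hν]
    exact hK.map_mem_hull h hlt hp hν
  · obtain ⟨x, rfl, hx⟩ := h.exists_access hp hν
    rw [hx.trace_eq h.norm]
    exact (f x).pos_mem_hull

lemma trace_mem_iff (h : Strip U n s₂ s₁) (hlt : s₂ < s₁) (f : U.Bd ≃ᵢ V.Bd)
    (hν : ⟪n, p⟫ = s₁) : trace f n s₁ p ∈ V ↔ p ∈ U := by
  by_cases hp : p ∈ U
  · obtain ⟨K, hK⟩ := h.exists_germ hlt f hp hν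
    rw [hK.trace_eq h.norm hp hν]
    exact iff_of_true (hK.map_mem h hlt hp hν) hp
  · obtain ⟨x, rfl, hx⟩ := h.exists_access hp hν
    rw [hx.trace_eq h.norm]
    exact iff_of_false (f x).pos_not_mem hp

/-- Only the base point of an identity germ is mapped to itself by the trace. -/
lemma eq_of_trace_eq (h : Strip U n s₂ s₁) (hlt : s₂ < s₁)
    (hν : ⟪n, p⟫ = s₁) {n' l' : Plane} {s₂' s₁' : ℝ} (h' : Strip U n' s₂' s₁')
    (hlt' : s₂' < s₁') (hl' : l' ∈ U) (hν' : ⟪n', l'⟫ = s₁')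
    (hI : Germ f n' s₁' l' (IsometryEquiv.refl _)) (he : trace f n s₁ p = l') : p = l' := by
  have hp : p ∈ U := (trace_mem_iff h hlt f hν).1 (he ▸ hI.map_mem h' hlt' hl' hν')
  obtain ⟨K, hK⟩ := h.exists_germ hlt f hp hν
  rw [hK.trace_eq h.norm hp hν] at he
  exact hK.eq_of_map_eq h hlt hp hν h' hlt' hl' hν' hI he

end Dom

/-- A map of the line that is nonexpanding on a closed set and on the complementary intervals, and
Lipschitz between them, is nonexpanding. -/
lemma dist_le_of_closed {g : ℝ → Plane} {T : Set ℝ} (hT : IsClosed T)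
    (h1 : ∀ s ∈ T, ∀ t ∈ T, dist (g s) (g t) ≤ |s - t|)
    (h2 : ∀ s t, (∀ u ∈ uIcc s t, u ∉ T) → dist (g s) (g t) ≤ |s - t|)
    (h3 : ∀ s ∉ T, ∀ t ∈ T, dist (g s) (g t) ≤ 3 * |s - t|) (s t : ℝ) :
    dist (g s) (g t) ≤ |s - t| := by
  have key : ∀ s a, a ∈ T → (∀ u ∈ uIcc s a, u ∈ T → u = a) → dist (g s) (g a) ≤ |s - a| := by
    intro s a ha hu
    rcases eq_or_ne s a with rfl | hne
    · simp
    set w : ℝ → ℝ := fun ε => a + ε * (s - a)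
    have hlim : Tendsto (fun ε => |s - w ε| + 3 * |w ε - a|) (𝓝[>] 0) (𝓝 |s - a|) := by
      have hc : Continuous fun ε => |s - w ε| + 3 * |w ε - a| := by fun_prop
      have := (hc.tendsto 0).mono_left (nhdsWithin_le_nhds (s := Ioi 0))
      simpa [w] using this
    refine ge_of_tendsto hlim ?_
    filter_upwards [Ioo_mem_nhdsGT zero_lt_one] with ε hε
    have hwne : w ε ≠ a := by
      simp only [w, ne_eq, add_eq_left, mul_eq_zero, not_or]
      exact ⟨hε.1.ne', sub_ne_zero.2 hne⟩
    have hws : ∀ u ∈ uIcc s (w ε), u ∈ uIcc s a ∧ u ≠ a := by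
      intro u hu
      simp only [w] at hu
      rcases lt_or_gt_of_ne hne with hsa | hsa
      · rw [uIcc_of_le (by nlinarith [hε.2])] at hu
        rw [uIcc_of_le hsa.le]
        have : u < a := by nlinarith [hε.1, hu.2]
        exact ⟨⟨hu.1, this.le⟩, this.ne⟩
      · rw [uIcc_of_ge (by nlinarith [hε.2])] at hu
        rw [uIcc_of_ge hsa.le]
        have : a < u := by nlinarith [hε.1, hu.1]
        exact ⟨⟨this.le, hu.2⟩, this.ne'⟩
    have e1 := h2 s (w ε) fun u hu' hT => (hws u hu').2 (hu u (hws u hu').1 hT)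
    have e2 := h3 (w ε) (fun hT => hwne (hu _ (hws _ right_mem_uIcc).1 hT)) a ha
    linarith [dist_triangle (g s) (g (w ε)) (g a)]
  wlog hst : s ≤ t generalizing s t
  · rw [dist_comm, abs_sub_comm]; exact this t s (le_of_not_ge hst)
  by_cases hne : (T ∩ Icc s t).Nonempty
  · have hcomp : IsCompact (T ∩ Icc s t) := isCompact_Icc.inter_left hT
    obtain ⟨a, ha, hamin⟩ := hcomp.exists_isLeast hne
    obtain ⟨b, hb, hbmax⟩ := hcomp.exists_isGreatest hne
    have hab : a ≤ b := hamin hb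
    have e1 := key s a ha.1 fun u hu huT => by
      rw [uIcc_of_le ha.2.1] at hu
      exact le_antisymm hu.2 (hamin ⟨huT, hu.1, hu.2.trans ha.2.2⟩)
    have e2 := key t b hb.1 fun u hu huT => by
      rw [uIcc_of_ge hb.2.2] at hu
      exact le_antisymm (hbmax ⟨huT, hb.2.1.trans hu.1, hu.2⟩) hu.1
    have e3 := h1 a ha.1 b hb.1
    rw [dist_comm] at e2
    rw [abs_of_nonpos (by linarith [ha.2.1])] at e1
    rw [abs_of_nonneg (by linarith [hb.2.2])] at e2
    rw [abs_of_nonpos (by linarith)] at e3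
    rw [abs_of_nonpos (by linarith)]
    linarith [dist_triangle4 (g s) (g a) (g b) (g t)]
  · refine h2 s t fun u hu hT => hne ⟨u, hT, ?_⟩
    rwa [uIcc_of_le hst] at hu

namespace Dom
variable {U V : Dom} {n τ l p : Plane} {s s₂ s₁ : ℝ} {f : U.Bd ≃ᵢ V.Bd}
  {K : Plane ≃ᵢ Plane}

/-- The trace is nonexpanding. -/
lemma dist_trace_le (h : Strip U n s₂ s₁) (hlt : s₂ < s₁) (hfr : Frame n τ) (f : U.Bd ≃ᵢ V.Bd)
    (s t : ℝ) :
    dist (trace f n s₁ (coord n τ s₁ s)) (trace f n s₁ (coord n τ s₁ t)) ≤ |s - t| := by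
  refine dist_le_of_closed (g := fun t => trace f n s₁ (coord n τ s₁ t))
    (U.isOpen.isClosed_compl.preimage (continuous_coord n τ s₁)) ?_ ?_ ?_ s t
  · intro s hs t ht
    obtain ⟨x, hx, hxa⟩ := h.exists_access hs (hfr.inner_n s₁ s)
    obtain ⟨y, hy, hya⟩ := h.exists_access ht (hfr.inner_n s₁ t)
    rw [← hfr.dist_coord s₁, ← hx, ← hy, hxa.trace_eq h.norm, hya.trace_eq h.norm,
      ← hxa.dist_eq hya h.norm, ← f.dist_eq]
    exact Bd.dist_pos_le _ _
  · intro s t hu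
    have hseg : segment ℝ (coord n τ s₁ s) (coord n τ s₁ t) ⊆ U.carrier := by
      rw [segment_eq_image_lineMap]
      rintro _ ⟨r, hr, rfl⟩
      rw [lineMap_coord]
      refine not_not.1 (hu _ ?_)
      rw [← segment_eq_uIcc, segment_eq_image_lineMap]
      exact ⟨r, hr, by simp [AffineMap.lineMap_apply]; ring⟩
    have hs := hseg (left_mem_segment ℝ _ _)
    have ht := hseg (right_mem_segment ℝ _ _)
    obtain ⟨K, hK⟩ := h.exists_germ hlt f hs (hfr.inner_n s₁ s)
    have hK' := hK.of_segment h hlt (hfr.inner_n s₁ s) (hfr.inner_n s₁ t) hseg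
    rw [hK.trace_eq h.norm hs (hfr.inner_n s₁ s), hK'.trace_eq h.norm ht (hfr.inner_n s₁ t),
      K.dist_eq, hfr.dist_coord]
  · intro s hs t ht
    have hs : coord n τ s₁ s ∈ U := not_not.1 hs
    obtain ⟨K, hK⟩ := h.exists_germ hlt f hs (hfr.inner_n s₁ s)
    obtain ⟨y, hy, hya⟩ := h.exists_access ht (hfr.inner_n s₁ t)
    rw [← hfr.dist_coord s₁, ← hy, hK.trace_eq h.norm hs (hfr.inner_n s₁ s), hya.trace_eq h.norm,
      ← hya.dp_eq h.norm hs (hfr.inner_n s₁ s)]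
    exact (dist_pos_le_dp (hK.map_mem h hlt hs (hfr.inner_n s₁ s)) _).trans
      (hK.dp_le h hlt hs (hfr.inner_n s₁ s) y)

end Dom

namespace Dom
variable {U V : Dom} {n τ l p : Plane} {s s₂ s₁ a a₂ : ℝ} {f : U.Bd ≃ᵢ V.Bd}
  {K : Plane ≃ᵢ Plane}

/-- A nondegenerate strip with identity germs at base points of both lines. -/
structure Base (f : U.Bd ≃ᵢ V.Bd) (n τ : Plane) (s₂ s₁ a₂ a : ℝ) : Prop where
  strip : Strip U n s₂ s₁
  lt : s₂ < s₁
  frame : Frame n τ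
  mem₁ : coord n τ s₁ a ∈ U
  mem₂ : coord n τ s₂ a₂ ∈ U
  germ₁ : Germ f n s₁ (coord n τ s₁ a) (IsometryEquiv.refl _)
  germ₂ : Germ f (-n) (-s₂) (coord n τ s₂ a₂) (IsometryEquiv.refl _)

namespace Base

lemma neg (h : Base f n τ s₂ s₁ a₂ a) : Base f n (-τ) s₂ s₁ (-a₂) (-a) where
  strip := h.strip
  lt := h.lt
  frame := h.frame.neg_right
  mem₁ := by rw [coord_neg_right, neg_neg]; exact h.mem₁
  mem₂ := by rw [coord_neg_right, neg_neg]; exact h.mem₂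
  germ₁ := by rw [coord_neg_right, neg_neg]; exact h.germ₁
  germ₂ := by rw [coord_neg_right, neg_neg]; exact h.germ₂

lemma flip (h : Base f n τ s₂ s₁ a₂ a) : Base f (-n) τ (-s₁) (-s₂) a a₂ where
  strip := h.strip.flip
  lt := neg_lt_neg h.lt
  frame := h.frame.neg_left
  mem₁ := by rw [coord_neg_left, neg_neg]; exact h.mem₂
  mem₂ := by rw [coord_neg_left, neg_neg]; exact h.mem₁
  germ₁ := by rw [coord_neg_left, neg_neg]; exact h.germ₂
  germ₂ := by rw [coord_neg_left, neg_neg, neg_neg]; exact h.germ₁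

lemma hull_le (h : Base f n τ s₂ s₁ a₂ a) (hp : p ∈ V.hull) : ⟪n, p⟫ ≤ s₁ :=
  h.germ₁.hull_subset h.strip h.lt h.mem₁ (h.frame.inner_n _ _) hp

lemma le_hull (h : Base f n τ s₂ s₁ a₂ a) (hp : p ∈ V.hull) : s₂ ≤ ⟪n, p⟫ := by
  have := h.flip.hull_le hp
  rwa [inner_neg_left, neg_le_neg_iff] at this

lemma base_mem_hull (h : Base f n τ s₂ s₁ a₂ a) : coord n τ s₁ a ∈ V.hull :=
  h.germ₁.map_mem_hull h.strip h.lt h.mem₁ (h.frame.inner_n _ _)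

lemma base_mem_hull' (h : Base f n τ s₂ s₁ a₂ a) : coord n τ s₂ a₂ ∈ V.hull := by
  have := h.flip.base_mem_hull
  rwa [coord_neg_left, neg_neg] at this

lemma lineMap_mem_interior_hull (h : Base f n τ s₂ s₁ a₂ a) {r : ℝ} (hr : r ∈ Ioo (0:ℝ) 1) :
    AffineMap.lineMap (coord n τ s₁ a) (coord n τ s₂ a₂) r ∈ interior V.hull := by
  set g : ℝ → Plane := fun r => AffineMap.lineMap (coord n τ s₁ a) (coord n τ s₂ a₂) r with hg
  have hgc : Continuous g := AffineMap.lineMap_continuous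
  have hνg : ∀ r, ⟪n, g r⟫ = s₁ + r * (s₂ - s₁) := fun r => by
    simp only [hg, AffineMap.lineMap_apply, vsub_eq_sub, vadd_eq_add, inner_add_right,
      real_inner_smul_right, inner_sub_right, h.frame.inner_n]
    ring
  have ht : Tendsto g (𝓝[>] 0) (𝓝[{p | ⟪n, p⟫ < s₁}] (coord n τ s₁ a)) := by
    rw [tendsto_nhdsWithin_iff]
    have h0 : g 0 = coord n τ s₁ a := by simp [hg]
    refine ⟨h0 ▸ (hgc.tendsto 0).mono_left nhdsWithin_le_nhds, ?_⟩
    filter_upwards [self_mem_nhdsWithin] with ε hε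
    rw [hνg]
    have : 0 < ε * (s₁ - s₂) := mul_pos hε (sub_pos.2 h.lt)
    linarith
  obtain ⟨ε, ⟨hF, hc⟩, hε⟩ := ((ht.eventually (h.germ₁.and (h.strip.eventually_mem_core h.lt h.mem₁
    (h.frame.inner_n _ _)))).and (Ioo_mem_nhdsGT hr.1)).exists
  have h1 : g ε ∈ interior V.hull := by
    have hF : U.F f (g ε) = g ε := hF
    exact hF ▸ core_subset_interior_hull (F_mem_core f hc)
  refine convex_hull.openSegment_interior_self_subset_interior h1 h.base_mem_hull' ?_
  rw [openSegment_eq_image_lineMap]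
  have hε1 : 0 < 1 - ε := by linarith [hε.2, hr.2]
  refine ⟨(r - ε) / (1 - ε), ⟨div_pos (by linarith [hε.2]) hε1,
    (div_lt_one hε1).2 (by linarith [hr.2])⟩, ?_⟩
  have e : (r - ε) / (1 - ε) * (1 - ε) = r - ε := div_mul_cancel₀ _ hε1.ne'
  simp only [hg, AffineMap.lineMap_apply, vsub_eq_sub, vadd_eq_add]
  linear_combination (norm := module) e • (coord n τ s₂ a₂ - coord n τ s₁ a)

/-- Near the base point the trace is the identity. -/
lemma eventually_trace_eq (h : Base f n τ s₂ s₁ a₂ a) :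
    ∀ᶠ t in 𝓝 a, trace f n s₁ (coord n τ s₁ t) = coord n τ s₁ t := by
  obtain ⟨δ, hδ, hb⟩ := Metric.isOpen_iff.1 U.isOpen _ h.mem₁
  refine Metric.eventually_nhds_iff_ball.2 ⟨δ, hδ, fun t ht => ?_⟩
  have ht' : coord n τ s₁ t ∈ ball (coord n τ s₁ a) δ := by
    rwa [mem_ball, h.frame.dist_coord]
  have hK := h.germ₁.of_segment h.strip h.lt (h.frame.inner_n _ _) (h.frame.inner_n _ _)
    (((convex_ball _ δ).segment_subset (mem_ball_self hδ) ht').trans hb)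
  exact hK.trace_eq h.strip.norm (hb ht') (h.frame.inner_n _ _)

lemma continuous_trace (h : Base f n τ s₂ s₁ a₂ a) :
    Continuous fun t => trace f n s₁ (coord n τ s₁ t) :=
  LipschitzWith.continuous (K := 1) (LipschitzWith.of_dist_le_mul fun s t => by
    simpa [Real.dist_eq] using dist_trace_le h.strip h.lt h.frame f s t)

/-- The trace of the ray stays on one side of the line through the base points. -/
lemma trace_pos (h : Base f n τ s₂ s₁ a₂ a) {t : ℝ} (ht : a < t) :
    0 < ⟪τ, trace f n s₁ (coord n τ s₁ t)⟫ - a -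
      (a₂ - a) / (s₂ - s₁) * (⟪n, trace f n s₁ (coord n τ s₁ t)⟫ - s₁) := by
  set Γ : ℝ → Plane := fun t => trace f n s₁ (coord n τ s₁ t) with hΓ
  set c := (a₂ - a) / (s₂ - s₁) with hc
  have hs : s₂ - s₁ ≠ 0 := (sub_neg.2 h.lt).ne
  set R : ℝ → ℝ := fun t => ⟪τ, Γ t⟫ - a - c * (⟪n, Γ t⟫ - s₁) with hR
  have hRc : Continuous R := by have := h.continuous_trace; fun_prop
  have hne : ∀ t, a < t → R t ≠ 0 := by
    intro t ht h0
    set r := (⟪n, Γ t⟫ - s₁) / (s₂ - s₁) with hr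
    have hrν : ⟪n, Γ t⟫ = s₁ + r * (s₂ - s₁) := by rw [hr, div_mul_cancel₀ _ hs]; ring
    have hrτ : ⟪τ, Γ t⟫ = a + r * (a₂ - a) := by
      have e : c * (⟪n, Γ t⟫ - s₁) = r * (a₂ - a) := by rw [hc, hr]; ring
      simp only [hR] at h0; linarith
    have hΓr : Γ t = AffineMap.lineMap (coord n τ s₁ a) (coord n τ s₂ a₂) r := by
      rw [← h.frame.coord_inner (Γ t), hrν, hrτ]
      simp only [AffineMap.lineMap_apply, vsub_eq_sub, vadd_eq_add, coord]
      module
    have hm : Γ t ∈ V.hull := trace_mem_hull h.strip h.lt f (h.frame.inner_n _ _)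
    have hr0 : 0 ≤ r := div_nonneg_of_nonpos (by linarith [h.hull_le hm]) (by linarith [h.lt])
    have hr1 : r ≤ 1 := by
      rw [hr, ← neg_div_neg_eq, div_le_one (by linarith [h.lt])]
      linarith [h.le_hull hm]
    rcases hr0.eq_or_lt with e0 | hr0
    · rw [← e0, AffineMap.lineMap_apply_zero] at hΓr
      have := eq_of_trace_eq h.strip h.lt (h.frame.inner_n _ _) h.strip h.lt h.mem₁
        (h.frame.inner_n _ _) h.germ₁ hΓr
      have h2 := h.frame.dist_coord s₁ t a
      rw [this, dist_self] at h2
      linarith [abs_eq_zero.1 h2.symm]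
    rcases hr1.eq_or_lt with e1 | hr1
    · rw [e1, AffineMap.lineMap_apply_one] at hΓr
      have := eq_of_trace_eq h.strip h.lt (h.frame.inner_n _ _) h.strip.flip (neg_lt_neg h.lt) h.mem₂
        (by rw [inner_neg_left, h.frame.inner_n]) h.germ₂ hΓr
      have h2 := h.frame.inner_n s₁ t
      rw [this, h.frame.inner_n] at h2
      exact h.lt.ne h2
    exact trace_not_mem_interior_hull h.strip h.lt f (h.frame.inner_n _ _)
      (show Γ t ∈ interior V.hull from hΓr ▸ h.lineMap_mem_interior_hull ⟨hr0, hr1⟩)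
  obtain ⟨t₀, ht₀, ht₀a⟩ := ((eventually_nhdsWithin_of_eventually_nhds h.eventually_trace_eq).and
    (self_mem_nhdsWithin (s := Ioi a))).exists
  have ht₀a : a < t₀ := ht₀a
  have hpos : 0 < R t₀ := by
    have e : Γ t₀ = coord n τ s₁ t₀ := ht₀
    simp only [hR, e, h.frame.inner_n, h.frame.inner_t]
    linarith
  by_contra! hle
  obtain ⟨u, hu, hu0⟩ := isPreconnected_Ioi.intermediate_value (s := Ioi a) ht ht₀a
    hRc.continuousOn ⟨hle, hpos.le⟩
  exact hne u hu hu0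

end Base

/-- The traces of the ray are unbounded. -/
lemma exists_trace_far (h : Strip U n s₂ s₁) (hlt : s₂ < s₁) (hfr : Frame n τ) (f : U.Bd ≃ᵢ V.Bd)
    (a B : ℝ) : ∃ t > a, B < ‖trace f n s₁ (coord n τ s₁ t)‖ := by
  by_contra! hB
  by_cases hT : ∃ t₀, ∀ t ≥ t₀, coord n τ s₁ t ∈ U
  · obtain ⟨t₀, ht₀⟩ := hT
    set t₁ := max t₀ (a + 1)
    obtain ⟨K, hK⟩ := h.exists_germ hlt f (ht₀ t₁ (le_max_left _ _)) (hfr.inner_n _ _)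
    set t := t₁ + (|B| + |B| + 1) with ht
    have htt : t₁ ≤ t := by linarith [abs_nonneg B]
    have hK' := hK.of_segment h hlt (hfr.inner_n _ _) (hfr.inner_n s₁ t) (by
      rw [segment_eq_image_lineMap]
      rintro _ ⟨r, hr, rfl⟩
      rw [lineMap_coord]
      exact ht₀ _ (by nlinarith [hr.1, le_max_left t₀ (a + 1)]))
    have e1 := hK.trace_eq h.norm (ht₀ t₁ (le_max_left _ _)) (hfr.inner_n _ _)
    have e2 := hK'.trace_eq h.norm (ht₀ t ((le_max_left _ _).trans htt)) (hfr.inner_n _ _)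
    have h1 := hB t₁ (by linarith [le_max_right t₀ (a + 1)])
    have h2 := hB t (by linarith [le_max_right t₀ (a + 1)])
    have h3 := dist_le_norm_add_norm (K (coord n τ s₁ t)) (K (coord n τ s₁ t₁))
    rw [K.dist_eq, hfr.dist_coord, ← e1, ← e2, abs_of_nonneg (by linarith)] at h3
    linarith [le_abs_self B]
  push Not at hT
  choose u hu huU using fun k : ℕ => hT (max (a + 1) k)
  have hua : ∀ k, a < u k := fun k => by linarith [hu k, le_max_left (a + 1) (k : ℝ)]
  choose x hx hxa using fun k => h.exists_access (huU k) (hfr.inner_n s₁ (u k))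
  choose o hoV hoh hod using fun k => (hxa k).exists_outer h hlt f (ε := 1 / 8) (by norm_num)
  have hne : V.hull.Nonempty := ⟨_, (f (x 0)).pos_mem_hull⟩
  choose m w hm1 hmh hmo _ hmU using fun k => exists_supporting hne (hoh k)
  have hcomp : IsCompact (closedBall (0 : Plane) (B + 1) ×ˢ sphere (0 : Plane) 1) :=
    (isCompact_closedBall _ _).prod (isCompact_sphere _ _)
  obtain ⟨_, _, φ, hφ, hlim⟩ := hcomp.tendsto_subseq (x := fun k => (o k, m k)) fun k => by
    refine ⟨?_, by rw [mem_sphere_zero_iff_norm]; exact hm1 k⟩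
    rw [mem_closedBall_zero_iff]
    have h1 := hB (u k) (hua k)
    rw [← hx k, (hxa k).trace_eq h.norm] at h1
    have h2 := (dist_pos_le_dp (hoV k) (f (x k))).trans_lt (hod k)
    have h3 := norm_le_norm_add_norm_sub' (o k) (f (x k)).pos
    rw [← dist_eq_norm] at h3
    change ‖o k‖ ≤ _
    linarith
  obtain ⟨N, hN⟩ := Metric.cauchySeq_iff.1 hlim.cauchySeq (1 / 8) (by norm_num)
  obtain ⟨M, hM⟩ := exists_nat_gt (u (φ N) + 1)
  set i := φ N
  set j := φ (max N M) with hj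
  have hij : u i + 1 ≤ u j := by
    have h1 : M ≤ j := (le_max_right N M).trans (hφ.id_le _)
    have h2 : (M : ℝ) ≤ j := by exact_mod_cast h1
    linarith [hu j, le_max_right (a + 1) (j : ℝ)]
  have hclose := hN N le_rfl (max N M) (le_max_left _ _)
  simp only [Function.comp_apply, Prod.dist_eq, max_lt_iff] at hclose
  obtain ⟨ho, hm⟩ := hclose
  set z := o i + (1 / 4 : ℝ) • m i with hz
  have hseg : ∀ k, w k < ⟪m k, z⟫ → segment ℝ (o k) z ⊆ V.carrier := fun k hk p hp =>
    hmU k ⟨o k, hoV k, hmo k⟩ p ((convex_halfPlane (m k) (w k)).segment_subset (hmo k) hk hp)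
  have hzi : w i < ⟪m i, z⟫ := by
    rw [hz, inner_add_right, real_inner_smul_right, real_inner_self_eq_norm_sq, hm1 i]
    linarith [hmo i]
  have hzj : w j < ⟪m j, z⟫ := by
    have e1 : ⟪m j, o j - o i⟫ ≤ 1 / 8 := by
      have := real_inner_le_norm (m j) (o j - o i)
      rw [hm1 j, one_mul, ← dist_eq_norm, dist_comm] at this
      exact this.trans ho.le
    have e2 := norm_sub_sq_real (m i) (m j)
    rw [hm1 i, hm1 j, real_inner_comm (m j) (m i), ← dist_eq_norm] at e2
    have e3 : dist (m i) (m j) ^ 2 ≤ (1 / 8) ^ 2 := by gcongr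
    rw [inner_sub_right] at e1
    rw [hz, inner_add_right, real_inner_smul_right]
    rw [real_inner_comm (m i) (m j)] at *
    linarith [hmo j]
  have hdz : dist (o i) z ≤ 1 / 4 := by
    rw [hz, dist_eq_norm, sub_add_cancel_left, norm_neg, norm_smul, hm1 i]
    norm_num
  have e1 := dist_pt_eq (hseg i hzi)
  have e2 := dist_pt_eq (hseg j hzj)
  have e3 : dist (o j) z ≤ 1 / 8 + 1 / 4 := by
    linarith [dist_triangle (o j) (o i) z, dist_comm (o i) (o j)]
  have e4 := dist_triangle (f (x i)).1 (V.pt (o i)) (f (x j)).1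
  have e5 := dist_triangle4 (V.pt (o i)) (V.pt z) (V.pt (o j)) (f (x j)).1
  rw [dist_comm (f (x i)).1 (V.pt (o i))] at e4
  rw [dist_comm (V.pt z) (V.pt (o j))] at e5
  have e6 : dist (f (x i)) (f (x j)) = u j - u i := by
    rw [f.dist_eq, (hxa i).dist_eq (hxa j) h.norm, hx, hx, hfr.dist_coord, abs_of_nonpos (by linarith)]
    ring
  have e7 : dist (f (x i)).1 (f (x j)).1 = u j - u i := e6
  have e8 : dist (V.pt (o i)) (f (x i)).1 < 1 / 8 := hod i
  have e9 : dist (V.pt (o j)) (f (x j)).1 < 1 / 8 := hod j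
  linarith

end Dom

/-- A closed convex set bounded in one direction and unbounded in the other contains rays. -/
lemma coord_mem_of_unbounded {n τ : Plane} (hfr : Frame n τ) {C : Set Plane} (hC : Convex ℝ C)
    (hCc : IsClosed C) {s a W : ℝ} (hl : coord n τ s a ∈ C) (hW : ∀ p ∈ C, |⟪n, p⟫ - s| ≤ W)
    (hun : ∀ M, ∃ p ∈ C, M < ⟪τ, p⟫) {t : ℝ} (ht : a ≤ t) : coord n τ s t ∈ C := by
  rw [← hCc.closure_eq, Metric.mem_closure_iff]
  intro ε hε
  obtain ⟨p, hp, hpM⟩ := hun (t + 1 + (t - a) * W / ε)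
  have hW0 : 0 ≤ W := (abs_nonneg _).trans (hW p hp)
  set X := ⟪τ, p⟫ - a with hX
  have hX1 : t - a < X := by
    have : 0 ≤ (t - a) * W / ε := by have := sub_nonneg.2 ht; positivity
    linarith
  have hX0 : 0 < X := by linarith
  set θ := (t - a) / X with hθ
  have hθX : θ * X = t - a := div_mul_cancel₀ _ hX0.ne'
  have hθ0 : 0 ≤ θ := div_nonneg (by linarith) hX0.le
  refine ⟨AffineMap.lineMap (coord n τ s a) p θ, hC.segment_subset hl hp (by
    rw [segment_eq_image_lineMap]
    exact ⟨θ, ⟨hθ0, (div_le_one hX0).2 hX1.le⟩, rfl⟩), ?_⟩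
  have e : coord n τ s t - AffineMap.lineMap (coord n τ s a) p θ = (θ * (s - ⟪n, p⟫)) • n := by
    conv_lhs => rw [← hfr.coord_inner p]
    simp only [AffineMap.lineMap_apply, vsub_eq_sub, vadd_eq_add, coord]
    have : t = a + θ * (⟪τ, p⟫ - a) := by rw [← hX, hθX]; ring
    conv_lhs => rw [this]
    module
  rw [dist_eq_norm, e, norm_smul, hfr.norm_n, mul_one, Real.norm_eq_abs, abs_mul, abs_of_nonneg hθ0,
    abs_sub_comm]
  have h1 : θ * |⟪n, p⟫ - s| ≤ θ * W := mul_le_mul_of_nonneg_left (hW p hp) hθ0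
  refine h1.trans_lt ?_
  rw [hθ, div_mul_eq_mul_div, div_lt_iff₀ hX0, ← div_lt_iff₀' hε]
  linarith

namespace Dom.Base
variable {U V : Dom} {n τ l p : Plane} {s s₂ s₁ a a₂ : ℝ} {f : U.Bd ≃ᵢ V.Bd}

lemma unbounded_hull (h : Base f n τ s₂ s₁ a₂ a) (M : ℝ) : ∃ p ∈ V.hull, M < ⟪τ, p⟫ := by
  set c := (a₂ - a) / (s₂ - s₁)
  obtain ⟨t, hta, ht⟩ := exists_trace_far h.strip h.lt h.frame f a
    (|s₁| + |s₂| + |a| + |c| * (s₁ - s₂) + |M|)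
  have hpos := h.trace_pos hta
  set p := trace f n s₁ (coord n τ s₁ t)
  have hm : p ∈ V.hull := trace_mem_hull h.strip h.lt f (h.frame.inner_n _ _)
  refine ⟨p, hm, ?_⟩
  by_contra! hle
  have h1 := h.hull_le hm
  have h2 := h.le_hull hm
  have hc : |c * (⟪n, p⟫ - s₁)| ≤ |c| * (s₁ - s₂) := by
    rw [abs_mul]
    gcongr
    rw [abs_le]; constructor <;> linarith
  have hn : |⟪n, p⟫| ≤ |s₁| + |s₂| := by
    rw [abs_le]
    constructor <;> linarith [le_abs_self s₁, neg_abs_le s₂, abs_nonneg s₁, abs_nonneg s₂]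
  have ht : |⟪τ, p⟫| ≤ |a| + |c| * (s₁ - s₂) + |M| := by
    rw [abs_le]
    have := (abs_le.1 hc).1
    have h0 : 0 ≤ |c| * (s₁ - s₂) := mul_nonneg (abs_nonneg c) (by linarith [h.lt])
    constructor <;> linarith [le_abs_self M, neg_abs_le a, abs_nonneg a, abs_nonneg M]
  have hnorm : ‖p‖ ≤ |⟪n, p⟫| + |⟪τ, p⟫| := by
    conv_lhs => rw [← h.frame.coord_inner p, coord]
    refine (norm_add_le _ _).trans (le_of_eq ?_)
    rw [norm_smul, norm_smul, h.frame.norm_n, h.frame.norm_t, mul_one, mul_one, Real.norm_eq_abs,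
      Real.norm_eq_abs]
  linarith

lemma coord_mem_hull (h : Base f n τ s₂ s₁ a₂ a) (t : ℝ) : coord n τ s₁ t ∈ V.hull := by
  have hW : ∀ p ∈ V.hull, |⟪n, p⟫ - s₁| ≤ s₁ - s₂ := fun p hp => by
    rw [abs_le]; constructor <;> linarith [h.hull_le hp, h.le_hull hp, h.lt]
  rcases le_total a t with ht | ht
  · exact coord_mem_of_unbounded h.frame convex_hull isClosed_hull h.base_mem_hull hW
      h.unbounded_hull ht
  · have := coord_mem_of_unbounded h.neg.frame convex_hull isClosed_hull h.neg.base_mem_hull hW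
      h.neg.unbounded_hull (neg_le_neg ht)
    rwa [coord_neg_right, neg_neg] at this

/-- The other domain is bounded by the same strip. -/
lemma strip_map (h : Base f n τ s₂ s₁ a₂ a) : Strip V n s₂ s₁ where
  norm := h.strip.norm
  le := h.strip.le
  up p hp := h.germ₁.map_up h.strip h.lt h.mem₁ (h.frame.inner_n _ _) hp
  dn p hp := h.flip.germ₁.map_up h.flip.strip h.flip.lt h.flip.mem₁ (h.flip.frame.inner_n _ _)
    (by rw [inner_neg_left]; linarith)
  hull p := by
    refine ⟨fun hp => ⟨h.le_hull hp, h.hull_le hp⟩, fun hp => ?_⟩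
    have h2 := h.flip.coord_mem_hull ⟪τ, p⟫
    rw [coord_neg_left, neg_neg] at h2
    have hs : 0 < s₁ - s₂ := sub_pos.2 h.lt
    refine convex_hull.segment_subset h2 (h.coord_mem_hull ⟪τ, p⟫) ?_
    rw [segment_eq_image_lineMap]
    refine ⟨(⟪n, p⟫ - s₂) / (s₁ - s₂), ⟨div_nonneg (by linarith [hp.1]) hs.le,
      (div_le_one hs).2 (by linarith [hp.2])⟩, ?_⟩
    have e : (⟪n, p⟫ - s₂) / (s₁ - s₂) * (s₁ - s₂) = ⟪n, p⟫ - s₂ := div_mul_cancel₀ _ hs.ne'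
    conv_rhs => rw [← h.frame.coord_inner p]
    simp only [AffineMap.lineMap_apply, vsub_eq_sub, vadd_eq_add, coord]
    linear_combination (norm := module) e • n

end Dom.Base

lemma Frame.dist_sq {n τ : Plane} (h : Frame n τ) (p : Plane) (s t : ℝ) :
    dist p (coord n τ s t) ^ 2 = (⟪n, p⟫ - s) ^ 2 + (⟪τ, p⟫ - t) ^ 2 := by
  have e : p - coord n τ s t = coord n τ (⟪n, p⟫ - s) (⟪τ, p⟫ - t) := by
    conv_lhs => rw [← h.coord_inner p]
    simp only [coord]
    module
  have h0 : ⟪(⟪n, p⟫ - s) • n, (⟪τ, p⟫ - t) • τ⟫ = 0 := by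
    rw [real_inner_smul_left, real_inner_smul_right, h.orth]; ring
  have := norm_add_sq_eq_norm_sq_add_norm_sq_real h0
  rw [dist_eq_norm, e, coord, sq, this, norm_smul, norm_smul, h.norm_n, h.norm_t, mul_one, mul_one,
    Real.norm_eq_abs, Real.norm_eq_abs, abs_mul_abs_self, abs_mul_abs_self]
  ring

namespace Dom
variable {U V : Dom} {n τ l p : Plane} {s s₂ s₁ a a₂ : ℝ} {f : U.Bd ≃ᵢ V.Bd}
  {K : Plane ≃ᵢ Plane}

/-- The inverse boundary map has the inverse germ. -/
lemma Germ.symm (h : Strip U n s₂ s₁) (hlt : s₂ < s₁) (hl : l ∈ U) (hν : ⟪n, l⟫ = s₁)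
    (hK : Germ f n s₁ l K) (h' : Strip V n s₂ s₁) (hν' : ⟪n, K l⟫ = s₁) :
    Germ f.symm n s₁ (K l) K.symm := by
  have hc := h'.eventually_mem_core hlt (hK.map_mem h hlt hl hν) hν'
  have ht : Tendsto K.symm (𝓝[{p | ⟪n, p⟫ < s₁}] (K l)) (𝓝[{p | ⟪n, p⟫ < s₁}] l) := by
    rw [tendsto_nhdsWithin_iff]
    refine ⟨?_, hc.mono fun q hq => hK.inner_lt_of_mem_core h hlt hl hν hq⟩
    have := (K.symm.continuous.tendsto (K l)).mono_left
      (nhdsWithin_le_nhds (s := {p : Plane | ⟪n, p⟫ < s₁}))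
    rwa [K.symm_apply_apply] at this
  filter_upwards [ht.eventually (hK.and (h.eventually_mem_core hlt hl hν))] with q hq
  have := F_symm_F f hq.2
  rwa [hq.1, K.apply_symm_apply] at this

namespace Base

lemma trace_eq_coord_base (h : Base f n τ s₂ s₁ a₂ a) :
    trace f n s₁ (coord n τ s₁ a) = coord n τ s₁ a :=
  h.germ₁.trace_eq h.strip.norm h.mem₁ (h.frame.inner_n _ _)

/-- The trace preserves the line. -/
lemma inner_trace (h : Base f n τ s₂ s₁ a₂ a) (hp : ⟪n, p⟫ = s₁) : ⟪n, trace f n s₁ p⟫ = s₁ := by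
  have hd : ∀ t, ⟪n, trace f n s₁ (coord n τ s₁ t)⟫ ∉ Ioo s₂ s₁ := by
    intro t ht
    refine trace_not_mem_interior_hull h.strip h.lt f (h.frame.inner_n s₁ t)
      (interior_maximal (s := V.hull) (t := {p : Plane | s₂ < ⟪n, p⟫} ∩ {p | ⟪n, p⟫ < s₁})
        (fun q hq => (h.strip_map.hull q).2 ⟨hq.1.le, hq.2.le⟩) ?_ ht)
    exact (isOpen_lt (by fun_prop) (by fun_prop)).inter (isOpen_lt (by fun_prop) (by fun_prop))
  have hm := (h.strip_map.hull _).1 (trace_mem_hull h.strip h.lt f hp)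
  rw [h.frame.coord_of_inner hp] at hm ⊢
  by_contra hne
  set t := ⟪τ, p⟫
  have hs : ⟪n, trace f n s₁ (coord n τ s₁ t)⟫ ≤ s₂ := by
    by_contra! hs
    exact hd t ⟨hs, lt_of_le_of_ne hm.2 hne⟩
  have hlt := h.lt
  have hg : Continuous fun t => ⟪n, trace f n s₁ (coord n τ s₁ t)⟫ := by
    have := h.continuous_trace
    fun_prop
  obtain ⟨u, -, hu⟩ := isPreconnected_univ.intermediate_value (mem_univ t) (mem_univ a)
    hg.continuousOn (show (s₂ + s₁) / 2 ∈ Icc _ _ from ⟨by linarith, by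
      rw [h.trace_eq_coord_base, h.frame.inner_n]; linarith⟩)
  beta_reduce at hu
  exact hd u ⟨by linarith, by linarith⟩

/-- Images of accessible elements are accessible. -/
lemma access_map (h : Base f n τ s₂ s₁ a₂ a) {x : U.Bd} (hx : Access n s₁ x) :
    Access n s₁ (f x) := by
  have hν := h.inner_trace hx.1
  rw [hx.trace_eq h.strip.norm] at hν
  obtain ⟨y, hy, hya⟩ := h.strip_map.exists_access (f x).pos_not_mem hν
  suffices y = f x from this ▸ hya
  refine Bd.ext_of_dp fun ε hε => ?_
  obtain ⟨o, hoV, hoh, hod⟩ := hx.exists_outer h.strip h.lt f (lt_min hε (sub_pos.2 h.lt))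
  have h1 := (dist_pos_le_dp hoV (f x)).trans_lt hod
  have h2 := (h.frame.abs_inner_n_sub_le o (f x).pos).trans_lt (h1.trans_le (min_le_right _ _))
  rw [hν] at h2
  have h3 : s₁ < ⟪n, o⟫ := by
    by_contra! hc
    exact hoh ((h.strip_map.hull o).2 ⟨by linarith [(abs_lt.1 h2).1], hc⟩)
  refine ⟨o, ?_, hod.trans_le (min_le_left _ _)⟩
  rw [hya.2 o h3, hy]
  exact h1.trans_le (min_le_left _ _)

lemma trace_symm_trace (h : Base f n τ s₂ s₁ a₂ a) (hp : ⟪n, p⟫ = s₁) :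
    trace f.symm n s₁ (trace f n s₁ p) = p := by
  have hν := h.inner_trace hp
  by_cases hpU : p ∈ U
  · obtain ⟨K, hK⟩ := h.strip.exists_germ h.lt f hpU hp
    rw [hK.trace_eq h.strip.norm hpU hp] at hν ⊢
    rw [(hK.symm h.strip h.lt hpU hp h.strip_map hν).trace_eq h.strip.norm
      (hK.map_mem h.strip h.lt hpU hp) hν, K.symm_apply_apply]
  · obtain ⟨x, rfl, hx⟩ := h.strip.exists_access hpU hp
    rw [hx.trace_eq h.strip.norm, (h.access_map hx).trace_eq h.strip.norm, f.symm_apply_apply]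

/-- The trace is the identity. -/
lemma trace_eq_self (h : Base f n τ s₂ s₁ a₂ a) (hp : ⟪n, p⟫ = s₁) : trace f n s₁ p = p := by
  set g : ℝ → ℝ := fun t => ⟪τ, trace f n s₁ (coord n τ s₁ t)⟫ with hg
  have hΓ : ∀ t, trace f n s₁ (coord n τ s₁ t) = coord n τ s₁ (g t) := fun t =>
    h.frame.coord_of_inner (h.inner_trace (h.frame.inner_n _ _))
  have hd : ∀ s t, |g s - g t| = |s - t| := by
    intro s t
    refine le_antisymm ?_ ?_
    · have := dist_trace_le h.strip h.lt h.frame f s t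
      rwa [hΓ, hΓ, h.frame.dist_coord] at this
    · have := dist_trace_le h.strip_map h.lt h.frame f.symm (g s) (g t)
      rwa [← hΓ, ← hΓ, h.trace_symm_trace (h.frame.inner_n _ _),
        h.trace_symm_trace (h.frame.inner_n _ _), h.frame.dist_coord] at this
  obtain ⟨b, hb, hba⟩ := ((eventually_nhdsWithin_of_eventually_nhds h.eventually_trace_eq).and
    (self_mem_nhdsWithin (s := Ioi a))).exists
  have hba : a < b := hba
  have ga : g a = a := by rw [hg]; simp only [h.trace_eq_coord_base, h.frame.inner_t]
  have gb : g b = b := by rw [hg]; simp only [hb, h.frame.inner_t]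
  have hgt : ∀ t, g t = t := by
    intro t
    have h1 := (sq_eq_sq_iff_abs_eq_abs _ _).2 (hd t a)
    have h2 := (sq_eq_sq_iff_abs_eq_abs _ _).2 (hd t b)
    rw [ga] at h1
    rw [gb] at h2
    have : (b - a) * (g t - t) = 0 := by linarith
    rcases mul_eq_zero.1 this with h0 | h0 <;> linarith
  rw [h.frame.coord_of_inner hp, hΓ, hgt]

/-- All germs at the line are identities. -/
lemma germ_refl (h : Base f n τ s₂ s₁ a₂ a) (hl : l ∈ U) (hν : ⟪n, l⟫ = s₁) :
    Germ f n s₁ l (IsometryEquiv.refl _) := by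
  obtain ⟨K, hK⟩ := h.strip.exists_germ h.lt f hl hν
  obtain ⟨δ, hδ, hb⟩ := Metric.isOpen_iff.1 U.isOpen _ hl
  have hle := h.frame.coord_of_inner hν
  set s := ⟪τ, l⟫
  have hfix : ∀ t, |t - s| < δ → K (coord n τ s₁ t) = coord n τ s₁ t := by
    intro t ht
    have ht' : coord n τ s₁ t ∈ ball l δ := by rwa [mem_ball, hle, h.frame.dist_coord]
    have hK' := hK.of_segment h.strip h.lt hν (h.frame.inner_n s₁ t)
      (((convex_ball _ δ).segment_subset (mem_ball_self hδ) ht').trans hb)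
    rw [← hK'.trace_eq h.strip.norm (hb ht') (h.frame.inner_n _ _),
      h.trace_eq_self (h.frame.inner_n _ _)]
  have h1 := hfix s (by simpa using hδ)
  have h2 := hfix (s + δ / 2) (by rw [add_sub_cancel_left, abs_of_pos (half_pos hδ)]; linarith)
  filter_upwards [hK, h.strip.eventually_mem_core h.lt hl hν] with p hp hpc
  have hlt := (h.strip_map.mem_core_iff.1 (F_mem_core f hpc)).2.2
  have hlt' := (h.strip.mem_core_iff.1 hpc).2.2
  rw [hp] at hlt
  change U.F f p = p
  rw [hp]
  have e1 := congrArg (· ^ 2) (K.dist_eq p (coord n τ s₁ s))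
  have e2 := congrArg (· ^ 2) (K.dist_eq p (coord n τ s₁ (s + δ / 2)))
  simp only [h1, h2, h.frame.dist_sq] at e1 e2
  have e3 : δ * (⟪τ, K p⟫ - ⟪τ, p⟫) = 0 := by linarith
  have e4 : ⟪τ, K p⟫ = ⟪τ, p⟫ := by
    rcases mul_eq_zero.1 e3 with h0 | h0 <;> linarith
  have e5 : ⟪n, K p⟫ = ⟪n, p⟫ := by
    rw [e4] at e1
    rcases sq_eq_sq_iff_eq_or_eq_neg.1 (add_right_cancel e1) with h0 | h0 <;> linarith
  rw [← h.frame.coord_inner (K p), e4, e5, h.frame.coord_inner]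

lemma F_eq_self (h : Base f n τ s₂ s₁ a₂ a) {q : Plane} (hq : q ∈ U.core) : U.F f q = q := by
  set z := coord n τ (s₁ + 1) 0 with hz
  have hνz : ⟪n, z⟫ = s₁ + 1 := h.frame.inner_n _ _
  have hzU : z ∈ U := h.strip.up z (by linarith)
  obtain ⟨γ, hγ, hγU, -, -, h0, h1, -⟩ := exists_path_X (U.pt q) (U.pt z) one_pos
  have e0 : γ 0 = q := by
    rcases h0 with h0 | h0
    · rw [← pos_pt (hγU (left_mem_Icc.2 zero_le_one)), ← h0, pos_pt (core_subset hq)]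
    · rw [pos_pt (core_subset hq)] at h0; exact absurd (core_subset hq) h0
  have e1 : γ 1 = z := by
    rcases h1 with h1 | h1
    · rw [← pos_pt (hγU (right_mem_Icc.2 zero_le_one)), ← h1, pos_pt hzU]
    · rw [pos_pt hzU] at h1; exact absurd hzU h1
  obtain ⟨b, hb, hc, hcl, hs⟩ := h.strip.exists_exit hγ hγU (e0 ▸ hq) (by
    rw [e1, h.strip.mem_core_iff, hνz]; rintro ⟨-, -, h⟩; linarith)
  have hbU : γ b ∈ U := hγU ⟨hb.1.le, hb.2⟩
  have hS : IsPreconnected (γ '' Ico 0 b) :=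
    isPreconnected_Ico.image _ (hγ.mono fun t ht => ⟨ht.1, ht.2.le.trans hb.2⟩)
  have hSc : γ '' Ico 0 b ⊆ U.core := by
    rintro _ ⟨t, ht, rfl⟩
    exact hc t ht
  have hqS : q ∈ γ '' Ico 0 b := ⟨0, ⟨le_rfl, hb.1⟩, e0⟩
  rcases hs with hs | hs
  · exact (h.flip.germ_refl hbU (by rw [inner_neg_left, hs])).eq_on h.strip.flip hS hSc hcl q hqS
  · exact (h.germ_refl hbU hs).eq_on h.strip hS hSc hcl q hqS

lemma mem_iff_of_inner (h : Base f n τ s₂ s₁ a₂ a) (hp : ⟪n, p⟫ = s₁) : p ∈ U ↔ p ∈ V := by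
  rw [← trace_mem_iff h.strip h.lt f hp, h.trace_eq_self hp]

lemma carrier_eq (h : Base f n τ s₂ s₁ a₂ a) : U.carrier = V.carrier := by
  have hcore : U.core = V.core := by
    rw [← image_F_core f, image_congr fun q hq => h.F_eq_self hq, image_id']
  ext p
  change p ∈ U ↔ p ∈ V
  rcases lt_trichotomy ⟪n, p⟫ s₁ with h1 | h1 | h1
  · rcases lt_trichotomy ⟪n, p⟫ s₂ with h2 | h2 | h2
    · exact iff_of_true (h.strip.dn p h2) (h.strip_map.dn p h2)
    · exact h.flip.mem_iff_of_inner (by rw [inner_neg_left, h2])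
    · have hU := h.strip.mem_core_iff (p := p)
      have hV := h.strip_map.mem_core_iff (p := p)
      rw [hcore] at hU
      have := hU.symm.trans hV
      simpa [h1, h2] using this
  · exact h.mem_iff_of_inner h1
  · exact iff_of_true (h.strip.up p h1) (h.strip_map.up p h1)

end Base

lemma Germ.trans_mapBd (h : Strip U n s₂ s₁) (hlt : s₂ < s₁) (hl : l ∈ U) (hν : ⟪n, l⟫ = s₁)
    (hK : Germ f n s₁ l K) :
    Germ (f.trans (mapBd K.symm V)) n s₁ l (IsometryEquiv.refl _) := by
  filter_upwards [hK, h.eventually_mem_core hlt hl hν] with p hp hpc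
  rw [F_mapBd f _ hpc, hp, K.symm_apply_apply]
  rfl

lemma Strip.exists_isometry_of_lt (h : Strip U n s₂ s₁) (hlt : s₂ < s₁) (f : U.Bd ≃ᵢ V.Bd) :
    ∃ J : Plane ≃ᵢ Plane, J '' U.carrier = V.carrier := by
  obtain ⟨l₁, hl₁, l₂, hl₂, hν₁, hν₂, J, hJ₁, hJ₂⟩ := h.exists_connecting hlt f
  have hfr := frame_rot h.norm
  have hν₂' : ⟪-n, l₂⟫ = -s₂ := by rw [inner_neg_left, hν₂]
  have hB : Base (f.trans (mapBd J.symm V)) n (rot n) s₂ s₁ ⟪rot n, l₂⟫ ⟪rot n, l₁⟫ := by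
    refine ⟨h, hlt, hfr, ?_, ?_, ?_, ?_⟩
    · rwa [← hfr.coord_of_inner hν₁]
    · rwa [← hfr.coord_of_inner hν₂]
    · rw [← hfr.coord_of_inner hν₁]
      exact hJ₁.trans_mapBd h hlt hl₁ hν₁
    · rw [← hfr.coord_of_inner hν₂]
      exact hJ₂.trans_mapBd h.flip (neg_lt_neg hlt) hl₂ hν₂'
  refine ⟨J, ?_⟩
  rw [hB.carrier_eq]
  change J '' (J.symm '' V.carrier) = V.carrier
  rw [image_image]
  simp

end Dom

/-- Corollary 1.1: if `F_U = ∅`, or `F_U` is nonempty and disconnected, then `U`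
is uniquely determined in the class of all plane domains by the relative metric
of its Hausdorff boundary. -/
theorem uniquely_determined_of_FPart_empty_or_disconnected
    (U : Set (Euc 2)) (hU : IsEucDomain U)
    (h : FPart U = ∅ ∨ ((FPart U).Nonempty ∧ ¬ IsConnected (FPart U))) :
    UniquelyDeterminedIn {V | IsEucDomain V} U := by
  rintro V hV ⟨g, hg⟩
  obtain ⟨f⟩ := Dom.exists_isometryEquiv (U := ⟨U, hU⟩) (V := ⟨V, hV⟩) hg
  rcases h with h | ⟨hne, hc⟩
  · exact Dom.exists_isometry_of_eq_core f (Dom.eq_core_of_FPart_eq_empty h)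
  · obtain ⟨n, s₂, s₁, hs⟩ := Dom.exists_strip (U := ⟨U, hU⟩) hne hc
    rcases hs.le.eq_or_lt with rfl | hlt
    · exact hs.exists_isometry_of_eq f
    · exact hs.exists_isometry_of_lt hlt f
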